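/- Let M be a smooth closed (compact without boundary) Levi-flat hypersurface in CP^n, n ≥ 2. Then CP^n \ M has exactly two connected components, and each of the two components is a Stein manifold. -/

import Mathlib

/- STATEMENT 8: Let M be a smooth closed Levi-flat hypersurface in ℂℙⁿ, n ≥ 2.  Then
ℂℙⁿ ∖ M has exactly two connected components, and each of them is a Stein manifold.

Subsets of ℂℙⁿ are encoded by cones in ℂ^{n+1} ∖ {0}.  Per the context, a complex
manifold is Stein if it admits a proper holomorphic embedding into some ℂ^N; for an open
subset of ℂℙⁿ this is encoded upstairs by `IsSteinConeDomain`. -/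

open Complex Set

noncomputable section

/-- The Levi form (up to a positive factor) of the defining function `ρ` at `p`,
evaluated at `w`: `D²ρ(p)(w,w) + D²ρ(p)(Jw,Jw) = 4 ∑ ∂²ρ/∂zⱼ∂z̄ₖ wⱼ w̄ₖ`. -/
def leviForm {m : ℕ} (ρ : (Fin m → ℂ) → ℝ) (p w : Fin m → ℂ) : ℝ :=
  iteratedFDeriv ℝ 2 ρ p ![w, w] + iteratedFDeriv ℝ 2 ρ p ![Complex.I • w, Complex.I • w]

/-- `w` belongs to the complex tangent space at `p` of the hypersurface `{ρ = 0}`. -/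
def IsComplexTangent {m : ℕ} (ρ : (Fin m → ℂ) → ℝ) (p w : Fin m → ℂ) : Prop :=
  fderiv ℝ ρ p w = 0 ∧ fderiv ℝ ρ p (Complex.I • w) = 0

/-- `M` is a smooth (`C^∞`) Levi-flat real hypersurface: near each of its points it is
the zero set of a smooth defining function with nonvanishing gradient whose Levi form
vanishes identically on complex tangent vectors. -/
def IsSmoothLeviFlatHypersurface {m : ℕ} (M : Set (Fin m → ℂ)) : Prop :=
  ∀ p ∈ M, ∃ V : Set (Fin m → ℂ), IsOpen V ∧ p ∈ V ∧ ∃ ρ : (Fin m → ℂ) → ℝ,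
    (∀ k : ℕ, ContDiffOn ℝ k ρ V) ∧ (∀ q ∈ V, fderiv ℝ ρ q ≠ 0) ∧
    (∀ q ∈ V, q ∈ M ↔ ρ q = 0) ∧
    (∀ q ∈ V, ρ q = 0 → ∀ w, IsComplexTangent ρ q w → leviForm ρ q w = 0)

/-- `S` is a cone: it is invariant under multiplication by nonzero complex scalars.
Subsets of `ℂℙⁿ` are encoded by the cones over them in `ℂ^{n+1} ∖ {0}`. -/
def IsCone {m : ℕ} (S : Set (Fin m → ℂ)) : Prop :=
  ∀ c : ℂ, c ≠ 0 → ∀ z ∈ S, c • z ∈ S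

/-- The cone `S ⊆ ℂ^{n+1} ∖ {0}` represents a closed (= compact) subset of `ℂℙⁿ`:
it is closed in the punctured space `ℂ^{n+1} ∖ {0}`. -/
def IsClosedInPunctured {m : ℕ} (S : Set (Fin m → ℂ)) : Prop :=
  ∀ z ∈ closure S, z ≠ 0 → z ∈ S

/-- The cone over a closed subset of `ℂℙⁿ`. -/
def IsProjectiveClosedSet {m : ℕ} (S : Set (Fin m → ℂ)) : Prop :=
  S.Nonempty ∧ (∀ z ∈ S, z ≠ 0) ∧ IsCone S ∧ IsClosedInPunctured S

/-- The conic domain `Ω ⊆ ℂ^{n+1} ∖ {0}`, representing an open set of `ℂℙⁿ`, is a Stein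
manifold: the corresponding open subset of `ℂℙⁿ` admits a proper holomorphic embedding
into some `ℂ^N` (encoded upstairs by a scaling-invariant holomorphic map which separates
lines, is an immersion transversally to the lines, and is proper at the level of `ℂℙⁿ`). -/
def IsSteinConeDomain {m : ℕ} (Ω : Set (Fin m → ℂ)) : Prop :=
  ∃ N : ℕ, ∃ F : (Fin m → ℂ) → (Fin N → ℂ),
    DifferentiableOn ℂ F Ω ∧
    (∀ c : ℂ, c ≠ 0 → ∀ z ∈ Ω, F (c • z) = F z) ∧
    (∀ z ∈ Ω, ∀ w ∈ Ω, F z = F w → ∃ c : ℂ, c ≠ 0 ∧ w = c • z) ∧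
    (∀ K : Set (Fin N → ℂ), IsCompact K → IsCompact {z | z ∈ Ω ∧ ‖z‖ = 1 ∧ F z ∈ K}) ∧
    (∀ z ∈ Ω, ∀ v : Fin m → ℂ, fderiv ℂ F z v = 0 ↔ ∃ c : ℂ, v = c • z)

namespace LeviFlat
open MeasureTheory Metric Filter Topology Asymptotics
open scoped ContDiff ComplexConjugate Convolution
local notation:max "ℂ^" m:max => (Fin m → ℂ)

/-- The first order operator `(∂/∂xⱼ + c ∂/∂yⱼ) / 2`: `c = -i` and `c = i` give the two
Wirtinger derivatives. -/
def wirt {m : ℕ} (c : ℂ) (j : Fin m) (f : ℂ^m → ℂ) (z : ℂ^m) : ℂ :=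
  (fderiv ℝ f z (Pi.single j 1) + c * fderiv ℝ f z (Pi.single j I)) / 2

/-- The Wirtinger derivative `∂/∂zⱼ`. -/
abbrev dz {m : ℕ} (j : Fin m) (f : ℂ^m → ℂ) : ℂ^m → ℂ := wirt (-I) j f

/-- The Wirtinger derivative `∂/∂z̄ⱼ`. -/
abbrev dzb {m : ℕ} (j : Fin m) (f : ℂ^m → ℂ) : ℂ^m → ℂ := wirt I j f

section Wirtinger
variable {m : ℕ} {c c' : ℂ} {j k : Fin m} {f g : ℂ^m → ℂ} {z : ℂ^m}

theorem wirt_add (hf : DifferentiableAt ℝ f z) (hg : DifferentiableAt ℝ g z) :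
    wirt c j (fun x => f x + g x) z = wirt c j f z + wirt c j g z := by
  simp only [wirt, fderiv_fun_add hf hg, add_apply]; ring

theorem wirt_sub (hf : DifferentiableAt ℝ f z) (hg : DifferentiableAt ℝ g z) :
    wirt c j (fun x => f x - g x) z = wirt c j f z - wirt c j g z := by
  simp only [wirt, fderiv_fun_sub hf hg, sub_apply]; ring

theorem wirt_neg : wirt c j (fun x => - f x) z = - wirt c j f z := by
  simp only [wirt, fderiv_fun_neg, neg_apply]; ring

theorem wirt_const (a : ℂ) : wirt c j (fun _ => a) z = 0 := by
  simp [wirt]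

theorem wirt_mul (hf : DifferentiableAt ℝ f z) (hg : DifferentiableAt ℝ g z) :
    wirt c j (fun x => f x * g x) z = wirt c j f z * g z + f z * wirt c j g z := by
  simp only [wirt, fderiv_fun_mul hf hg, add_apply,
    smul_apply, smul_eq_mul]; ring

theorem wirt_const_mul (a : ℂ) (hf : DifferentiableAt ℝ f z) :
    wirt c j (fun x => a * f x) z = a * wirt c j f z := by
  rw [wirt_mul (differentiableAt_const a) hf, wirt_const]; ring

theorem wirt_sum {ι : Type*} (s : Finset ι) {F : ι → ℂ^m → ℂ}
    (hF : ∀ i ∈ s, DifferentiableAt ℝ (F i) z) :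
    wirt c j (fun x => ∑ i ∈ s, F i x) z = ∑ i ∈ s, wirt c j (F i) z := by
  simp only [wirt, fderiv_fun_sum hF, sum_apply, Finset.mul_sum,
    ← Finset.sum_add_distrib, Finset.sum_div]

theorem wirt_conj (hf : DifferentiableAt ℝ f z) :
    wirt c j (fun x => conj (f x)) z = conj (wirt (conj c) j f z) := by
  have h : HasFDerivAt (fun x => conj (f x))
      ((conjCLE : ℂ →L[ℝ] ℂ).comp (fderiv ℝ f z)) z :=
    (conjCLE : ℂ →L[ℝ] ℂ).hasFDerivAt.comp z hf.hasFDerivAt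
  simp [wirt, h.fderiv, Complex.conj_ofNat]

theorem wirt_comp {G : ℂ → ℂ} {G' : ℂ} (hG : HasDerivAt G G' (f z))
    (hf : DifferentiableAt ℝ f z) :
    wirt c j (fun x => G (f x)) z = G' * wirt c j f z := by
  have h := (hG.hasFDerivAt.restrictScalars ℝ).comp z hf.hasFDerivAt
  have h' : fderiv ℝ (fun x => G (f x)) z = _ := h.fderiv
  simp only [wirt, h']
  simp; ring

theorem wirt_congr (h : f =ᶠ[𝓝 z] g) : wirt c j f z = wirt c j g z := by
  simp only [wirt, h.fderiv_eq]

theorem contDiff_wirt (hf : ContDiff ℝ ∞ f) : ContDiff ℝ ∞ (wirt c j f) := by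
  have h : ContDiff ℝ ∞ (fderiv ℝ f) := hf.fderiv_right (by simp)
  unfold wirt
  fun_prop

theorem contDiffAt_wirt (hf : ContDiffAt ℝ ∞ f z) : ContDiffAt ℝ ∞ (wirt c j f) z := by
  have h : ContDiffAt ℝ ∞ (fderiv ℝ f) z := hf.fderiv_right (by simp)
  unfold wirt
  fun_prop

theorem wirt_comm (hf : ContDiffAt ℝ ∞ f z) :
    wirt c j (wirt c' k f) z = wirt c' k (wirt c j f) z := by
  have h : ContDiffAt ℝ ∞ (fderiv ℝ f) z := hf.fderiv_right (by simp)
  have hd : DifferentiableAt ℝ (fderiv ℝ f) z := h.differentiableAt (by simp)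
  have hs : IsSymmSndFDerivAt ℝ f z := hf.isSymmSndFDerivAt (by simp; exact WithTop.coe_le_coe.2 (le_top : (2:ℕ∞) ≤ ⊤))
  have key : ∀ (c : ℂ) (k : Fin m) (v : ℂ^m), fderiv ℝ (wirt c k f) z v =
      (fderiv ℝ (fderiv ℝ f) z v (Pi.single k 1) +
        c * fderiv ℝ (fderiv ℝ f) z v (Pi.single k I)) / 2 := by
    intro c k v
    have e : ∀ w, HasFDerivAt (fun x => fderiv ℝ f x w)
        ((ContinuousLinearMap.apply ℝ ℂ w).comp (fderiv ℝ (fderiv ℝ f) z)) z := fun w =>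
      (ContinuousLinearMap.apply ℝ ℂ w).hasFDerivAt.comp z hd.hasFDerivAt
    have h2 := ((e (Pi.single k 1)).add ((e (Pi.single k I)).const_mul c)).mul_const (2⁻¹ : ℂ)
    have h3 : fderiv ℝ (wirt c k f) z = _ := HasFDerivAt.fderiv (f := wirt c k f) (by
      simpa only [wirt, div_eq_mul_inv] using! h2)
    rw [h3]; simp; ring
  rw [wirt, wirt, key, key, key, key, hs.eq (Pi.single j 1) (Pi.single k 1),
    hs.eq (Pi.single j 1) (Pi.single k I), hs.eq (Pi.single j I) (Pi.single k 1),
    hs.eq (Pi.single j I) (Pi.single k I)]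
  ring

theorem wirt_eq_zero_of_notMem (h : z ∉ tsupport f) : wirt c j f z = 0 := by
  have : f =ᶠ[𝓝 z] fun _ => 0 := notMem_tsupport_iff_eventuallyEq.mp h
  rw [wirt_congr this, wirt_const]

theorem tsupport_wirt_subset : tsupport (wirt c j f) ⊆ tsupport f :=
  closure_minimal (fun x hx => by
    by_contra h; exact hx (wirt_eq_zero_of_notMem h)) (isClosed_tsupport f)

theorem hasCompactSupport_wirt (hf : HasCompactSupport f) : HasCompactSupport (wirt c j f) :=
  hf.of_isClosed_subset (isClosed_tsupport _) tsupport_wirt_subset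

theorem hasCompactSupport_conj (hf : HasCompactSupport f) :
    HasCompactSupport (fun x => conj (f x)) :=
  hf.comp_left (g := fun x : ℂ => conj x) (by simp)

theorem hasCompactSupport_ofReal {φ : ℂ^m → ℝ} (hφ : HasCompactSupport φ) :
    HasCompactSupport fun x => (φ x : ℂ) :=
  hφ.comp_left (g := fun x : ℝ => (x : ℂ)) (by simp)

theorem hasCompactSupport_normSq (hf : HasCompactSupport f) :
    HasCompactSupport fun x => ‖f x‖ ^ 2 :=
  hf.comp_left (g := fun x : ℂ => ‖x‖ ^ 2) (by simp)

theorem norm_ofReal_mul_sq (r : ℝ) (a : ℂ) : ‖(r : ℂ) * a‖ ^ 2 = r ^ 2 * ‖a‖ ^ 2 := by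
  rw [norm_mul, norm_real, mul_pow, Real.norm_eq_abs, sq_abs]

theorem contDiff_conj (hf : ContDiff ℝ ∞ f) : ContDiff ℝ ∞ (fun x => conj (f x)) :=
  conjCLE.contDiff.comp hf

/-- Integration by parts for Wirtinger derivatives. -/
theorem integral_wirt_mul (hf : ContDiff ℝ ∞ f) (hg : ContDiff ℝ ∞ g)
    (hfg : HasCompactSupport f ∨ HasCompactSupport g) :
    ∫ z, wirt c j f z * g z = - ∫ z, f z * wirt c j g z := by
  have hcf := hf.continuous_fderiv (by simp)
  have hcg := hg.continuous_fderiv (by simp)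
  have hi : ∀ {u v : ℂ^m → ℂ}, Continuous u → Continuous v →
      HasCompactSupport u ∨ HasCompactSupport v → Integrable fun z => u z * v z :=
    fun hu hv h => (hu.mul hv).integrable_of_hasCompactSupport
      (h.elim (fun h => h.mul_right) fun h => h.mul_left)
  have i1 : ∀ v, Integrable fun z => f z * fderiv ℝ g z v := fun v =>
    hi (by fun_prop) (by fun_prop) (hfg.imp_right fun h => h.fderiv_apply ℝ v)
  have i2 : ∀ v, Integrable fun z => fderiv ℝ f z v * g z := fun v =>
    hi (by fun_prop) (by fun_prop) (hfg.imp_left fun h => h.fderiv_apply ℝ v)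
  have i3 := hi hf.continuous hg.continuous hfg
  have key : ∀ v, ∫ z, fderiv ℝ f z v * g z = - ∫ z, f z * fderiv ℝ g z v := by
    intro v
    rw [integral_mul_fderiv_eq_neg_fderiv_mul_of_integrable (i2 v) (i1 v) i3
      (fun x _ => hf.differentiable (by simp) x) (fun x _ => hg.differentiable (by simp) x), neg_neg]
  have e1 : (fun z => wirt c j f z * g z) = fun z =>
      (1 / 2 : ℂ) * (fderiv ℝ f z (Pi.single j 1) * g z) +
        (c / 2) * (fderiv ℝ f z (Pi.single j I) * g z) := by
    ext z; simp only [wirt]; ring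
  have e2 : (fun z => f z * wirt c j g z) = fun z =>
      (1 / 2 : ℂ) * (f z * fderiv ℝ g z (Pi.single j 1)) +
        (c / 2) * (f z * fderiv ℝ g z (Pi.single j I)) := by
    ext z; simp only [wirt]; ring
  rw [e1, e2, integral_add ((i2 _).const_mul _) ((i2 _).const_mul _),
    integral_add ((i1 _).const_mul _) ((i1 _).const_mul _)]
  simp only [integral_const_mul, key]
  ring

/-- A real differentiable function killed by all `∂/∂z̄ⱼ` is complex differentiable. -/
theorem differentiableAt_of_dzb (hf : DifferentiableAt ℝ f z) (h : ∀ j, dzb j f z = 0) :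
    DifferentiableAt ℂ f z := by
  have key : ∀ j, fderiv ℝ f z (Pi.single j I) = I * fderiv ℝ f z (Pi.single j 1) := by
    intro j
    have h1 := h j
    simp only [wirt, div_eq_zero_iff, OfNat.ofNat_ne_zero, or_false] at h1
    linear_combination -I * h1 + fderiv ℝ f z (Pi.single j I) * I_sq
  let L : ℂ^m →ₗ[ℂ] ℂ := ∑ j, (fderiv ℝ f z (Pi.single j 1)) • LinearMap.proj j
  refine (hasFDerivAt_of_restrictScalars ℝ (f' := L.toContinuousLinearMap)
    hf.hasFDerivAt ?_).differentiableAt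
  ext v
  have hv : v = ∑ j, ((v j).re • (Pi.single j 1 : ℂ^m) + (v j).im • (Pi.single j I : ℂ^m)) := by
    ext i
    simp only [Finset.sum_apply, Pi.add_apply, Pi.smul_apply, Pi.single_apply]
    simp [Finset.sum_add_distrib, re_add_im]
  have h2 : fderiv ℝ f z v = L v := by
    conv_lhs => rw [hv]
    simp only [map_sum, map_add, map_smul, key, L, LinearMap.sum_apply, LinearMap.smul_apply,
      LinearMap.proj_apply, smul_eq_mul]
    refine Finset.sum_congr rfl fun j _ => ?_
    conv_rhs => rw [← re_add_im (v j)]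
    simp only [real_smul]; ring
  simpa using h2.symm

theorem dzb_eq_zero (hf : DifferentiableAt ℂ f z) : dzb j f z = 0 := by
  have h : fderiv ℝ f z = (fderiv ℂ f z).restrictScalars ℝ :=
    (hf.hasFDerivAt.restrictScalars ℝ).fderiv
  have e : (Pi.single j I : ℂ^m) = I • Pi.single j 1 := by
    ext i; by_cases hi : i = j <;> simp [hi]
  simp only [wirt, h, e, ContinuousLinearMap.coe_restrictScalars', map_smul, smul_eq_mul,
    ← mul_assoc, I_mul_I]
  ring

end Wirtinger

section Bochner
variable {m : ℕ}

/-- The complex Hessian (Levi) form of `φ` at `z` in the direction `w`. -/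
def levi (φ : ℂ^m → ℝ) (z w : ℂ^m) : ℝ :=
  (∑ j, ∑ k, dzb k (dz j (fun x => (φ x : ℂ))) z * (w j * conj (w k))).re

/-- The adjoint of `-∂/∂z̄ⱼ` in the space with weight `e^{-φ}`. -/
def del (φ : ℂ^m → ℝ) (j : Fin m) (f : ℂ^m → ℂ) (z : ℂ^m) : ℂ :=
  dz j f z - dz j (fun x => (φ x : ℂ)) z * f z

variable {φ : ℂ^m → ℝ} {f g : ℂ^m → ℂ}

theorem contDiff_ofReal_comp (hφ : ContDiff ℝ ∞ φ) :
    ContDiff ℝ ∞ fun x => (φ x : ℂ) := ofRealCLM.contDiff.comp hφ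

theorem contDiff_del (hφ : ContDiff ℝ ∞ φ) (hf : ContDiff ℝ ∞ f) (j : Fin m) :
    ContDiff ℝ ∞ (del φ j f) :=
  (contDiff_wirt hf).sub ((contDiff_wirt (contDiff_ofReal_comp hφ)).mul hf)

theorem hasCompactSupport_del (hf : HasCompactSupport f) (j : Fin m) :
    HasCompactSupport (del φ j f) :=
  (hasCompactSupport_wirt hf).sub hf.mul_left

/-- The weight `e^{-φ}`, as a complex valued function. -/
def wt (φ : ℂ^m → ℝ) (z : ℂ^m) : ℂ := (Real.exp (-φ z) : ℂ)

theorem contDiff_wt (hφ : ContDiff ℝ ∞ φ) : ContDiff ℝ ∞ (wt φ) :=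
  contDiff_ofReal_comp hφ.neg.exp

theorem wirt_wt {c : ℂ} {j : Fin m} (hφ : ContDiff ℝ ∞ φ) (z : ℂ^m) :
    wirt c j (wt φ) z = - (wirt c j (fun x => (φ x : ℂ)) z * wt φ z) := by
  have h0 : wt φ = fun z => Complex.exp (-(φ z : ℂ)) := by ext z; simp [wt]
  have hd := (contDiff_ofReal_comp hφ).differentiable (by simp) z
  have := wirt_comp (c := c) (j := j) (f := fun x => -(φ x : ℂ)) (z := z)
    (Complex.hasDerivAt_exp _) hd.neg
  rw [h0, this, wirt_neg]; ring

theorem integral_mul_conj_del (hφ : ContDiff ℝ ∞ φ) (hf : ContDiff ℝ ∞ f)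
    (hg : ContDiff ℝ ∞ g) (hgc : HasCompactSupport g) (k : Fin m) :
    ∫ z, f z * conj (del φ k g z) * wt φ z = - ∫ z, dzb k f z * (conj (g z) * wt φ z) := by
  have h := integral_wirt_mul (c := I) (j := k) hf ((contDiff_conj hg).mul (contDiff_wt hφ))
    (Or.inr (hasCompactSupport_conj hgc).mul_right)
  rw [h, neg_neg]
  congr 1; ext z
  rw [wirt_mul ((contDiff_conj hg).differentiable (by simp) z)
    ((contDiff_wt hφ).differentiable (by simp) z), wirt_wt hφ,
    wirt_conj (hg.differentiable (by simp) z), del]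
  have h2 := wirt_conj (c := I) (j := k)
    ((contDiff_ofReal_comp hφ).differentiable (by simp) z)
  simp only [conj_ofReal, conj_I] at h2
  rw [h2]
  simp only [map_sub, map_mul, conj_I]; ring

theorem integral_del_mul_conj (hφ : ContDiff ℝ ∞ φ) (hf : ContDiff ℝ ∞ f)
    (hg : ContDiff ℝ ∞ g) (hfc : HasCompactSupport f) (k : Fin m) :
    ∫ z, del φ k f z * (conj (g z) * wt φ z) = - ∫ z, f z * conj (dzb k g z) * wt φ z := by
  have h := congrArg conj (integral_mul_conj_del hφ hg hf hfc k)
  rw [map_neg, ← integral_conj, ← integral_conj] at h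
  have e1 : ∀ z, conj (g z * conj (del φ k f z) * wt φ z) =
      del φ k f z * (conj (g z) * wt φ z) := fun z => by
    simp only [wt, map_mul, conj_ofReal, conj_conj]; ring
  have e2 : ∀ z, conj (dzb k g z * (conj (f z) * wt φ z)) =
      f z * conj (dzb k g z) * wt φ z := fun z => by
    simp only [wt, map_mul, conj_ofReal, conj_conj]; ring
  simpa only [e1, e2] using h

theorem dzb_del (hφ : ContDiff ℝ ∞ φ) (hf : ContDiff ℝ ∞ f) (j k : Fin m) (z : ℂ^m) :
    dzb k (del φ j f) z =
      del φ j (dzb k f) z - dzb k (dz j (fun x => (φ x : ℂ))) z * f z := by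
  have hφ' := contDiff_ofReal_comp hφ
  have h1 := (contDiff_wirt (c := -I) (j := j) hf).differentiable (by simp) z
  have h2 := (contDiff_wirt (c := -I) (j := j) hφ').differentiable (by simp) z
  have h3 := hf.differentiable (by simp) z
  have : dzb k (del φ j f) z = dzb k (dz j f) z -
      dzb k (fun x => dz j (fun x => (φ x : ℂ)) x * f x) z := wirt_sub h1 (h2.mul h3)
  have h4 : dzb k (fun x => dz j (fun x => (φ x : ℂ)) x * f x) z = _ := wirt_mul h2 h3
  have h5 : dzb k (dz j f) z = _ := wirt_comm hf.contDiffAt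
  rw [this, h4, h5, del]
  ring

variable {β : Fin m → ℂ^m → ℂ}

/-- The basic integration by parts identity of the `L²` theory. -/
theorem bochner_identity (hφ : ContDiff ℝ ∞ φ) (hβ : ∀ j, ContDiff ℝ ∞ (β j))
    (hc : ∀ j, HasCompactSupport (β j)) (j k : Fin m) :
    ∫ z, del φ j (β j) z * conj (del φ k (β k) z) * wt φ z =
      (∫ z, dzb k (β j) z * conj (dzb j (β k) z) * wt φ z) +
      ∫ z, dzb k (dz j (fun x => (φ x : ℂ))) z * (β j z * conj (β k z)) * wt φ z := by
  have hφ' := contDiff_ofReal_comp hφ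
  have c1 : ∀ c i, Continuous (wirt c i (fun x => (φ x : ℂ))) :=
    fun c i => (contDiff_wirt hφ').continuous
  have c2 : ∀ i, Continuous (β i) := fun i => (hβ i).continuous
  have c3 := (contDiff_wt hφ).continuous
  rw [integral_mul_conj_del hφ (contDiff_del hφ (hβ j) j) (hβ k) (hc k) k]
  have e : (fun z => dzb k (del φ j (β j)) z * (conj (β k z) * wt φ z)) = fun z =>
      del φ j (dzb k (β j)) z * (conj (β k z) * wt φ z) -
      dzb k (dz j (fun x => (φ x : ℂ))) z * (β j z * conj (β k z)) * wt φ z := by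
    ext z; rw [dzb_del hφ (hβ j)]; ring
  rw [e, integral_sub, integral_del_mul_conj hφ (contDiff_wirt (hβ j)) (hβ k)
    (hasCompactSupport_wirt (hc j))]
  · ring
  · have c4 := (contDiff_del hφ (contDiff_wirt (c := I) (j := k) (hβ j)) j).continuous
    exact Continuous.integrable_of_hasCompactSupport (by fun_prop)
      ((hasCompactSupport_conj (hc k)).mul_right.mul_left)
  · have c5 := (contDiff_wirt (c := I) (j := k) (contDiff_wirt (c := -I) (j := j) hφ')).continuous
    exact Continuous.integrable_of_hasCompactSupport (by fun_prop)
      ((hc j).mul_right.mul_left.mul_right)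

/-- The basic inequality of the `L²` theory. -/
theorem bochner_inequality (hφ : ContDiff ℝ ∞ φ) (hβ : ∀ j, ContDiff ℝ ∞ (β j))
    (hc : ∀ j, HasCompactSupport (β j)) :
    ∫ z, levi φ z (fun j => β j z) * Real.exp (-φ z) ≤
      (∫ z, ‖∑ j, del φ j (β j) z‖ ^ 2 * Real.exp (-φ z)) +
      ∫ z, (1 / 2 * ∑ j, ∑ k, ‖dzb j (β k) z - dzb k (β j) z‖ ^ 2) * Real.exp (-φ z) := by
  have hφ' := contDiff_ofReal_comp hφ
  have c0 := hφ.continuous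
  have c2 : ∀ i, Continuous (β i) := fun i => (hβ i).continuous
  have c3 := (contDiff_wt hφ).continuous
  have c4 : ∀ j, Continuous (del φ j (β j)) := fun j => (contDiff_del hφ (hβ j) j).continuous
  have c5 : ∀ j k, Continuous (dzb k (dz j (fun x => (φ x : ℂ)))) := fun j k =>
    (contDiff_wirt (contDiff_wirt hφ')).continuous
  have c6 : ∀ j k, Continuous (dzb j (β k)) := fun j k => (contDiff_wirt (hβ k)).continuous
  have i1 : ∀ j k, Integrable fun z => del φ j (β j) z * conj (del φ k (β k) z) * wt φ z :=
    fun j k => Continuous.integrable_of_hasCompactSupport (by fun_prop)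
      (hasCompactSupport_del (hc j) j).mul_right.mul_right
  have i2 : ∀ j k, Integrable fun z => dzb k (β j) z * conj (dzb j (β k) z) * wt φ z :=
    fun j k => Continuous.integrable_of_hasCompactSupport (by fun_prop)
      (hasCompactSupport_wirt (hc j)).mul_right.mul_right
  have i3 : ∀ j k, Integrable fun z =>
      dzb k (dz j (fun x => (φ x : ℂ))) z * (β j z * conj (β k z)) * wt φ z :=
    fun j k => Continuous.integrable_of_hasCompactSupport (by fun_prop)
      ((hc j).mul_right.mul_left.mul_right)
  have i4 : Integrable fun z => ∑ j, ∑ k, dzb k (β j) z * conj (dzb j (β k) z) * wt φ z :=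
    integrable_finsetSum _ fun j _ => integrable_finsetSum _ fun k _ => i2 j k
  have i5 : Integrable fun z => ∑ j, ∑ k,
      dzb k (dz j (fun x => (φ x : ℂ))) z * (β j z * conj (β k z)) * wt φ z :=
    integrable_finsetSum _ fun j _ => integrable_finsetSum _ fun k _ => i3 j k
  have i6 : Integrable fun z => ∑ j, ∑ k, del φ j (β j) z * conj (del φ k (β k) z) * wt φ z :=
    integrable_finsetSum _ fun j _ => integrable_finsetSum _ fun k _ => i1 j k
  have key : ∫ z, ∑ j, ∑ k, del φ j (β j) z * conj (del φ k (β k) z) * wt φ z =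
      (∫ z, ∑ j, ∑ k, dzb k (β j) z * conj (dzb j (β k) z) * wt φ z) + ∫ z, ∑ j, ∑ k,
        dzb k (dz j (fun x => (φ x : ℂ))) z * (β j z * conj (β k z)) * wt φ z := by
    rw [integral_finsetSum _ fun j _ => integrable_finsetSum _ fun k _ => i1 j k,
      integral_finsetSum _ fun j _ => integrable_finsetSum _ fun k _ => i2 j k,
      integral_finsetSum _ fun j _ => integrable_finsetSum _ fun k _ => i3 j k,
      ← Finset.sum_add_distrib]
    refine Finset.sum_congr rfl fun j _ => ?_
    rw [integral_finsetSum _ fun k _ => i1 j k, integral_finsetSum _ fun k _ => i2 j k,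
      integral_finsetSum _ fun k _ => i3 j k, ← Finset.sum_add_distrib]
    exact Finset.sum_congr rfl fun k _ => bochner_identity hφ hβ hc j k
  have key2 := congrArg re key
  rw [add_re] at key2
  have hre : ∀ {F : ℂ^m → ℂ}, Integrable F → (∫ z, F z).re = ∫ z, (F z).re :=
    fun hF => (integral_re hF).symm
  rw [hre i6, hre i4, hre i5] at key2
  have e1 : ∀ z, (∑ j, ∑ k, del φ j (β j) z * conj (del φ k (β k) z) * wt φ z).re =
      ‖∑ j, del φ j (β j) z‖ ^ 2 * Real.exp (-φ z) := by
    intro z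
    have : ∑ j, ∑ k, del φ j (β j) z * conj (del φ k (β k) z) * wt φ z =
        ((‖∑ j, del φ j (β j) z‖ ^ 2 * Real.exp (-φ z) : ℝ) : ℂ) := by
      rw [ofReal_mul, ofReal_pow, ← mul_conj', map_sum, Finset.sum_mul_sum]
      simp only [Finset.sum_mul, wt]
    rw [this, ofReal_re]
  have e2 : ∀ z, (∑ j, ∑ k,
        dzb k (dz j (fun x => (φ x : ℂ))) z * (β j z * conj (β k z)) * wt φ z).re =
      levi φ z (fun j => β j z) * Real.exp (-φ z) := by
    intro z
    simp only [levi, wt, ← Finset.sum_mul, re_mul_ofReal]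
  have e3 : ∀ z, -((∑ j, ∑ k, dzb k (β j) z * conj (dzb j (β k) z) * wt φ z).re) ≤
      (1 / 2 * ∑ j, ∑ k, ‖dzb j (β k) z - dzb k (β j) z‖ ^ 2) * Real.exp (-φ z) := by
    intro z
    simp only [wt, ← Finset.sum_mul, re_mul_ofReal, ← neg_mul]
    refine mul_le_mul_of_nonneg_right ?_ (Real.exp_pos _).le
    rw [Finset.mul_sum, re_sum, ← Finset.sum_neg_distrib]
    refine Finset.sum_le_sum fun j _ => ?_
    rw [Finset.mul_sum, re_sum, ← Finset.sum_neg_distrib]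
    refine Finset.sum_le_sum fun k _ => ?_
    rw [← Complex.normSq_eq_norm_sq, Complex.normSq_apply]
    simp only [mul_re, conj_re, conj_im, sub_re, sub_im]
    nlinarith [sq_nonneg (dzb j (β k) z).re, sq_nonneg (dzb j (β k) z).im,
      sq_nonneg (dzb k (β j) z).re, sq_nonneg (dzb k (β j) z).im]
  simp only [e1, e2] at key2
  have i7 : Integrable fun z =>
      (1 / 2 * ∑ j, ∑ k, ‖dzb j (β k) z - dzb k (β j) z‖ ^ 2) * Real.exp (-φ z) := by
    simp only [Finset.mul_sum, Finset.sum_mul]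
    refine integrable_finsetSum _ fun j _ => integrable_finsetSum _ fun k _ =>
      Continuous.integrable_of_hasCompactSupport (by fun_prop) ?_
    have h1 : HasCompactSupport fun z => dzb j (β k) z - dzb k (β j) z :=
      (hasCompactSupport_wirt (hc k)).sub (hasCompactSupport_wirt (hc j))
    exact ((hasCompactSupport_normSq h1).mul_left
      (f := fun _ => (1 / 2 : ℝ))).mul_right
  have := integral_mono (f := fun z => -((∑ j, ∑ k,
    dzb k (β j) z * conj (dzb j (β k) z) * wt φ z).re)) i4.re.neg i7 e3
  rw [integral_neg] at this
  linarith

end Bochner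

section Mollifier
variable {m : ℕ} {F : Type*} [NormedAddCommGroup F] [NormedSpace ℝ F]

/-- A radial bump function supported in the polydisc of radius `ε`. -/
def bump (m : ℕ) (ε : ℝ) (y : ℂ^m) : ℝ :=
  Real.smoothTransition (1 - (∑ j, ‖y j‖ ^ 2) / ε ^ 2)

/-- A radial mollifier. -/
def moll (ε : ℝ) (y : ℂ^m) : ℝ := bump m ε y / ∫ x, bump m ε x

theorem contDiff_normSq : ContDiff ℝ ∞ fun z : ℂ^m => ∑ j, ‖z j‖ ^ 2 :=
  ContDiff.sum fun j _ => (contDiff_apply ℝ ℂ j).norm_sq ℝ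

theorem contDiff_bump (ε : ℝ) : ContDiff ℝ ∞ (bump m ε) :=
  Real.smoothTransition.contDiff.comp (contDiff_const.sub (contDiff_normSq.div_const _))

variable {ε : ℝ}

theorem bump_eq_zero (hε : 0 < ε) {y : ℂ^m} (hy : ε ≤ ‖y‖) : bump m ε y = 0 := by
  refine Real.smoothTransition.zero_of_nonpos ?_
  rw [sub_nonpos, one_le_div (by positivity)]
  by_contra! h
  refine hy.not_gt ((pi_norm_lt_iff hε).2 fun j => ?_)
  refine lt_of_pow_lt_pow_left₀ 2 hε.le (lt_of_le_of_lt ?_ h)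
  exact Finset.single_le_sum (f := fun j => ‖y j‖ ^ 2) (fun i _ => by positivity)
    (Finset.mem_univ j)

theorem bump_nonneg (y : ℂ^m) : 0 ≤ bump m ε y := Real.smoothTransition.nonneg _

theorem hasCompactSupport_bump (hε : 0 < ε) : HasCompactSupport (bump m ε) :=
  HasCompactSupport.of_support_subset_isCompact (isCompact_closedBall 0 ε) fun y hy => by
    by_contra h
    exact hy (bump_eq_zero hε (by simpa using (not_le.1 (by simpa using h)).le))

theorem integral_bump_pos (hε : 0 < ε) : 0 < ∫ x, bump m ε x := by
  refine (contDiff_bump ε).continuous.integral_pos_of_hasCompactSupport_nonneg_nonzero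
    (hasCompactSupport_bump hε) (fun y => bump_nonneg y) (x := 0) ?_
  simp [bump]

theorem contDiff_moll : ContDiff ℝ ∞ (moll ε : ℂ^m → ℝ) :=
  (contDiff_bump ε).div_const _

theorem moll_eq_zero (hε : 0 < ε) {y : ℂ^m} (hy : ε ≤ ‖y‖) : moll ε y = 0 := by
  simp [moll, bump_eq_zero hε hy]

theorem moll_nonneg (hε : 0 < ε) (y : ℂ^m) : 0 ≤ moll ε y :=
  div_nonneg (bump_nonneg y) (integral_bump_pos hε).le

theorem hasCompactSupport_moll (hε : 0 < ε) :
    HasCompactSupport (moll ε : ℂ^m → ℝ) :=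
  HasCompactSupport.of_support_subset_isCompact (isCompact_closedBall 0 ε) fun y hy => by
    by_contra h
    exact hy (moll_eq_zero hε (by simpa using (not_le.1 (by simpa using h)).le))

theorem integral_moll (hε : 0 < ε) : ∫ x : ℂ^m, moll ε x = 1 := by
  simp only [moll, integral_div]
  exact div_self (integral_bump_pos hε).ne'

theorem moll_smul {c : ℂ} (hc : ‖c‖ = 1) (y : ℂ^m) : moll ε (c • y) = moll ε y := by
  simp [moll, bump, hc]

theorem integrable_moll (hε : 0 < ε) : Integrable (moll ε : ℂ^m → ℝ) :=
  contDiff_moll.continuous.integrable_of_hasCompactSupport (hasCompactSupport_moll hε)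

/-- Mollification of `f` at scale `ε`. -/
def sm (ε : ℝ) (f : ℂ^m → F) : ℂ^m → F :=
  moll ε ⋆[ContinuousLinearMap.lsmul ℝ ℝ, volume] f

variable {f g : ℂ^m → F}

theorem sm_apply (x : ℂ^m) : sm ε f x = ∫ t, moll ε t • f (x - t) := rfl

theorem sm_apply' (x : ℂ^m) : sm ε f x = ∫ t, moll ε (x - t) • f t :=
  convolution_lsmul_swap

theorem integrable_moll_smul (hε : 0 < ε) (hf : LocallyIntegrable f) (x : ℂ^m) :
    Integrable fun t => moll ε t • f (x - t) :=
  (hasCompactSupport_moll hε).convolutionExists_left (ContinuousLinearMap.lsmul ℝ ℝ)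
    contDiff_moll.continuous hf x

theorem contDiff_sm [CompleteSpace F] (hε : 0 < ε) (hf : LocallyIntegrable f) :
    ContDiff ℝ ∞ (sm ε f) :=
  (hasCompactSupport_moll hε).contDiff_convolution_left _ contDiff_moll hf

theorem sm_congr (hε : 0 < ε) {x : ℂ^m} (h : ∀ y, ‖y - x‖ < ε → f y = g y) :
    sm ε f x = sm ε g x := by
  rw [sm_apply, sm_apply]
  congr 1; ext t
  by_cases ht : ε ≤ ‖t‖
  · simp [moll_eq_zero hε ht]
  · rw [h _ (by simpa using ht)]

theorem sm_eq_zero (hε : 0 < ε) {x : ℂ^m} (h : ∀ y, ‖y - x‖ < ε → f y = 0) :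
    sm ε f x = 0 := by
  rw [sm_congr hε (g := fun _ => 0) h, sm_apply]; simp

theorem hasCompactSupport_sm (hε : 0 < ε) (hf : HasCompactSupport f) :
    HasCompactSupport (sm ε f) :=
  (hasCompactSupport_moll hε).convolution _ hf

theorem norm_sm_sub_le [CompleteSpace F] (hε : 0 < ε) (hf : LocallyIntegrable f) {x : ℂ^m} {a : F} {δ : ℝ}
    (h : ∀ y, ‖y - x‖ < ε → ‖f y - a‖ ≤ δ) : ‖sm ε f x - a‖ ≤ δ := by
  have e : sm ε f x - a = ∫ t, moll ε t • (f (x - t) - a) := by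
    simp_rw [smul_sub]
    rw [integral_sub (integrable_moll_smul hε hf x) ((integrable_moll hε).smul_const a),
      integral_smul_const, integral_moll hε, one_smul, sm_apply]
  rw [e]
  calc ‖∫ t, moll ε t • (f (x - t) - a)‖ ≤ ∫ t, moll ε t * δ := by
        refine norm_integral_le_of_norm_le ((integrable_moll hε).mul_const δ)
          (.of_forall fun t => ?_)
        rw [norm_smul, Real.norm_of_nonneg (moll_nonneg hε t)]
        by_cases ht : ε ≤ ‖t‖
        · simp [moll_eq_zero hε ht]
        · exact mul_le_mul_of_nonneg_left (h _ (by simpa using ht)) (moll_nonneg hε t)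
    _ = δ := by rw [integral_mul_const, integral_moll hε, one_mul]

theorem support_moll_sub (hε : 0 < ε) (x : ℂ^m) :
    Function.support (fun t => ((moll ε (x - t) : ℝ) : ℂ)) ⊆ closedBall x ε := by
  intro t ht
  by_contra hh
  refine ht ?_
  rw [mem_closedBall, dist_comm, dist_eq_norm, not_le] at hh
  simp [moll_eq_zero hε hh.le]

theorem wirt_sm_eq {c : ℂ} {j : Fin m} {f : ℂ^m → ℂ} (hε : 0 < ε)
    (hf : LocallyIntegrable f) (x : ℂ^m) :
    wirt c j (sm ε f) x = - ∫ y, f y * wirt c j (fun t => ((moll ε (x - t) : ℝ) : ℂ)) y := by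
  have hd := (hasCompactSupport_moll hε).hasFDerivAt_convolution_left
    (ContinuousLinearMap.lsmul ℝ ℝ) (contDiff_moll.of_le (by simp)) hf x
  have hsm : ContDiff ℝ ∞ (fderiv ℝ (moll ε : ℂ^m → ℝ)) :=
    contDiff_moll.fderiv_right (by simp)
  have hce := ((hasCompactSupport_moll hε).fderiv ℝ).convolutionExists_left
    ((ContinuousLinearMap.lsmul ℝ ℝ).precompL ℂ^m) hsm.continuous hf x
  have hce' := hce.integrable_swap
  have key : ∀ v, fderiv ℝ (sm ε f) x v = ∫ t, (fderiv ℝ (moll ε) (x - t) v) • f t := by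
    intro v
    have : fderiv ℝ (sm ε f) x = _ := hd.fderiv
    rw [this, convolution_eq_swap, ContinuousLinearMap.integral_apply hce']
    rfl
  have hint : ∀ v, Integrable fun t => (fderiv ℝ (moll ε) (x - t) v) • f t := fun v =>
    (ContinuousLinearMap.apply ℝ ℂ v).integrable_comp hce'
  have hx : ∀ t v, fderiv ℝ (fun t => ((moll ε (x - t) : ℝ) : ℂ)) t v =
      -((fderiv ℝ (moll ε) (x - t) v : ℝ) : ℂ) := by
    intro t v
    have h1 : HasFDerivAt (moll ε : ℂ^m → ℝ) (fderiv ℝ (moll ε) (x - t)) (x - t) :=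
      (contDiff_moll.differentiable (by simp) _).hasFDerivAt
    have h2 := ofRealCLM.hasFDerivAt.comp t (h1.comp t ((hasFDerivAt_id t).const_sub x))
    have h3 : fderiv ℝ (fun t => ((moll ε (x - t) : ℝ) : ℂ)) t = _ := h2.fderiv
    rw [h3]; simp
  rw [wirt, key, key, ← integral_neg, ← integral_const_mul,
    ← integral_add (hint _) ((hint _).const_mul c), ← integral_div]
  congr 1; ext t
  simp only [wirt, hx, real_smul]; ring

theorem integrable_mul_wirt_moll {c : ℂ} {j : Fin m} {f : ℂ^m → ℂ} (hε : 0 < ε)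
    (hf : LocallyIntegrable f) (x : ℂ^m) :
    Integrable fun y => f y * wirt c j (fun t => ((moll ε (x - t) : ℝ) : ℂ)) y := by
  have h1 : ContDiff ℝ ∞ fun t => ((moll ε (x - t) : ℝ) : ℂ) :=
    contDiff_ofReal_comp (contDiff_moll.comp (contDiff_const.sub contDiff_id))
  have h2 : HasCompactSupport fun t => ((moll ε (x - t) : ℝ) : ℂ) :=
    .of_support_subset_isCompact (isCompact_closedBall x ε) (support_moll_sub hε x)
  have := hf.integrable_smul_left_of_hasCompactSupport (contDiff_wirt h1 (c := c) (j := j)).continuous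
    (hasCompactSupport_wirt h2)
  simpa only [smul_eq_mul, mul_comm] using this

/-- Weak derivatives commute with mollification. -/
theorem wirt_sm {c : ℂ} {j : Fin m} {f g : ℂ^m → ℂ} (hε : 0 < ε)
    (hf : LocallyIntegrable f) {x : ℂ^m}
    (h : ∀ κ : ℂ^m → ℂ, ContDiff ℝ ∞ κ → tsupport κ ⊆ closedBall x ε →
      ∫ y, f y * wirt c j κ y = - ∫ y, g y * κ y) :
    wirt c j (sm ε f) x = sm ε g x := by
  have hκ := h (fun t => ((moll ε (x - t) : ℝ) : ℂ))
    (contDiff_ofReal_comp (contDiff_moll.comp (contDiff_const.sub contDiff_id)))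
    (closure_minimal (support_moll_sub hε x) isClosed_closedBall)
  rw [wirt_sm_eq hε hf, sm_apply', hκ, neg_neg]
  congr 1; ext t; rw [real_smul, mul_comm]

end Mollifier

section MollifierAnalysis
variable {m : ℕ} {F : Type*} [NormedAddCommGroup F] [NormedSpace ℝ F] {ε δ : ℝ}

theorem sm_comm [CompleteSpace F] {f : ℂ^m → F} (hε : 0 < ε) (hδ : 0 < δ)
    (hf : LocallyIntegrable f) (x : ℂ^m) : sm ε (sm δ f) x = sm δ (sm ε f) x := by
  have hf' : LocallyIntegrable fun x => ‖f x‖ := fun x =>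
    let ⟨s, hs, hi⟩ := hf x
    ⟨s, hs, hi.norm⟩
  have key : ∀ {ε δ : ℝ}, 0 < ε → 0 < δ → sm ε (sm δ f) x =
      ((moll ε ⋆[ContinuousLinearMap.mul ℝ ℝ, volume] moll δ)
        ⋆[ContinuousLinearMap.lsmul ℝ ℝ, volume] f) x := by
    intro ε δ hε hδ
    refine (convolution_assoc _ _ _ _ (fun a b z => by simp [mul_smul]; exact smul_comm _ _ _)
      contDiff_moll.continuous.aestronglyMeasurable
      contDiff_moll.continuous.aestronglyMeasurable hf.aestronglyMeasurable
      (.of_forall fun y => ?_) (.of_forall fun y => ?_) ?_).symm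
    · exact (hasCompactSupport_moll hε).convolutionExists_left _ contDiff_moll.continuous
        contDiff_moll.continuous.locallyIntegrable y
    · exact (hasCompactSupport_moll hδ).norm.convolutionExists_left _
        contDiff_moll.continuous.norm hf' y
    · refine (hasCompactSupport_moll hε).norm.convolutionExists_left _
        contDiff_moll.continuous.norm ?_ x
      exact ((hasCompactSupport_moll hδ).norm.continuous_convolution_left _
        contDiff_moll.continuous.norm hf').locallyIntegrable
  rw [key hε hδ, key hδ hε]
  congr 1
  rw [← convolution_flip]
  congr 1
  ext; simp

theorem measurePreserving_smul_unit {c : ℂ} (hc : ‖c‖ = 1) :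
    MeasurePreserving (fun y : ℂ^m => c • y) volume volume := by
  have := volume_preserving_pi (fun _ : Fin m =>
    (rotation ⟨c, by simp [Submonoid.unitSphere, hc]⟩).measurePreserving)
  exact this

theorem integral_comp_smul_unit {c : ℂ} (hc : ‖c‖ = 1) (f : ℂ^m → F) :
    ∫ y, f (c • y) = ∫ y, f y := by
  have hc0 : c ≠ 0 := by rintro rfl; simp at hc
  exact (measurePreserving_smul_unit hc).integral_comp
    ((Homeomorph.smulOfNeZero c hc0).measurableEmbedding) f

theorem sm_eq_rotate {f : ℂ^m → F} {c : ℂ} (hc : ‖c‖ = 1) (x : ℂ^m) :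
    sm ε f x = ∫ y, moll ε y • f (x + c • y) := by
  rw [sm_apply, ← integral_comp_smul_unit (c := -c) (by simpa using hc)]
  refine integral_congr_ae (.of_forall fun y => ?_)
  simp only [moll_smul (show ‖-c‖ = 1 by simpa using hc)]
  rw [neg_smul, sub_neg_eq_add]

theorem circleAverage_integral_moll [CompleteSpace F] {G : ℂ → ℂ^m → F} (hε : 0 < ε)
    (hG : Continuous (Function.uncurry G)) :
    Real.circleAverage (fun ζ => ∫ y, moll ε y • G ζ y) 0 1 =
      ∫ y, moll ε y • Real.circleAverage (fun ζ => G ζ y) 0 1 := by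
  have hm := contDiff_moll (m := m) (ε := ε).continuous
  have hcont : Continuous fun p : ℝ × ℂ^m => moll ε p.2 • G (circleMap 0 1 p.1) p.2 := by
    have h1 : Continuous fun p : ℝ × ℂ^m => circleMap 0 1 p.1 :=
      (continuous_circleMap 0 1).comp continuous_fst
    exact (hm.comp continuous_snd).smul (hG.comp (h1.prodMk continuous_snd))
  have hint : Integrable (Function.uncurry fun θ y => moll ε y • G (circleMap 0 1 θ) y)
      ((volume.restrict (Set.uIoc 0 (2 * Real.pi))).prod (volume : Measure ℂ^m)) := by
    have e : (volume.restrict (Set.uIoc 0 (2 * Real.pi))).prod (volume : Measure ℂ^m) =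
        ((volume : Measure ℝ).prod (volume : Measure ℂ^m)).restrict
          (Set.uIoc 0 (2 * Real.pi) ×ˢ univ) := by
      rw [← Measure.prod_restrict, Measure.restrict_univ]
    rw [e]
    have hK : IntegrableOn (Function.uncurry fun θ y => moll ε y • G (circleMap 0 1 θ) y)
        (Set.uIcc 0 (2 * Real.pi) ×ˢ closedBall (0 : ℂ^m) ε)
        ((volume : Measure ℝ).prod (volume : Measure ℂ^m)) :=
      hcont.continuousOn.integrableOn_compact
        (isCompact_uIcc.prod (isCompact_closedBall 0 ε))
    refine IntegrableOn.of_forall_sdiff_eq_zero hK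
      (measurableSet_uIoc.prod MeasurableSet.univ) fun p hp => ?_
    have hp2 : p.2 ∉ closedBall (0 : ℂ^m) ε := fun h =>
      hp.2 ⟨uIoc_subset_uIcc hp.1.1, h⟩
    simp only [mem_closedBall, dist_zero_right, not_le] at hp2
    simp [Function.uncurry, moll_eq_zero hε hp2.le]
  simp only [Real.circleAverage, smul_comm (moll ε _) _ _, integral_smul]
  congr 1
  rw [intervalIntegral_integral_swap hint]
  simp only [intervalIntegral.integral_smul]

theorem sm_eq_circleAverage [CompleteSpace F] {f : ℂ^m → F} (hε : 0 < ε)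
    (hf : Continuous f) (x : ℂ^m) :
    sm ε f x = ∫ y, moll ε y • Real.circleAverage (fun ζ => f (x + ζ • y)) 0 1 := by
  rw [← circleAverage_integral_moll hε (G := fun ζ y => f (x + ζ • y)) (by
    simp only [Function.uncurry_def]; fun_prop)]
  refine (Real.circleAverage_const_on_circle fun ζ hζ => ?_).symm
  exact (sm_eq_rotate (by simpa using hζ) x).symm

/-- Smooth cutoff functions. -/
theorem exists_cutoff {K O : Set ℂ^m} (hK : IsCompact K) (hO : IsOpen O)
    (hKO : K ⊆ O) : ∃ χ : ℂ^m → ℝ, ContDiff ℝ ∞ χ ∧ HasCompactSupport χ ∧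
      tsupport χ ⊆ O ∧ (∃ V, IsOpen V ∧ K ⊆ V ∧ ∀ x ∈ V, χ x = 1) ∧ ∀ x, χ x ∈ Icc (0:ℝ) 1 := by
  obtain ⟨L, hL, hKL, hLO⟩ := exists_compact_between hK hO hKO
  obtain ⟨f, h1, h2, h3⟩ := exists_contMDiffMap_one_nhds_of_subset_interior (n := ⊤)
    (modelWithCornersSelf ℝ ℂ^m) hK.isClosed hKL
  have ht : tsupport f ⊆ L := closure_minimal (fun x hx => by
    by_contra h; exact hx (h2 x h)) hL.isClosed
  obtain ⟨V, hV, hKV, hV1⟩ := (eventually_nhdsSet_iff_exists).1 h1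
  exact ⟨f, f.contMDiff.contDiff, hL.of_isClosed_subset (isClosed_tsupport _) ht,
    ht.trans hLO, ⟨V, hV, hKV, hV1⟩, h3⟩

theorem contDiff_smul_of_tsupport {χ : ℂ^m → ℝ}
    {f : ℂ^m → F}
    {O : Set ℂ^m} {n : WithTop ℕ∞} (hO : IsOpen O) (hχ : ContDiff ℝ n χ)
    (hs : tsupport χ ⊆ O) (hf : ContDiffOn ℝ n f O) : ContDiff ℝ n fun x => χ x • f x := by
  rw [contDiff_iff_contDiffAt]
  intro x
  by_cases hx : x ∈ O
  · exact hχ.contDiffAt.smul (hf.contDiffAt (hO.mem_nhds hx))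
  · have : (fun x => χ x • f x) =ᶠ[𝓝 x] fun _ => 0 := by
      filter_upwards [notMem_tsupport_iff_eventuallyEq.1 (fun h => hx (hs h))] with y hy
      rw [hy]; simp
    exact contDiffAt_const.congr_of_eventuallyEq this

/-- A smooth function on an open set can be modified outside of a neighbourhood of a compact
set so as to become globally smooth. -/
theorem exists_extension {f : ℂ^m → F} {n : WithTop ℕ∞} (hn : n ≤ ∞)
    {K O : Set ℂ^m} (hK : IsCompact K)
    (hO : IsOpen O) (hKO : K ⊆ O) (hf : ContDiffOn ℝ n f O) :
    ∃ g : ℂ^m → F, ContDiff ℝ n g ∧ HasCompactSupport g ∧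
      ∃ V, IsOpen V ∧ K ⊆ V ∧ EqOn g f V := by
  obtain ⟨χ, h1, h2, h3, ⟨V, hV, hKV, h4⟩, -⟩ := exists_cutoff hK hO hKO
  exact ⟨fun x => χ x • f x, contDiff_smul_of_tsupport hO (h1.of_le hn) h3 hf,
    h2.smul_right, V, hV, hKV, fun x hx => by simp [h4 x hx]⟩

theorem differentiableAt_comp_line {f : ℂ^m → ℂ} {x y : ℂ^m} {ζ : ℂ}
    (hf : DifferentiableAt ℂ f (x + ζ • y)) :
    DifferentiableAt ℂ (fun ζ : ℂ => f (x + ζ • y)) ζ :=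
  DifferentiableAt.comp ζ hf (by fun_prop)

/-- Mean value property of holomorphic functions. -/
theorem sm_eq_self {f : ℂ^m → ℂ} (hε : 0 < ε) {x : ℂ^m}
    (hf : ∀ y ∈ closedBall x ε, DifferentiableAt ℂ f y) : sm ε f x = f x := by
  have hc : ContinuousOn f (closedBall x ε) := fun y hy =>
    (hf y hy).continuousAt.continuousWithinAt
  obtain ⟨g, hg⟩ := ContinuousMap.exists_restrict_eq isClosed_closedBall
    (⟨_, hc.domRestrict⟩ : C(closedBall x ε, ℂ))
  have hgf : ∀ y ∈ closedBall x ε, g y = f y := fun y hy =>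
    congrArg (fun h : C(closedBall x ε, ℂ) => h ⟨y, hy⟩) hg
  rw [← sm_congr hε (f := g) fun y hy => hgf y (by simpa [dist_eq_norm] using hy.le),
    sm_eq_circleAverage hε g.continuous]
  have : ∀ y, moll ε y • Real.circleAverage (fun ζ => g (x + ζ • y)) 0 1 = moll ε y • f x := by
    intro y
    by_cases hy : ε ≤ ‖y‖
    · simp [moll_eq_zero hε hy]
    have hin : ∀ ζ : ℂ, ‖ζ‖ ≤ 1 → x + ζ • y ∈ closedBall x ε := fun ζ hζ => by
      rw [mem_closedBall, dist_eq_norm, add_sub_cancel_left, norm_smul]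
      nlinarith [norm_nonneg y, norm_nonneg ζ]
    have e : Real.circleAverage (fun ζ => g (x + ζ • y)) 0 1 =
        Real.circleAverage (fun ζ => f (x + ζ • y)) 0 1 :=
      Real.circleAverage_congr_sphere fun ζ hζ => hgf _ (hin ζ (by simpa using hζ.le))
    have hdiff : ∀ ζ : ℂ, ‖ζ‖ ≤ 1 → DifferentiableAt ℂ (fun ζ : ℂ => f (x + ζ • y)) ζ :=
      fun ζ hζ => differentiableAt_comp_line (hf _ (hin ζ hζ))
    rw [e, circleAverage_of_differentiable_on_off_countable (s := ∅) (by simp)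
      (fun ζ hζ => (hdiff ζ (by simpa using hζ)).continuousAt.continuousWithinAt)
      (fun ζ hζ => hdiff ζ (by simpa using (mem_ball.1 hζ.1).le))]
    simp
  simp only [this]
  rw [integral_smul_const, integral_moll hε, one_smul]

end MollifierAnalysis

section LTwo
variable {m : ℕ} {ε δ : ℝ} {f g : ℂ^m → ℂ}

theorem memLp_two_iff (hf : AEStronglyMeasurable f) :
    MemLp f 2 ↔ Integrable fun x => ‖f x‖ ^ 2 :=
  memLp_two_iff_integrable_sq_norm hf

theorem integrable_normSq {μ : Measure ℂ^m} (hf : MemLp f 2 μ) :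
    Integrable (fun x => ‖f x‖ ^ 2) μ :=
  (memLp_two_iff_integrable_sq_norm hf.1).1 hf

theorem locInt_of_memLp (hf : MemLp f 2) : LocallyIntegrable f :=
  hf.locallyIntegrable (by norm_num)

theorem norm_sm_sq_le (hε : 0 < ε) (hf : MemLp f 2) (x : ℂ^m) :
    ‖sm ε f x‖ ^ 2 ≤ sm ε (fun y => ‖f y‖ ^ 2) x := by
  have h1 : Integrable fun t => moll ε t * ‖f (x - t)‖ := by
    refine (integrable_moll_smul hε (locInt_of_memLp hf) x).norm.congr (.of_forall fun t => ?_)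
    simp [abs_of_nonneg (moll_nonneg hε t)]
  have h2 : Integrable fun t => moll ε t * ‖f (x - t)‖ ^ 2 :=
    integrable_moll_smul hε (integrable_normSq hf).locallyIntegrable x
  set c := ∫ t, moll ε t * ‖f (x - t)‖ with hc
  have h3 : ‖sm ε f x‖ ≤ c := by
    rw [sm_apply]
    refine (norm_integral_le_integral_norm _).trans (le_of_eq ?_)
    congr 1; ext t
    simp [abs_of_nonneg (moll_nonneg hε t)]
  have h4 : 0 ≤ ∫ t, moll ε t * (‖f (x - t)‖ - c) ^ 2 :=
    integral_nonneg fun t => mul_nonneg (moll_nonneg hε t) (sq_nonneg _)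
  have h5 : ∫ t, moll ε t * (‖f (x - t)‖ - c) ^ 2 =
      (∫ t, moll ε t * ‖f (x - t)‖ ^ 2) - 2 * c * c + c ^ 2 := by
    have e : (fun t => moll ε t * (‖f (x - t)‖ - c) ^ 2) = fun t =>
        moll ε t * ‖f (x - t)‖ ^ 2 - 2 * c * (moll ε t * ‖f (x - t)‖) + c ^ 2 * moll ε t := by
      ext t; ring
    have h2' : Integrable fun t => moll ε t * ‖f (x - t)‖ ^ 2 -
        2 * c * (moll ε t * ‖f (x - t)‖) := h2.sub (h1.const_mul _)
    rw [e, integral_add h2' ((integrable_moll hε).const_mul _),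
      integral_sub h2 (h1.const_mul _), integral_const_mul, integral_const_mul, ← hc,
      integral_moll hε, mul_one]
  have h6 : sm ε (fun y => ‖f y‖ ^ 2) x = ∫ t, moll ε t * ‖f (x - t)‖ ^ 2 := rfl
  nlinarith [norm_nonneg (sm ε f x)]

theorem integrable_sm {F : Type*} [NormedAddCommGroup F] [NormedSpace ℝ F]
    {f : ℂ^m → F} (hε : 0 < ε) (hf : Integrable f) : Integrable (sm ε f) :=
  (integrable_moll hε).integrable_convolution _ hf

theorem memLp_sm (hε : 0 < ε) (hf : MemLp f 2) : MemLp (sm ε f) 2 := by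
  have hc := (contDiff_sm hε (locInt_of_memLp hf)).continuous
  rw [memLp_two_iff hc.aestronglyMeasurable]
  refine (integrable_sm hε (integrable_normSq hf)).mono' (by fun_prop)
    (.of_forall fun x => ?_)
  rw [Real.norm_of_nonneg (by positivity)]
  exact norm_sm_sq_le hε hf x

theorem integral_norm_sm_sq_le (hε : 0 < ε) (hf : MemLp f 2) :
    ∫ x, ‖sm ε f x‖ ^ 2 ≤ ∫ x, ‖f x‖ ^ 2 := by
  have h := integrable_normSq hf
  refine (integral_mono (integrable_normSq (memLp_sm hε hf)) (integrable_sm hε h)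
    (norm_sm_sq_le hε hf)).trans (le_of_eq ?_)
  have := integral_convolution (ContinuousLinearMap.lsmul ℝ ℝ) (integrable_moll (m := m) hε) h
  rw [integral_moll hε] at this
  exact this.trans (by simp)

theorem sm_sub (hε : 0 < ε) (hf : LocallyIntegrable f) (hg : LocallyIntegrable g)
    (x : ℂ^m) : sm ε (fun y => f y - g y) x = sm ε f x - sm ε g x := by
  simp only [sm_apply, smul_sub]
  exact integral_sub (integrable_moll_smul hε hf x) (integrable_moll_smul hε hg x)

theorem exists_sm_near (hg : Continuous g) (hgc : HasCompactSupport g) {η : ℝ} (hη : 0 < η) :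
    ∃ δ > 0, ∀ ε, 0 < ε → ε < δ → ∫ x, ‖sm ε g x - g x‖ ^ 2 ≤ η := by
  obtain ⟨R, hR⟩ := hgc.isCompact.isBounded.subset_closedBall (0 : ℂ^m)
  set V := (volume (closedBall (0 : ℂ^m) (R + 1))).toReal with hV
  have hV0 : 0 ≤ V := ENNReal.toReal_nonneg
  have huc := hgc.uniformContinuous_of_continuous hg
  obtain ⟨δ, hδ, h⟩ := uniformContinuous_iff_le.1 huc (√(η / (V + 1))) (by positivity)
  refine ⟨min δ 1, by positivity, fun ε hε hεδ => ?_⟩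
  have hb : ∀ x, ‖sm ε g x - g x‖ ^ 2 ≤ η / (V + 1) := fun x => by
    have := norm_sm_sub_le hε hg.locallyIntegrable (x := x) (a := g x)
      (δ := √(η / (V + 1))) fun y hy => by
        rw [← dist_eq_norm]
        exact h (by rw [dist_eq_norm]; exact hy.le.trans (hεδ.le.trans (min_le_left _ _)))
    calc _ ≤ (√(η / (V + 1))) ^ 2 := by gcongr
      _ = _ := Real.sq_sqrt (by positivity)
  have h0 : ∀ x ∉ closedBall (0 : ℂ^m) (R + 1), ‖sm ε g x - g x‖ ^ 2 = 0 := by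
    intro x hx
    have hz : ∀ y, ‖y - x‖ < ε → g y = 0 := by
      intro y hy
      by_contra hne
      have h1 := hR (subset_tsupport g hne)
      rw [mem_closedBall, dist_zero_right] at h1 hx
      have h2 : ‖x‖ ≤ ‖y‖ + ‖y - x‖ := by
        calc ‖x‖ = ‖y - (y - x)‖ := by abel_nf
          _ ≤ _ := norm_sub_le _ _
      have h3 := hεδ.trans_le (min_le_right δ 1)
      exact hx (by linarith)
    rw [sm_eq_zero hε hz, hz x (by simpa using hε)]; simp
  rw [← setIntegral_eq_integral_of_forall_compl_eq_zero h0]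
  have hfin : volume (closedBall (0 : ℂ^m) (R + 1)) < ⊤ :=
    measure_closedBall_lt_top
  calc ∫ x in closedBall 0 (R + 1), ‖sm ε g x - g x‖ ^ 2
      ≤ ∫ x in closedBall (0 : ℂ^m) (R + 1), η / (V + 1) := by
        refine setIntegral_mono_on ?_ (integrableOn_const hfin.ne) measurableSet_closedBall
          fun x _ => hb x
        have := (contDiff_sm hε hg.locallyIntegrable).continuous
        exact (Continuous.continuousOn (by fun_prop)).integrableOn_compact
          (isCompact_closedBall _ _)
    _ = V * (η / (V + 1)) := by
        rw [setIntegral_const, smul_eq_mul]; rfl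
    _ ≤ η := by
        rw [mul_div_assoc', div_le_iff₀ (by positivity)]; nlinarith

theorem tendsto_sm (hf : MemLp f 2) :
    Tendsto (fun ε => ∫ x, ‖sm ε f x - f x‖ ^ 2) (𝓝[>] 0) (𝓝 0) := by
  rw [Metric.tendsto_nhds]
  intro η hη
  obtain ⟨g, hgc, hgf, hg, hgL⟩ := hf.exists_hasCompactSupport_eLpNorm_sub_le (by norm_num)
    (ε := ENNReal.ofReal (√(η / 12))) (by simpa using by positivity)
  have hfg : MemLp (fun x => f x - g x) 2 := hf.sub hgL
  have hfg2 : ∫ x, ‖f x - g x‖ ^ 2 ≤ η / 12 := by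
    have h1 := hfg.eLpNorm_eq_integral_rpow_norm (by norm_num) (by norm_num)
    have h2 : eLpNorm (fun x => f x - g x) 2 volume ≤ ENNReal.ofReal (√(η / 12)) := hgf
    rw [h1, ENNReal.ofReal_le_ofReal_iff (by positivity)] at h2
    have h3 : (0:ℝ) ≤ ∫ x, ‖f x - g x‖ ^ 2 := integral_nonneg fun x => by positivity
    simp only [ENNReal.toReal_ofNat, Real.rpow_ofNat, ← one_div] at h2
    rw [← Real.sqrt_eq_rpow] at h2
    exact (Real.sqrt_le_sqrt_iff (by positivity)).1 h2
  obtain ⟨δ, hδ, hδ'⟩ := exists_sm_near hg hgc (η := η / 12) (by positivity)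
  filter_upwards [Ioo_mem_nhdsGT hδ] with ε hε
  have hsg : MemLp (sm ε g) 2 := memLp_sm hε.1 hgL
  have i1 : MemLp (fun x => sm ε (fun y => f y - g y) x) 2 := memLp_sm hε.1 hfg
  have i2 : MemLp (fun x => sm ε g x - g x) 2 := hsg.sub hgL
  have j1 := integrable_normSq i1
  have j2 := integrable_normSq i2
  have j3 := integrable_normSq hfg
  have hle : ∫ x, ‖sm ε f x - f x‖ ^ 2 ≤ ∫ x, (3 * ‖sm ε (fun y => f y - g y) x‖ ^ 2 +
      3 * ‖sm ε g x - g x‖ ^ 2 + 3 * ‖f x - g x‖ ^ 2) := by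
    refine integral_mono (integrable_normSq ((memLp_sm hε.1 hf).sub hf))
      (((j1.const_mul 3).add (j2.const_mul 3)).add (j3.const_mul 3)) fun x => ?_
    have e : sm ε f x - f x = sm ε (fun y => f y - g y) x + (sm ε g x - g x) - (f x - g x) := by
      rw [sm_sub hε.1 (locInt_of_memLp hf) (locInt_of_memLp hgL)]; ring
    have hn := (norm_sub_le (sm ε (fun y => f y - g y) x + (sm ε g x - g x)) (f x - g x)).trans
      (add_le_add_left (norm_add_le (sm ε (fun y => f y - g y) x) (sm ε g x - g x)) _)
    dsimp only
    rw [e]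
    set a := ‖sm ε (fun y => f y - g y) x‖
    set b := ‖sm ε g x - g x‖
    set c := ‖f x - g x‖
    calc _ ≤ (a + b + c) ^ 2 := by gcongr
      _ ≤ _ := by nlinarith [sq_nonneg (a - b), sq_nonneg (b - c), sq_nonneg (a - c)]
  have j12 : Integrable fun x => 3 * ‖sm ε (fun y => f y - g y) x‖ ^ 2 +
      3 * ‖sm ε g x - g x‖ ^ 2 := (j1.const_mul 3).add (j2.const_mul 3)
  rw [integral_add j12 (j3.const_mul 3),
    integral_add (j1.const_mul 3) (j2.const_mul 3), integral_const_mul, integral_const_mul,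
    integral_const_mul] at hle
  have h1 := integral_norm_sm_sq_le hε.1 hfg
  have h2 := hδ' ε hε.1 hε.2
  rw [Real.dist_0_eq_abs, abs_of_nonneg (integral_nonneg fun x => by positivity)]
  linarith

/-- Weyl's lemma on a ball. -/
theorem weyl_ball {x₀ : ℂ^m} {R : ℝ} (hR : 0 < R)
    (hf : MemLp f 2 (volume.restrict (ball x₀ R)))
    (h : ∀ κ : ℂ^m → ℂ, ContDiff ℝ ∞ κ → HasCompactSupport κ →
      tsupport κ ⊆ ball x₀ R → ∀ j, ∫ y, f y * dzb j κ y = 0) :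
    ∃ F, DifferentiableOn ℂ F (ball x₀ (R / 2)) ∧
      f =ᵐ[volume.restrict (ball x₀ (R / 2))] F := by
  set f' := (ball x₀ R).indicator f
  have hf' : MemLp f' 2 := (memLp_indicator_iff_restrict measurableSet_ball).2 hf
  have hol : ∀ ε, 0 < ε → ∀ x, dist x x₀ < R - ε → DifferentiableAt ℂ (sm ε f') x := by
    intro ε hε x hx
    have hb : closedBall x ε ⊆ ball x₀ R :=
      closedBall_subset_ball' (by linarith)
    refine differentiableAt_of_dzb ((contDiff_sm hε (locInt_of_memLp hf')).differentiable (by simp) x)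
      fun j => ?_
    refine (wirt_sm hε (locInt_of_memLp hf') (g := fun _ => 0) fun κ hκ hs => ?_).trans
      (sm_eq_zero hε fun _ _ => rfl)
    simp only [zero_mul, integral_zero, neg_zero]
    rw [← h κ hκ ((isCompact_closedBall x ε).of_isClosed_subset
      (isClosed_tsupport _) hs) (hs.trans hb) j]
    congr 1; ext y
    by_cases hy : y ∈ ball x₀ R
    · simp only [f', indicator_of_mem hy]
    · have : wirt I j κ y = 0 := wirt_eq_zero_of_notMem fun hh => hy (hb (hs hh))
      simp [this]
  have heq : ∀ ε δ, 0 < ε → 0 < δ → ε < R / 4 → δ < R / 4 →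
      ∀ x ∈ ball x₀ (R / 2), sm ε f' x = sm δ f' x := by
    have hh : ∀ ε δ, 0 < ε → 0 < δ → ε < R / 4 → δ < R / 4 →
        ∀ x ∈ ball x₀ (R / 2), sm δ (sm ε f') x = sm ε f' x := by
      intro ε δ hε hδ hε' hδ' x hx
      refine sm_eq_self hδ fun y hy => hol ε hε y ?_
      have := dist_triangle y x x₀
      rw [mem_closedBall] at hy
      rw [mem_ball] at hx
      linarith
    intro ε δ hε hδ hε' hδ' x hx
    rw [← hh ε δ hε hδ hε' hδ' x hx, sm_comm hδ hε (locInt_of_memLp hf'), hh δ ε hδ hε hδ' hε' x hx]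
  refine ⟨sm (R / 8) f', fun x hx => (hol (R / 8) (by positivity) x (by
    rw [mem_ball] at hx; linarith)).differentiableWithinAt, ?_⟩
  set B := ball x₀ (R / 2)
  have hI : MemLp (fun x => sm (R / 8) f' x - f' x) 2 := (memLp_sm (by positivity) hf').sub hf'
  have hz : ∫ x in B, ‖sm (R / 8) f' x - f' x‖ ^ 2 = 0 := by
    refine le_antisymm ?_ (integral_nonneg fun x => by positivity)
    refine ge_of_tendsto (tendsto_sm hf') ?_
    filter_upwards [Ioo_mem_nhdsGT (show 0 < R / 4 by positivity)] with ε hε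
    have : ∫ x in B, ‖sm (R / 8) f' x - f' x‖ ^ 2 = ∫ x in B, ‖sm ε f' x - f' x‖ ^ 2 :=
      setIntegral_congr_fun measurableSet_ball fun x hx => by
        rw [heq (R / 8) ε (by positivity) hε.1 (by linarith) hε.2 x hx]
    rw [this]
    exact setIntegral_le_integral (integrable_normSq ((memLp_sm hε.1 hf').sub hf'))
      (.of_forall fun x => by positivity)
  rw [integral_eq_zero_iff_of_nonneg (fun x => by positivity)
    (integrable_normSq hI).integrableOn] at hz
  filter_upwards [hz, ae_restrict_mem measurableSet_ball] with x hx hxB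
  have hx' : x ∈ ball x₀ R := ball_subset_ball (by linarith) hxB
  have : sm (R / 8) f' x - f' x = 0 := by simpa using hx
  rw [sub_eq_zero.1 this]
  simp only [f', indicator_of_mem hx']

/-- Weyl's lemma. -/
theorem weyl {Y : Set ℂ^m} (hY : IsOpen Y)
    (hf : ∀ K ⊆ Y, IsCompact K → MemLp f 2 (volume.restrict K))
    (h : ∀ κ : ℂ^m → ℂ, ContDiff ℝ ∞ κ → HasCompactSupport κ →
      tsupport κ ⊆ Y → ∀ j, ∫ y, f y * dzb j κ y = 0) :
    ∃ F, DifferentiableOn ℂ F Y ∧ f =ᵐ[volume.restrict Y] F := by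
  have loc : ∀ x ∈ Y, ∃ r > 0, ∃ F, DifferentiableOn ℂ F (ball x r) ∧
      f =ᵐ[volume.restrict (ball x r)] F := by
    intro x hx
    obtain ⟨R, hR, hRY⟩ := nhds_basis_closedBall.mem_iff.1 (hY.mem_nhds hx)
    obtain ⟨F, h1, h2⟩ := weyl_ball (f := f) (x₀ := x) hR ((hf _ hRY (isCompact_closedBall x R)).mono_measure
      (Measure.restrict_mono ball_subset_closedBall le_rfl)) fun κ hκ hc hs =>
        h κ hκ hc (hs.trans (ball_subset_closedBall.trans hRY))
    exact ⟨R / 2, by positivity, F, h1, h2⟩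
  choose! r hr G hG hfG using loc
  have hover : ∀ x ∈ Y, ∀ y ∈ Y, y ∈ ball x (r x) → G x y = G y y := by
    intro x hx y hy hyx
    set O := ball x (r x) ∩ ball y (r y)
    have hO : IsOpen O := isOpen_ball.inter isOpen_ball
    have a1 : f =ᵐ[volume.restrict O] G x :=
      ae_restrict_of_ae_restrict_of_subset inter_subset_left (hfG x hx)
    have a2 : f =ᵐ[volume.restrict O] G y :=
      ae_restrict_of_ae_restrict_of_subset inter_subset_right (hfG y hy)
    have hae : G x =ᵐ[volume.restrict O] G y := a1.symm.trans a2
    exact Measure.eqOn_open_of_ae_eq hae hO ((hG x hx).continuousOn.mono inter_subset_left)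
      ((hG y hy).continuousOn.mono inter_subset_right) ⟨hyx, mem_ball_self (hr y hy)⟩
  have hnear : ∀ x ∈ Y, ∀ y ∈ ball x (r x) ∩ Y, G y y = G x y := fun x hx y hy =>
    (hover x hx y hy.2 hy.1).symm
  refine ⟨fun y => G y y, fun x hx => ?_, ?_⟩
  · have hn : ball x (r x) ∩ Y ∈ 𝓝 x :=
      inter_mem (ball_mem_nhds x (hr x hx)) (hY.mem_nhds hx)
    refine (DifferentiableAt.congr_of_eventuallyEq
      ((hG x hx).differentiableAt (ball_mem_nhds x (hr x hx))) ?_).differentiableWithinAt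
    filter_upwards [hn] with y hy using hnear x hx y hy
  · rw [Filter.EventuallyEq, ae_restrict_iff' hY.measurableSet, ae_iff]
    have : {a | ¬(a ∈ Y → f a = G a a)} ⊆ Y := fun a ha => by
      by_contra h; exact ha fun h' => absurd h' h
    refine measure_null_of_locally_null _ fun x hx => ?_
    have hxY := this hx
    refine ⟨_, inter_mem_nhdsWithin _ (ball_mem_nhds x (hr x hxY)), ?_⟩
    have h1 := hfG x hxY
    rw [Filter.EventuallyEq, ae_restrict_iff' measurableSet_ball, ae_iff] at h1
    refine measure_mono_null (fun y hy => ?_) h1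
    intro hh
    exact hy.1 fun hyY => (hh hy.2).trans (hnear x hxY y ⟨hy.2, hyY⟩).symm

end LTwo

section Submean

/-- A weak form of subharmonicity at the origin of the plane. -/
def FourPt (f : ℂ → ℝ) : Prop :=
  ∀ ε > 0, ∀ᶠ t : ℝ in 𝓝[>] 0,
    4 * f 0 - ε * t ^ 2 ≤ f t + f (I * t) + f (-t) + f (-(I * t))

theorem tendsto_mul_ofReal (c : ℂ) : Tendsto (fun t : ℝ => c * (t : ℂ)) (𝓝[>] 0) (𝓝 0) :=
  (Continuous.tendsto' (by fun_prop) 0 0 (by simp)).mono_left nhdsWithin_le_nhds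

theorem eventually_four {P : ℂ → Prop} (h : ∀ᶠ ζ in 𝓝 0, P ζ) :
    ∀ᶠ t : ℝ in 𝓝[>] 0, P t ∧ P (I * t) ∧ P (-t) ∧ P (-(I * t)) := by
  have aux : ∀ c : ℂ, ∀ᶠ t : ℝ in 𝓝[>] 0, P (c * t) := fun c => (tendsto_mul_ofReal c).eventually h
  filter_upwards [aux 1, aux I, aux (-1), aux (-I)] with t h1 h2 h3 h4
  simp only [one_mul, neg_mul] at h1 h2 h3 h4
  exact ⟨h1, h2, h3, h4⟩

theorem re_four_sum (a b t : ℂ) :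
    (a * t + b * t ^ 2).re + (a * (I * t) + b * (I * t) ^ 2).re +
      (a * (-t) + b * (-t) ^ 2).re + (a * (-(I * t)) + b * (-(I * t)) ^ 2).re = 0 := by
  rw [← add_re, ← add_re, ← add_re, ← zero_re]
  congr 1
  linear_combination (2 * b * t ^ 2) * I_sq

theorem FourPt.add {f g : ℂ → ℝ} (hf : FourPt f) (hg : FourPt g) :
    FourPt fun ζ => f ζ + g ζ := by
  intro ε hε
  filter_upwards [hf (ε / 2) (by positivity), hg (ε / 2) (by positivity)] with t h1 h2
  linarith

theorem FourPt.const_mul {f : ℂ → ℝ} (hf : FourPt f) {c : ℝ} (hc : 0 ≤ c) :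
    FourPt fun ζ => c * f ζ := by
  intro ε hε
  filter_upwards [hf (ε / (c + 1)) (by positivity)] with t h1
  have h2 : c * (ε / (c + 1)) ≤ ε := by
    rw [mul_div_assoc', div_le_iff₀ (by positivity)]; nlinarith
  nlinarith [mul_le_mul_of_nonneg_left h1 hc, mul_le_mul_of_nonneg_right h2 (sq_nonneg t)]

theorem FourPt.congr {f g : ℂ → ℝ} (hf : FourPt f) (h : f =ᶠ[𝓝 0] g) : FourPt g := by
  intro ε hε
  filter_upwards [hf ε hε, eventually_four h] with t h0 ⟨h1, h2, h3, h4⟩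
  rwa [h1, h2, h3, h4, h.eq_of_nhds] at h0

theorem fourPt_re {F : ℂ → ℂ} (hF : Differentiable ℂ F) (ζ : ℂ) :
    FourPt fun ξ => (F (ζ + ξ)).re := by
  obtain ⟨p, hp⟩ := hF.analyticAt ζ
  have h := hp.isBigO_sub_partialSum_pow 3
  intro ε hε
  have ho : (fun y : ℂ => F (ζ + y) - p.partialSum 3 y) =o[𝓝 0] fun y => ‖y‖ ^ 2 := by
    refine h.trans_isLittleO ?_
    exact (Asymptotics.isLittleO_norm_pow_norm_pow (by norm_num : 2 < 3))
  have hc : ∀ c : ℂ, ‖c‖ = 1 → ∀ᶠ t : ℝ in 𝓝[>] 0,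
      ‖F (ζ + c * t) - p.partialSum 3 (c * t)‖ ≤ ε / 4 * t ^ 2 := fun c hc => by
    filter_upwards [(tendsto_mul_ofReal c).eventually (ho.bound (show 0 < ε / 4 by positivity))] with t ht
    simpa [hc] using ht
  filter_upwards [hc 1 (by simp), hc I (by simp), hc (-1) (by simp), hc (-I) (by simp)]
    with t h1 h2 h3 h4
  have hs : p.partialSum 3 (1 * t) + p.partialSum 3 (I * t) + p.partialSum 3 (-1 * t) +
      p.partialSum 3 (-I * t) = 4 * F ζ := by
    have h0 : p.coeff 0 = F ζ := hp.coeff_zero _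
    simp only [FormalMultilinearSeries.partialSum, Finset.sum_range_succ, Finset.sum_range_zero,
      FormalMultilinearSeries.apply_eq_pow_smul_coeff, smul_eq_mul, h0]
    linear_combination (2 * (t:ℂ) ^ 2 * p.coeff 2) * I_sq
  have hs' := congrArg re hs
  simp only [add_re, mul_re, re_ofNat, im_ofNat, zero_mul, sub_zero] at hs'
  have e1 := (abs_le.1 ((abs_re_le_norm _).trans h1)).1
  have e2 := (abs_le.1 ((abs_re_le_norm _).trans h2)).1
  have e3 := (abs_le.1 ((abs_re_le_norm _).trans h3)).1
  have e4 := (abs_le.1 ((abs_re_le_norm _).trans h4)).1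
  simp only [sub_re, one_mul, neg_mul] at e1 e2 e3 e4
  simp only [add_zero]
  simp only [one_mul, neg_mul] at hs'
  linarith

/-- Real continuous functions on the circle are approximated by real parts of entire
functions. -/
theorem exists_re_near {f : ℂ → ℝ} (hf : ContinuousOn f (sphere 0 1)) {η : ℝ}
    (hη : 0 < η) : ∃ F : ℂ → ℂ, Differentiable ℂ F ∧ ∀ ζ, ‖ζ‖ = 1 → |f ζ - (F ζ).re| ≤ η := by
  have : Fact (0 < 2 * Real.pi) := ⟨Real.two_pi_pos⟩
  have hcont : Continuous fun x : AddCircle (2 * Real.pi) =>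
      ((f (AddCircle.toCircle x : ℂ) : ℝ) : ℂ) := by
    refine continuous_ofReal.comp (hf.comp_continuous
      (continuous_subtype_val.comp AddCircle.continuous_toCircle) fun x => ?_)
    exact mem_sphere_zero_iff_norm.2 (Circle.norm_coe _)
  let g : C(AddCircle (2 * Real.pi), ℂ) := ⟨_, hcont⟩
  have hg : g ∈ (Submodule.span ℂ (range <| @fourier (2 * Real.pi))).topologicalClosure := by
    rw [span_fourier_closure_eq_top]; trivial
  obtain ⟨h, hh, hgh⟩ := Metric.mem_closure_iff.1 hg η hη
  have key : ∃ p q : ℂ → ℂ, Differentiable ℂ p ∧ Differentiable ℂ q ∧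
      ∀ x, h x = p (AddCircle.toCircle x) + conj (q (AddCircle.toCircle x)) := by
    refine Submodule.span_induction ?_ ?_ ?_ ?_ hh
    · rintro _ ⟨n, rfl⟩
      obtain ⟨k, rfl | rfl⟩ := n.eq_nat_or_neg
      · refine ⟨fun z => z ^ k, fun _ => 0, by fun_prop, by fun_prop, fun x => ?_⟩
        simp [fourier_apply, AddCircle.toCircle_nsmul]
      · refine ⟨fun _ => 0, fun z => z ^ k, by fun_prop, by fun_prop, fun x => ?_⟩
        simp [fourier_apply, AddCircle.toCircle_neg, AddCircle.toCircle_nsmul, ← Circle.coe_inv_eq_conj]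
    · exact ⟨fun _ => 0, fun _ => 0, by fun_prop, by fun_prop, fun x => by simp⟩
    · rintro a b - - ⟨p, q, hp, hq, h1⟩ ⟨p', q', hp', hq', h2⟩
      refine ⟨fun z => p z + p' z, fun z => q z + q' z, by fun_prop, by fun_prop, fun x => ?_⟩
      simp only [ContinuousMap.add_apply, h1, h2, map_add]; ring
    · rintro c a - ⟨p, q, hp, hq, h1⟩
      refine ⟨fun z => c * p z, fun z => conj c * q z, by fun_prop, by fun_prop, fun x => ?_⟩
      simp only [ContinuousMap.smul_apply, h1, map_mul, conj_conj, smul_eq_mul]; ring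
  obtain ⟨p, q, hp, hq, hpq⟩ := key
  refine ⟨fun z => p z + q z, by fun_prop, fun ζ hζ => ?_⟩
  obtain ⟨x, hx⟩ := (AddCircle.homeomorphCircle (T := 2 * Real.pi) (by positivity)).surjective
    ⟨ζ, by simpa [Submonoid.unitSphere] using hζ⟩
  rw [AddCircle.homeomorphCircle_apply] at hx
  have hx' : (AddCircle.toCircle x : ℂ) = ζ := by rw [hx]
  have h1 : ‖g x - h x‖ ≤ η := by
    rw [← dist_eq_norm]; exact (ContinuousMap.dist_apply_le_dist x).trans hgh.le
  have h2 := (abs_re_le_norm _).trans h1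
  rw [hpq x, hx'] at h2
  have : (g x).re = f ζ := by rw [← hx']; rfl
  simpa [this] using h2

theorem circleAverage_re {F : ℂ → ℂ} (hF : Differentiable ℂ F) :
    Real.circleAverage (fun ζ => (F ζ).re) 0 1 = (F 0).re := by
  have h1 := (hF.differentiableOn.diffContOnCl (s := ball (0:ℂ) |1|)).circleAverage
  have h2 := reCLM.circleAverage_comp_comm (f := F) (c := 0) (R := 1)
    (hF.continuous.continuousOn.circleIntegrable')
  rw [h1] at h2
  exact h2

/-- The sub-mean value property. -/
theorem le_circleAverage {f : ℂ → ℝ} (hf : ContinuousOn f (closedBall 0 1))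
    (h : ∀ ζ ∈ ball (0:ℂ) 1, FourPt fun ξ => f (ζ + ξ)) :
    f 0 ≤ Real.circleAverage f 0 1 := by
  have hsph : sphere (0:ℂ) 1 ⊆ closedBall 0 1 := sphere_subset_closedBall
  refine le_of_forall_pos_le_add fun ε hε => ?_
  obtain ⟨F, hF, hfF⟩ := exists_re_near (hf.mono hsph) (η := ε / 4) (by positivity)
  have hmax : ∀ ζ ∈ closedBall (0:ℂ) 1, f ζ - (F ζ).re + ε / 4 * ‖ζ‖ ^ 2 ≤ ε / 2 := by
    obtain ⟨ζ₀, hζ₀, hm⟩ := (isCompact_closedBall (0:ℂ) 1).exists_isMaxOn ⟨0, by simp⟩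
      (f := fun ζ => f ζ - (F ζ).re + ε / 4 * ‖ζ‖ ^ 2)
      ((hf.sub (continuous_re.comp hF.continuous).continuousOn).add
        (Continuous.continuousOn (by fun_prop)))
    intro ζ hζ
    refine (hm hζ).trans ?_
    rcases (mem_closedBall_zero_iff.1 hζ₀).lt_or_eq with hlt | heq
    · exfalso
      have hF' : FourPt fun ξ => -(F (ζ₀ + ξ)).re := by simpa using fourPt_re hF.neg ζ₀
      have hfp := (h ζ₀ (by simpa using hlt)).add hF'
      have hin : ∀ c : ℂ, ∀ᶠ t : ℝ in 𝓝[>] 0, ζ₀ + c * t ∈ closedBall (0:ℂ) 1 := by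
        intro c
        have h1 : Continuous fun t : ℝ => ζ₀ + c * (t : ℂ) := by fun_prop
        have h2 := (h1.tendsto 0).mono_left (nhdsWithin_le_nhds (s := Ioi 0))
        refine h2.eventually (closedBall_mem_nhds_of_mem ?_)
        simpa using hlt
      obtain ⟨t, ht, h0, h1, h2, h3, h4⟩ := ((hfp (ε / 2) (by positivity)).and
        ((eventually_mem_nhdsWithin (s := Ioi (0:ℝ))).and
        ((hin 1).and ((hin I).and ((hin (-1)).and (hin (-I))))))).exists
      have m1 := hm h1
      have m2 := hm h2
      have m3 := hm h3
      have m4 := hm h4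
      simp only [one_mul, neg_mul, mem_Ioi, mem_ofPred_eq, add_zero] at m1 m2 m3 m4 ht h0
      have hsum : ‖ζ₀ + t‖ ^ 2 + ‖ζ₀ + I * t‖ ^ 2 + ‖ζ₀ + -(t:ℂ)‖ ^ 2 + ‖ζ₀ + -(I * t)‖ ^ 2 =
          4 * ‖ζ₀‖ ^ 2 + 4 * t ^ 2 := by
        simp only [Complex.sq_norm, normSq_apply, add_re, add_im, neg_re, neg_im, ofReal_re,
          ofReal_im, mul_re, mul_im, I_re, I_im]
        ring
      nlinarith [mul_pos hε (pow_pos h0 2), congrArg (fun x => ε / 4 * x) hsum]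
    · have := (abs_le.1 (hfF ζ₀ heq)).2
      simp only [heq]; linarith
  have h0 := hmax 0 (by simp)
  have hFm := circleAverage_re hF
  have hle : Real.circleAverage (fun ζ => (F ζ).re - ε / 4) 0 1 ≤ Real.circleAverage f 0 1 := by
    refine Real.circleAverage_mono ?_ ?_ fun ζ hζ => ?_
    · exact (((continuous_re.comp hF.continuous).sub continuous_const).continuousOn).circleIntegrable'
    · exact ContinuousOn.circleIntegrable' (by simpa using hf.mono hsph)
    · have := (abs_le.1 (hfF ζ (by simpa using hζ))).1
      linarith
  rw [Real.circleAverage_fun_sub (f₁ := fun ζ => (F ζ).re) (((continuous_re.comp hF.continuous)).continuousOn.circleIntegrable')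
    (continuous_const.continuousOn.circleIntegrable'), hFm, Real.circleAverage_const] at hle
  simp at h0
  linarith

end Submean

section Taylor
variable {E F : Type*} [NormedAddCommGroup E] [NormedSpace ℝ E] [NormedAddCommGroup F]
  [NormedSpace ℝ F]

/-- Second order Taylor formula. -/
theorem taylor_two {f : E → F} {x : E} (hf : ContDiffAt ℝ 2 f x) :
    (fun v => f (x + v) - f x - fderiv ℝ f x v - (2:ℝ)⁻¹ • fderiv ℝ (fderiv ℝ f) x v v)
      =o[𝓝 0] fun v => ‖v‖ ^ 2 := by
  set B := fderiv ℝ (fderiv ℝ f) x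
  have hsymm : IsSymmSndFDerivAt ℝ f x := hf.isSymmSndFDerivAt (by simp)
  have hd : DifferentiableAt ℝ (fderiv ℝ f) x :=
    (hf.fderiv_right (m := 1) (by norm_num)).differentiableAt (by norm_num)
  have hev : ∀ᶠ v in 𝓝 (0:E), DifferentiableAt ℝ f (x + v) := by
    have h1 : ∀ᶠ y in 𝓝 x, DifferentiableAt ℝ f y :=
      (hf.eventually (by simp)).mono fun y hy => hy.differentiableAt (by norm_num)
    have h2 : Tendsto (fun v : E => x + v) (𝓝 0) (𝓝 x) := by
      have : Continuous fun v : E => x + v := by fun_prop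
      simpa using this.tendsto 0
    exact h2.eventually h1
  have ho := (hasFDerivAt_iff_isLittleO_nhds_zero.1 hd.hasFDerivAt)
  refine Asymptotics.isLittleO_iff.2 fun c hc => ?_
  obtain ⟨r, hr, h⟩ := eventually_nhds_iff_ball.1 (hev.and (ho.bound hc))
  filter_upwards [ball_mem_nhds (0:E) hr] with v hv
  have hconv : Convex ℝ (segment ℝ 0 v) := convex_segment 0 v
  have hseg : ∀ y ∈ segment ℝ 0 v, ‖y‖ ≤ ‖v‖ := by
    rintro y hy
    have := segment_subset_closedBall_left (0:E) v hy
    simpa using this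
  have hball : ∀ y ∈ segment ℝ 0 v, y ∈ ball (0:E) r := fun y hy => by
    rw [mem_ball_zero_iff] at hv ⊢; exact (hseg y hy).trans_lt hv
  have hder : ∀ y ∈ segment ℝ 0 v, HasFDerivWithinAt
      (fun v => f (x + v) - f x - fderiv ℝ f x v - (2:ℝ)⁻¹ • B v v)
      (fderiv ℝ f (x + y) - fderiv ℝ f x - B y) (segment ℝ 0 v) y := by
    intro y hy
    have h1 : HasFDerivAt (fun v => f (x + v)) (fderiv ℝ f (x + y)) y := by
      exact ((h y (hball y hy)).1.hasFDerivAt.comp y ((hasFDerivAt_id y).const_add x)).congr_fderiv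
        (by simp)
    have h2 : HasFDerivAt (fun v => B v v) (B y + B.flip y) y := by
      have := B.hasFDerivAt (x := y) |>.clm_apply (hasFDerivAt_id y)
      refine this.congr_fderiv ?_
      ext u; simp
    have h3 := ((h1.sub_const (f x)).sub (fderiv ℝ f x).hasFDerivAt).sub
      (h2.const_smul (2:ℝ)⁻¹)
    refine (h3.congr_fderiv ?_).hasFDerivWithinAt
    ext u
    have : B u y = B y u := hsymm u y
    simp only [sub_apply, smul_apply,
      add_apply, ContinuousLinearMap.flip_apply, this]
    rw [← two_smul ℝ (B y u), smul_smul]; norm_num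
  have hb : ∀ y ∈ segment ℝ 0 v, ‖fderiv ℝ f (x + y) - fderiv ℝ f x - B y‖ ≤ c * ‖v‖ := by
    intro y hy
    exact (h y (hball y hy)).2.trans (mul_le_mul_of_nonneg_left (hseg y hy) hc.le)
  have := hconv.norm_image_sub_le_of_norm_hasFDerivWithin_le hder hb
    (left_mem_segment ℝ 0 v) (right_mem_segment ℝ 0 v)
  simp only [add_zero, map_zero, sub_self, sub_zero, smul_zero] at this
  rw [Real.norm_of_nonneg (by positivity), pow_two, ← mul_assoc]
  exact this

end Taylor

section LeviRules
variable {m : ℕ} {f g φ ψ : ℂ^m → ℝ} {z w : ℂ^m}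

theorem sum_mul_linear (A : ℂ^m →L[ℝ] ℂ) (w : ℂ^m) :
    ∑ j, w j * (A (Pi.single j 1) - I * A (Pi.single j I)) = A w - I * A (I • w) := by
  have h : ∀ v : ℂ^m, A v =
      ∑ j, ((v j).re * A (Pi.single j 1) + (v j).im * A (Pi.single j I)) := by
    intro v
    have hv : v = ∑ j, ((v j).re • (Pi.single j (1:ℂ) : ℂ^m) +
        (v j).im • (Pi.single j I : ℂ^m)) := by
      ext i
      simp [Finset.sum_apply, Pi.single_apply, Finset.sum_add_distrib]
    conv_lhs => rw [hv]
    simp [map_sum]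
  rw [h w, h (I • w), Finset.mul_sum, ← Finset.sum_sub_distrib]
  refine Finset.sum_congr rfl fun j _ => ?_
  simp only [Pi.smul_apply, smul_eq_mul, mul_re, mul_im, I_re, I_im, zero_mul, one_mul, zero_sub,
    zero_add, ofReal_neg]
  conv_lhs => rw [← re_add_im (w j)]
  linear_combination (-((w j).im * A (Pi.single j I)) : ℂ) * I_sq

theorem sum_mul_dz (hf : DifferentiableAt ℝ f z) (w : ℂ^m) :
    ∑ j, w j * dz j (fun x => (f x : ℂ)) z =
      ((fderiv ℝ f z w : ℂ) - I * (fderiv ℝ f z (I • w) : ℂ)) / 2 := by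
  have hA : fderiv ℝ (fun x => (f x : ℂ)) z = ofRealCLM.comp (fderiv ℝ f z) :=
    (ofRealCLM.hasFDerivAt.comp z hf.hasFDerivAt).fderiv
  have := sum_mul_linear (ofRealCLM.comp (fderiv ℝ f z)) w
  simp only [wirt, hA, neg_mul, ← sub_eq_add_neg, mul_div_assoc', ← Finset.sum_div, this]
  simp

theorem dzb_ofReal (hf : DifferentiableAt ℝ f z) (j : Fin m) :
    dzb j (fun x => (f x : ℂ)) z = conj (dz j (fun x => (f x : ℂ)) z) := by
  have h : DifferentiableAt ℝ (fun x => (f x : ℂ)) z := ofRealCLM.differentiableAt.comp z hf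
  have := wirt_conj (c := I) (j := j) h
  simpa using this

/-- The Levi form in terms of the real Hessian. -/
theorem levi_eq (hf : ContDiffAt ℝ ∞ f z) (w : ℂ^m) :
    levi f z w = (fderiv ℝ (fderiv ℝ f) z w w +
      fderiv ℝ (fderiv ℝ f) z (I • w) (I • w)) / 4 := by
  set B := fderiv ℝ (fderiv ℝ f) z with hB
  have hd : DifferentiableAt ℝ (fderiv ℝ f) z :=
    (hf.fderiv_right (m := ∞) (by simp)).differentiableAt (by simp)
  have hev : ∀ᶠ y in 𝓝 z, DifferentiableAt ℝ f y :=
    ((hf.of_le (m := 1) (by simp)).eventually (by simp)).mono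
      fun y hy => hy.differentiableAt (by norm_num)
  have e1 : (fun y => ∑ j, w j * dz j (fun x => (f x : ℂ)) y) =ᶠ[𝓝 z]
      fun y => ((fderiv ℝ f y w : ℂ) - I * (fderiv ℝ f y (I • w) : ℂ)) / 2 :=
    hev.mono fun y hy => sum_mul_dz hy w
  have hA : ∀ v : ℂ^m, HasFDerivAt (fun y => ((fderiv ℝ f y v : ℝ) : ℂ))
      (ofRealCLM.comp (B.flip v)) z := fun v => by
    have h1 : HasFDerivAt (fun y => fderiv ℝ f y v) (B.flip v) z := by
      refine (hd.hasFDerivAt.clm_apply (hasFDerivAt_const v z)).congr_fderiv ?_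
      ext u; simp [hB]
    exact ofRealCLM.hasFDerivAt.comp z h1
  set A : ℂ^m →L[ℝ] ℂ := (2:ℂ)⁻¹ • (ofRealCLM.comp (B.flip w) -
    I • ofRealCLM.comp (B.flip (I • w))) with hAdef
  have hd2 : fderiv ℝ (fun y => ∑ j, w j * dz j (fun x => (f x : ℂ)) y) z = A := by
    rw [e1.fderiv_eq]
    refine HasFDerivAt.fderiv ?_
    have := ((hA w).sub ((hA (I • w)).const_mul I)).mul_const (2:ℂ)⁻¹
    refine this.congr_fderiv ?_
    ext u; simp [hAdef]
  have hsm : ∀ j, DifferentiableAt ℝ (dz j (fun x => (f x : ℂ))) z := fun j =>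
    (contDiffAt_wirt (ofRealCLM.contDiff.contDiffAt.comp z hf)).differentiableAt (by simp)
  have e2 : ∀ k, ∑ j, w j * dzb k (dz j fun x => (f x : ℂ)) z =
      (A (Pi.single k 1) + I * A (Pi.single k I)) / 2 := by
    intro k
    have h1 : dzb k (fun y => ∑ j, w j * dz j (fun x => (f x : ℂ)) y) z =
        ∑ j, w j * dzb k (dz j fun x => (f x : ℂ)) z := by
      refine (wirt_sum _ fun j _ => (hsm j).const_mul _).trans ?_
      exact Finset.sum_congr rfl fun j _ => wirt_const_mul _ (hsm j)
    rw [← h1, ← hd2]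
    rfl
  have e3 : ∑ k, conj (w k) * (A (Pi.single k 1) + I * A (Pi.single k I)) =
      A w + I * A (I • w) := by
    have := congrArg conj (sum_mul_linear (conjCLE.toContinuousLinearMap.comp A) w)
    simpa [map_sum] using this
  have e4 : ∑ j, ∑ k, dzb k (dz j fun x => (f x : ℂ)) z * (w j * conj (w k)) =
      (A w + I * A (I • w)) / 2 := by
    rw [Finset.sum_comm, ← e3, Finset.sum_div]
    refine Finset.sum_congr rfl fun k _ => ?_
    rw [mul_div_assoc, ← e2, Finset.mul_sum]
    exact Finset.sum_congr rfl fun j _ => by ring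
  rw [levi, e4, hAdef]
  simp
  ring

theorem levi_add (hf : ContDiffAt ℝ ∞ f z) (hg : ContDiffAt ℝ ∞ g z) (w : ℂ^m) :
    levi (fun x => f x + g x) z w = levi f z w + levi g z w := by
  have hf' : ContDiffAt ℝ ∞ (fun x => (f x : ℂ)) z := ofRealCLM.contDiff.contDiffAt.comp z hf
  have hg' : ContDiffAt ℝ ∞ (fun x => (g x : ℂ)) z := ofRealCLM.contDiff.contDiffAt.comp z hg
  have h : ∀ j k, dzb k (dz j fun x => ((f x + g x : ℝ) : ℂ)) z =
      dzb k (dz j fun x => (f x : ℂ)) z + dzb k (dz j fun x => (g x : ℂ)) z := by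
    intro j k
    rw [← wirt_add ((contDiffAt_wirt hf').differentiableAt (by simp))
      ((contDiffAt_wirt hg').differentiableAt (by simp))]
    refine wirt_congr ?_
    filter_upwards [(hf'.of_le (m := 1) (by simp)).eventually (by simp),
      (hg'.of_le (m := 1) (by simp)).eventually (by simp)] with y h1 h2
    simp only [ofReal_add]
    exact wirt_add (h1.differentiableAt (by norm_num)) (h2.differentiableAt (by norm_num))
  simp only [levi, h, add_mul, Finset.sum_add_distrib, add_re]

theorem levi_const_mul (hf : ContDiff ℝ ∞ f) (c : ℝ) (w : ℂ^m) :
    levi (fun x => c * f x) z w = c * levi f z w := by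
  have hf' := contDiff_ofReal_comp hf
  have h : ∀ j k, dzb k (dz j fun x => ((c * f x : ℝ) : ℂ)) z =
      c * dzb k (dz j fun x => (f x : ℂ)) z := by
    intro j k
    rw [← wirt_const_mul _ ((contDiff_wirt hf').differentiable (by simp) z)]
    congr 1; ext y
    simp only [ofReal_mul]
    exact wirt_const_mul _ (hf'.differentiable (by simp) y)
  simp only [levi, h, mul_assoc, ← Finset.mul_sum, re_ofReal_mul]

theorem levi_exp (hf : ContDiff ℝ ∞ f) (w : ℂ^m) :
    levi (fun x => Real.exp (f x)) z w = Real.exp (f z) *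
      (levi f z w + ‖∑ j, w j * dz j (fun x => (f x : ℂ)) z‖ ^ 2) := by
  have hf' := contDiff_ofReal_comp hf
  have hd := hf'.differentiable (by simp)
  have h1 : ∀ c j y, wirt c j (fun x => ((Real.exp (f x) : ℝ) : ℂ)) y =
      (Real.exp (f y) : ℝ) * wirt c j (fun x => (f x : ℂ)) y := by
    intro c j y
    simp only [ofReal_exp]
    exact wirt_comp (G := Complex.exp) (Complex.hasDerivAt_exp _) (hd y)
  have h : ∀ j k, dzb k (dz j fun x => ((Real.exp (f x) : ℝ) : ℂ)) z =
      (Real.exp (f z) : ℝ) * (dzb k (dz j fun x => (f x : ℂ)) z +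
        conj (dz k (fun x => (f x : ℂ)) z) * dz j (fun x => (f x : ℂ)) z) := by
    intro j k
    have e : (dz j fun x => ((Real.exp (f x) : ℝ) : ℂ)) = fun y =>
      ((Real.exp (f y) : ℝ) : ℂ) * dz j (fun x => (f x : ℂ)) y := funext fun y => h1 _ j y
    have e2 : DifferentiableAt ℝ (fun x => ((Real.exp (f x) : ℝ) : ℂ)) z :=
      (contDiff_ofReal_comp hf.exp).differentiable (by simp) z
    have e3 := wirt_mul (c := I) (j := k) e2 ((contDiff_wirt (c := -I) (j := j) hf').differentiable (by simp) z)
    rw [e]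
    refine e3.trans ?_
    rw [h1, ← dzb_ofReal (hf.differentiable (by simp) z)]
    ring
  have h2 : ∑ j, ∑ k, conj (dz k (fun x => (f x : ℂ)) z) * dz j (fun x => (f x : ℂ)) z *
      (w j * conj (w k)) = ((‖∑ j, w j * dz j (fun x => (f x : ℂ)) z‖ ^ 2 : ℝ) : ℂ) := by
    rw [← normSq_eq_norm_sq, ← mul_conj, map_sum, Finset.sum_mul_sum]
    refine Finset.sum_congr rfl fun j _ => Finset.sum_congr rfl fun k _ => ?_
    rw [map_mul]; ring
  simp only [levi, h, mul_assoc, ← Finset.mul_sum, re_ofReal_mul, add_mul,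
    Finset.sum_add_distrib, add_re]
  simp only [mul_assoc] at h2
  rw [h2, ofReal_re]

theorem levi_normSq (w : ℂ^m) :
    levi (fun x => ∑ j, ‖x j‖ ^ 2) z w = ∑ j, ‖w j‖ ^ 2 := by
  have hc : ∀ c k i y, wirt c k (fun x : ℂ^m => x i) y = if k = i then (1 + c * I) / 2 else 0 := by
    intro c k i y
    have : fderiv ℝ (fun x : ℂ^m => x i) y = ContinuousLinearMap.proj i :=
      (ContinuousLinearMap.proj (R := ℝ) (φ := fun _ : Fin m => ℂ) i).fderiv
    simp only [wirt, this, ContinuousLinearMap.proj_apply, Pi.single_apply, eq_comm (a := i)]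
    split_ifs <;> simp
  have hd : ∀ i y, DifferentiableAt ℝ (fun x : ℂ^m => x i) y := fun i y => by fun_prop
  have hd' : ∀ i y, DifferentiableAt ℝ (fun x : ℂ^m => conj (x i)) y := fun i y =>
    conjCLE.differentiableAt.comp y (hd i y)
  have h1 : ∀ j, (dz j fun x : ℂ^m => ((∑ i, ‖x i‖ ^ 2 : ℝ) : ℂ)) = fun y => conj (y j) := by
    intro j; ext y
    have e : (fun x : ℂ^m => ((∑ i, ‖x i‖ ^ 2 : ℝ) : ℂ)) =
        fun x => ∑ i, x i * conj (x i) := by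
      ext x
      rw [ofReal_sum]
      exact Finset.sum_congr rfl fun i _ => by rw [mul_conj, normSq_eq_norm_sq]
    rw [e]
    refine (wirt_sum _ fun i _ => (hd i y).mul (hd' i y)).trans ?_
    have : ∀ i, wirt (-I) j (fun x : ℂ^m => x i * conj (x i)) y =
        if j = i then conj (y i) else 0 := by
      intro i
      rw [wirt_mul (hd i y) (hd' i y), wirt_conj (hd i y), hc, hc]
      split_ifs <;> simp
    exact (Finset.sum_congr rfl fun i _ => this i).trans (by simp)
  have h2 : ∀ j k, dzb k (dz j fun x : ℂ^m => ((∑ i, ‖x i‖ ^ 2 : ℝ) : ℂ)) z =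
      if k = j then 1 else 0 := by
    intro j k
    rw [h1]
    refine (wirt_conj (hd j z)).trans ?_
    rw [hc]
    split_ifs <;> simp
  simp only [levi, h2, ite_mul, one_mul, zero_mul, Finset.sum_ite_eq', Finset.mem_univ, if_true]
  rw [re_sum]
  exact Finset.sum_congr rfl fun i _ => by rw [mul_conj, ofReal_re, normSq_eq_norm_sq]

end LeviRules

section Psh
variable {m : ℕ} {u v : ℂ^m → ℝ} {O : Set ℂ^m} {ε : ℝ}

/-- Continuous plurisubharmonic functions. -/
structure Psh (u : ℂ^m → ℝ) (O : Set ℂ^m) : Prop where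
  cont : ContinuousOn u O
  fourPt : ∀ z ∈ O, ∀ w : ℂ^m, FourPt fun ζ => u (z + ζ • w)

theorem Psh.add (hu : Psh u O) (hv : Psh v O) : Psh (fun z => u z + v z) O :=
  ⟨hu.cont.add hv.cont, fun z hz w => (hu.fourPt z hz w).add (hv.fourPt z hz w)⟩

theorem Psh.const_mul (hu : Psh u O) {c : ℝ} (hc : 0 ≤ c) : Psh (fun z => c * u z) O :=
  ⟨hu.cont.const_smul c, fun z hz w => (hu.fourPt z hz w).const_mul hc⟩

theorem Psh.mono {O' : Set ℂ^m} (hu : Psh u O) (h : O' ⊆ O) : Psh u O' :=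
  ⟨hu.cont.mono h, fun z hz w => hu.fourPt z (h hz) w⟩

theorem Psh.congr (hO : IsOpen O) (hu : Psh u O) (h : EqOn u v O) : Psh v O := by
  refine ⟨hu.cont.congr fun z hz => (h hz).symm, fun z hz w => (hu.fourPt z hz w).congr ?_⟩
  have hc : Continuous fun ζ : ℂ => z + ζ • w := by fun_prop
  have : Tendsto (fun ζ : ℂ => z + ζ • w) (𝓝 0) (𝓝 z) := by simpa using hc.tendsto 0
  exact (this.eventually (hO.mem_nhds hz)).mono fun ζ hζ => h hζ

theorem Psh.le_circleAverage (hu : Psh u O) {z w : ℂ^m}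
    (h : ∀ ζ : ℂ, ‖ζ‖ ≤ 1 → z + ζ • w ∈ O) :
    u z ≤ Real.circleAverage (fun ζ => u (z + ζ • w)) 0 1 := by
  have := LeviFlat.le_circleAverage (f := fun ζ => u (z + ζ • w))
    (hu.cont.comp (Continuous.continuousOn (by fun_prop)) fun ζ hζ => h ζ (by simpa using hζ))
    fun ζ hζ => by
      have := hu.fourPt _ (h ζ (mem_ball_zero_iff.1 hζ).le) w
      simpa only [add_smul, add_assoc] using this
  simpa using this

theorem sm_le_circleAverage (hc : Continuous u) (hu : Psh u O) (hε : 0 < ε)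
    {x w : ℂ^m} (h : ∀ y, ‖y‖ ≤ ε → ∀ ζ : ℂ, ‖ζ‖ ≤ 1 → x - y + ζ • w ∈ O) :
    sm ε u x ≤ Real.circleAverage (fun ζ => sm ε u (x + ζ • w)) 0 1 := by
  have hG : Continuous (Function.uncurry fun (ζ : ℂ) (y : ℂ^m) => u (x + ζ • w - y)) := by
    simp only [Function.uncurry_def]; fun_prop
  have h1 := circleAverage_integral_moll hε hG
  have h2 : (fun ζ : ℂ => sm ε u (x + ζ • w)) =
      fun ζ : ℂ => ∫ y, moll ε y • u (x + ζ • w - y) := rfl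
  rw [h2, h1, sm_apply]
  have hA : Continuous fun y => Real.circleAverage (fun ζ => u (x + ζ • w - y)) 0 1 := by
    unfold Real.circleAverage
    have : Continuous fun p : ℂ^m × ℝ => circleMap 0 1 p.2 :=
      (continuous_circleMap 0 1).comp continuous_snd
    have h3 : Continuous fun y : ℂ^m =>
        ∫ θ in (0 : ℝ)..2 * Real.pi, u (x + circleMap 0 1 θ • w - y) :=
      intervalIntegral.continuous_parametric_intervalIntegral_of_continuous'
        (by simp only [Function.uncurry_def]; fun_prop) _ _
    exact h3.const_smul (2 * Real.pi)⁻¹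
  refine integral_mono (integrable_moll_smul hε hc.locallyIntegrable x) ?_ fun y => ?_
  · have hm := contDiff_moll (m := m) (ε := ε).continuous
    exact Continuous.integrable_of_hasCompactSupport (hm.smul hA)
      ((hasCompactSupport_moll hε).smul_right)
  · by_cases hy : ‖y‖ ≤ ε
    · refine mul_le_mul_of_nonneg_left ?_ (moll_nonneg hε y)
      have := hu.le_circleAverage (h y hy)
      simpa only [sub_add_eq_add_sub] using this
    · simp [moll_eq_zero hε (not_le.1 hy).le]

/-- Mollifications of plurisubharmonic functions have nonnegative Levi form. -/
theorem levi_sm_nonneg (hc : Continuous u) (hu : Psh u O) (hO : IsOpen O) (hε : 0 < ε)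
    {x : ℂ^m} (hx : closedBall x ε ⊆ O) (w : ℂ^m) :
    0 ≤ levi (sm ε u) x w := by
  by_contra hneg
  rw [not_le] at hneg
  set S := sm ε u with hS
  have hSs : ContDiff ℝ ∞ S := contDiff_sm hε hc.locallyIntegrable
  set L := levi S x w with hL
  obtain ⟨δ, hδ, hδO⟩ := (isCompact_closedBall x ε).exists_cthickening_subset_open hO hx
  rw [cthickening_closedBall hδ.le hε.le] at hδO
  set c := -L / (2 * (‖w‖ ^ 2 + 1)) with hcdef
  have hc0 : 0 < c := div_pos (by linarith) (by positivity)
  have hcw : c * ‖w‖ ^ 2 < -L := by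
    rw [hcdef, div_mul_eq_mul_div, div_lt_iff₀ (by positivity)]
    nlinarith [sq_nonneg ‖w‖]
  obtain ⟨r, hr, hT⟩ := eventually_nhds_iff_ball.1
    ((taylor_two ((contDiff_infty.1 hSs 2).contDiffAt (x := x))).bound hc0)
  obtain ⟨t, ht, htr, htδ⟩ : ∃ t > 0, t * ‖w‖ < r ∧ t * ‖w‖ ≤ δ := by
    refine ⟨min r δ / (‖w‖ + 1), by positivity, ?_, ?_⟩
    · rw [div_mul_eq_mul_div, div_lt_iff₀ (by positivity)]
      nlinarith [min_le_left r δ, norm_nonneg w]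
    · rw [div_mul_eq_mul_div, div_le_iff₀ (by positivity)]
      nlinarith [min_le_right r δ, norm_nonneg w]
  have hsub : S x ≤ Real.circleAverage (fun ζ => S (x + ζ • (t • w))) 0 1 := by
    refine sm_le_circleAverage hc hu hε fun y hy ζ hζ => hδO ?_
    rw [mem_closedBall, dist_eq_norm, add_sub_right_comm, sub_sub_cancel_left]
    refine (norm_add_le _ _).trans ?_
    rw [norm_neg, norm_smul, norm_smul, Real.norm_of_nonneg ht.le]
    have : ‖ζ‖ * (t * ‖w‖) ≤ 1 * (t * ‖w‖) := by gcongr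
    linarith
  set a := fderiv ℝ S x w
  set b := fderiv ℝ S x (I • w)
  set B := fderiv ℝ (fderiv ℝ S) x with hB
  have hLB : 4 * L = B w w + B (I • w) (I • w) := by
    rw [hL, levi_eq hSs.contDiffAt]; ring
  set G : ℂ → ℂ := fun ζ => ((S x + c * t ^ 2 * ‖w‖ ^ 2 + t ^ 2 * L : ℝ) : ℂ) +
    t * (a - I * b) * ζ + (t ^ 2 / 4 * ((B w w - B (I • w) (I • w) : ℝ) -
      I * (B w (I • w) + B (I • w) w : ℝ))) * ζ ^ 2 with hG
  have hGd : Differentiable ℂ G := by fun_prop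
  have hle : Real.circleAverage (fun ζ => S (x + ζ • (t • w))) 0 1 ≤
      Real.circleAverage (fun ζ => (G ζ).re) 0 1 := by
    refine Real.circleAverage_mono ?_ ?_ fun ζ hζ => ?_
    · exact ContinuousOn.circleIntegrable' (Continuous.continuousOn (by
        have := hSs.continuous; fun_prop))
    · exact (continuous_re.comp hGd.continuous).continuousOn.circleIntegrable'
    · have hζ1 : ‖ζ‖ = 1 := by simpa using hζ
      have hn : ‖ζ • (t • w)‖ = t * ‖w‖ := by
        rw [norm_smul, norm_smul, hζ1, one_mul, Real.norm_of_nonneg ht.le]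
      have h1 := hT (ζ • (t • w)) (by rw [mem_ball_zero_iff, hn]; exact htr)
      rw [hn, norm_pow, norm_mul, norm_norm, Real.norm_of_nonneg ht.le, Real.norm_eq_abs] at h1
      have h2 := (abs_le.1 h1).2
      have hv : ζ • (t • w) = (t * ζ.re) • w + (t * ζ.im) • (I • w) := by
        ext i
        simp only [Pi.smul_apply, Pi.add_apply, smul_eq_mul, real_smul]
        conv_lhs => rw [← re_add_im ζ]
        push_cast; ring
      have hsq : ζ.re ^ 2 + ζ.im ^ 2 = 1 := by
        have := Complex.sq_norm ζ
        rw [hζ1, normSq_apply] at this; nlinarith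
      have hd : fderiv ℝ S x (ζ • (t • w)) = t * (ζ.re * a + ζ.im * b) := by
        rw [hv, map_add, map_smul, map_smul, smul_eq_mul, smul_eq_mul]; ring
      have hBv : B (ζ • (t • w)) (ζ • (t • w)) = t ^ 2 * (ζ.re ^ 2 * B w w +
          ζ.re * ζ.im * (B w (I • w) + B (I • w) w) + ζ.im ^ 2 * B (I • w) (I • w)) := by
        rw [hv]
        simp only [map_add, map_smul, add_apply, smul_apply, smul_eq_mul]
        ring
      have hGr : (G ζ).re = S x + c * t ^ 2 * ‖w‖ ^ 2 + t ^ 2 * L + t * (ζ.re * a + ζ.im * b) +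
          t ^ 2 / 4 * ((B w w - B (I • w) (I • w)) * (ζ.re ^ 2 - ζ.im ^ 2) +
            2 * (B w (I • w) + B (I • w) w) * (ζ.re * ζ.im)) := by
        have e1 : (t:ℂ) ^ 2 / 4 = ((t ^ 2 / 4 : ℝ) : ℂ) := by push_cast; ring
        have e2 : ζ ^ 2 = ζ * ζ := pow_two ζ
        simp only [hG, e1, e2, add_re, mul_re, mul_im, sub_re, sub_im, ofReal_re, ofReal_im, I_re,
          I_im]
        ring
      rw [hd, hBv, smul_eq_mul] at h2
      rw [hGr]
      have e3 : t ^ 2 * (ζ.re ^ 2 + ζ.im ^ 2) * (4 * L) = t ^ 2 * (4 * L) := by rw [hsq]; ring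
      rw [hLB] at e3
      have e4 : t ^ 2 * L = t ^ 2 * (B w w + B (I • w) (I • w)) / 4 := by rw [← hLB]; ring
      nlinarith
  rw [circleAverage_re hGd] at hle
  have hG0 : (G 0).re = S x + c * t ^ 2 * ‖w‖ ^ 2 + t ^ 2 * L := by
    simp only [hG, mul_zero, add_zero, ofReal_re, ne_eq, OfNat.ofNat_ne_zero, not_false_eq_true,
      zero_pow]
  rw [hG0] at hle
  nlinarith [mul_pos (pow_pos ht 2) (sub_pos.2 hcw)]

end Psh

section SupBound
variable {m : ℕ}

theorem bump_le_one {ε : ℝ} (y : ℂ^m) : bump m ε y ≤ 1 := Real.smoothTransition.le_one _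

theorem integral_bump {r : ℝ} (hr : 0 < r) :
    ∫ y, bump m r y = r ^ (2 * m) * ∫ y, bump m 1 y := by
  have h1 : ∀ y, bump m r y = bump m 1 (r⁻¹ • y) := by
    intro y
    simp only [bump, Pi.smul_apply, norm_smul, norm_inv, Real.norm_of_nonneg hr.le, mul_pow,
      ← Finset.mul_sum]
    congr 2
    field_simp
  have h2 : Module.finrank ℝ ℂ^m = 2 * m := by
    rw [Module.finrank_pi_fintype]; simp [mul_comm]
  simp only [h1]
  rw [Measure.integral_comp_smul, h2, smul_eq_mul, inv_pow, inv_inv, abs_of_nonneg (by positivity)]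

/-- Point values of holomorphic functions are controlled by `L²` norms. -/
theorem normSq_le_integral {f : ℂ^m → ℂ} {x : ℂ^m} {r : ℝ} (hr : 0 < r)
    (hf : ∀ y ∈ closedBall x r, DifferentiableAt ℂ f y) :
    ‖f x‖ ^ 2 ≤ (∫ y, bump m r y)⁻¹ * ∫ y in closedBall x r, ‖f y‖ ^ 2 := by
  have hcont : ContinuousOn f (closedBall x r) := fun y hy =>
    (hf y hy).continuousAt.continuousWithinAt
  set g := (closedBall x r).indicator f with hg
  have hgL : MemLp g 2 := by
    rw [hg, memLp_indicator_iff_restrict measurableSet_closedBall]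
    rw [memLp_two_iff_integrable_sq_norm
      (hcont.aestronglyMeasurable measurableSet_closedBall)]
    exact (hcont.norm.pow 2).integrableOn_compact (isCompact_closedBall x r)
  have h1 : sm r g x = f x := by
    rw [← sm_eq_self hr hf]
    refine sm_congr hr fun y hy => ?_
    rw [hg, indicator_of_mem]
    rw [mem_closedBall, dist_eq_norm]; exact hy.le
  have h2 := norm_sm_sq_le hr hgL x
  rw [h1] at h2
  have hi := integrable_normSq hgL
  have hi' : Integrable fun t => ‖g (x - t)‖ ^ 2 := hi.comp_sub_left x
  have h3 : sm r (fun y => ‖g y‖ ^ 2) x ≤ ∫ t, (∫ y, bump m r y)⁻¹ * ‖g (x - t)‖ ^ 2 := by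
    rw [sm_apply]
    refine integral_mono (integrable_moll_smul hr hi.locallyIntegrable x) (hi'.const_mul _)
      fun t => ?_
    simp only [smul_eq_mul, moll, div_eq_inv_mul]
    have := bump_le_one (ε := r) t
    have h0 : 0 ≤ (∫ y, bump m r y)⁻¹ := inv_nonneg.2 (integral_bump_pos hr).le
    calc _ ≤ ((∫ y, bump m r y)⁻¹ * 1) * ‖g (x - t)‖ ^ 2 := by gcongr
      _ = _ := by rw [mul_one]
  rw [integral_const_mul, integral_sub_left_eq_self (fun t => ‖g t‖ ^ 2)] at h3
  refine h2.trans (h3.trans (le_of_eq ?_))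
  congr 1
  rw [← integral_indicator measurableSet_closedBall]
  congr 1; ext y
  by_cases hy : y ∈ closedBall x r <;> simp [hg, hy]

end SupBound

section Vec
variable {m : ℕ} {X Y B : Fin m → ℂ^m → ℂ}

/-- The `L²` class of a vector of `L²` functions. -/
def vec (X : Fin m → ℂ^m → ℂ) (hX : ∀ j, MemLp (X j) 2) :
    Lp (EuclideanSpace ℂ (Fin m)) 2 (volume : Measure ℂ^m) :=
  (MemLp.of_eval_piLp (f := fun z => WithLp.toLp 2 fun j => X j z) hX).toLp

theorem coeFn_vec (hX : ∀ j, MemLp (X j) 2) :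
    vec X hX =ᵐ[volume] fun z => WithLp.toLp 2 fun j => X j z :=
  MemLp.coeFn_toLp _

theorem inner_vec (hX : ∀ j, MemLp (X j) 2) (hY : ∀ j, MemLp (Y j) 2) :
    inner ℂ (vec X hX) (vec Y hY) = ∫ z, ∑ j, Y j z * conj (X j z) := by
  rw [L2.inner_def]
  refine integral_congr_ae ?_
  filter_upwards [coeFn_vec hX, coeFn_vec hY] with z h1 h2
  rw [h1, h2, PiLp.inner_apply]
  rfl

theorem norm_vec_sq (hX : ∀ j, MemLp (X j) 2) :
    ‖vec X hX‖ ^ 2 = ∫ z, ∑ j, ‖X j z‖ ^ 2 := by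
  have h : inner ℂ (vec X hX) (vec X hX) = ((‖vec X hX‖ ^ 2 : ℝ) : ℂ) := by
    rw [inner_self_eq_norm_sq_to_K]; push_cast; rfl
  have e : ∀ z, ∑ j, X j z * conj (X j z) = ((∑ j, ‖X j z‖ ^ 2 : ℝ) : ℂ) := fun z => by
    simp only [mul_conj, normSq_eq_norm_sq]; push_cast; rfl
  rw [inner_vec] at h
  simp only [e] at h
  rw [integral_complex_ofReal] at h
  exact (ofReal_injective h).symm

theorem norm_integral_sum_mul_conj_le (hX : ∀ j, MemLp (X j) 2) (hY : ∀ j, MemLp (Y j) 2) :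
    ‖∫ z, ∑ j, X j z * conj (Y j z)‖ ≤
      √(∫ z, ∑ j, ‖X j z‖ ^ 2) * √(∫ z, ∑ j, ‖Y j z‖ ^ 2) := by
  rw [← inner_vec hY hX, ← norm_vec_sq hX, ← norm_vec_sq hY, Real.sqrt_sq (norm_nonneg _),
    Real.sqrt_sq (norm_nonneg _), mul_comm]
  exact norm_inner_le_norm _ _

/-- Orthogonal projection onto the annihilator of a family of `L²` vectors. -/
theorem exists_annihilator_proj {ι : Type*} {T : ι → Fin m → ℂ^m → ℂ}
    (hT : ∀ i j, MemLp (T i j) 2) (hB : ∀ j, MemLp (B j) 2) :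
    ∃ B' : Fin m → ℂ^m → ℂ, (∀ j, MemLp (B' j) 2) ∧
      (∫ z, ∑ j, ‖B' j z‖ ^ 2) ≤ (∫ z, ∑ j, ‖B j z‖ ^ 2) ∧
      (∀ i, ∫ z, ∑ j, B' j z * conj (T i j z) = 0) ∧
      ∀ X : Fin m → ℂ^m → ℂ, (∀ j, MemLp (X j) 2) →
        (∀ i, ∫ z, ∑ j, X j z * conj (T i j z) = 0) →
        ∫ z, ∑ j, X j z * conj (B' j z) = ∫ z, ∑ j, X j z * conj (B j z) := by
  set A := (Submodule.span ℂ (range fun i => vec (T i) (hT i)))ᗮ with hA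
  have memA : ∀ v, v ∈ A ↔ ∀ i, inner ℂ (vec (T i) (hT i)) v = 0 := by
    intro v
    rw [hA, Submodule.mem_orthogonal]
    refine ⟨fun h i => h _ (Submodule.subset_span ⟨i, rfl⟩), fun h u hu => ?_⟩
    induction hu using Submodule.span_induction with
    | mem x hx => obtain ⟨i, rfl⟩ := hx; exact h i
    | zero => simp
    | add x y _ _ hx hy => rw [inner_add_left, hx, hy, add_zero]
    | smul a x _ hx => rw [inner_smul_left, hx, mul_zero]
  set p := A.starProjection (vec B hB) with hp
  have hpA : p ∈ A := Submodule.starProjection_apply_mem _ _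
  have hm : ∀ j, MemLp (fun z => (p z) j) 2 := fun j => (Lp.memLp p).eval_piLp j
  have hpv : vec (fun j z => (p z) j) hm = p := by
    refine Lp.ext ?_
    filter_upwards [coeFn_vec hm] with z h
    rw [h]
  refine ⟨fun j z => (p z) j, hm, ?_, fun i => ?_, fun X hX hXT => ?_⟩
  · rw [← norm_vec_sq hm, ← norm_vec_sq hB, hpv]
    gcongr
    exact Submodule.norm_starProjection_apply_le _ _
  · rw [← inner_vec (hT i) hm, hpv]
    exact (memA p).1 hpA i
  · rw [← inner_vec hm hX, ← inner_vec hB hX, hpv]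
    have hXA : vec X hX ∈ A := (memA _).2 fun i => by rw [inner_vec]; exact hXT i
    have := Submodule.starProjection_inner_eq_zero (K := A) (vec B hB) _ hXA
    rw [inner_sub_left, sub_eq_zero] at this
    exact this.symm

end Vec

section LimSq
variable {m : ℕ} {F G : ℝ → ℂ^m → ℂ} {f g : ℂ^m → ℂ}

/-- `L²` convergence of a family of functions as the parameter decreases to zero. -/
structure LimSq (F : ℝ → ℂ^m → ℂ) (f : ℂ^m → ℂ) : Prop where
  memLp : ∀ ε > 0, MemLp (F ε) 2
  memLp' : MemLp f 2
  lim : Tendsto (fun ε => ∫ x, ‖F ε x - f x‖ ^ 2) (𝓝[>] 0) (𝓝 0)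

theorem limSq_sm (hf : MemLp f 2) : LimSq (fun ε => sm ε f) f :=
  ⟨fun _ hε => memLp_sm hε hf, hf, tendsto_sm hf⟩

theorem norm_add_sq_le_two (a b : ℂ) : ‖a + b‖ ^ 2 ≤ 2 * ‖a‖ ^ 2 + 2 * ‖b‖ ^ 2 := by
  have := norm_add_le a b
  nlinarith [norm_nonneg (a + b), sq_nonneg (‖a‖ - ‖b‖)]

theorem LimSq.integrable_sub (hF : LimSq F f) {ε : ℝ} (hε : 0 < ε) :
    Integrable fun x => ‖F ε x - f x‖ ^ 2 :=
  integrable_normSq ((hF.memLp ε hε).sub hF.memLp')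

theorem LimSq.add (hF : LimSq F f) (hG : LimSq G g) :
    LimSq (fun ε x => F ε x + G ε x) (fun x => f x + g x) := by
  refine ⟨fun ε hε => (hF.memLp ε hε).add (hG.memLp ε hε), hF.memLp'.add hG.memLp', ?_⟩
  have h := (hF.lim.const_mul 2).add (hG.lim.const_mul 2)
  rw [mul_zero, add_zero] at h
  refine squeeze_zero' (.of_forall fun ε => integral_nonneg fun x => by positivity) ?_ h
  filter_upwards [self_mem_nhdsWithin] with ε hε
  have i1 := hF.integrable_sub hε
  have i2 := hG.integrable_sub hε
  have i3 : Integrable fun x => ‖F ε x + G ε x - (f x + g x)‖ ^ 2 := integrable_normSq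
    (((hF.memLp ε hε).add (hG.memLp ε hε)).sub (hF.memLp'.add hG.memLp'))
  rw [← integral_const_mul, ← integral_const_mul,
    ← integral_add (i1.const_mul 2) (i2.const_mul 2)]
  refine integral_mono i3 ((i1.const_mul 2).add (i2.const_mul 2)) fun x => ?_
  have e : F ε x + G ε x - (f x + g x) = (F ε x - f x) + (G ε x - g x) := by ring
  dsimp only
  rw [e]
  exact norm_add_sq_le_two _ _

theorem LimSq.mul (hF : LimSq F f) {c : ℂ^m → ℂ} (hc : Continuous c)
    (hcc : HasCompactSupport c) : LimSq (fun ε x => c x * F ε x) (fun x => c x * f x) := by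
  obtain ⟨C, hC⟩ := hc.bounded_above_of_compact_support hcc
  have hC0 : 0 ≤ C := (norm_nonneg _).trans (hC 0)
  have hm : ∀ {h : ℂ^m → ℂ}, MemLp h 2 → MemLp (fun x => c x * h x) 2 := fun hh =>
    hh.of_le_mul (c := C) (hc.aestronglyMeasurable.mul hh.1) (.of_forall fun x => by
      rw [norm_mul]; gcongr; exact hC x)
  refine ⟨fun ε hε => hm (hF.memLp ε hε), hm hF.memLp', ?_⟩
  have h := hF.lim.const_mul (C ^ 2)
  rw [mul_zero] at h
  refine squeeze_zero' (.of_forall fun ε => integral_nonneg fun x => by positivity) ?_ h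
  filter_upwards [self_mem_nhdsWithin] with ε hε
  have i1 := hF.integrable_sub hε
  have i3 : Integrable fun x => ‖c x * F ε x - c x * f x‖ ^ 2 :=
    integrable_normSq ((hm (hF.memLp ε hε)).sub (hm hF.memLp'))
  rw [← integral_const_mul]
  refine integral_mono i3 (i1.const_mul _) fun x => ?_
  dsimp only
  rw [← mul_sub, norm_mul, mul_pow]
  have := hC x
  gcongr

theorem LimSq.zero : LimSq (fun _ (_ : ℂ^m) => 0) fun _ => 0 :=
  ⟨fun _ _ => MemLp.zero', MemLp.zero', by simp⟩

theorem LimSq.sum {ι : Type*} (s : Finset ι) {F : ι → ℝ → ℂ^m → ℂ}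
    {f : ι → ℂ^m → ℂ} (h : ∀ i ∈ s, LimSq (F i) (f i)) :
    LimSq (fun ε x => ∑ i ∈ s, F i ε x) fun x => ∑ i ∈ s, f i x := by
  classical
  induction s using Finset.induction_on with
  | empty => simpa using LimSq.zero
  | insert a s ha ih =>
    simp only [Finset.sum_insert ha]
    exact (h a (by simp)).add (ih fun i hi => h i (by simp [hi]))

theorem LimSq.tendsto (hF : LimSq F f) :
    Tendsto (fun ε => ∫ x, ‖F ε x‖ ^ 2) (𝓝[>] 0) (𝓝 (∫ x, ‖f x‖ ^ 2)) := by
  have h := hF.lim.sqrt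
  set N := ∫ x, ‖f x‖ ^ 2 with hN
  have hN0 : 0 ≤ N := integral_nonneg fun x => by positivity
  have hlim := ((h.const_mul (2 * √N)).add hF.lim)
  rw [Real.sqrt_zero, mul_zero, add_zero] at hlim
  rw [tendsto_iff_dist_tendsto_zero]
  refine squeeze_zero' (.of_forall fun ε => dist_nonneg) ?_ hlim
  filter_upwards [self_mem_nhdsWithin] with ε hε
  have hs : MemLp (fun x => F ε x - f x) 2 := (hF.memLp ε hε).sub hF.memLp'
  have nrm : ∀ {h : ℂ^m → ℂ} (hh : MemLp h 2), ‖hh.toLp‖ = √(∫ x, ‖h x‖ ^ 2) := by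
    intro h hh
    rw [Lp.norm_toLp, hh.eLpNorm_eq_integral_rpow_norm (by norm_num) (by norm_num),
      ENNReal.toReal_ofReal (by positivity), Real.sqrt_eq_rpow]
    simp
  have e : (hF.memLp ε hε).toLp = hF.memLp'.toLp + hs.toLp := by
    rw [← MemLp.toLp_add]
    congr 1; ext x; simp
  have h1 : ‖(hF.memLp ε hε).toLp‖ ≤ ‖hF.memLp'.toLp‖ + ‖hs.toLp‖ := by
    rw [e]; exact norm_add_le _ _
  have h2 : ‖hF.memLp'.toLp‖ ≤ ‖(hF.memLp ε hε).toLp‖ + ‖hs.toLp‖ := by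
    have := norm_sub_le ((hF.memLp ε hε).toLp) hs.toLp
    rwa [e, add_sub_cancel_right, ← e] at this
  rw [nrm, nrm, nrm] at h1 h2
  rw [← hN] at h1 h2
  have hA0 : 0 ≤ ∫ x, ‖F ε x‖ ^ 2 := integral_nonneg fun x => by positivity
  have hD0 : 0 ≤ ∫ x, ‖F ε x - f x‖ ^ 2 := integral_nonneg fun x => by positivity
  rw [Real.dist_eq, abs_le]
  have q1 := Real.sq_sqrt hA0
  have q2 := Real.sq_sqrt hD0
  have q3 := Real.sq_sqrt hN0
  have p1 := Real.sqrt_nonneg (∫ x, ‖F ε x‖ ^ 2)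
  have p2 := Real.sqrt_nonneg (∫ x, ‖F ε x - f x‖ ^ 2)
  have p3 := Real.sqrt_nonneg N
  set a := √(∫ x, ‖F ε x‖ ^ 2)
  set d := √(∫ x, ‖F ε x - f x‖ ^ 2)
  set n := √N
  rw [← q1, ← q2, ← q3]
  constructor <;> nlinarith

end LimSq

section WeakBochner
variable {m : ℕ}

theorem sum_wirt_sm_eq {ι : Type*} (s : Finset ι) {ε : ℝ} (hε : 0 < ε) {c : ι → ℂ} {l : ι → Fin m}
    {F : ι → ℂ^m → ℂ} {g : ℂ^m → ℂ} (hF : ∀ i, LocallyIntegrable (F i))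
    (h : ∀ κ : ℂ^m → ℂ, ContDiff ℝ ∞ κ → HasCompactSupport κ →
      ∫ y, ∑ i ∈ s, F i y * wirt (c i) (l i) κ y = - ∫ y, g y * κ y) (x : ℂ^m) :
    ∑ i ∈ s, wirt (c i) (l i) (sm ε (F i)) x = sm ε g x := by
  have hκ := h (fun t => ((moll ε (x - t) : ℝ) : ℂ))
    (contDiff_ofReal_comp (contDiff_moll.comp (contDiff_const.sub contDiff_id)))
    (.of_support_subset_isCompact (isCompact_closedBall x ε) (support_moll_sub hε x))
  rw [integral_finsetSum _ fun i _ => integrable_mul_wirt_moll hε (hF i) x] at hκ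
  simp only [wirt_sm_eq hε (hF _), Finset.sum_neg_distrib, hκ, neg_neg, sm_apply']
  congr 1; ext t; rw [real_smul, mul_comm]

theorem continuous_levi {φ : ℂ^m → ℝ} (hφ : ContDiff ℝ ∞ φ)
    {β : Fin m → ℂ^m → ℂ} (hβ : ∀ j, Continuous (β j)) :
    Continuous fun z => levi φ z fun j => β j z := by
  have c5 : ∀ j k, Continuous (dzb k (dz j (fun x => (φ x : ℂ)))) := fun j k =>
    (contDiff_wirt (contDiff_wirt (contDiff_ofReal_comp hφ))).continuous
  unfold levi
  fun_prop

/-- The basic inequality for compactly supported `L²` vectors. -/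
theorem bochner_weak {φ q : ℂ^m → ℝ} (hφ : ContDiff ℝ ∞ φ) (hq : Continuous q)
    (hq0 : ∀ z, 0 ≤ q z) {a : Fin m → ℂ^m → ℂ} (ha : ∀ j, Continuous (a j))
    {K U : Set ℂ^m} (hK : IsCompact K) (hU : IsOpen U) (hKU : K ⊆ U)
    (hlev : ∀ z ∈ U, ∀ w, q z * ∑ j, ‖w j‖ ^ 2 + 2 * ‖∑ j, a j z * w j‖ ^ 2 ≤ levi φ z w)
    {b : Fin m → ℂ^m → ℂ} (hb : ∀ j, MemLp (b j) 2) (hbK : ∀ j, ∀ z ∉ K, b j z = 0)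
    {θ : Fin m → Fin m → ℂ^m → ℂ} (hθ : ∀ j k, MemLp (θ j k) 2)
    (hθK : ∀ j k, ∀ z ∉ K, θ j k z = 0)
    {h : ℂ^m → ℂ} (hh : MemLp h 2) (hhK : ∀ z ∉ K, h z = 0)
    (W1 : ∀ κ : ℂ^m → ℂ, ContDiff ℝ ∞ κ → HasCompactSupport κ → ∀ j k,
      ∫ z, (b k z * dzb j κ z - b j z * dzb k κ z) = - ∫ z, θ j k z * κ z)
    (W2 : ∀ κ : ℂ^m → ℂ, ContDiff ℝ ∞ κ → HasCompactSupport κ →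
      ∫ z, ∑ j, b j z * dz j κ z = - ∫ z, h z * κ z) :
    ∑ j, (∫ z, q z * ‖b j z‖ ^ 2 * Real.exp (-φ z)) +
        2 * (∫ z, ‖∑ j, a j z * b j z‖ ^ 2 * Real.exp (-φ z)) ≤
      (∫ z, ‖h z - ∑ j, dz j (fun x => (φ x : ℂ)) z * b j z‖ ^ 2 * Real.exp (-φ z)) +
        1 / 2 * ∑ j, ∑ k, ∫ z, ‖θ j k z‖ ^ 2 * Real.exp (-φ z) := by
  obtain ⟨χ, hχ, hχc, -, ⟨V, hV, hKV, hχ1⟩, -⟩ := exists_cutoff hK hU hKU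
  obtain ⟨δ, hδ, hδV⟩ := hK.exists_cthickening_subset_open (hV.inter hU) (subset_inter hKV hKU)
  set p : ℂ^m → ℝ := fun z => χ z * Real.exp (-φ z / 2) with hp
  have hφc := hφ.continuous
  have hpc : Continuous p := by have := hχ.continuous; fun_prop
  have hpK : HasCompactSupport p := hχc.mul_right
  have hpC : Continuous fun z => (p z : ℂ) := by fun_prop
  have hpCK : HasCompactSupport fun z => (p z : ℂ) := hasCompactSupport_ofReal hpK
  have hp2 : ∀ z ∈ V, p z ^ 2 = Real.exp (-φ z) := by
    intro z hz
    rw [hp]; dsimp only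
    rw [hχ1 z hz, one_mul, ← Real.exp_nat_mul]; congr 1; push_cast; ring
  have norm_p : ∀ (z : ℂ^m) (c : ℂ), (z ∉ V → c = 0) → ‖(p z : ℂ) * c‖ ^ 2 =
      ‖c‖ ^ 2 * Real.exp (-φ z) := by
    intro z c hc
    by_cases hz : z ∈ V
    · rw [norm_ofReal_mul_sq, hp2 z hz, mul_comm]
    · simp [hc hz]
  -- the convergent families
  have Lq : ∀ j, LimSq (fun ε z => ((p z * √(q z) : ℝ) : ℂ) * sm ε (b j) z)
      (fun z => ((p z * √(q z) : ℝ) : ℂ) * b j z) := fun j =>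
    (limSq_sm (hb j)).mul (by fun_prop)
      (hasCompactSupport_ofReal hpK.mul_right)
  have La : LimSq (fun ε z => ∑ j, ((p z : ℂ) * a j z) * sm ε (b j) z)
      (fun z => ∑ j, ((p z : ℂ) * a j z) * b j z) := LimSq.sum _ fun j _ =>
    (limSq_sm (hb j)).mul (by have := ha j; fun_prop) hpCK.mul_right
  have hdφ : ∀ j, Continuous fun z => dz j (fun x => (φ x : ℂ)) z := fun j =>
    (contDiff_wirt (contDiff_ofReal_comp hφ)).continuous
  have Lh : LimSq (fun ε z => (p z : ℂ) * sm ε h z +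
        ∑ j, ((p z : ℂ) * -dz j (fun x => (φ x : ℂ)) z) * sm ε (b j) z)
      (fun z => (p z : ℂ) * h z + ∑ j, ((p z : ℂ) * -dz j (fun x => (φ x : ℂ)) z) * b j z) :=
    ((limSq_sm hh).mul hpC hpCK).add (LimSq.sum _ fun j _ =>
      (limSq_sm (hb j)).mul (by have := hdφ j; fun_prop) hpCK.mul_right)
  have Lθ : ∀ j k, LimSq (fun ε z => (p z : ℂ) * sm ε (θ j k) z) (fun z => (p z : ℂ) * θ j k z) :=
    fun j k => (limSq_sm (hθ j k)).mul hpC hpCK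
  have key : ∀ᶠ ε in 𝓝[>] (0:ℝ), ∑ j, (∫ z, ‖((p z * √(q z) : ℝ) : ℂ) * sm ε (b j) z‖ ^ 2) +
        2 * (∫ z, ‖∑ j, ((p z : ℂ) * a j z) * sm ε (b j) z‖ ^ 2) ≤
      (∫ z, ‖(p z : ℂ) * sm ε h z +
        ∑ j, ((p z : ℂ) * -dz j (fun x => (φ x : ℂ)) z) * sm ε (b j) z‖ ^ 2) +
        1 / 2 * ∑ j, ∑ k, ∫ z, ‖(p z : ℂ) * sm ε (θ j k) z‖ ^ 2 := by
    filter_upwards [Ioo_mem_nhdsGT hδ] with ε hε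
    have van : ∀ {f : ℂ^m → ℂ}, (∀ z ∉ K, f z = 0) → ∀ z, z ∉ V ∩ U → sm ε f z = 0 := by
      intro f hf z hz
      refine sm_eq_zero hε.1 fun y hy => hf y fun hyK => hz (hδV ?_)
      refine mem_cthickening_of_dist_le z y δ K hyK ?_
      rw [dist_comm, dist_eq_norm]; linarith [hε.2]
    have hcs : ∀ {f : ℂ^m → ℂ}, (∀ z ∉ K, f z = 0) → HasCompactSupport f := fun hf =>
      .of_support_subset_isCompact hK fun z hz => by
        by_contra hzK; exact hz (hf z hzK)
    have hbs : ∀ j, ContDiff ℝ ∞ (sm ε (b j)) := fun j => contDiff_sm hε.1 (locInt_of_memLp (hb j))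
    have hbc : ∀ j, Continuous (sm ε (b j)) := fun j => (hbs j).continuous
    have hbcs : ∀ j, HasCompactSupport (sm ε (b j)) := fun j =>
      hasCompactSupport_sm hε.1 (hcs (hbK j))
    have hboch := bochner_inequality hφ hbs hbcs
    have hcurl : ∀ j k z, dzb j (sm ε (b k)) z - dzb k (sm ε (b j)) z = sm ε (θ j k) z := by
      intro j k z
      rw [← sum_wirt_sm_eq (Finset.univ : Finset Bool) hε.1 (c := fun _ => I)
        (l := fun i => if i then j else k) (F := fun i => if i then b k else fun z => - b j z)
        (g := θ j k) ?_ ?_ z]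
      · have hneg : sm ε (fun z => - b j z) = fun z => - sm ε (b j) z := by
          ext z; simp [sm_apply, integral_neg]
        have hn : wirt I k (fun z => - sm ε (b j) z) z = _ := wirt_neg
        simp [hneg, hn, sub_eq_add_neg]
      · intro i
        cases i
        · rw [if_neg Bool.false_ne_true]; exact (locInt_of_memLp (hb j)).neg
        · simpa using locInt_of_memLp (hb k)
      · intro κ h1 h2
        rw [← W1 κ h1 h2 j k]
        congr 1; ext z; simp; ring
    have hdiv : ∀ z, ∑ j, del φ j (sm ε (b j)) z = sm ε h z +
        ∑ j, -dz j (fun x => (φ x : ℂ)) z * sm ε (b j) z := by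
      intro z
      have := sum_wirt_sm_eq Finset.univ hε.1 (c := fun _ => -I) (l := fun j => j) (F := b) (g := h)
        (fun j => locInt_of_memLp (hb j)) W2 z
      rw [← this, ← Finset.sum_add_distrib]
      refine Finset.sum_congr rfl fun j _ => ?_
      rw [del]; ring
    simp only [hcurl, hdiv] at hboch
    have e1 : ∀ z, ‖(p z : ℂ) * sm ε h z +
        ∑ j, ((p z : ℂ) * -dz j (fun x => (φ x : ℂ)) z) * sm ε (b j) z‖ ^ 2 =
        ‖sm ε h z + ∑ j, -dz j (fun x => (φ x : ℂ)) z * sm ε (b j) z‖ ^ 2 * Real.exp (-φ z) := by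
      intro z
      rw [← norm_p z _ fun hz => by simp [van hhK z fun h => hz h.1, van (hbK _) z fun h => hz h.1],
        mul_add, Finset.mul_sum]
      simp only [mul_assoc]
    have e2 : ∀ j k z, ‖(p z : ℂ) * sm ε (θ j k) z‖ ^ 2 =
        ‖sm ε (θ j k) z‖ ^ 2 * Real.exp (-φ z) := fun j k z =>
      norm_p z _ fun hz => van (hθK j k) z fun h => hz h.1
    have hsθ : (1 / 2 * ∑ j, ∑ k, ∫ z, ‖(p z : ℂ) * sm ε (θ j k) z‖ ^ 2) =
        ∫ z, (1 / 2 * ∑ j, ∑ k, ‖sm ε (θ j k) z‖ ^ 2) * Real.exp (-φ z) := by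
      have i0 : ∀ j k, Integrable fun z => ‖(p z : ℂ) * sm ε (θ j k) z‖ ^ 2 := fun j k =>
        integrable_normSq ((Lθ j k).memLp ε hε.1)
      rw [← Finset.sum_congr rfl fun j _ => integral_finsetSum _ fun k _ => i0 j k,
        ← integral_finsetSum _ fun j _ => integrable_finsetSum _ fun k _ => i0 j k,
        ← integral_const_mul]
      simp only [e2, Finset.sum_mul, mul_assoc]
    have iq : ∀ j, Integrable fun z => ‖((p z * √(q z) : ℝ) : ℂ) * sm ε (b j) z‖ ^ 2 := fun j =>
      integrable_normSq ((Lq j).memLp ε hε.1)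
    have ia := integrable_normSq (La.memLp ε hε.1)
    rw [hsθ]
    simp only [e1]
    refine le_trans ?_ hboch
    rw [← integral_finsetSum _ fun j _ => iq j, ← integral_const_mul,
      ← integral_add (integrable_finsetSum _ fun j _ => iq j) (ia.const_mul 2)]
    refine integral_mono_of_nonneg (.of_forall fun z => by positivity) ?_
      (.of_forall fun z => ?_)
    · refine Continuous.integrable_of_hasCompactSupport
        ((continuous_levi hφ hbc).mul (by fun_prop)) (HasCompactSupport.mul_right ?_)
      refine HasCompactSupport.intro' (hK.cthickening (r := δ)) isClosed_cthickening
        fun z hz => ?_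
      have : (fun j => sm ε (b j) z) = 0 := funext fun j => sm_eq_zero hε.1 fun y hy =>
        hbK j y fun hyK => hz (mem_cthickening_of_dist_le z y δ K hyK (by
          rw [dist_comm, dist_eq_norm]; linarith [hε.2]))
      rw [this]; simp [levi]
    · dsimp only
      have s1 : ∀ j, ‖((p z * √(q z) : ℝ) : ℂ) * sm ε (b j) z‖ ^ 2 =
          q z * ‖sm ε (b j) z‖ ^ 2 * Real.exp (-φ z) := by
        intro j
        rw [ofReal_mul, mul_assoc, norm_p z _ fun hz => by
          rw [van (hbK j) z fun h => hz h.1, mul_zero], norm_ofReal_mul_sq,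
          Real.sq_sqrt (hq0 z)]
      have s2 : ‖∑ j, ((p z : ℂ) * a j z) * sm ε (b j) z‖ ^ 2 =
          ‖∑ j, a j z * sm ε (b j) z‖ ^ 2 * Real.exp (-φ z) := by
        simp only [mul_assoc, ← Finset.mul_sum]
        exact norm_p z _ fun hz => by simp [van (hbK _) z fun h => hz h.1]
      simp only [s1, s2, ← Finset.sum_mul, ← Finset.mul_sum]
      rw [← mul_assoc, ← add_mul]
      refine mul_le_mul_of_nonneg_right ?_ (Real.exp_pos _).le
      by_cases hz : z ∈ U
      · exact hlev z hz _
      · have : ∀ j, sm ε (b j) z = 0 := fun j => van (hbK j) z fun h => hz h.2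
        simp [levi, this]
  have T1 := (tendsto_finsetSum Finset.univ fun j _ => (Lq j).tendsto).add (La.tendsto.const_mul 2)
  have T2 := Lh.tendsto.add ((tendsto_finsetSum Finset.univ fun j _ =>
    tendsto_finsetSum Finset.univ fun k _ => (Lθ j k).tendsto).const_mul (1 / 2))
  have fin := le_of_tendsto_of_tendsto T1 T2 key
  have r1 : ∀ j z, ‖((p z * √(q z) : ℝ) : ℂ) * b j z‖ ^ 2 =
      q z * ‖b j z‖ ^ 2 * Real.exp (-φ z) := by
    intro j z
    rw [ofReal_mul, mul_assoc, norm_p z _ fun hz => by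
      rw [hbK j z fun h => hz (hKV h), mul_zero], norm_ofReal_mul_sq, Real.sq_sqrt (hq0 z)]
  have r2 : ∀ z, ‖∑ j, ((p z : ℂ) * a j z) * b j z‖ ^ 2 =
      ‖∑ j, a j z * b j z‖ ^ 2 * Real.exp (-φ z) := by
    intro z
    simp only [mul_assoc, ← Finset.mul_sum]
    exact norm_p z _ fun hz => by simp [hbK _ z fun h => hz (hKV h)]
  have r3 : ∀ z, ‖(p z : ℂ) * h z + ∑ j, ((p z : ℂ) * -dz j (fun x => (φ x : ℂ)) z) * b j z‖ ^ 2 =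
      ‖h z - ∑ j, dz j (fun x => (φ x : ℂ)) z * b j z‖ ^ 2 * Real.exp (-φ z) := by
    intro z
    rw [← norm_p z _ fun hz => by simp [hhK z fun h => hz (hKV h), hbK _ z fun h => hz (hKV h)],
      sub_eq_add_neg, mul_add, ← Finset.sum_neg_distrib, Finset.mul_sum]
    simp only [mul_assoc, neg_mul]
  have r4 : ∀ j k z, ‖(p z : ℂ) * θ j k z‖ ^ 2 = ‖θ j k z‖ ^ 2 * Real.exp (-φ z) :=
    fun j k z => norm_p z _ fun hz => hθK j k z fun h => hz (hKV h)
  simpa only [r1, r2, r3, r4] using fin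

end WeakBochner

section DualEstimate
variable {m : ℕ}

theorem memLp_mul {c f : ℂ^m → ℂ} (hc : Continuous c) (hcc : HasCompactSupport c)
    (hf : MemLp f 2) : MemLp (fun x => c x * f x) 2 :=
  ((limSq_sm hf).mul hc hcc).memLp'

theorem memLp_indicator_of_bounded {U : Set ℂ^m} (hU : IsOpen U)
    (hUb : Bornology.IsBounded U) {f : ℂ^m → ℂ} (hf : Continuous f) :
    MemLp (U.indicator f) 2 := by
  rw [memLp_indicator_iff_restrict hU.measurableSet,
    memLp_two_iff_integrable_sq_norm hf.aestronglyMeasurable]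
  have h : IsCompact (closure U) := hUb.isCompact_closure
  exact ((hf.norm.pow 2).continuousOn.integrableOn_compact h).mono_set subset_closure

theorem integral_curl_eq_zero {u κ : ℂ^m → ℂ} (hu : ContDiff ℝ ∞ u) (hκ : ContDiff ℝ ∞ κ)
    (hκc : HasCompactSupport κ) (j k : Fin m) :
    ∫ z, (dzb k u z * dzb j κ z - dzb j u z * dzb k κ z) = 0 := by
  have hi : ∀ j k, Integrable fun z => dzb k u z * dzb j κ z := fun j k =>
    Continuous.integrable_of_hasCompactSupport
      ((contDiff_wirt hu).continuous.mul (contDiff_wirt hκ).continuous)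
      (hasCompactSupport_wirt hκc).mul_left
  have h : ∀ j k, ∫ z, dzb k u z * dzb j κ z = - ∫ z, dzb j (dzb k u) z * κ z := by
    intro j k
    rw [eq_neg_iff_add_eq_zero, add_comm, ← eq_neg_iff_add_eq_zero]
    exact integral_wirt_mul (contDiff_wirt hu) hκ (.inr hκc)
  rw [integral_sub (hi j k) (hi k j), h, h]
  have : ∀ z, dzb j (dzb k u) z = dzb k (dzb j u) z := fun z => wirt_comm hu.contDiffAt
  simp only [this, sub_self]

theorem integrable_mul_of_compact {c f : ℂ^m → ℝ} (hc : Continuous c)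
    (hcc : HasCompactSupport c) (hf : Integrable f) : Integrable fun x => c x * f x := by
  obtain ⟨C, hC⟩ := hc.bounded_above_of_compact_support hcc
  exact hf.bdd_mul hc.aestronglyMeasurable (.of_forall hC)

theorem norm_sum_mul_sq_le {ι : Type*} (s : Finset ι) (a b : ι → ℂ) :
    ‖∑ j ∈ s, a j * b j‖ ^ 2 ≤ (∑ j ∈ s, ‖a j‖ ^ 2) * ∑ j ∈ s, ‖b j‖ ^ 2 := by
  refine le_trans ?_ (Finset.sum_mul_sq_le_sq_mul_sq s (fun j => ‖a j‖) fun j => ‖b j‖)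
  gcongr
  exact (norm_sum_le _ _).trans (le_of_eq (Finset.sum_congr rfl fun j _ => norm_mul _ _))

theorem norm_sq_mul_exp (c : ℂ) (t : ℝ) :
    ‖c‖ ^ 2 * Real.exp t = ‖((Real.exp (t / 2) : ℝ) : ℂ) * c‖ ^ 2 := by
  rw [norm_ofReal_mul_sq, ← Real.exp_nat_mul, mul_comm]
  congr 2; push_cast; ring

theorem norm_curl_sq_le (a b : ℂ^m) (e : ℝ) :
    ∑ j, ∑ k, ‖(e : ℂ) * a j * b k - (e : ℂ) * a k * b j‖ ^ 2 ≤
      4 * (e ^ 2 * ((∑ j, ‖a j‖ ^ 2) * ∑ j, ‖b j‖ ^ 2)) := by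
  have h : ∀ j k, ‖(e : ℂ) * a j * b k - (e : ℂ) * a k * b j‖ ^ 2 ≤
      2 * e ^ 2 * (‖a j‖ ^ 2 * ‖b k‖ ^ 2) + 2 * e ^ 2 * (‖a k‖ ^ 2 * ‖b j‖ ^ 2) := by
    intro j k
    rw [sub_eq_add_neg]
    refine (norm_add_sq_le_two _ _).trans (le_of_eq ?_)
    simp only [norm_neg, norm_mul, norm_real, mul_pow, Real.norm_eq_abs, sq_abs]
    ring
  refine (Finset.sum_le_sum fun j _ => Finset.sum_le_sum fun k _ => h j k).trans (le_of_eq ?_)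
  simp only [Finset.sum_add_distrib, ← Finset.mul_sum, ← Finset.sum_mul]
  ring

theorem sum_mul_conj_curl (X : ℂ^m) (j k : Fin m) (e : ℝ) (a b : ℂ) :
    ∑ l, X l * conj ((e : ℂ) * ((if l = k then conj a else 0) - (if l = j then conj b else 0))) =
      e * (X k * a - X j * b) := by
  simp only [map_mul, map_sub, conj_ofReal, apply_ite (starRingEnd ℂ), conj_conj, map_zero, mul_sub,
    Finset.sum_sub_distrib, mul_ite, mul_zero, Finset.sum_ite_eq', Finset.mem_univ, if_true]
  ring

/-- The representation of the functional `γ ↦ ∫ ∂̄g · γ` by a vector satisfying an a priori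
estimate. -/
theorem exists_dual_vector {φ η : ℂ^m → ℝ} (hφ : ContDiff ℝ ∞ φ) (hη : ContDiff ℝ ∞ η)
    {U : Set ℂ^m} (hU : IsOpen U) (hUb : Bornology.IsBounded U)
    (hlev : ∀ z ∈ U, ∀ w, Real.exp (η z) * ∑ j, ‖w j‖ ^ 2 +
      2 * ‖∑ j, dz j (fun x => (η x : ℂ)) z * w j‖ ^ 2 ≤ levi φ z w)
    {χ : ℂ^m → ℝ} (hχ : ContDiff ℝ ∞ χ) (hχc : HasCompactSupport χ) (hχU : tsupport χ ⊆ U)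
    {γ : Fin m → ℂ^m → ℂ} (hγ : ∀ j, ContDiff ℝ ∞ (γ j))
    (hγc : ∀ j, HasCompactSupport (γ j)) (hχ1 : ∀ j, ∀ z ∈ tsupport (γ j), χ z = 1)
    {g : ℂ^m → ℂ} (hg : ContDiff ℝ ∞ g) :
    ∃ B : Fin m → ℂ^m → ℂ, (∀ j, MemLp (B j) 2) ∧
      ∫ z, ∑ j, ‖B j z‖ ^ 2 ≤ ∫ z, ∑ j, ‖γ j z‖ ^ 2 * Real.exp (φ z - η z) ∧
      ∫ z, ∑ j, U.indicator (fun z => dzb j g z * Real.exp (-(φ z - η z) / 2)) z * conj (B j z) =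
        ∫ z, ∑ j, dzb j g z * γ j z ∧
      ∫ z, χ z ^ 2 * ∑ j, ‖B j z‖ ^ 2 ≤
        4 * (∫ z, ‖∑ j, dzb j (γ j) z‖ ^ 2 * Real.exp (φ z - 2 * η z)) +
        6 * ∫ z, ((∑ j, ‖dz j (fun x => (χ x : ℂ)) z‖ ^ 2) * Real.exp (-η z)) *
          ∑ j, ‖B j z‖ ^ 2 := by
  set φ2 : ℂ^m → ℝ := fun z => φ z - η z with hφ2
  have hφ2s : ContDiff ℝ ∞ φ2 := hφ.sub hη
  have hφ2c := hφ2s.continuous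
  have hφc := hφ.continuous
  have hηc := hη.continuous
  have hχC : ContDiff ℝ ∞ fun z => (χ z : ℂ) := contDiff_ofReal_comp hχ
  have hχCc : HasCompactSupport fun z => (χ z : ℂ) :=
    hasCompactSupport_ofReal hχc
  have hχt : ∀ z, z ∉ tsupport χ → (χ z : ℂ) = 0 := fun z hz => by
    rw [image_eq_zero_of_notMem_tsupport hz, ofReal_zero]
  have htχ : tsupport (fun z => (χ z : ℂ)) ⊆ tsupport χ :=
    closure_mono fun z hz h => hz (by simp [h])
  have hγU : ∀ j, tsupport (γ j) ⊆ tsupport χ := fun j z hz =>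
    subset_tsupport _ (by simp [hχ1 j z hz])
  set E : ℂ^m → ℝ := fun z => Real.exp (φ2 z / 2) with hE
  set E' : ℂ^m → ℝ := fun z => Real.exp (-φ2 z / 2) with hE'
  have hEE : ∀ z, (E z : ℂ) * E' z = 1 := fun z => by
    rw [← ofReal_mul, hE, hE']; dsimp only
    rw [← Real.exp_add]; ring_nf; simp
  have hE2 : ∀ z, (E z : ℂ) ^ 2 = cexp (φ2 z) := fun z => by
    rw [← ofReal_pow, hE]; dsimp only
    rw [← Real.exp_nat_mul, ofReal_exp]; congr 2; push_cast; ring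
  have hEc : Continuous E := by fun_prop
  have hE'c : Continuous E' := by fun_prop
  set ι := {κ : ℂ^m → ℂ // ContDiff ℝ ∞ κ ∧ HasCompactSupport κ ∧ tsupport κ ⊆ U} ×
    Fin m × Fin m
  set T : ι → Fin m → ℂ^m → ℂ := fun i l z => (E z : ℂ) *
    ((if l = i.2.2 then conj (dzb i.2.1 i.1.1 z) else 0) -
      (if l = i.2.1 then conj (dzb i.2.2 i.1.1 z) else 0)) with hTdef
  have hTsum : ∀ (X : Fin m → ℂ^m → ℂ) (i : ι) z, ∑ l, X l z * conj (T i l z) =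
      (E z : ℂ) * (X i.2.2 z * dzb i.2.1 i.1.1 z - X i.2.1 z * dzb i.2.2 i.1.1 z) := fun X i z =>
    sum_mul_conj_curl (fun l => X l z) _ _ _ _ _
  have hT : ∀ i l, MemLp (T i l) 2 := by
    intro i l
    have h1 : ∀ (p : Prop) [Decidable p] (j : Fin m),
        Continuous fun z => if p then conj (dzb j i.1.1 z) else 0 := by
      intro p _ j
      have := (contDiff_wirt i.1.2.1 (c := I) (j := j)).continuous
      split_ifs <;> fun_prop
    have h2 : ∀ (p : Prop) [Decidable p] (j : Fin m),
        HasCompactSupport fun z => if p then conj (dzb j i.1.1 z) else 0 := by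
      intro p _ j
      split_ifs
      · exact hasCompactSupport_conj (hasCompactSupport_wirt i.1.2.2.1)
      · exact HasCompactSupport.zero
    refine Continuous.memLp_of_hasCompactSupport ?_ ?_
    · have e1 := h1 (l = i.2.2) i.2.1
      have e2 := h1 (l = i.2.1) i.2.2
      exact (continuous_ofReal.comp hEc).mul (e1.sub e2)
    · exact ((h2 _ _).sub (h2 _ _)).mul_left
  set B0 : Fin m → ℂ^m → ℂ := fun j z => conj (γ j z) * E z with hB0
  have hB0L : ∀ j, MemLp (B0 j) 2 := fun j => by
    refine Continuous.memLp_of_hasCompactSupport ?_ (hasCompactSupport_conj (hγc j)).mul_right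
    have := (hγ j).continuous
    fun_prop
  obtain ⟨B, hB, hBle, hBT, hBX⟩ := exists_annihilator_proj hT hB0L
  -- the gradient vectors annihilate the family
  set G : (ℂ^m → ℂ) → Fin m → ℂ^m → ℂ := fun u j =>
    U.indicator (fun z => dzb j u z * E' z) with hG
  have hGX : ∀ u, ContDiff ℝ ∞ u → ∫ z, ∑ j, G u j z * conj (B j z) =
      ∫ z, ∑ j, dzb j u z * γ j z := by
    intro u hu
    have hGL : ∀ j, MemLp (G u j) 2 := fun j => memLp_indicator_of_bounded hU hUb (by
      have := (contDiff_wirt hu (c := I) (j := j)).continuous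
      fun_prop)
    rw [hBX (G u) hGL ?_]
    · congr 1; ext z
      refine Finset.sum_congr rfl fun j _ => ?_
      by_cases hz : z ∈ U
      · simp only [hG, hB0, indicator_of_mem hz, map_mul, conj_conj, conj_ofReal]
        linear_combination dzb j u z * γ j z * hEE z
      · have : γ j z = 0 := image_eq_zero_of_notMem_tsupport fun h => hz (hχU (hγU j h))
        simp [hG, hB0, this]
    · intro i
      simp only [hTsum]
      rw [← integral_curl_eq_zero hu i.1.2.1 i.1.2.2.1 i.2.1 i.2.2]
      congr 1; ext z
      by_cases hz : z ∈ U
      · simp only [hG, indicator_of_mem hz]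
        linear_combination (dzb i.2.2 u z * dzb i.2.1 i.1.1 z -
          dzb i.2.1 u z * dzb i.2.2 i.1.1 z) * hEE z
      · have : ∀ j, dzb j i.1.1 z = 0 := fun j =>
          wirt_eq_zero_of_notMem fun h => hz (i.1.2.2.2 h)
        simp [this]
  refine ⟨B, hB, hBle.trans (le_of_eq ?_), hGX g hg, ?_⟩
  · congr 1; ext z
    refine Finset.sum_congr rfl fun j _ => ?_
    rw [hB0]; dsimp only
    rw [norm_mul, mul_pow, RCLike.norm_conj, norm_real, Real.norm_of_nonneg (Real.exp_pos _).le,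
      ← Real.exp_nat_mul]
    congr 2; rw [hφ2]; push_cast; ring
  -- the compactly supported vector to which the basic inequality is applied
  have hφC := contDiff_ofReal_comp hφ
  have hηC := contDiff_ofReal_comp hη
  have hφ2C := contDiff_ofReal_comp hφ2s
  have cdχ : ∀ (c : ℂ) j, Continuous (wirt c j fun x => (χ x : ℂ)) := fun c j =>
    (contDiff_wirt hχC).continuous
  have sdχ : ∀ (c : ℂ) j, HasCompactSupport (wirt c j fun x => (χ x : ℂ)) := fun c j =>
    hasCompactSupport_wirt hχCc
  have zdχ : ∀ (c : ℂ) j z, z ∉ tsupport χ → wirt c j (fun x => (χ x : ℂ)) z = 0 := fun c j z hz =>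
    wirt_eq_zero_of_notMem fun h => hz (htχ h)
  have hχc' : Continuous fun z => (χ z : ℂ) := hχC.continuous
  have hEC : Continuous fun z => (E z : ℂ) := continuous_ofReal.comp hEc
  set b : Fin m → ℂ^m → ℂ := fun j z => ((χ z : ℂ) * E z) * B j z with hbdef
  set θ : Fin m → Fin m → ℂ^m → ℂ := fun j k z =>
    ((E z : ℂ) * dzb j (fun x => (χ x : ℂ)) z) * B k z -
      ((E z : ℂ) * dzb k (fun x => (χ x : ℂ)) z) * B j z with hθdef
  set d : ℂ^m → ℂ := fun z => ∑ j, dzb j (γ j) z with hd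
  have hdc : Continuous d := by
    have := fun j => (contDiff_wirt (hγ j) (c := I) (j := j)).continuous
    fun_prop
  have hdz : ∀ z, χ z ≠ 1 → d z = 0 := fun z hz => Finset.sum_eq_zero fun j _ =>
    wirt_eq_zero_of_notMem fun h => hz (hχ1 j z h)
  have hdχ : ∀ z ∉ tsupport χ, d z = 0 := fun z hz => hdz z fun h => by
    rw [image_eq_zero_of_notMem_tsupport hz] at h; exact zero_ne_one h
  have hdcs : HasCompactSupport d := .intro' hχc (isClosed_tsupport χ) hdχ
  set h : ℂ^m → ℂ := fun z => (∑ j, dz j (fun x => (φ2 x : ℂ)) z * b j z) +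
    ((E z : ℂ) ^ 2 * conj (d z) +
      ∑ j, ((E z : ℂ) * dz j (fun x => (χ x : ℂ)) z) * B j z) with hhdef
  have hbL : ∀ j, MemLp (b j) 2 := fun j => memLp_mul (by fun_prop) hχCc.mul_right (hB j)
  have hBc : ∀ (c : ℂ) j k, MemLp (fun z => ((E z : ℂ) * wirt c j (fun x => (χ x : ℂ)) z) * B k z) 2 :=
    fun c j k => memLp_mul (hEC.mul (cdχ c j)) (sdχ c j).mul_left (hB k)
  have hθL : ∀ j k, MemLp (θ j k) 2 := fun j k => (hBc I j k).sub (hBc I k j)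
  have hhL : MemLp h 2 := by
    refine (memLp_finsetSum _ fun j _ => ?_).add (MemLp.add ?_ (memLp_finsetSum _ fun j _ => hBc _ j j))
    · have := (contDiff_wirt hφ2C (c := -I) (j := j)).continuous
      have := memLp_mul (c := fun z => dz j (fun x => (φ2 x : ℂ)) z * (χ z * E z)) (by fun_prop)
        (HasCompactSupport.mul_left hχCc.mul_right) (hB j)
      simpa only [hbdef, mul_assoc] using this
    · exact Continuous.memLp_of_hasCompactSupport (by fun_prop)
        (hasCompactSupport_conj hdcs).mul_left
  have hint : ∀ {f κ : ℂ^m → ℂ}, MemLp f 2 → Continuous κ → HasCompactSupport κ →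
      Integrable fun z => f z * κ z := fun hf h1 h2 =>
    MemLp.integrable_mul (p := 2) (q := 2) hf (h1.memLp_of_hasCompactSupport h2)
  have hWκ : ∀ {κ : ℂ^m → ℂ} {c : ℂ} {j : Fin m}, ContDiff ℝ ∞ κ →
      Continuous (wirt c j κ) := fun hκ => (contDiff_wirt hκ).continuous
  have W1 : ∀ κ : ℂ^m → ℂ, ContDiff ℝ ∞ κ → HasCompactSupport κ → ∀ j k,
      ∫ z, (b k z * dzb j κ z - b j z * dzb k κ z) = - ∫ z, θ j k z * κ z := by
    intro κ hκ hκc j k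
    have h1 := hBT ⟨⟨fun z => χ z * κ z, hχC.mul hκ, hκc.mul_left,
      ((tsupport_mul_subset_left).trans htχ).trans hχU⟩, j, k⟩
    simp only [hTsum] at h1
    have i1 : Integrable fun z => b k z * dzb j κ z - b j z * dzb k κ z :=
      (hint (hbL k) (hWκ hκ) (hasCompactSupport_wirt hκc)).sub
        (hint (hbL j) (hWκ hκ) (hasCompactSupport_wirt hκc))
    rw [← add_eq_zero_iff_eq_neg, ← integral_add i1 (hint (hθL j k) hκ.continuous hκc), ← h1]
    congr 1; ext z
    have e : ∀ l, dzb l (fun z => (χ z : ℂ) * κ z) z = _ := fun l =>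
      wirt_mul (hχC.differentiable (by simp) z) (hκ.differentiable (by simp) z)
    rw [e, e]
    simp only [hbdef, hθdef]
    ring
  have W2 : ∀ κ : ℂ^m → ℂ, ContDiff ℝ ∞ κ → HasCompactSupport κ →
      ∫ z, ∑ j, b j z * dz j κ z = - ∫ z, h z * κ z := by
    intro κ hκ hκc
    set v : ℂ^m → ℂ := fun z => cexp (φ2 z) * (χ z * κ z) with hv
    have hvs : ContDiff ℝ ∞ v := (hφ2C.cexp).mul (hχC.mul hκ)
    have hvc : HasCompactSupport v := HasCompactSupport.mul_left hχCc.mul_right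
    have hvχ : tsupport v ⊆ tsupport χ :=
      (tsupport_mul_subset_right.trans tsupport_mul_subset_left).trans htχ
    have hdv : ∀ j z, dz j v z = (E z : ℂ) ^ 2 * (dz j (fun x => (φ2 x : ℂ)) z * (χ z * κ z) +
        dz j (fun x => (χ x : ℂ)) z * κ z + χ z * dz j κ z) := by
      intro j z
      have d1 := hφ2C.differentiable (by simp) z
      have d2 := hχC.differentiable (by simp) z
      have d3 := hκ.differentiable (by simp) z
      have e1 : dz j (fun z => cexp (φ2 z)) z = _ := wirt_comp (hasDerivAt_exp _) d1
      have e2 : dz j v z = _ := wirt_mul (hφ2C.cexp.differentiable (by simp) z) (d2.mul d3)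
      have e3 : dz j (fun z => (χ z : ℂ) * κ z) z = _ := wirt_mul d2 d3
      rw [e2, show wirt (-I) j (fun z => cexp (φ2 z)) z = _ from e1,
        show wirt (-I) j (fun z => (χ z : ℂ) * κ z) z = _ from e3, hE2]; ring
    have h1 := hGX _ (contDiff_conj hvs)
    have h2 := congrArg (starRingEnd ℂ) h1
    rw [← integral_conj, ← integral_conj] at h2
    have hr : ∫ z, conj (∑ j, dzb j (fun x => conj (v x)) z * γ j z) =
        - ∫ z, v z * conj (d z) := by
      have e : ∀ z, conj (∑ j, dzb j (fun x => conj (v x)) z * γ j z) =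
          ∑ j, dz j v z * conj (γ j z) := by
        intro z
        rw [map_sum]
        refine Finset.sum_congr rfl fun j _ => ?_
        have : dzb j (fun x => conj (v x)) z = _ := wirt_conj (hvs.differentiable (by simp) z)
        rw [this, map_mul, conj_conj, conj_I]
      have i1 : ∀ j, Integrable fun z => dz j v z * conj (γ j z) := fun j =>
        Continuous.integrable_of_hasCompactSupport
          ((hWκ hvs).mul (contDiff_conj (hγ j)).continuous) (hasCompactSupport_wirt hvc).mul_right
      have i2 : ∀ j, Integrable fun z => v z * conj (dzb j (γ j) z) := fun j =>
        Continuous.integrable_of_hasCompactSupport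
          (hvs.continuous.mul (contDiff_conj (contDiff_wirt (hγ j))).continuous) hvc.mul_right
      simp only [e, hd, map_sum, Finset.mul_sum]
      rw [integral_finsetSum _ fun j _ => i1 j, integral_finsetSum _ fun j _ => i2 j,
        ← Finset.sum_neg_distrib]
      refine Finset.sum_congr rfl fun j _ => ?_
      rw [show (∫ z, dz j v z * conj (γ j z)) = _ from
        integral_wirt_mul hvs (contDiff_conj (hγ j)) (.inl hvc)]
      congr 2; ext z
      have : wirt (-I) j (fun x => conj (γ j x)) z = _ :=
        wirt_conj ((hγ j).differentiable (by simp) z)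
      rw [this, map_neg, conj_I, neg_neg]
    rw [hr] at h2
    have iv : Integrable fun z => v z * conj (d z) :=
      Continuous.integrable_of_hasCompactSupport (hvs.continuous.mul
        (continuous_conj.comp hdc)) hvc.mul_right
    have ib : Integrable fun z => ∑ j, b j z * dz j κ z := integrable_finsetSum _ fun j _ =>
      hint (hbL j) (hWκ hκ) (hasCompactSupport_wirt hκc)
    have ih := hint hhL hκ.continuous hκc
    have hl : ∀ z, conj (∑ j, G (fun x => conj (v x)) j z * conj (B j z)) =
        (∑ j, b j z * dz j κ z) + h z * κ z - v z * conj (d z) := by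
      intro z
      have hvd : v z * conj (d z) = (E z : ℂ) ^ 2 * conj (d z) * κ z := by
        by_cases hz : χ z = 1
        · rw [hv, hE2]; dsimp only
          rw [hz, ofReal_one]; ring
        · simp [hdz z hz]
      rw [hvd]
      have hterm : ∀ j, conj (G (fun x => conj (v x)) j z) = dz j v z * E' z := by
        intro j
        have e : dzb j (fun x => conj (v x)) z = _ := wirt_conj (hvs.differentiable (by simp) z)
        by_cases hz : z ∈ U
        · simp only [hG, indicator_of_mem hz, e, map_mul, conj_conj, conj_I, conj_ofReal]
        · have : dz j v z = 0 := wirt_eq_zero_of_notMem fun h => hz (hχU (hvχ h))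
          simp [hG, hz, this]
      simp only [map_sum, map_mul, conj_conj, hterm, hhdef, hdv, hbdef, add_mul, Finset.sum_mul]
      rw [show ∀ a b c e : ℂ, a + (b + (c + e)) - c = a + b + e from fun a b c e => by ring,
        ← Finset.sum_add_distrib, ← Finset.sum_add_distrib]
      refine Finset.sum_congr rfl fun j _ => ?_
      linear_combination (E z : ℂ) * B j z * (dz j (fun x => (φ2 x : ℂ)) z * (χ z * κ z) +
        dz j (fun x => (χ x : ℂ)) z * κ z + χ z * dz j κ z) * hEE z
    simp only [hl] at h2
    have i3 : Integrable fun z => (∑ j, b j z * dz j κ z) + h z * κ z := ib.add ih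
    rw [integral_sub i3 iv, integral_add ib ih] at h2
    linear_combination h2
  have hbK : ∀ j, ∀ z ∉ tsupport χ, b j z = 0 := fun j z hz => by simp [hbdef, hχt z hz]
  have fin := bochner_weak hφ (by fun_prop) (fun z => (Real.exp_pos (η z)).le)
    (fun j => (contDiff_wirt hηC).continuous) hχc hU hχU hlev hbL hbK hθL
    (fun j k z hz => by simp [hθdef, zdχ _ _ z hz]) hhL
    (fun z hz => by simp [hhdef, zdχ _ _ z hz, hbK _ z hz, hdχ z hz]) W1 W2
  have eE : ∀ z, E z ^ 2 * Real.exp (-φ z) = Real.exp (-η z) := fun z => by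
    rw [hE, hφ2]; dsimp only
    rw [← Real.exp_nat_mul, ← Real.exp_add]; congr 1; push_cast; ring
  set S : ℂ^m → ℝ := fun z => ∑ j, ‖B j z‖ ^ 2 with hS
  set Gχ : ℂ^m → ℝ := fun z => ∑ j, ‖dz j (fun x => (χ x : ℂ)) z‖ ^ 2 with hGχ
  have hSi : Integrable S := integrable_finsetSum _ fun j _ => integrable_normSq (hB j)
  have hGc : Continuous fun z => Gχ z * Real.exp (-η z) := by
    have := cdχ (-I)
    fun_prop
  have hGz : HasCompactSupport fun z => Gχ z * Real.exp (-η z) :=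
    .intro' hχc (isClosed_tsupport χ) fun z hz => by
      rw [hGχ]; dsimp only
      rw [Finset.sum_eq_zero fun j _ => by rw [show dz j (fun x => (χ x : ℂ)) z = 0 from zdχ _ j z hz]; simp, zero_mul]
  have hGi := integrable_mul_of_compact hGc hGz hSi
  -- left-hand side
  have l1 : ∑ j, (∫ z, Real.exp (η z) * ‖b j z‖ ^ 2 * Real.exp (-φ z)) =
      ∫ z, χ z ^ 2 * S z := by
    have e : ∀ j, (fun z => Real.exp (η z) * ‖b j z‖ ^ 2 * Real.exp (-φ z)) =
        fun z => χ z ^ 2 * ‖B j z‖ ^ 2 := fun j => by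
      ext z
      rw [hbdef]; dsimp only
      rw [mul_assoc (χ z : ℂ), norm_ofReal_mul_sq, norm_ofReal_mul_sq]
      have : Real.exp (η z) * Real.exp (-η z) = 1 := by rw [← Real.exp_add]; simp
      linear_combination Real.exp (η z) * χ z ^ 2 * ‖B j z‖ ^ 2 * eE z + χ z ^ 2 * ‖B j z‖ ^ 2 * this
    have hi : ∀ j, Integrable fun z => χ z ^ 2 * ‖B j z‖ ^ 2 := fun j =>
      integrable_mul_of_compact (by have := hχ.continuous; fun_prop)
        (hχc.comp_left (g := fun x : ℝ => x ^ 2) (by simp)) (integrable_normSq (hB j))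
    simp only [e, hS, Finset.mul_sum]
    rw [integral_finsetSum _ fun j _ => hi j]
  -- the curl terms
  have l2 : ∑ j, ∑ k, ∫ z, ‖θ j k z‖ ^ 2 * Real.exp (-φ z) ≤
      4 * ∫ z, (Gχ z * Real.exp (-η z)) * S z := by
    have hi : ∀ j k, Integrable fun z => ‖θ j k z‖ ^ 2 * Real.exp (-φ z) := by
      intro j k
      have c1 : ∀ j k, MemLp (fun z => (((Real.exp (-φ z / 2) : ℝ) : ℂ) *
          ((E z : ℂ) * dzb j (fun x => (χ x : ℂ)) z)) * B k z) 2 := fun j k =>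
        memLp_mul (by have := cdχ I j; fun_prop) (sdχ I j).mul_left.mul_left (hB k)
      refine (integrable_normSq ((c1 j k).sub (c1 k j))).congr (.of_forall fun z => ?_)
      dsimp only
      rw [norm_sq_mul_exp]
      simp only [Pi.sub_apply, hθdef]
      congr 2
      ring
    rw [← integral_const_mul, Finset.sum_congr rfl fun j _ =>
      (integral_finsetSum Finset.univ fun k _ => hi j k).symm, ← integral_finsetSum _ fun j _ =>
      integrable_finsetSum _ fun k _ => hi j k]
    refine integral_mono (integrable_finsetSum _ fun j _ => integrable_finsetSum _ fun k _ => hi j k)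
      (hGi.const_mul 4) fun z => ?_
    have := norm_curl_sq_le (fun j => dzb j (fun x => (χ x : ℂ)) z) (fun j => B j z) (E z)
    have e1 : ∑ j, ‖dzb j (fun x => (χ x : ℂ)) z‖ ^ 2 = Gχ z := by
      refine Finset.sum_congr rfl fun j _ => ?_
      rw [dzb_ofReal (hχ.differentiable (by simp) z), RCLike.norm_conj]
    rw [e1] at this
    simp only [← Finset.sum_mul]
    calc _ ≤ 4 * (E z ^ 2 * (Gχ z * S z)) * Real.exp (-φ z) := by gcongr
      _ = _ := by linear_combination 4 * Gχ z * S z * eE z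
  -- the divergence term
  have l3 : ∫ z, ‖h z - ∑ j, dz j (fun x => (φ x : ℂ)) z * b j z‖ ^ 2 * Real.exp (-φ z) ≤
      2 * (∫ z, ‖∑ j, dz j (fun x => (η x : ℂ)) z * b j z‖ ^ 2 * Real.exp (-φ z)) +
      (4 * (∫ z, ‖d z‖ ^ 2 * Real.exp (φ z - 2 * η z)) +
        4 * ∫ z, (Gχ z * Real.exp (-η z)) * S z) := by
    have i1 : Integrable fun z => ‖∑ j, dz j (fun x => (η x : ℂ)) z * b j z‖ ^ 2 *
        Real.exp (-φ z) := by
      have c1 : ∀ j, MemLp (fun z => ((Real.exp (-φ z / 2) : ℝ) * dz j (fun x => (η x : ℂ)) z *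
          ((χ z : ℂ) * E z)) * B j z) 2 := fun j =>
        memLp_mul (by have := (contDiff_wirt hηC (c := -I) (j := j)).continuous; fun_prop)
          (HasCompactSupport.mul_left hχCc.mul_right) (hB j)
      refine (integrable_normSq (memLp_finsetSum Finset.univ fun j _ => c1 j)).congr
        (.of_forall fun z => ?_)
      dsimp only
      rw [norm_sq_mul_exp]
      simp only [hbdef, Finset.mul_sum]
      congr 2
      exact Finset.sum_congr rfl fun j _ => by ring
    have i2 : Integrable fun z => ‖d z‖ ^ 2 * Real.exp (φ z - 2 * η z) :=
      Continuous.integrable_of_hasCompactSupport (by fun_prop)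
        (hasCompactSupport_normSq hdcs).mul_right
    have i3 : Integrable fun z => 4 * (‖d z‖ ^ 2 * Real.exp (φ z - 2 * η z)) +
        4 * ((Gχ z * Real.exp (-η z)) * S z) := (i2.const_mul 4).add (hGi.const_mul 4)
    rw [← integral_const_mul, ← integral_const_mul, ← integral_const_mul,
      ← integral_add (i2.const_mul 4) (hGi.const_mul 4), ← integral_add (i1.const_mul 2) i3]
    refine integral_mono_of_nonneg (.of_forall fun z => by positivity)
      ((i1.const_mul 2).add i3) (.of_forall fun z => ?_)
    have e0 : h z - ∑ j, dz j (fun x => (φ x : ℂ)) z * b j z =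
        -(∑ j, dz j (fun x => (η x : ℂ)) z * b j z) + ((E z : ℂ) ^ 2 * conj (d z) +
          (E z : ℂ) * ∑ j, dz j (fun x => (χ x : ℂ)) z * B j z) := by
      have e1 : ∀ j, dz j (fun x => (φ2 x : ℂ)) z = dz j (fun x => (φ x : ℂ)) z -
          dz j (fun x => (η x : ℂ)) z := fun j => by
        have : dz j (fun x => (φ x : ℂ) - (η x : ℂ)) z = _ :=
          wirt_sub (hφC.differentiable (by simp) z) (hηC.differentiable (by simp) z)
        rw [← this]; simp only [hφ2, ofReal_sub]
      rw [hhdef]; dsimp only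
      simp only [e1, sub_mul, Finset.sum_sub_distrib, Finset.mul_sum, mul_assoc]
      ring
    have e2 := norm_sum_mul_sq_le Finset.univ (fun j => dz j (fun x => (χ x : ℂ)) z)
      fun j => B j z
    have e3 : ‖(E z : ℂ) ^ 2 * conj (d z)‖ ^ 2 * Real.exp (-φ z) =
        ‖d z‖ ^ 2 * Real.exp (φ z - 2 * η z) := by
      rw [norm_mul, RCLike.norm_conj, norm_pow, norm_real, Real.norm_eq_abs, sq_abs]
      have : E z ^ 2 * Real.exp (-η z) = Real.exp (φ z - 2 * η z) := by
        rw [hE, hφ2]; dsimp only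
        rw [← Real.exp_nat_mul, ← Real.exp_add]; congr 1; push_cast; ring
      linear_combination E z ^ 2 * ‖d z‖ ^ 2 * eE z + ‖d z‖ ^ 2 * this
    have e4 : ‖(E z : ℂ) * ∑ j, dz j (fun x => (χ x : ℂ)) z * B j z‖ ^ 2 * Real.exp (-φ z) ≤
        (Gχ z * Real.exp (-η z)) * S z := by
      rw [norm_ofReal_mul_sq]
      calc _ ≤ E z ^ 2 * (Gχ z * S z) * Real.exp (-φ z) := by gcongr
        _ = _ := by linear_combination Gχ z * S z * eE z
    have e5 := norm_add_sq_le_two (-(∑ j, dz j (fun x => (η x : ℂ)) z * b j z))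
      ((E z : ℂ) ^ 2 * conj (d z) + (E z : ℂ) * ∑ j, dz j (fun x => (χ x : ℂ)) z * B j z)
    have e6 := norm_add_sq_le_two ((E z : ℂ) ^ 2 * conj (d z))
      ((E z : ℂ) * ∑ j, dz j (fun x => (χ x : ℂ)) z * B j z)
    rw [norm_neg] at e5
    have e7 := mul_le_mul_of_nonneg_right (e5.trans (add_le_add_right
      (mul_le_mul_of_nonneg_left e6 zero_le_two) _)) (Real.exp_pos (-φ z)).le
    dsimp only
    rw [e0]
    linarith
  rw [l1] at fin
  linarith

end DualEstimate

section LocalDual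
variable {m : ℕ}

theorem wirt_ofReal_comp {f : ℂ^m → ℝ} {z : ℂ^m} {G : ℝ → ℝ} {G' : ℝ}
    (hG : HasDerivAt G G' (f z)) (hf : DifferentiableAt ℝ f z) (c : ℂ) (j : Fin m) :
    wirt c j (fun x => ((G (f x) : ℝ) : ℂ)) z = G' * wirt c j (fun x => (f x : ℂ)) z := by
  have h1 : fderiv ℝ (fun x => (f x : ℂ)) z = ofRealCLM.comp (fderiv ℝ f z) :=
    (ofRealCLM.hasFDerivAt.comp z hf.hasFDerivAt).fderiv
  have h2 : fderiv ℝ (fun x => ((G (f x) : ℝ) : ℂ)) z = ofRealCLM.comp (G' • fderiv ℝ f z) :=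
    (ofRealCLM.hasFDerivAt.comp z (hG.comp_hasFDerivAt z hf.hasFDerivAt)).fderiv
  simp only [wirt, h1, h2]
  simp
  ring

theorem levi_weight {φ0 s : ℂ^m → ℝ} (hφ0 : ContDiff ℝ ∞ φ0) (hs : ContDiff ℝ ∞ s)
    {z : ℂ^m} (h0 : ∀ w, ∑ j, ‖w j‖ ^ 2 ≤ levi φ0 z w)
    (h1 : ∀ w, ∑ j, ‖w j‖ ^ 2 ≤ levi s z w) {Λ : ℝ} (hΛ : 1 ≤ Λ) (a : ℝ) (w : ℂ^m) :
    Real.exp (Real.log (1 + Real.exp (-(Λ * a)) * Real.exp (Λ * s z))) * ∑ j, ‖w j‖ ^ 2 +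
      2 * ‖∑ j, dz j (fun x => ((Real.log (1 + Real.exp (-(Λ * a)) * Real.exp (Λ * s x)) : ℝ) : ℂ)) z *
        w j‖ ^ 2 ≤
      levi (fun x => φ0 x + (2 * Real.exp (-(Λ * a))) * Real.exp (Λ * s x)) z w := by
  set e := Real.exp (-(Λ * a)) with he
  have e0 : 0 < e := Real.exp_pos _
  have hΛs : ContDiff ℝ ∞ fun x => Λ * s x := contDiff_const.mul hs
  have hsd := hs.differentiable (by simp) z
  rw [levi_add hφ0.contDiffAt (contDiff_const.mul hΛs.exp).contDiffAt, levi_const_mul hΛs.exp,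
    levi_exp hΛs, levi_const_mul hs]
  set t := e * Real.exp (Λ * s z) with ht
  have t0 : 0 < t := by positivity
  set A := ∑ j, dz j (fun x => (s x : ℂ)) z * w j with hA
  have d1 : ∀ j, dz j (fun x => ((Λ * s x : ℝ) : ℂ)) z = Λ * dz j (fun x => (s x : ℂ)) z := fun j =>
    wirt_ofReal_comp (G := fun x => Λ * x) (by simpa using (hasDerivAt_id (s z)).const_mul Λ) hsd _ _
  have d2 : ∀ j, dz j (fun x => ((Real.log (1 + e * Real.exp (Λ * s x)) : ℝ) : ℂ)) z =
      ((t * Λ / (1 + t) : ℝ) : ℂ) * dz j (fun x => (s x : ℂ)) z := fun j => by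
    refine wirt_ofReal_comp (G := fun x => Real.log (1 + e * Real.exp (Λ * x))) ?_ hsd _ _
    have := ((((hasDerivAt_id' (s z)).const_mul Λ).exp.const_mul e).const_add 1).log
      (by positivity)
    convert this using 1
    rw [ht]; ring
  have s1 : ∑ j, w j * dz j (fun x => ((Λ * s x : ℝ) : ℂ)) z = Λ * A := by
    simp only [d1, hA, Finset.mul_sum]
    exact Finset.sum_congr rfl fun j _ => by ring
  have s2 : ∑ j, dz j (fun x => ((Real.log (1 + e * Real.exp (Λ * s x)) : ℝ) : ℂ)) z * w j =
      ((t * Λ / (1 + t) : ℝ) : ℂ) * A := by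
    simp only [d2, hA, Finset.mul_sum]
    exact Finset.sum_congr rfl fun j _ => by ring
  rw [s1, s2, norm_ofReal_mul_sq, norm_ofReal_mul_sq, Real.exp_log (by positivity)]
  have k1 : (t * Λ / (1 + t)) ^ 2 ≤ t * Λ ^ 2 := by
    rw [div_pow, div_le_iff₀ (by positivity)]
    have : 0 ≤ Λ ^ 2 * t := by positivity
    nlinarith [mul_nonneg this t0.le, mul_nonneg (mul_nonneg this t0.le) t0.le]
  have k2 := mul_le_mul_of_nonneg_right k1 (sq_nonneg ‖A‖)
  have k3 := h0 w
  have k4 := mul_le_mul_of_nonneg_left (h1 w) (show 0 ≤ 2 * t * Λ by positivity)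
  have k5 : 0 ≤ (2 * Λ - 1) * t * ∑ j, ‖w j‖ ^ 2 := by
    have : 0 ≤ 2 * Λ - 1 := by linarith
    positivity
  rw [show 2 * e * (Real.exp (Λ * s z) * (Λ * levi s z w + Λ ^ 2 * ‖A‖ ^ 2)) =
    2 * t * Λ * levi s z w + 2 * (t * Λ ^ 2 * ‖A‖ ^ 2) by rw [ht]; ring]
  linarith

theorem hasCompactSupport_sum {ι X F : Type*} [TopologicalSpace X] [AddCommMonoid F] (s : Finset ι)
    {f : ι → X → F} (h : ∀ i, HasCompactSupport (f i)) :
    HasCompactSupport fun x => ∑ i ∈ s, f i x := by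
  convert Finset.sum_induction f HasCompactSupport (fun _ _ => HasCompactSupport.add)
    HasCompactSupport.zero fun i (_ : i ∈ s) => h i using 1
  ext x; simp

/-- The dual estimate with the parameter `Λ` of the auxiliary weight. -/
theorem local_dual_aux {φ0 s : ℂ^m → ℝ} (hφ0 : ContDiff ℝ ∞ φ0) (hs : ContDiff ℝ ∞ s)
    {U : Set ℂ^m} (hU : IsOpen U) (hUb : Bornology.IsBounded U)
    (h0 : ∀ z ∈ U, ∀ w, ∑ j, ‖w j‖ ^ 2 ≤ levi φ0 z w)
    (h1 : ∀ z ∈ U, ∀ w, ∑ j, ‖w j‖ ^ 2 ≤ levi s z w) {a b δ C : ℝ}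
    {χ : ℂ^m → ℝ} (hχ : ContDiff ℝ ∞ χ) (hχc : HasCompactSupport χ) (hχU : tsupport χ ⊆ U)
    {V : Set ℂ^m} (hV : IsOpen V) (hVb : ∀ z ∈ U, s z ≤ b → z ∈ V)
    (hχV : ∀ z ∈ V, χ z = 1) (hχI : ∀ z, χ z ∈ Icc (0 : ℝ) 1)
    (hC : ∀ z, ∑ j, ‖dz j (fun x => (χ x : ℂ)) z‖ ^ 2 ≤ C)
    {γ : Fin m → ℂ^m → ℂ} (hγ : ∀ j, ContDiff ℝ ∞ (γ j))
    (hγc : ∀ j, HasCompactSupport (γ j)) (hγV : ∀ j, tsupport (γ j) ⊆ V)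
    (hγs : ∀ j, ∀ z ∈ tsupport (γ j), s z ≤ a - δ)
    {g : ℂ^m → ℂ} (hg : ContDiff ℝ ∞ g) {Λ : ℝ} (hΛ : 1 ≤ Λ) :
    ‖∫ z, ∑ j, dzb j g z * γ j z‖ ≤
      √(∫ z in U, ∑ j, ‖dzb j g z‖ ^ 2 * Real.exp (-φ0 z)) *
        √(Real.exp (2 * Real.exp (-(Λ * δ))) *
          (4 * (∫ z, ‖∑ j, dzb j (γ j) z‖ ^ 2 * Real.exp (φ0 z)) + 6 * (C *
          Real.exp (-(Λ * (b - a))) * ∫ z, ∑ j, ‖γ j z‖ ^ 2 * Real.exp (φ0 z)))) +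
      √(Real.exp (-(Λ * (b - a))) *
          ∫ z in U, ∑ j, ‖dzb j g z‖ ^ 2 * Real.exp (-φ0 z)) *
        √(Real.exp (2 * Real.exp (-(Λ * δ))) *
          ∫ z, ∑ j, ‖γ j z‖ ^ 2 * Real.exp (φ0 z)) := by
  have hφ0c := hφ0.continuous
  have hsc := hs.continuous
  set t : ℂ^m → ℝ := fun z => Real.exp (-(Λ * a)) * Real.exp (Λ * s z) with ht
  have ht' : ∀ z, t z = Real.exp (Λ * (s z - a)) := fun z => by
    rw [ht]; dsimp only; rw [← Real.exp_add]; ring_nf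
  have t0 : ∀ z, 0 < t z := fun z => by rw [ht']; exact Real.exp_pos _
  have htC : ContDiff ℝ ∞ t := contDiff_const.mul (contDiff_const.mul hs).exp
  set η : ℂ^m → ℝ := fun z => Real.log (1 + t z) with hη
  have hηC : ContDiff ℝ ∞ η := (contDiff_const.add htC).log fun z => by have := t0 z; positivity
  have η0 : ∀ z, 0 ≤ η z := fun z => Real.log_nonneg (by linarith [t0 z])
  have ηt : ∀ z, η z ≤ t z := fun z => by
    have := Real.log_le_sub_one_of_pos (show 0 < 1 + t z by linarith [t0 z])
    rw [hη]; dsimp only; linarith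
  set φ : ℂ^m → ℝ := fun z => φ0 z + (2 * Real.exp (-(Λ * a))) * Real.exp (Λ * s z) with hφ
  have hφt : ∀ z, φ z = φ0 z + 2 * t z := fun z => by rw [hφ, ht]; dsimp only; ring
  have hφC : ContDiff ℝ ∞ φ := hφ0.add (contDiff_const.mul (contDiff_const.mul hs).exp)
  set τ := Real.exp (-(Λ * δ)) with hτ
  set o := Real.exp (-(Λ * (b - a))) with ho
  have o0 : 0 < o := Real.exp_pos _
  have tτ : ∀ z, s z ≤ a - δ → t z ≤ τ := fun z hz => by
    rw [ht', hτ]; exact Real.exp_le_exp.2 (by nlinarith)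
  have eη : ∀ z, Real.exp (-η z) = (1 + t z)⁻¹ := fun z => by
    rw [Real.exp_neg, hη, Real.exp_log (by linarith [t0 z])]
  have ηo : ∀ z, b ≤ s z → Real.exp (-η z) ≤ o := fun z hz => by
    rw [eη]
    have h2 : o⁻¹ ≤ t z := by
      rw [ht', ho, ← Real.exp_neg]; exact Real.exp_le_exp.2 (by nlinarith)
    rw [inv_le_comm₀ (by linarith [t0 z]) o0]; linarith
  have C0 : 0 ≤ C := le_trans (Finset.sum_nonneg fun j _ => by positivity) (hC 0)
  obtain ⟨B, hB, hBn, hBg, hBe⟩ := exists_dual_vector hφC hηC hU hUb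
    (fun z hz w => levi_weight hφ0 hs (h0 z hz) (h1 z hz) hΛ a w) hχ hχc hχU hγ hγc
    (fun j z hz => hχV z (hγV j hz)) hg
  set A := ∫ z in U, ∑ j, ‖dzb j g z‖ ^ 2 * Real.exp (-φ0 z) with hA
  set N := ∫ z, ∑ j, ‖γ j z‖ ^ 2 * Real.exp (φ0 z) with hN
  set D := ∫ z, ‖∑ j, dzb j (γ j) z‖ ^ 2 * Real.exp (φ0 z) with hD
  have hdg : ∀ j, Continuous (dzb j g) := fun j => (contDiff_wirt hg).continuous
  have hdγ : ∀ j, Continuous (dzb j (γ j)) := fun j => (contDiff_wirt (hγ j)).continuous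
  have hγ' : ∀ j, Continuous (γ j) := fun j => (hγ j).continuous
  have hηc := hηC.continuous
  have hφc := hφC.continuous
  have hχ' := hχ.continuous
  have htc := htC.continuous
  -- sizes of the data
  have b1 : ∫ z, ∑ j, ‖B j z‖ ^ 2 ≤ Real.exp (2 * τ) * N := by
    refine hBn.trans ?_
    rw [hN, ← integral_const_mul]
    have hcs : ∀ f : ℂ^m → ℝ, HasCompactSupport fun z => ∑ j, ‖γ j z‖ ^ 2 * f z := fun f =>
      hasCompactSupport_sum _ fun j => (hasCompactSupport_normSq (hγc j)).mul_right
    refine integral_mono (Continuous.integrable_of_hasCompactSupport (by fun_prop) (hcs _))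
      ((Continuous.integrable_of_hasCompactSupport (by fun_prop) (hcs _)).const_mul _) fun z => ?_
    dsimp only
    rw [Finset.mul_sum]
    refine Finset.sum_le_sum fun j _ => ?_
    by_cases hz : z ∈ tsupport (γ j)
    · have : Real.exp (φ z - η z) ≤ Real.exp (2 * τ) * Real.exp (φ0 z) := by
        rw [← Real.exp_add]
        refine Real.exp_le_exp.2 ?_
        rw [hφt]; linarith [tτ z (hγs j z hz), η0 z]
      nlinarith [sq_nonneg ‖γ j z‖]
    · simp [image_eq_zero_of_notMem_tsupport hz]
  have hBi : Integrable fun z => ∑ j, ‖B j z‖ ^ 2 :=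
    integrable_finsetSum _ fun j _ => integrable_normSq (hB j)
  have b2 : ∫ z, ‖∑ j, dzb j (γ j) z‖ ^ 2 * Real.exp (φ z - 2 * η z) ≤ Real.exp (2 * τ) * D := by
    rw [hD, ← integral_const_mul]
    have hcs' : ∀ f : ℂ^m → ℝ, HasCompactSupport fun z =>
        ‖∑ j, dzb j (γ j) z‖ ^ 2 * f z := fun f =>
      (hasCompactSupport_normSq
        (hasCompactSupport_sum _ fun j => hasCompactSupport_wirt (hγc j))).mul_right
    refine integral_mono (Continuous.integrable_of_hasCompactSupport (by fun_prop) (hcs' _))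
      ((Continuous.integrable_of_hasCompactSupport (by fun_prop) (hcs' _)).const_mul _) fun z => ?_
    dsimp only
    by_cases hz : ∃ j, z ∈ tsupport (γ j)
    · obtain ⟨j, hz⟩ := hz
      have : Real.exp (φ z - 2 * η z) ≤ Real.exp (2 * τ) * Real.exp (φ0 z) := by
        rw [← Real.exp_add]
        refine Real.exp_le_exp.2 ?_
        rw [hφt]; linarith [tτ z (hγs j z hz), η0 z]
      nlinarith [sq_nonneg ‖∑ j, dzb j (γ j) z‖]
    · rw [Finset.sum_eq_zero fun j _ => wirt_eq_zero_of_notMem fun h => hz ⟨j, h⟩]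
      simp
  have b3 : ∫ z, ((∑ j, ‖dz j (fun x => (χ x : ℂ)) z‖ ^ 2) * Real.exp (-η z)) * ∑ j, ‖B j z‖ ^ 2 ≤
      C * o * (Real.exp (2 * τ) * N) := by
    refine le_trans ?_ (mul_le_mul_of_nonneg_left b1 (by positivity))
    rw [← integral_const_mul]
    refine integral_mono_of_nonneg (.of_forall fun z => by positivity) (hBi.const_mul _)
      (.of_forall fun z => ?_)
    dsimp only
    refine mul_le_mul_of_nonneg_right ?_ (by positivity)
    by_cases hz : z ∈ U
    · by_cases hzb : s z ≤ b
      · have : ∀ j, dz j (fun x => (χ x : ℂ)) z = 0 := fun j => by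
          have e : (fun x => (χ x : ℂ)) =ᶠ[𝓝 z] fun _ => 1 := by
            filter_upwards [hV.mem_nhds (hVb z hz hzb)] with x hx
            rw [hχV x hx, ofReal_one]
          have e1 : dz j (fun x => (χ x : ℂ)) z = _ := wirt_congr e
          rw [e1, wirt_const]
        simp only [this]
        simp
        positivity
      · exact mul_le_mul (hC z) (ηo z (not_le.1 hzb).le) (Real.exp_pos _).le C0
    · have : ∀ j, dz j (fun x => (χ x : ℂ)) z = 0 := fun j =>
        wirt_eq_zero_of_notMem fun h => hz (hχU (closure_mono (fun y hy e => hy (by simp [e]) : Function.support (fun x => (χ x : ℂ)) ⊆ Function.support χ) h))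
      simp only [this]
      simp
      positivity
  have b4 : ∫ z, χ z ^ 2 * ∑ j, ‖B j z‖ ^ 2 ≤
      Real.exp (2 * τ) * (4 * D + 6 * (C * o * N)) := by linarith
  -- the vector representing the gradient
  set X : Fin m → ℂ^m → ℂ := fun j =>
    U.indicator fun z => dzb j g z * Real.exp (-(φ z - η z) / 2) with hX
  have hXL : ∀ j, MemLp (X j) 2 := fun j =>
    memLp_indicator_of_bounded hU hUb (by have := hdg j; fun_prop)
  have hgi : IntegrableOn (fun z => ∑ j, ‖dzb j g z‖ ^ 2 * Real.exp (-φ0 z)) U := by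
    have : Continuous fun z => ∑ j, ‖dzb j g z‖ ^ 2 * Real.exp (-φ0 z) := by fun_prop
    exact (this.continuousOn.integrableOn_compact hUb.isCompact_closure).mono_set subset_closure
  have hgi' := (integrable_indicator_iff hU.measurableSet).2 hgi
  have hA' : A = ∫ z, U.indicator (fun z => ∑ j, ‖dzb j g z‖ ^ 2 * Real.exp (-φ0 z)) z :=
    (integral_indicator hU.measurableSet).symm
  have X1 : ∀ z, ∑ j, ‖X j z‖ ^ 2 ≤ Real.exp (-t z) *
      U.indicator (fun z => ∑ j, ‖dzb j g z‖ ^ 2 * Real.exp (-φ0 z)) z := by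
    intro z
    by_cases hz : z ∈ U
    · simp only [hX, indicator_of_mem hz, Finset.mul_sum]
      refine Finset.sum_le_sum fun j _ => ?_
      rw [mul_comm (dzb j g z), ← norm_sq_mul_exp, mul_left_comm]
      refine mul_le_mul_of_nonneg_left ?_ (by positivity)
      rw [← Real.exp_add]
      refine Real.exp_le_exp.2 ?_
      rw [hφt]; linarith [ηt z]
    · simp [hX, indicator_of_notMem hz]
  have I0 : ∀ z, 0 ≤ U.indicator (fun z => ∑ j, ‖dzb j g z‖ ^ 2 * Real.exp (-φ0 z)) z := fun z =>
    indicator_nonneg (fun z _ => by positivity) z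
  have X2 : ∫ z, ∑ j, ‖X j z‖ ^ 2 ≤ A := by
    rw [hA']
    refine integral_mono_of_nonneg (.of_forall fun z => by positivity) hgi' (.of_forall fun z =>
      (X1 z).trans (mul_le_of_le_one_left (I0 z) ?_))
    exact Real.exp_le_one_iff.2 (by linarith [t0 z])
  have nχ : ∀ z (x : ℂ), ‖((1 - χ z : ℝ) : ℂ) * x‖ ≤ ‖x‖ := fun z x => by
    rw [norm_mul, norm_real, Real.norm_eq_abs, abs_of_nonneg (sub_nonneg.2 (hχI z).2)]
    exact mul_le_of_le_one_left (norm_nonneg _) (sub_le_self _ (hχI z).1)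
  have hYL : ∀ j, MemLp (fun z => ((1 - χ z : ℝ) : ℂ) * X j z) 2 := fun j => by
    refine (hXL j).mono ((Continuous.aestronglyMeasurable (by fun_prop)).mul (hXL j).1)
      (.of_forall fun z => nχ z _)
  have X3 : ∫ z, ∑ j, ‖((1 - χ z : ℝ) : ℂ) * X j z‖ ^ 2 ≤ o * A := by
    rw [hA', ← integral_const_mul]
    refine integral_mono_of_nonneg (.of_forall fun z => by positivity) (hgi'.const_mul _)
      (.of_forall fun z => ?_)
    dsimp only
    by_cases hz : z ∈ U
    · by_cases hzb : s z ≤ b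
      · rw [hχV z (hVb z hz hzb)]
        simp only [sub_self, ofReal_zero, zero_mul, norm_zero]
        have := I0 z
        simp
        positivity
      · have e1 : ∀ j, ‖((1 - χ z : ℝ) : ℂ) * X j z‖ ^ 2 ≤ ‖X j z‖ ^ 2 := fun j =>
          pow_le_pow_left₀ (norm_nonneg _) (nχ z _) 2
        refine (Finset.sum_le_sum fun j _ => e1 j).trans ((X1 z).trans
          (mul_le_mul_of_nonneg_right ?_ (I0 z)))
        refine le_trans ?_ (ηo z (not_le.1 hzb).le)
        exact Real.exp_le_exp.2 (by linarith [ηt z])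
    · have : ∀ j, X j z = 0 := fun j => indicator_of_notMem hz _
      simp only [this, mul_zero, norm_zero]
      have := I0 z
      simp
      positivity
  have hχB : ∀ j, MemLp (fun z => (χ z : ℂ) * B j z) 2 := fun j =>
    memLp_mul (by fun_prop) (hasCompactSupport_ofReal hχc) (hB j)
  have hi : ∀ {X Y : Fin m → ℂ^m → ℂ}, (∀ j, MemLp (X j) 2) → (∀ j, MemLp (Y j) 2) →
      Integrable fun z => ∑ j, X j z * conj (Y j z) := fun hX hY =>
    integrable_finsetSum _ fun j _ =>
      MemLp.integrable_mul (p := 2) (q := 2) (hX j) (hY j).star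
  have split : ∫ z, ∑ j, dzb j g z * γ j z = (∫ z, ∑ j, X j z * conj ((χ z : ℂ) * B j z)) +
      ∫ z, ∑ j, ((1 - χ z : ℝ) : ℂ) * X j z * conj (B j z) := by
    rw [← hBg, ← integral_add (hi hXL hχB) (hi hYL hB)]
    congr 1; ext z
    rw [← Finset.sum_add_distrib]
    refine Finset.sum_congr rfl fun j _ => ?_
    change X j z * conj (B j z) = _
    rw [map_mul, conj_ofReal]; push_cast; ring
  have e2 : ∫ z, ∑ j, ‖(χ z : ℂ) * B j z‖ ^ 2 = ∫ z, χ z ^ 2 * ∑ j, ‖B j z‖ ^ 2 := by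
    congr 1; ext z
    rw [Finset.mul_sum]
    refine Finset.sum_congr rfl fun j _ => ?_
    rw [norm_ofReal_mul_sq]
  rw [split]
  refine (norm_add_le _ _).trans (add_le_add ?_ ?_)
  · refine (norm_integral_sum_mul_conj_le hXL hχB).trans ?_
    rw [e2]
    gcongr
  · refine (norm_integral_sum_mul_conj_le hYL hB).trans ?_
    gcongr

/-- The dual form of the weighted `L²` estimate for `∂̄`, for a gradient `∂̄g`. -/
theorem local_dual {φ0 s : ℂ^m → ℝ} (hφ0 : ContDiff ℝ ∞ φ0) (hs : ContDiff ℝ ∞ s)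
    {U : Set ℂ^m} (hU : IsOpen U) (hUb : Bornology.IsBounded U)
    (h0 : ∀ z ∈ U, ∀ w, ∑ j, ‖w j‖ ^ 2 ≤ levi φ0 z w)
    (h1 : ∀ z ∈ U, ∀ w, ∑ j, ‖w j‖ ^ 2 ≤ levi s z w) {a b : ℝ} (hab : a < b)
    (hK : IsCompact {z | z ∈ U ∧ s z ≤ b})
    {γ : Fin m → ℂ^m → ℂ} (hγ : ∀ j, ContDiff ℝ ∞ (γ j))
    (hγc : ∀ j, HasCompactSupport (γ j)) (hγU : ∀ j, tsupport (γ j) ⊆ U)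
    (hγs : ∀ j, ∀ z ∈ tsupport (γ j), s z < a)
    {g : ℂ^m → ℂ} (hg : ContDiff ℝ ∞ g) :
    ‖∫ z, ∑ j, dzb j g z * γ j z‖ ^ 2 ≤
      4 * (∫ z in U, ∑ j, ‖dzb j g z‖ ^ 2 * Real.exp (-φ0 z)) *
        ∫ z, ‖∑ j, dzb j (γ j) z‖ ^ 2 * Real.exp (φ0 z) := by
  obtain ⟨χ, hχ, hχc, hχU, ⟨V, hV, hKV, hχ1⟩, hχI⟩ := exists_cutoff hK hU fun z hz => hz.1
  have hχC := contDiff_ofReal_comp hχ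
  obtain ⟨C, hC⟩ : ∃ C, ∀ z, ∑ j, ‖dz j (fun x => (χ x : ℂ)) z‖ ^ 2 ≤ C := by
    have hb : ∀ j, ∃ C, ∀ z, ‖dz j (fun x => (χ x : ℂ)) z‖ ≤ C := fun j =>
      (contDiff_wirt hχC).continuous.bounded_above_of_compact_support
        (hasCompactSupport_wirt (hasCompactSupport_ofReal hχc))
    choose C hC using hb
    exact ⟨∑ j, C j ^ 2, fun z => Finset.sum_le_sum fun j _ => by have := hC j z; gcongr⟩
  obtain ⟨δ, hδ, hγδ⟩ : ∃ δ > 0, ∀ j, ∀ z ∈ tsupport (γ j), s z ≤ a - δ := by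
    have : ∀ j, ∃ δ > 0, ∀ z ∈ tsupport (γ j), s z ≤ a - δ := by
      intro j
      rcases (tsupport (γ j)).eq_empty_or_nonempty with h | h
      · exact ⟨1, one_pos, by simp [h]⟩
      · obtain ⟨z0, hz0, hm⟩ := (hγc j).isCompact.exists_isMaxOn h hs.continuous.continuousOn
        exact ⟨a - s z0, sub_pos.2 (hγs j z0 hz0), fun z hz => by simpa using hm hz⟩
    choose δ hδ h using this
    rcases isEmpty_or_nonempty (Fin m) with hm | hm
    · exact ⟨1, one_pos, fun j => isEmptyElim j⟩
    · obtain ⟨i, -, hi⟩ := Finset.exists_min_image Finset.univ δ Finset.univ_nonempty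
      exact ⟨δ i, hδ i, fun j z hz => (h j z hz).trans (by linarith [hi j (Finset.mem_univ j)])⟩
  have hΛ : ∀ᶠ Λ : ℝ in atTop, _ := (eventually_ge_atTop 1).mono fun Λ hΛ =>
    local_dual_aux hφ0 hs hU hUb h0 h1 (a := a) (b := b) hχ hχc hχU hV (fun z hz hb => hKV ⟨hz, hb⟩)
      hχ1 hχI hC hγ hγc (fun j z hz => hKV ⟨hγU j hz, by linarith [hγs j z hz]⟩) hγδ hg hΛ
  set A := ∫ z in U, ∑ j, ‖dzb j g z‖ ^ 2 * Real.exp (-φ0 z) with hA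
  set N := ∫ z, ∑ j, ‖γ j z‖ ^ 2 * Real.exp (φ0 z)
  set D := ∫ z, ‖∑ j, dzb j (γ j) z‖ ^ 2 * Real.exp (φ0 z)
  have lim : ∀ c : ℝ, 0 < c → Tendsto (fun Λ : ℝ => Real.exp (-(Λ * c))) atTop (𝓝 0) := fun c hc =>
    Real.tendsto_exp_neg_atTop_nhds_zero.comp (tendsto_id.atTop_mul_const hc)
  have l1 := lim δ hδ
  have l2 := lim (b - a) (sub_pos.2 hab)
  have l3 : Tendsto (fun Λ : ℝ => Real.exp (2 * Real.exp (-(Λ * δ)))) atTop (𝓝 (Real.exp (2 * 0))) :=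
    (Real.continuous_exp.tendsto _).comp (l1.const_mul 2)
  have l4 := ((l3.mul (((l2.const_mul C).mul_const N).const_mul 6 |>.const_add (4 * D))).sqrt.const_mul
    √A).add (((l2.mul_const A).sqrt).mul (l3.mul_const N).sqrt)
  have h := ge_of_tendsto l4 hΛ
  simp only [mul_zero, zero_mul, Real.exp_zero, one_mul, add_zero, Real.sqrt_zero] at h
  have A0 : 0 ≤ A := integral_nonneg fun z => by positivity
  have D0 : 0 ≤ D := integral_nonneg fun z => by positivity
  calc _ ≤ (√A * √(4 * D)) ^ 2 := by gcongr
    _ = _ := by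
      rw [mul_pow, Real.sq_sqrt A0, Real.sq_sqrt (by positivity)]; ring

end LocalDual

section GlobalDual
variable {m : ℕ}

/-- A plurisubharmonic function is approximated on compact sets by smooth ones. -/
theorem Psh.exists_smooth {u : ℂ^m → ℝ} {Y K : Set ℂ^m} (hY : IsOpen Y)
    (hu : Psh u Y) (hK : IsCompact K) (hKY : K ⊆ Y) {θ : ℝ} (hθ : 0 < θ) :
    ∃ v : ℂ^m → ℝ, ContDiff ℝ ∞ v ∧ (∀ z ∈ K, ∀ w, 0 ≤ levi v z w) ∧
      ∀ z ∈ K, |v z - u z| ≤ θ := by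
  obtain ⟨g, hg, hgc, V, hV, hKV, hgV⟩ := exists_extension (n := 0) (by simp) hK hY hKY
    (contDiffOn_zero.2 hu.cont)
  rw [contDiff_zero] at hg
  obtain ⟨δ, hδ, hδV⟩ := hK.exists_cthickening_subset_open (hV.inter hY) (subset_inter hKV hKY)
  have huc := hg.uniformContinuous_of_tendsto_cocompact hgc.is_zero_at_infty
  obtain ⟨δ', hδ', hu'⟩ := uniformContinuous_iff.1 huc θ hθ
  have hε : 0 < min δ δ' := lt_min hδ hδ'
  have hgY : Psh g (V ∩ Y) := (hu.mono inter_subset_right).congr (hV.inter hY)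
    fun z hz => (hgV hz.1).symm
  refine ⟨sm (min δ δ') g, contDiff_sm hε hg.locallyIntegrable, fun z hz w =>
    levi_sm_nonneg hg hgY (hV.inter hY) hε (subset_trans ?_ hδV) w, fun z hz => ?_⟩
  · exact (closedBall_subset_closedBall (min_le_left _ _)).trans
      (closedBall_subset_cthickening hz δ)
  · rw [← hgV (hKV hz)]
    refine norm_sm_sub_le (a := g z) hε hg.locallyIntegrable fun y hy => ?_
    rw [← dist_eq_norm]
    exact (hu' (by rw [dist_eq_norm]; exact hy.trans_le (min_le_right _ _))).le

theorem levi_add_normSq {v : ℂ^m → ℝ} (hv : ContDiff ℝ ∞ v) {z w : ℂ^m}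
    (h : 0 ≤ levi v z w) : ∑ j, ‖w j‖ ^ 2 ≤ levi (fun x => v x + ∑ j, ‖x j‖ ^ 2) z w := by
  rw [levi_add hv.contDiffAt contDiff_normSq.contDiffAt, levi_normSq]
  linarith

/-- The dual estimate on a domain with plurisubharmonic exhaustion and weight. -/
theorem global_dual {Y : Set ℂ^m} (hY : IsOpen Y) {P ψ : ℂ^m → ℝ} (hP : Psh P Y)
    (hPc : ∀ c, IsCompact {z | z ∈ Y ∧ P z + ∑ j, ‖z j‖ ^ 2 ≤ c}) (hψ : Psh ψ Y)
    {g : ℂ^m → ℂ} (hg : ContDiffOn ℝ ∞ g Y)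
    (hgi : IntegrableOn (fun z => ∑ j, ‖dzb j g z‖ ^ 2 * Real.exp (-(ψ z + ∑ j, ‖z j‖ ^ 2))) Y)
    {γ : Fin m → ℂ^m → ℂ} (hγ : ∀ j, ContDiff ℝ ∞ (γ j))
    (hγc : ∀ j, HasCompactSupport (γ j)) (hγY : ∀ j, tsupport (γ j) ⊆ Y) :
    ‖∫ z, ∑ j, dzb j g z * γ j z‖ ^ 2 ≤
      4 * (∫ z in Y, ∑ j, ‖dzb j g z‖ ^ 2 * Real.exp (-(ψ z + ∑ j, ‖z j‖ ^ 2))) *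
        ∫ z, ‖∑ j, dzb j (γ j) z‖ ^ 2 * Real.exp (ψ z + ∑ j, ‖z j‖ ^ 2) := by
  set n2 : ℂ^m → ℝ := fun z => ∑ j, ‖z j‖ ^ 2 with hn2
  have n2c : Continuous n2 := contDiff_normSq.continuous
  have hPn : ContinuousOn (fun z => P z + n2 z) Y := hP.cont.add n2c.continuousOn
  obtain ⟨c, hc⟩ : ∃ c, ∀ j, ∀ z ∈ tsupport (γ j), P z + n2 z ≤ c := by
    have : ∀ j, ∃ c, ∀ z ∈ tsupport (γ j), P z + n2 z ≤ c := fun j => by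
      obtain ⟨c, hc⟩ := (hγc j).isCompact.bddAbove_image (hPn.mono (hγY j))
      exact ⟨c, fun z hz => hc ⟨z, hz, rfl⟩⟩
    choose c hc using this
    obtain ⟨b, hb⟩ := (Set.finite_range c).bddAbove
    exact ⟨b, fun j z hz => (hc j z hz).trans (hb ⟨j, rfl⟩)⟩
  set K := {z | z ∈ Y ∧ P z + n2 z ≤ c + 3} with hKdef
  have hK : IsCompact K := hPc _
  have hKY : K ⊆ Y := fun z hz => hz.1
  set U := {z | z ∈ Y ∧ P z + n2 z < c + 3} with hUdef
  have hU : IsOpen U := hPn.isOpen_inter_preimage hY isOpen_Iio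
  have hUK : U ⊆ K := fun z hz => ⟨hz.1, hz.2.le⟩
  have hUb : Bornology.IsBounded U := hK.isBounded.subset hUK
  have hγU : ∀ j, tsupport (γ j) ⊆ U := fun j z hz => ⟨hγY j hz, by linarith [hc j z hz]⟩
  obtain ⟨s0, hs0, hs0l, hs0P⟩ := hP.exists_smooth hY hK hKY (θ := 1 / 4) (by norm_num)
  obtain ⟨g', hg', -, V, hV, hKV, hgV⟩ := exists_extension (n := ∞) le_rfl hK hY hKY hg
  have hgd : ∀ z ∈ U, ∀ j, dzb j g' z = dzb j g z := fun z hz j =>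
    wirt_congr (by filter_upwards [hV.mem_nhds (hKV (hUK hz))] with y hy using hgV hy)
  set A := ∫ z in Y, ∑ j, ‖dzb j g z‖ ^ 2 * Real.exp (-(ψ z + n2 z)) with hA
  set D := ∫ z, ‖∑ j, dzb j (γ j) z‖ ^ 2 * Real.exp (ψ z + n2 z) with hD
  have key : ∀ θ > 0, ‖∫ z, ∑ j, dzb j g z * γ j z‖ ^ 2 ≤
      4 * (Real.exp θ * A) * (Real.exp θ * D) := by
    intro θ hθ
    obtain ⟨v, hv, hvl, hvψ⟩ := hψ.exists_smooth hY hK hKY hθ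
    have hs1 : ∀ z ∈ K, |s0 z + n2 z - (P z + n2 z)| ≤ 1 / 4 := fun z hz => by
      have := hs0P z hz; rwa [add_sub_add_right_eq_sub]
    have hsK : IsCompact {z | z ∈ U ∧ s0 z + n2 z ≤ c + 2} := by
      have : {z | z ∈ U ∧ s0 z + n2 z ≤ c + 2} = K ∩ {z | s0 z + n2 z ≤ c + 2} := by
        ext z
        refine ⟨fun h => ⟨hUK h.1, h.2⟩, fun h => ⟨⟨h.1.1, ?_⟩, h.2⟩⟩
        have h1 := abs_le.1 (hs1 z h.1)
        have h2 : s0 z + n2 z ≤ c + 2 := h.2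
        linarith [h1.1]
      rw [this]
      exact hK.inter_right (isClosed_le (hs0.continuous.add n2c) continuous_const)
    have h := local_dual (φ0 := fun x => v x + n2 x) (s := fun x => s0 x + n2 x)
      (hv.add contDiff_normSq) (hs0.add contDiff_normSq) hU hUb
      (fun z hz w => levi_add_normSq hv (hvl z (hUK hz) w))
      (fun z hz w => levi_add_normSq hs0 (hs0l z (hUK hz) w)) (a := c + 1) (b := c + 2)
      (by linarith) hsK hγ hγc hγU (fun j z hz => by
        have h1 := abs_le.1 (hs1 z (hUK (hγU j hz)))
        linarith [h1.2, hc j z hz]) hg'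
    have e1 : ∫ z, ∑ j, dzb j g' z * γ j z = ∫ z, ∑ j, dzb j g z * γ j z := by
      congr 1; ext z
      refine Finset.sum_congr rfl fun j _ => ?_
      by_cases hz : z ∈ tsupport (γ j)
      · rw [hgd z (hγU j hz)]
      · rw [image_eq_zero_of_notMem_tsupport hz, mul_zero, mul_zero]
    rw [e1] at h
    refine h.trans ?_
    have A1 : ∫ z in U, ∑ j, ‖dzb j g' z‖ ^ 2 * Real.exp (-(v z + n2 z)) ≤ Real.exp θ * A := by
      rw [hA, ← integral_const_mul]
      refine le_trans (setIntegral_mono_on ?_ (IntegrableOn.mono_set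
        (hgi.const_mul (Real.exp θ)) fun z hz => hz.1) hU.measurableSet (fun z hz => ?_)) (setIntegral_mono_set
          (hgi.const_mul (Real.exp θ)) (.of_forall fun z => ?_) (.of_forall fun z (hz : z ∈ U) => hz.1))
      · have : Continuous fun z => ∑ j, ‖dzb j g' z‖ ^ 2 * Real.exp (-(v z + n2 z)) := by
          have := fun j => (contDiff_wirt hg' (c := I) (j := j)).continuous
          have := hv.continuous
          fun_prop
        exact (this.continuousOn.integrableOn_compact hK).mono_set hUK
      · rw [Finset.mul_sum]
        refine Finset.sum_le_sum fun j _ => ?_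
        rw [hgd z hz, mul_left_comm]
        refine mul_le_mul_of_nonneg_left ?_ (by positivity)
        rw [← Real.exp_add]
        refine Real.exp_le_exp.2 ?_
        have := abs_le.1 (hvψ z (hUK hz))
        change -(v z + n2 z) ≤ θ + -(ψ z + n2 z)
        linarith [this.1]
      · simp only [Pi.zero_apply]; positivity
    have hdc : ∀ j, Continuous (dzb j (γ j)) := fun j => (contDiff_wirt (hγ j)).continuous
    have hds : ∀ z, z ∉ U → ∑ j, dzb j (γ j) z = 0 := fun z hz => Finset.sum_eq_zero fun j _ =>
      wirt_eq_zero_of_notMem fun h => hz (hγU j h)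
    have D1 : ∫ z, ‖∑ j, dzb j (γ j) z‖ ^ 2 * Real.exp (v z + n2 z) ≤ Real.exp θ * D := by
      rw [hD, ← integral_const_mul]
      refine integral_mono_of_nonneg (.of_forall fun z => by positivity) (Integrable.const_mul ?_ _)
        (.of_forall fun z => ?_)
      · have : IntegrableOn (fun z => ‖∑ j, dzb j (γ j) z‖ ^ 2 * Real.exp (ψ z + n2 z)) K := by
          refine ContinuousOn.integrableOn_compact hK ?_
          have h1 := hψ.cont.mono hKY
          have h2 : Continuous fun z => ‖∑ j, dzb j (γ j) z‖ ^ 2 := by fun_prop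
          exact h2.continuousOn.mul (Real.continuous_exp.comp_continuousOn (h1.add n2c.continuousOn))
        refine (integrableOn_iff_integrable_of_support_subset fun z hz => ?_).1 this
        by_contra hzK
        exact hz (by simp [hds z fun h => hzK (hUK h)])
      · dsimp only
        by_cases hz : z ∈ U
        · rw [mul_left_comm]
          refine mul_le_mul_of_nonneg_left ?_ (by positivity)
          rw [← Real.exp_add]
          refine Real.exp_le_exp.2 ?_
          have := abs_le.1 (hvψ z (hUK hz))
          linarith [this.2]
        · simp [hds z hz]
    have : 0 ≤ ∫ z, ‖∑ j, dzb j (γ j) z‖ ^ 2 * Real.exp (v z + n2 z) :=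
      integral_nonneg fun z => by positivity
    have A0 : 0 ≤ A := integral_nonneg fun z => by positivity
    gcongr
  have l1 : Tendsto (fun θ : ℝ => 4 * (Real.exp θ * A) * (Real.exp θ * D)) (𝓝[>] 0)
      (𝓝 (4 * (Real.exp 0 * A) * (Real.exp 0 * D))) :=
    (Continuous.tendsto (by fun_prop) 0).mono_left nhdsWithin_le_nhds
  have := ge_of_tendsto l1 (eventually_mem_nhdsWithin.mono key)
  simpa using this

end GlobalDual

section Solve

theorem exists_riesz {V H : Type*} [AddCommGroup V] [Module ℂ V] [NormedAddCommGroup H]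
    [InnerProductSpace ℂ H] [CompleteSpace H] (x : V →ₗ[ℂ] H) (l : V →ₗ[ℂ] ℂ) {C : ℝ}
    (hC : 0 ≤ C) (h : ∀ γ, ‖l γ‖ ≤ C * ‖x γ‖) :
    ∃ v : H, ‖v‖ ≤ C ∧ ∀ γ, inner ℂ v (x γ) = l γ := by
  have hk : LinearMap.ker x ≤ LinearMap.ker l := fun γ hγ => by
    have := h γ
    rw [LinearMap.mem_ker.1 hγ, norm_zero, mul_zero] at this
    exact norm_le_zero_iff.1 this
  let f0 : LinearMap.range x →ₗ[ℂ] ℂ :=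
    ((LinearMap.ker x).liftQ l hk).comp x.quotKerEquivRange.symm.toLinearMap
  have f0x : ∀ γ, f0 ⟨x γ, γ, rfl⟩ = l γ := fun γ => by
    have : x.quotKerEquivRange.symm ⟨x γ, γ, rfl⟩ = Submodule.Quotient.mk γ := by
      rw [LinearEquiv.symm_apply_eq]; rfl
    simp [f0, this]
  have hb : ∀ y, ‖f0 y‖ ≤ C * ‖y‖ := by
    rintro ⟨_, γ, rfl⟩
    rw [f0x]; exact h γ
  obtain ⟨g, hg, hgn⟩ := exists_extension_norm_eq _ (f0.mkContinuous C hb)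
  refine ⟨(InnerProductSpace.toDual ℂ H).symm g, ?_, fun γ => ?_⟩
  · rw [LinearIsometryEquiv.norm_map, hgn]
    exact f0.mkContinuous_norm_le hC hb
  · rw [InnerProductSpace.toDual_symm_apply]
    have := hg ⟨x γ, γ, rfl⟩
    rw [this, LinearMap.mkContinuous_apply, f0x]

variable {m : ℕ}

/-- Tuples of test functions with support in `Y`. -/
def testTuples (Y : Set ℂ^m) : Submodule ℂ (Fin m → ℂ^m → ℂ) where
  carrier := {γ | ∀ j, ContDiff ℝ ∞ (γ j) ∧ HasCompactSupport (γ j) ∧ tsupport (γ j) ⊆ Y}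
  add_mem' ha hb j := ⟨(ha j).1.add (hb j).1, (ha j).2.1.add (hb j).2.1,
    (tsupport_add _ _).trans (union_subset (ha j).2.2 (hb j).2.2)⟩
  zero_mem' j := ⟨contDiff_const, HasCompactSupport.zero, by
    change tsupport (0 : ℂ^m → ℂ) ⊆ Y
    simp [tsupport]⟩
  smul_mem' c γ h j := by
    have hsub : tsupport ((c • γ) j) ⊆ tsupport (γ j) :=
      tsupport_smul_subset_right (fun _ => c) (γ j)
    have hd : ContDiff ℝ ∞ fun z => c * γ j z := contDiff_const.mul (h j).1
    exact ⟨hd, (h j).2.1.mono' (subset_trans subset_closure hsub),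
      hsub.trans (h j).2.2⟩

/-- The (formal) divergence of a tuple. -/
def divb (γ : Fin m → ℂ^m → ℂ) (z : ℂ^m) : ℂ := ∑ j, dzb j (γ j) z

variable {Y : Set ℂ^m}

theorem continuous_divb {γ} (h : γ ∈ testTuples Y) : Continuous (divb γ) :=
  continuous_finsetSum _ fun j _ => (contDiff_wirt (h j).1).continuous

theorem support_divb_subset {γ : Fin m → ℂ^m → ℂ} :
    Function.support (divb γ) ⊆ ⋃ j, tsupport (γ j) := fun z hz => by
  by_contra h
  rw [mem_iUnion, not_exists] at h
  exact hz (Finset.sum_eq_zero fun j _ => wirt_eq_zero_of_notMem (h j))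

theorem tsupport_divb {γ} (h : γ ∈ testTuples Y) :
    HasCompactSupport (divb γ) ∧ tsupport (divb γ) ⊆ Y := by
  have hc : IsCompact (⋃ j, tsupport (γ j)) := isCompact_iUnion fun j => (h j).2.1.isCompact
  have hs : tsupport (divb γ) ⊆ ⋃ j, tsupport (γ j) :=
    closure_minimal support_divb_subset hc.isClosed
  exact ⟨hc.of_isClosed_subset (isClosed_tsupport _) hs,
    hs.trans (iUnion_subset fun j => (h j).2.2)⟩

theorem memLp_divb_mul {γ} (hY : IsOpen Y) (h : γ ∈ testTuples Y) {W : ℂ^m → ℝ}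
    (hW : ContinuousOn W Y) : MemLp (fun z => divb γ z * (Real.exp (W z) : ℂ)) 2 := by
  obtain ⟨hc, hs⟩ := tsupport_divb h
  have : Continuous fun z => divb γ z * (Real.exp (W z) : ℂ) := by
    refine continuous_of_tsupport fun z hz => ?_
    have hzY := hs (tsupport_mul_subset_left hz)
    refine (continuous_divb h).continuousAt.mul ?_
    exact (Complex.continuous_ofReal.comp_continuousOn
      (Real.continuous_exp.comp_continuousOn hW)).continuousAt (hY.mem_nhds hzY)
  exact this.memLp_of_hasCompactSupport hc.mul_right

theorem divb_add {γ δ} (h : γ ∈ testTuples Y) (h' : δ ∈ testTuples Y) (z) :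
    divb (γ + δ) z = divb γ z + divb δ z := by
  simp only [divb, ← Finset.sum_add_distrib]
  refine Finset.sum_congr rfl fun j _ => ?_
  exact wirt_add ((h j).1.differentiable (by simp)).differentiableAt
    ((h' j).1.differentiable (by simp)).differentiableAt

theorem divb_smul {γ} (h : γ ∈ testTuples Y) (c : ℂ) (z) :
    divb (c • γ) z = c * divb γ z := by
  simp only [divb, Finset.mul_sum]
  refine Finset.sum_congr rfl fun j _ => ?_
  exact wirt_const_mul c ((h j).1.differentiable (by simp)).differentiableAt

theorem divb_single [DecidableEq (Fin m)] (κ : ℂ^m → ℂ) (j : Fin m) (z) :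
    divb (Pi.single j κ) z = dzb j κ z := by
  rw [divb, Finset.sum_eq_single j]
  · rw [Pi.single_eq_same]
  · intro i _ hij
    rw [Pi.single_eq_of_ne hij]
    exact wirt_const 0
  · simp

theorem single_mem_testTuples [DecidableEq (Fin m)] {κ : ℂ^m → ℂ} (h1 : ContDiff ℝ ∞ κ)
    (h2 : HasCompactSupport κ) (h3 : tsupport κ ⊆ Y) (j : Fin m) :
    (Pi.single j κ : Fin m → ℂ^m → ℂ) ∈ testTuples Y := fun i => by
  by_cases hij : i = j
  · subst hij; rw [Pi.single_eq_same]; exact ⟨h1, h2, h3⟩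
  · rw [Pi.single_eq_of_ne hij]; exact (testTuples Y).zero_mem i

theorem norm_sq_Lp (f : Lp ℂ 2 (volume : Measure ℂ^m)) : ‖f‖ ^ 2 = ∫ z, ‖f z‖ ^ 2 := by
  have h := inner_self_eq_norm_sq_to_K (𝕜 := ℂ) f
  rw [L2.inner_def] at h
  have h2 : ∫ z, inner ℂ (f z) (f z) = ((∫ z, ‖f z‖ ^ 2 : ℝ) : ℂ) := by
    rw [← integral_complex_ofReal]
    congr 1; ext z
    simp [inner_self_eq_norm_sq_to_K]
  rw [h2] at h
  have h3 : (((‖f‖ ^ 2 : ℝ)) : ℂ) = ((∫ z, ‖f z‖ ^ 2 : ℝ) : ℂ) := by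
    rw [h]; push_cast; rfl
  exact Complex.ofReal_injective h3

theorem integrable_mul_divb (hY : IsOpen Y) {γ} (h : γ ∈ testTuples Y) {f : ℂ^m → ℂ}
    (hf : ContinuousOn f Y) (j : Fin m) : Integrable fun z => f z * γ j z := by
  have hc : Continuous fun z => f z * γ j z := by
    refine continuous_of_tsupport fun z hz => ?_
    exact (hf.continuousAt (hY.mem_nhds ((h j).2.2 (tsupport_mul_subset_right hz)))).mul
      (h j).1.continuous.continuousAt
  exact hc.integrable_of_hasCompactSupport (h j).2.1.mul_left

/-- Solution of the inhomogeneous Cauchy-Riemann equations with weighted `L²` estimates. -/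
theorem exists_holomorphic_near (hY : IsOpen Y) {P ψ : ℂ^m → ℝ} (hP : Psh P Y)
    (hPc : ∀ c, IsCompact {z | z ∈ Y ∧ P z + ∑ j, ‖z j‖ ^ 2 ≤ c}) (hψ : Psh ψ Y)
    {g : ℂ^m → ℂ} (hg : ContDiffOn ℝ ∞ g Y)
    (hgi : IntegrableOn (fun z => ∑ j, ‖dzb j g z‖ ^ 2 * Real.exp (-(ψ z + ∑ j, ‖z j‖ ^ 2))) Y) :
    ∃ F, DifferentiableOn ℂ F Y ∧
      IntegrableOn (fun z => ‖g z - F z‖ ^ 2 * Real.exp (-(ψ z + ∑ j, ‖z j‖ ^ 2))) Y ∧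
      ∫ z in Y, ‖g z - F z‖ ^ 2 * Real.exp (-(ψ z + ∑ j, ‖z j‖ ^ 2)) ≤
        4 * ∫ z in Y, ∑ j, ‖dzb j g z‖ ^ 2 * Real.exp (-(ψ z + ∑ j, ‖z j‖ ^ 2)) := by
  classical
  set W : ℂ^m → ℝ := fun z => ψ z + ∑ j, ‖z j‖ ^ 2 with hW
  have hWc : ContinuousOn W Y := hψ.cont.add contDiff_normSq.continuous.continuousOn
  have hW2 : ContinuousOn (fun z => W z / 2) Y := hWc.div_const 2
  set A := ∫ z in Y, ∑ j, ‖dzb j g z‖ ^ 2 * Real.exp (-(W z)) with hA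
  have hA0 : 0 ≤ A := integral_nonneg fun z => by positivity
  have hdg : ∀ j, ContinuousOn (dzb j g) Y := fun j z hz =>
    ((contDiffAt_wirt (hg.contDiffAt (hY.mem_nhds hz))).continuousAt).continuousWithinAt
  have hmem : ∀ γ : testTuples Y, MemLp (fun z => divb γ z * (Real.exp (W z / 2) : ℂ)) 2 :=
    fun γ => memLp_divb_mul hY γ.2 hW2
  let x : testTuples Y →ₗ[ℂ] Lp ℂ 2 (volume : Measure ℂ^m) :=
    { toFun := fun γ => (hmem γ).toLp _
      map_add' := fun γ δ => by
        rw [← MemLp.toLp_add]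
        congr 1; ext z
        simp only [Pi.add_apply]
        rw [← add_mul, ← divb_add γ.2 δ.2 z]; rfl
      map_smul' := fun c γ => by
        rw [RingHom.id_apply, ← MemLp.toLp_const_smul]
        congr 1; ext z
        simp only [Pi.smul_apply, smul_eq_mul]
        rw [← mul_assoc, ← divb_smul γ.2 c z]; rfl }
  let l : testTuples Y →ₗ[ℂ] ℂ :=
    { toFun := fun γ => -∫ z, ∑ j, dzb j g z * γ.1 j z
      map_add' := fun γ δ => by
        have i1 := fun γ : testTuples Y =>
          integrable_finsetSum Finset.univ fun j _ => integrable_mul_divb hY γ.2 (hdg j) j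
        rw [← neg_add, ← integral_add (i1 γ) (i1 δ)]
        congr 2; ext z
        rw [← Finset.sum_add_distrib]
        exact Finset.sum_congr rfl fun j _ => mul_add _ _ _
      map_smul' := fun c γ => by
        rw [RingHom.id_apply, smul_eq_mul, mul_neg, ← integral_const_mul]
        congr 2; ext z
        rw [Finset.mul_sum]
        exact Finset.sum_congr rfl fun j _ => mul_left_comm _ _ _ }
  have hxn : ∀ γ : testTuples Y, ‖x γ‖ ^ 2 = ∫ z, ‖divb γ z‖ ^ 2 * Real.exp (W z) := fun γ => by
    rw [norm_sq_Lp]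
    refine integral_congr_ae ?_
    filter_upwards [(hmem γ).coeFn_toLp] with z hz
    rw [norm_sq_mul_exp, mul_comm, ← hz]
    rfl
  obtain ⟨v, hv, hvl⟩ := exists_riesz x l (C := 2 * Real.sqrt A) (by positivity) fun γ => by
    refine le_of_sq_le_sq ?_ (by positivity)
    rw [mul_pow, hxn, mul_pow, Real.sq_sqrt hA0]
    have := global_dual hY hP hPc hψ hg hgi (fun j => (γ.2 j).1) (fun j => (γ.2 j).2.1)
      (fun j => (γ.2 j).2.2)
    change ‖-∫ z, ∑ j, dzb j g z * γ.1 j z‖ ^ 2 ≤ _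
    rw [norm_neg]
    norm_num
    exact this
  set u : ℂ^m → ℂ := fun z => conj (v z) * (Real.exp (W z / 2) : ℂ) with hu
  have hvm : MemLp (fun z => v z) 2 := Lp.memLp v
  have huK : ∀ K ⊆ Y, IsCompact K → MemLp u 2 (volume.restrict K) := fun K hKY hK => by
    have hc : ContinuousOn (fun z => (Real.exp (W z / 2) : ℂ)) K :=
      (Complex.continuous_ofReal.comp_continuousOn
        (Real.continuous_exp.comp_continuousOn hW2)).mono hKY
    obtain ⟨C, hC⟩ := hK.exists_bound_of_continuousOn hc
    refine (hvm.restrict K).of_le_mul (c := C) ?_ ?_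
    · exact (continuous_conj.comp_aestronglyMeasurable hvm.1.restrict).mul
        (hc.aestronglyMeasurable hK.measurableSet)
    · filter_upwards [ae_restrict_mem hK.measurableSet] with z hz
      rw [hu]
      simp only [norm_mul, RCLike.norm_conj]
      rw [mul_comm]
      exact mul_le_mul_of_nonneg_right (hC z hz) (norm_nonneg _)
  have hgK : ∀ K ⊆ Y, IsCompact K → MemLp g 2 (volume.restrict K) := fun K hKY hK => by
    have hc := hg.continuousOn.mono hKY
    rw [memLp_two_iff_integrable_sq_norm (hc.aestronglyMeasurable hK.measurableSet)]
    exact (hc.norm.pow 2).integrableOn_compact hK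
  have hweak : ∀ γ : testTuples Y, ∫ z, u z * divb γ z = l γ := fun γ => by
    rw [← hvl, L2.inner_def]
    refine integral_congr_ae ?_
    filter_upwards [(hmem γ).coeFn_toLp] with z hz
    change _ = inner ℂ (v z) ((hmem γ).toLp _ z)
    rw [hz, RCLike.inner_apply, hu]
    dsimp only
    ring
  obtain ⟨F, hF, hfF⟩ := weyl hY (f := fun z => g z - u z)
    (fun K hKY hK => (hgK K hKY hK).sub (huK K hKY hK)) fun κ h1 h2 h3 j => by
      have hw := hweak ⟨_, single_mem_testTuples h1 h2 h3 j⟩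
      change ∫ z, u z * divb (Pi.single j κ) z =
        -∫ z, ∑ i, dzb i g z * (Pi.single j κ : Fin m → ℂ^m → ℂ) i z at hw
      simp only [divb_single] at hw
      have e1 : ∀ z, ∑ i, dzb i g z * (Pi.single j κ : Fin m → ℂ^m → ℂ) i z
          = dzb j g z * κ z := fun z => by
        rw [Finset.sum_eq_single j]
        · rw [Pi.single_eq_same]
        · intro i _ hij; rw [Pi.single_eq_of_ne hij]; simp
        · simp
      simp only [e1] at hw
      obtain ⟨g', hg', -, V, hV, hKV, hgV⟩ := exists_extension le_rfl h2.isCompact hY h3 hg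
      have e2 : ∫ z, g z * dzb j κ z = ∫ z, g' z * dzb j κ z := by
        congr 1; ext z
        by_cases hz : z ∈ tsupport κ
        · rw [hgV (hKV hz)]
        · rw [show dzb j κ z = 0 from wirt_eq_zero_of_notMem hz, mul_zero, mul_zero]
      have e3 : ∫ z, dzb j g z * κ z = ∫ z, dzb j g' z * κ z := by
        congr 1; ext z
        by_cases hz : z ∈ tsupport κ
        · rw [show dzb j g z = dzb j g' z from wirt_congr (by
            filter_upwards [hV.mem_nhds (hKV hz)] with y hy using (hgV hy).symm)]
        · rw [image_eq_zero_of_notMem_tsupport hz, mul_zero, mul_zero]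
      have e4 : ∫ z, dzb j g' z * κ z = -∫ z, g' z * dzb j κ z :=
        integral_wirt_mul hg' h1 (.inr h2)
      have hdκ : MemLp (dzb j κ) 2 := ((contDiff_wirt h1).continuous).memLp_of_hasCompactSupport
        (hasCompactSupport_wirt h2)
      have hint : ∀ f, (∀ K ⊆ Y, IsCompact K → MemLp f 2 (volume.restrict K)) →
          Integrable fun z => f z * dzb j κ z := fun f hf => by
        have : IntegrableOn (fun z => f z * dzb j κ z) (tsupport κ) :=
          (hf _ h3 h2.isCompact).integrable_mul (p := 2) (q := 2) (hdκ.restrict _)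
        refine (integrableOn_iff_integrable_of_support_subset fun z hz => ?_).1 this
        by_contra h
        exact hz (by simp [show dzb j κ z = 0 from wirt_eq_zero_of_notMem h])
      simp only [sub_mul]
      rw [integral_sub (hint g hgK) (hint u huK), hw, e2, e3, e4]
      ring
  have hmain : ∀ᵐ z ∂volume.restrict Y,
      ‖g z - F z‖ ^ 2 * Real.exp (-(W z)) = ‖v z‖ ^ 2 := by
    filter_upwards [hfF] with z hz
    rw [← hz, sub_sub_cancel, hu]
    simp only [norm_mul, RCLike.norm_conj, norm_real, mul_pow, Real.norm_eq_abs, sq_abs]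
    rw [← Real.exp_nat_mul, mul_assoc, ← Real.exp_add]
    simp [mul_div_cancel₀]
  have hvi : Integrable fun z => ‖v z‖ ^ 2 :=
    (memLp_two_iff_integrable_sq_norm hvm.1).1 hvm
  refine ⟨F, hF, (hvi.integrableOn (s := Y)).congr (hmain.mono fun z hz => hz.symm), ?_⟩
  rw [integral_congr_ae hmain]
  refine (setIntegral_le_integral hvi (.of_forall fun z => by positivity)).trans ?_
  have hvn : ∫ z, ‖v z‖ ^ 2 = ‖v‖ ^ 2 := (norm_sq_Lp v).symm
  rw [hvn]
  calc ‖v‖ ^ 2 ≤ (2 * Real.sqrt A) ^ 2 := by gcongr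
    _ = 4 * A := by rw [mul_pow, Real.sq_sqrt hA0]; norm_num

end Solve

section Distance
variable {m : ℕ} {M : Set ℂ^m}

/-- The Euclidean norm. -/
def eu (z : ℂ^m) : ℝ := ‖(WithLp.toLp 2 z : EuclideanSpace ℂ (Fin m))‖

/-- The Euclidean distance to `M`. -/
def dM (M : Set ℂ^m) (z : ℂ^m) : ℝ :=
  infDist (WithLp.toLp 2 z : EuclideanSpace ℂ (Fin m)) (WithLp.toLp 2 '' M)

theorem eu_sq (z : ℂ^m) : eu z ^ 2 = ∑ j, ‖z j‖ ^ 2 := by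
  rw [eu, EuclideanSpace.norm_sq_eq]

theorem eu_nonneg (z : ℂ^m) : 0 ≤ eu z := norm_nonneg _

theorem eu_add_le (z w : ℂ^m) : eu (z + w) ≤ eu z + eu w := by
  unfold eu; rw [WithLp.toLp_add]; exact norm_add_le _ _

theorem eu_sub_comm (z w : ℂ^m) : eu (z - w) = eu (w - z) := by
  unfold eu; rw [WithLp.toLp_sub, WithLp.toLp_sub, norm_sub_rev]

theorem eu_smul (c : ℂ) (z : ℂ^m) : eu (c • z) = ‖c‖ * eu z := by
  unfold eu; rw [WithLp.toLp_smul, norm_smul]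

theorem eu_eq_zero {z : ℂ^m} : eu z = 0 ↔ z = 0 := by
  unfold eu; simp

theorem eu_pos {z : ℂ^m} (h : z ≠ 0) : 0 < eu z :=
  (eu_nonneg z).lt_of_ne' (eu_eq_zero.not.2 h)

theorem norm_le_eu (z : ℂ^m) : ‖z‖ ≤ eu z := by
  refine (pi_norm_le_iff_of_nonneg (eu_nonneg z)).2 fun j => ?_
  exact PiLp.norm_apply_le (WithLp.toLp 2 z : EuclideanSpace ℂ (Fin m)) j

theorem eu_le_norm (z : ℂ^m) : eu z ≤ Real.sqrt m * ‖z‖ := by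
  rw [eu, EuclideanSpace.norm_eq, ← Real.sqrt_sq (norm_nonneg z),
    ← Real.sqrt_mul (Nat.cast_nonneg m)]
  refine Real.sqrt_le_sqrt ?_
  refine (Finset.sum_le_sum fun j _ => pow_le_pow_left₀ (norm_nonneg _) (norm_le_pi_norm z j) 2).trans ?_
  simp

theorem continuous_eu : Continuous (eu : ℂ^m → ℝ) :=
  (PiLp.continuous_toLp 2 _).norm

theorem continuous_dM : Continuous (dM M) :=
  (continuous_infDist_pt _).comp (PiLp.continuous_toLp 2 _)

theorem dM_nonneg (z : ℂ^m) : 0 ≤ dM M z := infDist_nonneg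

theorem dM_le {x : ℂ^m} (hx : x ∈ M) (z : ℂ^m) : dM M z ≤ eu (z - x) := by
  refine (infDist_le_dist_of_mem (mem_image_of_mem _ hx)).trans_eq ?_
  rw [dist_eq_norm, eu, WithLp.toLp_sub]

theorem dM_le_add (z w : ℂ^m) : dM M z ≤ dM M w + eu (z - w) := by
  have h := infDist_le_infDist_add_dist (s := WithLp.toLp 2 '' M)
    (x := (WithLp.toLp 2 z : EuclideanSpace ℂ (Fin m))) (y := WithLp.toLp 2 w)
  rwa [dist_eq_norm, ← WithLp.toLp_sub] at h

theorem exists_near (hM : M.Nonempty) {z : ℂ^m} {r : ℝ} (h : dM M z < r) :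
    ∃ x ∈ M, eu (z - x) < r := by
  obtain ⟨_, ⟨x, hx, rfl⟩, hxr⟩ := (infDist_lt_iff (hM.image _)).1 h
  refine ⟨x, hx, ?_⟩
  rwa [eu, WithLp.toLp_sub, ← dist_eq_norm]

/-- A defining function near `p` with vanishing Levi form at `p`. -/
structure Chart (M : Set ℂ^m) (p : ℂ^m) (ρ : ℂ^m → ℝ) : Prop where
  smooth : ContDiffAt ℝ ∞ ρ p
  grad : fderiv ℝ ρ p ≠ 0
  zero : ∀ᶠ q in 𝓝 p, q ∈ M ↔ ρ q = 0
  flat : ∀ w, IsComplexTangent ρ p w → leviForm ρ p w = 0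

theorem exists_chart (h : IsSmoothLeviFlatHypersurface M) {p : ℂ^m} (hp : p ∈ M) :
    ∃ ρ, Chart M p ρ := by
  obtain ⟨V, hV, hpV, ρ, h1, h2, h3, h4⟩ := h p hp
  refine ⟨ρ, contDiffAt_infty.2 fun k => (h1 k).contDiffAt (hV.mem_nhds hpV), h2 p hpV, ?_,
    h4 p hpV ((h3 p hpV).1 hp)⟩
  filter_upwards [hV.mem_nhds hpV] with q hq using h3 q hq

/-- Near a point of a hypersurface the defining function increases in a suitable direction. -/
theorem Chart.exists_dir {p : ℂ^m} {ρ : ℂ^m → ℝ} (hc : Chart M p ρ) :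
    ∃ e : ℂ^m, ∃ r > 0, ContinuousOn ρ (ball p r) ∧
      (∀ q ∈ ball p r, q ∈ M ↔ ρ q = 0) ∧
      ∀ x ∈ ball p r, ∀ t : ℝ, 0 < t → x + (t : ℂ) • e ∈ ball p r →
        ρ x + t ≤ ρ (x + (t : ℂ) • e) := by
  set A := fderiv ℝ ρ p
  obtain ⟨e, he⟩ : ∃ e, A e = 2 := by
    obtain ⟨e, he⟩ : ∃ e, A e ≠ 0 := by
      by_contra! h
      exact hc.grad (by ext v; exact h v)
    exact ⟨(2 / A e) • e, by rw [map_smul, smul_eq_mul, div_mul_cancel₀ _ he]⟩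
  have hs : HasStrictFDerivAt ρ A p := hc.smooth.hasStrictFDerivAt (by simp)
  have he0 : 0 < ‖e‖ := norm_pos_iff.2 fun h => by rw [h, map_zero] at he; norm_num at he
  have h1 := hs.isLittleO.def (c := 1 / ‖e‖) (by positivity)
  rw [nhds_prod_eq] at h1
  obtain ⟨t, ht, ht'⟩ := (Filter.eventually_prod_self_iff
    (r := fun x y => ‖ρ x - ρ y - A (x - y)‖ ≤ 1 / ‖e‖ * ‖x - y‖)).1 h1
  have h2 : ∀ᶠ y in 𝓝 p, ContinuousAt ρ y :=
    ((hc.smooth.of_le (m := 1) (by simp)).eventually (by simp)).mono fun y hy => hy.continuousAt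
  obtain ⟨r, hr, hr'⟩ := eventually_nhds_iff_ball.1 (hc.zero.and (h2.and ht))
  refine ⟨e, r, hr, fun y hy => (hr' y hy).2.1.continuousWithinAt, fun q hq => (hr' q hq).1,
    fun x hx t ht0 hxt => ?_⟩
  have := ht' _ (hr' _ hxt).2.2 _ (hr' x hx).2.2
  have hsm : (t : ℂ) • e = t • e := Complex.coe_smul t e
  simp only [add_sub_cancel_left, hsm, map_smul, he, norm_smul, Real.norm_eq_abs,
    abs_of_pos ht0] at this ⊢
  have h5 : 1 / ‖e‖ * (t * ‖e‖) = t := by field_simp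
  rw [h5] at this
  have := (abs_le.1 this).1
  rw [smul_eq_mul] at this
  linarith

theorem Chart.dM_le {p : ℂ^m} {ρ : ℂ^m → ℝ} (hc : Chart M p ρ) (hp : p ∈ M) :
    ∃ C, 0 ≤ C ∧ ∀ᶠ x in 𝓝 p, dM M x ≤ C * |ρ x| := by
  obtain ⟨e, r, hr, hcont, hz, hinc⟩ := hc.exists_dir
  refine ⟨eu e, eu_nonneg e, ?_⟩
  have hρp : ρ p = 0 := (hz p (mem_ball_self hr)).1 hp
  have h1 : Tendsto (fun x => ‖x - p‖ + |ρ x| * ‖e‖) (𝓝 p) (𝓝 (‖p - p‖ + |ρ p| * ‖e‖)) := by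
    have := hc.smooth.continuousAt
    exact ((continuous_id.sub continuous_const).norm.tendsto p).add
      ((this.tendsto.abs).mul_const _)
  rw [hρp] at h1
  simp only [sub_self, norm_zero, abs_zero, zero_mul, add_zero] at h1
  filter_upwards [h1.eventually (gt_mem_nhds hr)] with x hx
  have hball : ∀ t : ℝ, |t| ≤ |ρ x| → x + (t : ℂ) • e ∈ ball p r := fun t ht => by
    rw [mem_ball_iff_norm]
    calc ‖x + (t : ℂ) • e - p‖ = ‖(x - p) + (t : ℂ) • e‖ := by congr 1; abel
      _ ≤ ‖x - p‖ + |t| * ‖e‖ := by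
        refine (norm_add_le _ _).trans_eq ?_
        rw [norm_smul, norm_real, Real.norm_eq_abs]
      _ ≤ ‖x - p‖ + |ρ x| * ‖e‖ := by gcongr
      _ < r := hx
  have hx0 := hball 0 (by simp)
  rw [ofReal_zero, zero_smul, add_zero] at hx0
  have key : ∃ t : ℝ, |t| ≤ |ρ x| ∧ ρ (x + (t : ℂ) • e) = 0 := by
    set s := |ρ x| with hs
    rcases eq_or_lt_of_le (abs_nonneg (ρ x)) with h0 | h0
    · exact ⟨0, by simp [hs], by simpa using (abs_eq_zero.1 h0.symm)⟩
    have c1 : ContinuousOn (fun t : ℝ => ρ (x + (t : ℂ) • e)) (Icc (-s) s) := by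
      refine hcont.comp (by fun_prop) fun t ht => hball t (abs_le.2 ht)
    have a1 : 0 ≤ ρ (x + (s : ℂ) • e) := by
      have := hinc x hx0 s h0 (hball s (by rw [hs, abs_abs]))
      linarith [neg_abs_le (ρ x), hs.ge]
    have a2 : ρ (x + ((-s : ℝ) : ℂ) • e) ≤ 0 := by
      have := hinc _ (hball (-s) (by rw [hs, abs_neg, abs_abs])) s h0 (by
        rw [add_assoc, ← add_smul, ofReal_neg, neg_add_cancel, zero_smul, add_zero]
        exact hx0)
      rw [add_assoc, ← add_smul, ofReal_neg, neg_add_cancel, zero_smul, add_zero] at this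
      rw [ofReal_neg]
      linarith [le_abs_self (ρ x), hs.ge]
    obtain ⟨t, ht, ht0⟩ := intermediate_value_Icc (by linarith) c1 ⟨a2, a1⟩
    exact ⟨t, abs_le.2 ht, ht0⟩
  obtain ⟨t, ht, ht0⟩ := key
  refine (LeviFlat.dM_le ((hz _ (hball t ht)).2 ht0) x).trans ?_
  have : x - (x + (t : ℂ) • e) = (-(t : ℂ)) • e := by rw [neg_smul]; abel
  rw [this, eu_smul, norm_neg, norm_real, Real.norm_eq_abs, mul_comm]
  exact mul_le_mul_of_nonneg_left ht (eu_nonneg e)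

end Distance

section Osculate
variable {m : ℕ} {M : Set ℂ^m} {p : ℂ^m} {ρ : ℂ^m → ℝ}

/-- The complex linear form with real part `dρ`. -/
def clin (ρ : ℂ^m → ℝ) (p : ℂ^m) : ℂ^m →ₗ[ℂ] ℂ where
  toFun w := (fderiv ℝ ρ p w : ℂ) - I * fderiv ℝ ρ p (I • w)
  map_add' v w := by simp only [smul_add, map_add, ofReal_add]; ring
  map_smul' c w := by
    have h : ∀ c : ℂ, ∀ v, fderiv ℝ ρ p (c • v) =
        c.re * fderiv ℝ ρ p v + c.im * fderiv ℝ ρ p (I • v) := fun c v => by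
      have : c • v = c.re • v + c.im • (I • v) := by
        conv_lhs => rw [← re_add_im c]
        rw [add_smul, mul_smul]; rfl
      rw [this, map_add, map_smul, map_smul]; rfl
    rw [h c w, smul_smul, mul_comm I c, ← smul_smul, h c (I • w), smul_smul, I_mul_I, neg_one_smul,
      map_neg, RingHom.id_apply, smul_eq_mul]
    push_cast
    conv_rhs => rw [← re_add_im c]
    linear_combination ((c.im : ℂ) * fderiv ℝ ρ p (I • w)) * I_sq

theorem clin_apply (w) : clin ρ p w = (fderiv ℝ ρ p w : ℂ) - I * fderiv ℝ ρ p (I • w) := rfl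

theorem re_clin (w) : (clin ρ p w).re = fderiv ℝ ρ p w := by simp [clin_apply]

theorem isComplexTangent_of_clin {w} (h : clin ρ p w = 0) : IsComplexTangent ρ p w := by
  have h1 := congrArg re h
  have h2 := congrArg im h
  simp only [clin_apply, sub_re, sub_im, mul_re, mul_im, ofReal_re, ofReal_im, I_re, I_im] at h1 h2
  constructor <;> simp at h1 h2 <;> linarith

theorem Chart.osculate (hc : Chart M p ρ) (hp : p ∈ M) {w : ℂ^m} (hw : clin ρ p w = 0) :
    ∃ B : ℂ, ∀ (x : ℂ → Fin m → ℂ) (w2 : ℂ^m), clin ρ p w2 = -B →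
      (fun ζ => x ζ - p - ζ • w - ζ ^ 2 • w2) =o[𝓝 0] (fun ζ => ‖ζ‖ ^ 2) →
      (fun ζ => dM M (x ζ)) =o[𝓝 0] fun ζ => ‖ζ‖ ^ 2 := by
  set A := fderiv ℝ ρ p with hA
  set H := fderiv ℝ (fderiv ℝ ρ) p with hH
  have hsymm : ∀ v w, H v w = H w v := fun v w =>
    ((contDiffAt_infty.1 hc.smooth 2).isSymmSndFDerivAt (by simp)) v w
  have htan := isComplexTangent_of_clin hw
  have hlevi : H (I • w) (I • w) = - H w w := by
    have := hc.flat w htan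
    rw [leviForm, iteratedFDeriv_two_apply, iteratedFDeriv_two_apply] at this
    simp only [Matrix.cons_val_zero, Matrix.cons_val_one] at this
    linarith
  set B : ℂ := ((H w w : ℂ) - I * H w (I • w)) / 2 with hB
  refine ⟨B, fun x w2 hw2 hx => ?_⟩
  set v : ℂ → Fin m → ℂ := fun ζ => x ζ - p with hv
  set r : ℂ → Fin m → ℂ := fun ζ => x ζ - p - ζ • w - ζ ^ 2 • w2 with hr
  have hvr : ∀ ζ, v ζ = ζ • w + ζ ^ 2 • w2 + r ζ := fun ζ => by simp only [hv, hr]; abel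
  have o12 : (fun ζ : ℂ => ‖ζ‖ ^ 2) =O[𝓝 0] fun ζ => ‖ζ‖ := by
    refine IsBigO.of_bound 1 ?_
    filter_upwards [closedBall_mem_nhds (0 : ℂ) one_pos] with ζ hζ
    have h1 : ‖ζ‖ ≤ 1 := by simpa using hζ
    rw [norm_pow, norm_norm, one_mul, sq]
    nlinarith [norm_nonneg ζ]
  have hq : (fun ζ : ℂ => ζ ^ 2 • w2) =O[𝓝 0] fun ζ => ‖ζ‖ ^ 2 :=
    IsBigO.of_bound ‖w2‖ (.of_forall fun ζ => by
      rw [norm_smul, norm_pow, norm_pow, norm_norm, mul_comm])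
  have hlin : (fun ζ : ℂ => ζ • w) =O[𝓝 0] fun ζ => ‖ζ‖ :=
    IsBigO.of_bound ‖w‖ (.of_forall fun ζ => by rw [norm_smul, norm_norm, mul_comm])
  have hrem : (fun ζ => v ζ - ζ • w) =O[𝓝 0] fun ζ => ‖ζ‖ ^ 2 := by
    refine (hq.add hx.isBigO).congr_left fun ζ => ?_
    rw [hvr]; abel
  have hvO : v =O[𝓝 0] fun ζ => ‖ζ‖ := by
    refine (hlin.add (hrem.trans o12)).congr_left fun ζ => ?_
    abel
  have hv0 : Tendsto v (𝓝 0) (𝓝 0) := by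
    refine hvO.trans_tendsto ?_
    simpa using (continuous_norm.tendsto (0 : ℂ))
  have hnorm0 : Tendsto (fun ζ : ℂ => ‖ζ‖) (𝓝 0) (𝓝 0) := by
    simpa using (continuous_norm.tendsto (0 : ℂ))
  have hT := ((taylor_two (contDiffAt_infty.1 hc.smooth 2)).comp_tendsto hv0).trans_isBigO
    (show ((fun v => ‖v‖ ^ 2) ∘ v) =O[𝓝 0] fun ζ : ℂ => ‖ζ‖ ^ 2 from (hvO.norm_left).pow 2)
  have hρp : ρ p = 0 := hc.zero.self_of_nhds.1 hp
  -- the second order terms cancel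
  have hcancel : ∀ ζ : ℂ, A (ζ • w) + A (ζ ^ 2 • w2) + 2⁻¹ * H (ζ • w) (ζ • w) = 0 := fun ζ => by
    have e1 : A (ζ • w) = 0 := by rw [← re_clin, map_smul, hw, smul_zero, zero_re]
    have e2 : A (ζ ^ 2 • w2) = (-(ζ ^ 2 * B)).re := by
      rw [← re_clin, map_smul, hw2, smul_eq_mul, mul_neg]
    have e3 : ζ • w = ζ.re • w + ζ.im • (I • w) := by
      conv_lhs => rw [← re_add_im ζ]
      rw [add_smul, mul_smul]; rfl
    have e4 : H (ζ • w) (ζ • w) = (ζ.re ^ 2 - ζ.im ^ 2) * H w w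
        + 2 * ζ.re * ζ.im * H w (I • w) := by
      rw [e3]
      simp only [map_add, map_smul, add_apply, smul_apply, smul_eq_mul]
      rw [hlevi, hsymm (I • w) w]; ring
    rw [e1, e2, e4, hB]
    simp [sq]
    ring
  have hρ : (fun ζ => ρ (x ζ)) =o[𝓝 0] fun ζ => ‖ζ‖ ^ 2 := by
    have t1 : (fun ζ => A (r ζ)) =o[𝓝 0] fun ζ => ‖ζ‖ ^ 2 := (A.isBigO_comp r _).trans_isLittleO hx
    have bil : ∀ f g : ℂ → Fin m → ℂ, (fun ζ => H (f ζ) (g ζ)) =O[𝓝 0] fun ζ => ‖f ζ‖ * ‖g ζ‖ :=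
      fun f g => IsBigO.of_bound ‖H‖ (.of_forall fun ζ => by
        rw [norm_mul, norm_norm, norm_norm, ← mul_assoc]; exact H.le_opNorm₂ _ _)
    have cub : (fun ζ : ℂ => ‖ζ‖ ^ 2 * ‖ζ‖) =o[𝓝 0] fun ζ => ‖ζ‖ ^ 2 := by
      have := (isBigO_refl (fun ζ : ℂ => ‖ζ‖ ^ 2) (𝓝 0)).mul_isLittleO
        ((isLittleO_one_iff ℝ).2 hnorm0)
      simpa using this
    have t2 : (fun ζ => H (v ζ - ζ • w) (v ζ)) =o[𝓝 0] fun ζ => ‖ζ‖ ^ 2 :=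
      ((bil _ _).trans (hrem.norm_left.mul hvO.norm_left)).trans_isLittleO cub
    have t3 : (fun ζ => H (ζ • w) (v ζ - ζ • w)) =o[𝓝 0] fun ζ => ‖ζ‖ ^ 2 := by
      refine ((bil _ _).trans (hlin.norm_left.mul hrem.norm_left)).trans_isLittleO ?_
      simpa only [mul_comm] using cub
    refine (((hT.add t1).add (t2.const_mul_left 2⁻¹)).add (t3.const_mul_left 2⁻¹)).congr_left
      fun ζ => ?_
    have e0 : p + v ζ = x ζ := by simp [hv]
    simp only [Function.comp, e0, hρp, smul_eq_mul]
    have := hcancel ζ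
    have e5 : A (v ζ) = A (ζ • w) + A (ζ ^ 2 • w2) + A (r ζ) := by rw [hvr, map_add, map_add]
    rw [← hA, ← hH, e5]
    simp only [map_sub, sub_apply]
    linarith
  obtain ⟨C, hC, hd⟩ := hc.dM_le hp
  have hxp : Tendsto x (𝓝 0) (𝓝 p) := by
    have := hv0.add_const p
    simpa [hv] using this
  refine (IsBigO.of_bound C ?_ : (fun ζ => dM M (x ζ)) =O[𝓝 0] fun ζ => ρ (x ζ)).trans_isLittleO hρ
  filter_upwards [hxp.eventually hd] with ζ hζ
  rwa [Real.norm_eq_abs, abs_of_nonneg (dM_nonneg _)]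

end Osculate

section Nearest
variable {m : ℕ} {M : Set ℂ^m}

theorem closure_subset_insert (hM : IsProjectiveClosedSet M) : closure M ⊆ insert 0 M :=
  fun z hz => by
    by_cases h : z = 0
    · exact .inl h
    · exact .inr (hM.2.2.2 z hz h)

theorem dM_smul_le (hM : IsProjectiveClosedSet M) {c : ℂ} (hc : c ≠ 0) (z : ℂ^m) :
    dM M (c • z) ≤ ‖c‖ * dM M z := by
  refine le_of_forall_pos_le_add fun ε hε => ?_
  have hc' : 0 < ‖c‖ := norm_pos_iff.2 hc
  obtain ⟨x, hx, hxz⟩ := exists_near hM.1 (show dM M z < dM M z + ε / ‖c‖ by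
    linarith [div_pos hε hc'])
  refine (dM_le (hM.2.2.1 c hc x hx) _).trans ?_
  rw [← smul_sub, eu_smul]
  calc ‖c‖ * eu (z - x) ≤ ‖c‖ * (dM M z + ε / ‖c‖) := by gcongr
    _ = _ := by field_simp

theorem dM_smul (hM : IsProjectiveClosedSet M) {c : ℂ} (hc : c ≠ 0) (z : ℂ^m) :
    dM M (c • z) = ‖c‖ * dM M z := by
  refine (dM_smul_le hM hc z).antisymm ?_
  have := dM_smul_le hM (inv_ne_zero hc) (c • z)
  rw [inv_smul_smul₀ hc, norm_inv, ← div_eq_inv_mul, le_div_iff₀ (norm_pos_iff.2 hc)] at this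
  rwa [mul_comm]

theorem dM_pos (hM : IsProjectiveClosedSet M) {z : ℂ^m} (hz : z ≠ 0) (hzM : z ∉ M) :
    0 < dM M z := by
  have h : z ∉ closure M := fun h => hzM (hM.2.2.2 z h hz)
  refine (infDist_pos_iff_notMem_closure (hM.1.image _)).1 fun h' => h ?_
  have := (mem_image_of_mem (WithLp.ofLp (p := 2) (V := Fin m → ℂ)) h')
  have h2 := (image_closure_subset_closure_image (PiLp.continuous_ofLp 2 _)) this
  rwa [image_image, image_id'] at h2

theorem exists_nearest_closure (hM : IsProjectiveClosedSet M) (z : ℂ^m) :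
    ∃ q ∈ insert 0 M, eu (z - q) = dM M z := by
  obtain ⟨y, hy, hyd⟩ := isClosed_closure.exists_infDist_eq_dist
    ((hM.1.image (WithLp.toLp (V := Fin m → ℂ) 2)).closure) (WithLp.toLp 2 z)
  rw [infDist_closure] at hyd
  refine ⟨WithLp.ofLp y, closure_subset_insert hM ?_, ?_⟩
  · have := (mem_image_of_mem (WithLp.ofLp (p := 2) (V := Fin m → ℂ)) hy)
    have h2 := (image_closure_subset_closure_image (PiLp.continuous_ofLp 2 _)) this
    rwa [image_image, image_id'] at h2
  · rw [eu, WithLp.toLp_sub, ← dist_eq_norm]; exact hyd.symm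

/-- The Hermitian product. -/
def herm (z w : ℂ^m) : ℂ := ∑ j, z j * conj (w j)

theorem herm_add (z v w : ℂ^m) : herm (z + v) w = herm z w + herm v w := by
  simp [herm, add_mul, Finset.sum_add_distrib]

theorem herm_smul (c : ℂ) (z w : ℂ^m) : herm (c • z) w = c * herm z w := by
  simp [herm, Finset.mul_sum, mul_assoc]

theorem herm_self (z : ℂ^m) : herm z z = (eu z ^ 2 : ℝ) := by
  rw [eu_sq, herm]; push_cast
  exact Finset.sum_congr rfl fun j _ => mul_conj' _

theorem eu_add_sq (z w : ℂ^m) :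
    eu (z + w) ^ 2 = eu z ^ 2 + 2 * (herm w z).re + eu w ^ 2 := by
  simp only [eu_sq, herm, re_sum, Finset.mul_sum, ← Finset.sum_add_distrib]
  refine Finset.sum_congr rfl fun j _ => ?_
  simp only [Pi.add_apply, ← Complex.normSq_eq_norm_sq, normSq_apply, add_re, add_im, mul_re,
    conj_re, conj_im]
  ring

theorem exists_not_orthogonal (hM : IsProjectiveClosedSet M)
    (hL : IsSmoothLeviFlatHypersurface M) {z : ℂ^m} (hz : z ≠ 0) :
    ∃ p ∈ M, herm p z ≠ 0 := by
  by_contra! h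
  obtain ⟨p, hp⟩ := hM.1
  obtain ⟨ρ, hc⟩ := exists_chart hL hp
  set A := fderiv ℝ ρ p
  have hzz : herm z z ≠ 0 := by
    rw [herm_self]; exact ofReal_ne_zero.2 (pow_ne_zero 2 (eu_pos hz).ne')
  obtain ⟨e, he, hez⟩ : ∃ e, A e ≠ 0 ∧ herm e z ≠ 0 := by
    obtain ⟨e, he⟩ : ∃ e, A e ≠ 0 := by
      by_contra! h
      exact hc.grad (by ext v; exact h v)
    by_cases hez : herm e z = 0
    · by_cases hAz : A z = 0
      · refine ⟨e + z, by rwa [map_add, hAz, add_zero], by rwa [herm_add, hez, zero_add]⟩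
      · exact ⟨z, hAz, hzz⟩
    · exact ⟨e, he, hez⟩
  have hd : HasDerivAt (fun t : ℝ => ρ (p + (t : ℂ) • e)) (A e) 0 := by
    have h1 : HasDerivAt (fun t : ℝ => p + (t : ℂ) • e) e 0 := by
      simpa using ((ofRealCLM.hasDerivAt (x := (0 : ℝ))).smul_const e).const_add p
    have h2 : HasFDerivAt ρ A (p + ((0 : ℝ) : ℂ) • e) := by
      simpa using (hc.smooth.differentiableAt (by simp)).hasFDerivAt
    exact h2.comp_hasDerivAt 0 h1
  have hρp : ρ p = 0 := hc.zero.self_of_nhds.1 hp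
  have hs := hasDerivAt_iff_tendsto_slope_zero.1 hd
  simp only [zero_add, ofReal_zero, zero_smul, add_zero, hρp, sub_zero, smul_eq_mul] at hs
  have hneg : Tendsto (fun t : ℝ => -t) (𝓝[≠] 0) (𝓝[≠] 0) := by
    refine tendsto_nhdsWithin_iff.2 ⟨?_, ?_⟩
    · exact ((continuous_neg.tendsto' 0 0 neg_zero).mono_left nhdsWithin_le_nhds)
    · filter_upwards [self_mem_nhdsWithin] with t ht using neg_ne_zero.2 ht
  have hprod := hs.mul (hs.comp hneg)
  have hpos := (hprod.eventually (lt_mem_nhds (mul_self_pos.2 he))).filter_mono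
    (nhdsGT_le_nhdsNE 0)
  have hcont : ∀ᶠ y in 𝓝 p, ContinuousAt ρ y :=
    ((contDiffAt_infty.1 hc.smooth 1).eventually (by simp)).mono fun y hy => hy.continuousAt
  obtain ⟨r, hr, hr'⟩ := eventually_nhds_iff_ball.1 (hc.zero.and hcont)
  have hsmall : ∀ᶠ t : ℝ in 𝓝[>] 0, t * ‖e‖ < r :=
    ((Continuous.tendsto' (by fun_prop) 0 0 (by simp) :
      Tendsto (fun t : ℝ => t * ‖e‖) (𝓝 0) (𝓝 0)).mono_left nhdsWithin_le_nhds).eventually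
      (gt_mem_nhds hr)
  obtain ⟨t, htp, htr, ht0⟩ := (hpos.and (hsmall.and eventually_mem_nhdsWithin)).exists
  have ht0 : 0 < t := ht0
  have hball : ∀ θ : ℝ, p + (t * exp (θ * I)) • e ∈ ball p r := fun θ => by
    rw [mem_ball_iff_norm, add_sub_cancel_left, norm_smul, norm_mul, norm_exp_ofReal_mul_I,
      norm_real, mul_one, Real.norm_eq_abs, abs_of_pos ht0]
    exact htr
  have hf : Continuous fun θ : ℝ => ρ (p + (t * exp (θ * I)) • e) := by
    refine continuous_iff_continuousAt.2 fun θ => ?_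
    exact (hr' _ (hball θ)).2.comp (f := fun θ : ℝ => p + (t * exp (θ * I)) • e) (by fun_prop)
  have hmem : (0 : ℝ) ∈ uIcc (ρ (p + (t * exp ((0 : ℝ) * I)) • e))
      (ρ (p + (t * exp ((Real.pi : ℝ) * I)) • e)) := by
    rw [exp_pi_mul_I, ofReal_zero, zero_mul, exp_zero, mul_one, mul_neg_one]
    simp only [Function.comp, ofReal_neg] at htp
    have h3 : ρ (p + (t : ℂ) • e) * ρ (p + (-t : ℂ) • e) < 0 := by
      have h4 : ρ (p + (t : ℂ) • e) * ρ (p + (-t : ℂ) • e) = -(t ^ 2) *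
        (t⁻¹ * ρ (p + (t : ℂ) • e) * ((-t)⁻¹ * ρ (p + (-t : ℂ) • e))) := by
        field_simp
      rw [h4]
      nlinarith [sq_pos_of_pos ht0]
    rcases mul_neg_iff.1 h3 with h5 | h5
    · exact mem_uIcc.2 (.inr ⟨h5.2.le, h5.1.le⟩)
    · exact mem_uIcc.2 (.inl ⟨h5.1.le, h5.2.le⟩)
  obtain ⟨θ, -, hθ⟩ := intermediate_value_uIcc hf.continuousOn hmem
  have := h _ ((hr' _ (hball θ)).1.2 hθ)
  rw [herm_add, h p hp, zero_add, herm_smul] at this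
  exact mul_ne_zero (mul_ne_zero (ofReal_ne_zero.2 ht0.ne') (exp_ne_zero _)) hez this

theorem dM_lt_eu (hM : IsProjectiveClosedSet M) (hL : IsSmoothLeviFlatHypersurface M)
    {z : ℂ^m} (hz : z ≠ 0) : dM M z < eu z := by
  obtain ⟨p, hp, hpz⟩ := exists_not_orthogonal hM hL hz
  have hp0 := eu_pos (hM.2.1 p hp)
  set c : ℂ := - conj (herm p z) / (eu p ^ 2 : ℝ) with hcdef
  have hp2 : ((eu p ^ 2 : ℝ) : ℂ) ≠ 0 := ofReal_ne_zero.2 (by positivity)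
  have hc : c ≠ 0 := div_ne_zero (neg_ne_zero.2 ((map_ne_zero _).2 hpz)) hp2
  refine (dM_le (hM.2.2.1 (-c) (neg_ne_zero.2 hc) p hp) z).trans_lt ?_
  refine lt_of_pow_lt_pow_left₀ 2 (eu_nonneg z) ?_
  rw [neg_smul, sub_neg_eq_add, eu_add_sq, herm_smul, eu_smul]
  have h1 : (c * herm p z).re = - ‖herm p z‖ ^ 2 / eu p ^ 2 := by
    have : c * herm p z = ((- ‖herm p z‖ ^ 2 / eu p ^ 2 : ℝ) : ℂ) := by
      rw [hcdef, div_mul_eq_mul_div, neg_mul, mul_comm, mul_conj']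
      push_cast; rfl
    rw [this, ofReal_re]
  have h2 : ‖c‖ = ‖herm p z‖ / eu p ^ 2 := by
    rw [hcdef, norm_div, norm_neg, RCLike.norm_conj, norm_real, Real.norm_eq_abs,
      abs_of_pos (by positivity)]
  rw [h1, h2]
  have h3 : 0 < ‖herm p z‖ := norm_pos_iff.2 hpz
  have h4 : (‖herm p z‖ / eu p ^ 2 * eu p) ^ 2 = ‖herm p z‖ ^ 2 / eu p ^ 2 := by
    field_simp
  rw [h4, neg_div]
  have : 0 < ‖herm p z‖ ^ 2 / eu p ^ 2 := by positivity
  linarith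

theorem exists_nearest (hM : IsProjectiveClosedSet M) (hL : IsSmoothLeviFlatHypersurface M)
    {z : ℂ^m} (hz : z ≠ 0) : ∃ q ∈ M, eu (z - q) = dM M z := by
  obtain ⟨q, hq, hqd⟩ := exists_nearest_closure hM z
  rcases hq with rfl | hq
  · rw [sub_zero] at hqd
    exact absurd hqd (dM_lt_eu hM hL hz).ne'
  · exact ⟨q, hq, hqd⟩

end Nearest

section LogDistance
variable {m : ℕ} {M : Set ℂ^m}

theorem fderiv_nearest_ne {z q : ℂ^m} {ρ : ℂ^m → ℝ} (hc : Chart M q ρ)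
    (hq : q ∈ M) (hqz : eu (z - q) = dM M z) (hpos : 0 < dM M z) : fderiv ℝ ρ q (z - q) ≠ 0 := by
  intro h0
  set e := z - q with he
  obtain ⟨C, hC, hd⟩ := hc.dM_le hq
  have hd' : HasDerivAt (fun t : ℝ => ρ (q + (t : ℂ) • e)) 0 0 := by
    have h1 : HasDerivAt (fun t : ℝ => q + (t : ℂ) • e) e 0 := by
      simpa using ((ofRealCLM.hasDerivAt (x := (0 : ℝ))).smul_const e).const_add q
    have h2 : HasFDerivAt ρ (fderiv ℝ ρ q) (q + ((0 : ℝ) : ℂ) • e) := by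
      simpa using (hc.smooth.differentiableAt (by simp)).hasFDerivAt
    have := h2.comp_hasDerivAt 0 h1
    rwa [h0] at this
  have hρp : ρ q = 0 := hc.zero.self_of_nhds.1 hq
  have hs := hasDerivAt_iff_tendsto_slope_zero.1 hd'
  simp only [zero_add, ofReal_zero, zero_smul, add_zero, hρp, sub_zero, smul_eq_mul] at hs
  have hs2 : Tendsto (fun t : ℝ => C * |t⁻¹ * ρ (q + (t : ℂ) • e)|) (𝓝[>] 0) (𝓝 0) := by
    have := ((hs.mono_left (nhdsGT_le_nhdsNE 0)).abs).const_mul C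
    simpa using this
  have hline : Tendsto (fun t : ℝ => q + (t : ℂ) • e) (𝓝[>] 0) (𝓝 q) :=
    (Continuous.tendsto' (by fun_prop) 0 q (by simp)).mono_left nhdsWithin_le_nhds
  have h1 : ∀ᶠ t : ℝ in 𝓝[>] 0, t < 1 := nhdsWithin_le_nhds (gt_mem_nhds one_pos)
  refine absurd (ge_of_tendsto hs2 (b := dM M z) ?_) hpos.not_ge
  filter_upwards [hline.eventually hd, h1, eventually_mem_nhdsWithin] with t ht ht1 (ht0 : 0 < t)
  have h2 := dM_le_add (M := M) z (q + (t : ℂ) • e)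
  have h3 : z - (q + (t : ℂ) • e) = ((1 - t : ℝ) : ℂ) • e := by
    rw [ofReal_sub, ofReal_one, sub_smul, one_smul, he]; abel
  rw [h3, eu_smul, norm_real, Real.norm_eq_abs, abs_of_pos (by linarith), hqz] at h2
  rw [abs_mul, abs_inv, abs_of_pos ht0, mul_left_comm, ← div_eq_inv_mul, le_div_iff₀ ht0]
  nlinarith

theorem exp_two_jet (a b : ℂ) :
    (fun ζ : ℂ => exp (a * ζ + b * ζ ^ 2) - 1 - a * ζ - (b + a ^ 2 / 2) * ζ ^ 2)
      =o[𝓝 0] fun ζ => ‖ζ‖ ^ 2 := by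
  have h0 : Tendsto (fun ζ : ℂ => a * ζ + b * ζ ^ 2) (𝓝 0) (𝓝 0) :=
    Continuous.tendsto' (by fun_prop) 0 0 (by simp)
  have h1 := (Complex.exp_sub_sum_range_succ_isLittleO_pow 2).comp_tendsto h0
  have hO : (fun ζ : ℂ => a * ζ + b * ζ ^ 2) =O[𝓝 0] fun ζ => ζ := by
    have e : (fun ζ : ℂ => a * ζ + b * ζ ^ 2) = fun ζ => (a + b * ζ) * ζ := by ext; ring
    have hb : (fun ζ : ℂ => a + b * ζ) =O[𝓝 0] fun _ => (1 : ℂ) :=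
      (Continuous.tendsto (by fun_prop) (0 : ℂ) : Tendsto (fun ζ : ℂ => a + b * ζ) _ _).isBigO_one ℂ
    rw [e]
    simpa using hb.mul (isBigO_refl (fun ζ : ℂ => ζ) (𝓝 0))
  have h2 := h1.trans_isBigO (show ((fun x : ℂ => x ^ 2) ∘ fun ζ : ℂ => a * ζ + b * ζ ^ 2) =O[𝓝 0]
    fun ζ => ζ ^ 2 from hO.pow 2)
  have h3 : (fun ζ : ℂ => (a * b + b ^ 2 / 2 * ζ) * (ζ * ζ ^ 2)) =o[𝓝 0] fun ζ => ζ ^ 2 := by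
    have hb : (fun ζ : ℂ => a * b + b ^ 2 / 2 * ζ) =O[𝓝 0] fun _ => (1 : ℂ) :=
      (Continuous.tendsto (by fun_prop) (0 : ℂ) :
        Tendsto (fun ζ : ℂ => a * b + b ^ 2 / 2 * ζ) _ _).isBigO_one ℂ
    have hid : (fun ζ : ℂ => ζ) =o[𝓝 0] fun _ => (1 : ℂ) := (isLittleO_one_iff ℂ).2 tendsto_id
    simpa using hb.mul_isLittleO (hid.mul_isBigO (isBigO_refl (fun ζ : ℂ => ζ ^ 2) (𝓝 0)))
  have h4 := (h2.add h3).norm_right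
  simp only [norm_pow] at h4
  refine h4.congr_left fun ζ => ?_
  simp only [Function.comp, Finset.sum_range_succ, Finset.sum_range_zero]
  simp [Nat.factorial]
  ring

/-- The distance to `M` along a quadratic curve is dominated to second order by the modulus of a
nonvanishing holomorphic function. -/
theorem dM_two_jet_le (hM : IsProjectiveClosedSet M) (hL : IsSmoothLeviFlatHypersurface M)
    {z : ℂ^m} (hz : z ≠ 0) (hzM : z ∉ M) (w w2 : ℂ^m) :
    ∃ a b : ℂ, ∀ ε > 0, ∀ᶠ ζ : ℂ in 𝓝 0, dM M (z + ζ • w + ζ ^ 2 • w2) ≤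
      dM M z * Real.exp (a * ζ + b * ζ ^ 2).re + ε * ‖ζ‖ ^ 2 := by
  obtain ⟨q, hq, hqz⟩ := exists_nearest hM hL hz
  obtain ⟨ρ, hc⟩ := exists_chart hL hq
  have hpos := dM_pos hM hz hzM
  set e := z - q with he
  have hLe : clin ρ q e ≠ 0 := fun h => fderiv_nearest_ne hc hq hqz hpos (by
    rw [← re_clin, h, zero_re])
  set a := clin ρ q w / clin ρ q e with ha
  have hw : clin ρ q (w - a • e) = 0 := by
    rw [map_sub, map_smul, smul_eq_mul, ha, div_mul_cancel₀ _ hLe, sub_self]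
  obtain ⟨B, hB⟩ := hc.osculate hq hw
  set b := (clin ρ q w2 + B) / clin ρ q e - a ^ 2 / 2 with hb
  have hw2 : clin ρ q (w2 - (b + a ^ 2 / 2) • e) = -B := by
    rw [map_sub, map_smul, smul_eq_mul, hb, sub_add_cancel, div_mul_cancel₀ _ hLe]; ring
  refine ⟨a, b, fun ε hε => ?_⟩
  have key := hB (fun ζ => z + ζ • w + ζ ^ 2 • w2 - exp (a * ζ + b * ζ ^ 2) • e) _ hw2 (by
    have := ((exp_two_jet a b).neg_left.norm_left).const_mul_left ‖e‖
    refine (IsBigO.of_bound 1 (.of_forall fun ζ => ?_)).trans_isLittleO this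
    have h3 : z + ζ • w + ζ ^ 2 • w2 - exp (a * ζ + b * ζ ^ 2) • e - q - ζ • (w - a • e) -
        ζ ^ 2 • (w2 - (b + a ^ 2 / 2) • e) =
        (-(exp (a * ζ + b * ζ ^ 2) - 1 - a * ζ - (b + a ^ 2 / 2) * ζ ^ 2)) • e := by
      have : q = z - e := by rw [he]; abel
      rw [this]
      module
    rw [h3, norm_smul, one_mul, Real.norm_eq_abs, abs_mul, abs_norm, abs_norm, mul_comm])
  filter_upwards [key.def hε] with ζ hζ
  rw [Real.norm_eq_abs, abs_of_nonneg (dM_nonneg _), Real.norm_eq_abs,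
    abs_of_nonneg (by positivity)] at hζ
  refine (dM_le_add _ (z + ζ • w + ζ ^ 2 • w2 - exp (a * ζ + b * ζ ^ 2) • e)).trans ?_
  rw [sub_sub_cancel, eu_smul, norm_exp, hqz, mul_comm (Real.exp _)]
  linarith

theorem log_le_of_le {d R s δ ε : ℝ} (hd : 0 < d) (hδ : 0 < δ) (hR : |R| ≤ 1) (hs : 0 ≤ s)
    (hε : 0 ≤ ε) (h : d ≤ δ * Real.exp R + ε * s) : Real.log d ≤ Real.log δ + R + ε * 3 / δ * s := by
  have h1 : Real.log d ≤ Real.log (δ * Real.exp R * Real.exp (ε * 3 / δ * s)) := by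
    refine Real.log_le_log hd (h.trans ?_)
    have h2 := Real.add_one_le_exp (ε * 3 / δ * s)
    have h3 : 1 / 3 ≤ Real.exp R := by
      have : Real.exp (-1) ≤ Real.exp R := Real.exp_le_exp.2 (abs_le.1 hR).1
      have h4 := Real.exp_one_lt_three
      rw [Real.exp_neg] at this
      have h5 : (1 / 3 : ℝ) ≤ (Real.exp 1)⁻¹ := by
        rw [one_div]; exact inv_anti₀ (Real.exp_pos 1) h4.le
      linarith
    have h6 : δ * Real.exp R * (ε * 3 / δ * s + 1) ≤
      δ * Real.exp R * Real.exp (ε * 3 / δ * s) := by gcongr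
    have h7 : δ * Real.exp R * (ε * 3 / δ * s + 1) = δ * Real.exp R + Real.exp R * 3 * (ε * s) := by
      field_simp
      ring
    nlinarith [mul_nonneg hε hs]
  rwa [mul_assoc, ← Real.exp_add, Real.log_mul hδ.ne' (Real.exp_pos _).ne', Real.log_exp,
    ← add_assoc] at h1

/-- Averaging the logarithm of the previous estimate. -/
theorem log_dM_two_jet (hM : IsProjectiveClosedSet M) (hL : IsSmoothLeviFlatHypersurface M)
    {z : ℂ^m} (hz : z ≠ 0) (hzM : z ∉ M) (w w2 : ℂ^m) :
    ∃ a b : ℂ, ∀ ε > 0, ∀ᶠ ζ : ℂ in 𝓝 0, ∀ d : ℝ, 0 < d → d ≤ dM M (z + ζ • w + ζ ^ 2 • w2)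
      + ε * ‖ζ‖ ^ 2 →
      Real.log d ≤ Real.log (dM M z) + (a * ζ + b * ζ ^ 2).re + 6 * ε / dM M z * ‖ζ‖ ^ 2 := by
  obtain ⟨a, b, h⟩ := dM_two_jet_le hM hL hz hzM w w2
  refine ⟨a, b, fun ε hε => ?_⟩
  have h0 : Tendsto (fun ζ : ℂ => |(a * ζ + b * ζ ^ 2).re|) (𝓝 0) (𝓝 0) :=
    Continuous.tendsto' (by fun_prop) 0 0 (by simp)
  filter_upwards [h ε hε, h0.eventually (gt_mem_nhds one_pos)] with ζ h1 h2 d hd hdle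
  have := log_le_of_le hd (dM_pos hM hz hzM) h2.le (by positivity : 0 ≤ ‖ζ‖ ^ 2)
    (by positivity : 0 ≤ 2 * ε) (by linarith)
  convert this using 2
  ring

theorem psh_neg_log_dM (hM : IsProjectiveClosedSet M) (hL : IsSmoothLeviFlatHypersurface M) :
    Psh (fun z => -Real.log (dM M z)) {z | z ≠ 0 ∧ z ∉ M} := by
  refine ⟨fun z hz => ((continuous_dM.continuousAt.log
    (dM_pos hM hz.1 hz.2).ne').neg).continuousWithinAt, fun z hz w ε hε => ?_⟩
  have hpos := dM_pos hM hz.1 hz.2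
  obtain ⟨a, b, h⟩ := log_dM_two_jet hM hL hz.1 hz.2 w 0
  have h1 := h (ε * dM M z / 24) (by positivity)
  have hline : Tendsto (fun ζ : ℂ => z + ζ • w) (𝓝 0) (𝓝 z) :=
    Continuous.tendsto' (by fun_prop) 0 z (by simp)
  have h2 : ∀ᶠ ζ : ℂ in 𝓝 0, 0 < dM M (z + ζ • w) :=
    hline.eventually (continuous_dM.continuousAt.eventually (lt_mem_nhds hpos))
  filter_upwards [eventually_four (h1.and h2), eventually_mem_nhdsWithin] with t ht (ht0 : 0 < t)
  have aux : ∀ ζ : ℂ, ‖ζ‖ = t → ((∀ d : ℝ, 0 < d → d ≤ dM M (z + ζ • w + ζ ^ 2 • (0 : ℂ^m))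
      + ε * dM M z / 24 * ‖ζ‖ ^ 2 → Real.log d ≤ Real.log (dM M z) + (a * ζ + b * ζ ^ 2).re +
        6 * (ε * dM M z / 24) / dM M z * ‖ζ‖ ^ 2) ∧ 0 < dM M (z + ζ • w)) →
      -Real.log (dM M z) - (a * ζ + b * ζ ^ 2).re - ε / 4 * t ^ 2 ≤
        -Real.log (dM M (z + ζ • w)) := fun ζ hζ h => by
    have h0 : 0 ≤ ε * dM M z / 24 * ‖ζ‖ ^ 2 := by positivity
    have := h.1 _ h.2 (by rw [smul_zero, add_zero]; linarith)
    have e1 : 6 * (ε * dM M z / 24) / dM M z = ε / 4 := by field_simp; norm_num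
    rw [e1, hζ] at this
    linarith
  have nt : ‖(t : ℂ)‖ = t := Complex.norm_of_nonneg ht0.le
  have k1 := aux _ nt ht.1
  have k2 := aux (I * t) (by simp [abs_of_pos ht0]) ht.2.1
  have k3 := aux (-t) (by rw [norm_neg, nt]) ht.2.2.1
  have k4 := aux (-(I * t)) (by simp [abs_of_pos ht0]) ht.2.2.2
  have hsum := re_four_sum a b t
  simp only [zero_smul, add_zero]
  linarith

end LogDistance

section Frankel
variable {m : ℕ} {M N : Set ℂ^m}

theorem IsProjectiveClosedSet.exists_norm_one (hM : IsProjectiveClosedSet M) {x : ℂ^m}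
    (hx : x ∈ M) : ∃ c : ℂ, c ≠ 0 ∧ ‖c • x‖ = 1 ∧ c • x ∈ M := by
  have h0 : ‖x‖ ≠ 0 := norm_ne_zero_iff.2 (hM.2.1 x hx)
  have hc : ((‖x‖⁻¹ : ℝ) : ℂ) ≠ 0 := ofReal_ne_zero.2 (inv_ne_zero h0)
  refine ⟨_, hc, ?_, hM.2.2.1 _ hc x hx⟩
  rw [norm_smul, norm_real, norm_inv, norm_norm, inv_mul_cancel₀ h0]

theorem IsProjectiveClosedSet.isCompact_sphere (hM : IsProjectiveClosedSet M) :
    IsCompact {x | x ∈ M ∧ ‖x‖ = 1} := by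
  have : {x | x ∈ M ∧ ‖x‖ = 1} = closure M ∩ sphere 0 1 := by
    ext x
    simp only [mem_inter_iff, mem_sphere_zero_iff_norm]
    refine ⟨fun h => ⟨subset_closure h.1, h.2⟩, fun h => ⟨hM.2.2.2 x h.1 ?_, h.2⟩⟩
    rintro rfl
    simpa using h.2
  rw [this]
  exact (_root_.isCompact_sphere 0 1).inter_left isClosed_closure

theorem sub_sq_le_log {y : ℝ} (hy : -(1 / 2) ≤ y) : y - 2 * y ^ 2 ≤ Real.log (1 + y) := by
  have h := Real.one_sub_inv_le_log_of_pos (show 0 < 1 + y by linarith)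
  refine le_trans ?_ h
  have : 0 < 1 + y := by linarith
  rw [← sub_nonneg]
  have e : 1 - (1 + y)⁻¹ - (y - 2 * y ^ 2) = y ^ 2 * (1 + 2 * y) / (1 + y) := by
    field_simp
    ring
  rw [e]
  have : 0 ≤ 1 + 2 * y := by linarith
  positivity

theorem sum_log_eu_ge {q w w2 : ℂ^m} (hq : q ≠ 0) (hwq : herm w q = 0) :
    ∀ ε > 0, ∀ᶠ t : ℝ in 𝓝[>] 0,
      (2 * eu w ^ 2 / eu q ^ 2 - ε) * t ^ 2 + 4 * Real.log (eu q) ≤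
        Real.log (eu (q + (t : ℂ) • w + (t : ℂ) ^ 2 • w2)) +
        Real.log (eu (q + (I * t) • w + (I * t) ^ 2 • w2)) +
        Real.log (eu (q + (-t : ℂ) • w + (-t : ℂ) ^ 2 • w2)) +
        Real.log (eu (q + (-(I * t)) • w + (-(I * t)) ^ 2 • w2)) := by
  intro ε hε
  have hQ := eu_pos hq
  set Q := eu q ^ 2 with hQd
  have hQ2 : 0 < Q := by positivity
  set C := (2 * ‖herm w2 q‖ + (eu w + eu w2) ^ 2) / Q with hC
  have hC0 : 0 ≤ C := by positivity
  have hs1 : Tendsto (fun t : ℝ => C * t ^ 2) (𝓝[>] 0) (𝓝 0) :=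
    (Continuous.tendsto' (by fun_prop) 0 0 (by simp)).mono_left nhdsWithin_le_nhds
  have hs2 : Tendsto (fun t : ℝ => 4 * C ^ 2 * t ^ 2) (𝓝[>] 0) (𝓝 0) :=
    (Continuous.tendsto' (by fun_prop) 0 0 (by simp)).mono_left nhdsWithin_le_nhds
  have h1 : ∀ᶠ t : ℝ in 𝓝[>] 0, t < 1 := nhdsWithin_le_nhds (gt_mem_nhds one_pos)
  filter_upwards [hs1.eventually (gt_mem_nhds (show (0:ℝ) < 1 / 2 by norm_num)),
    hs2.eventually (gt_mem_nhds hε), h1, eventually_mem_nhdsWithin] with t ht1 ht2 htl (ht0 : 0 < t)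
  set X : ℂ → ℝ := fun ζ => 2 * (ζ ^ 2 * herm w2 q).re + eu (ζ • w + ζ ^ 2 • w2) ^ 2 with hX
  have hXe : ∀ ζ : ℂ, eu (q + ζ • w + ζ ^ 2 • w2) ^ 2 = Q * (1 + X ζ / Q) := fun ζ => by
    rw [add_assoc, eu_add_sq, herm_add, herm_smul, hwq, mul_zero, zero_add, herm_smul, hX]
    field_simp
    ring
  have hXb : ∀ ζ : ℂ, ‖ζ‖ = t → |X ζ / Q| ≤ C * t ^ 2 := fun ζ hζ => by
    rw [abs_div, abs_of_pos hQ2, hC, div_mul_eq_mul_div]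
    gcongr
    have a1 : |(ζ ^ 2 * herm w2 q).re| ≤ t ^ 2 * ‖herm w2 q‖ := by
      refine (abs_re_le_norm _).trans_eq ?_
      rw [norm_mul, norm_pow, hζ]
    have a2 : eu (ζ • w + ζ ^ 2 • w2) ≤ t * (eu w + eu w2) := by
      refine (eu_add_le _ _).trans ?_
      rw [eu_smul, eu_smul, norm_pow, hζ]
      nlinarith [mul_nonneg (mul_nonneg ht0.le (sub_nonneg.2 htl.le)) (eu_nonneg w2)]
    have a3 : eu (ζ • w + ζ ^ 2 • w2) ^ 2 ≤ (t * (eu w + eu w2)) ^ 2 :=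
      pow_le_pow_left₀ (eu_nonneg _) a2 2
    rw [abs_le] at a1 ⊢
    simp only [hX]
    constructor
    · nlinarith [sq_nonneg (eu (ζ • w + ζ ^ 2 • w2)), sq_nonneg (t * (eu w + eu w2))]
    · nlinarith
  have hlog : ∀ ζ : ℂ, ‖ζ‖ = t → Real.log (eu q) + (X ζ / Q - 2 * (C * t ^ 2) ^ 2) / 2 ≤
      Real.log (eu (q + ζ • w + ζ ^ 2 • w2)) := fun ζ hζ => by
    have b := hXb ζ hζ
    have b1 := sub_sq_le_log (y := X ζ / Q) (by linarith [(abs_le.1 b).1])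
    have b2 : (X ζ / Q) ^ 2 ≤ (C * t ^ 2) ^ 2 := sq_le_sq' (by linarith [(abs_le.1 b).1]) (abs_le.1 b).2
    have b3 : 0 < 1 + X ζ / Q := by linarith [(abs_le.1 b).1]
    have b4 : 2 * Real.log (eu (q + ζ • w + ζ ^ 2 • w2)) = 2 * Real.log (eu q)
        + Real.log (1 + X ζ / Q) := by
      have := congrArg Real.log (hXe ζ)
      rw [Real.log_mul hQ2.ne' b3.ne', Real.log_pow, hQd, Real.log_pow] at this
      exact_mod_cast this
    linarith
  have nt : ‖(t : ℂ)‖ = t := Complex.norm_of_nonneg ht0.le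
  have k1 := hlog _ nt
  have k2 := hlog (I * t) (by simp [abs_of_pos ht0])
  have k3 := hlog (-t) (by rw [norm_neg, nt])
  have k4 := hlog (-(I * t)) (by simp [abs_of_pos ht0])
  have par : ∀ v u : ℂ^m, eu (v + u) ^ 2 + eu (-v + u) ^ 2 ≥ 2 * eu v ^ 2 := fun v u => by
    have hn : eu (-v) = eu v := by rw [← neg_one_smul ℂ v, eu_smul]; simp
    have : herm u (-v) = - herm u v := by simp [herm]
    rw [eu_add_sq, eu_add_sq, hn, this, neg_re]
    nlinarith [sq_nonneg (eu u)]
  have hsum : 4 * t ^ 2 * eu w ^ 2 ≤ X t + X (I * t) + X (-t) + X (-(I * t)) := by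
    have p1 := par ((t : ℂ) • w) ((t : ℂ) ^ 2 • w2)
    have p2 := par ((I * t) • w) ((I * t) ^ 2 • w2)
    rw [eu_smul, nt] at p1
    rw [eu_smul, norm_mul, norm_I, one_mul, nt] at p2
    simp only [hX, neg_sq, neg_smul]
    have : (I * (t : ℂ)) ^ 2 = -(t : ℂ) ^ 2 := by rw [mul_pow, I_sq]; ring
    rw [this, neg_mul, neg_re]
    rw [this] at p2
    nlinarith
  have hsumQ : 4 * (eu w ^ 2 / Q) * t ^ 2 ≤
      X t / Q + X (I * t) / Q + X (-t) / Q + X (-(I * t)) / Q := by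
    rw [← add_div, ← add_div, ← add_div, le_div_iff₀ hQ2]
    refine le_trans (le_of_eq ?_) hsum
    field_simp
  have hfin : 4 * (C * t ^ 2) ^ 2 ≤ ε * t ^ 2 := by nlinarith [sq_nonneg t]
  have : 2 * eu w ^ 2 / Q = 2 * (eu w ^ 2 / Q) := by ring
  rw [this]
  linarith

theorem exists_tangent_orthogonal (hm : 3 ≤ m) (f : ℂ^m →ₗ[ℂ] ℂ) (q : ℂ^m) :
    ∃ w : ℂ^m, w ≠ 0 ∧ f w = 0 ∧ herm w q = 0 := by
  let h : ℂ^m →ₗ[ℂ] ℂ :=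
    { toFun := fun w => herm w q
      map_add' := fun v w => herm_add v w q
      map_smul' := fun c w => herm_smul c w q }
  have hk : LinearMap.ker (f.prod h) ≠ ⊥ := LinearMap.ker_ne_bot_of_finrank_lt (by
    simp; omega)
  obtain ⟨w, hw, hw0⟩ := Submodule.exists_mem_ne_zero_of_ne_bot hk
  have := LinearMap.mem_ker.1 hw
  exact ⟨w, hw0, congrArg Prod.fst this, congrArg Prod.snd this⟩

/-- Two closed Levi-flat hypersurfaces of projective space of dimension at least two meet. -/
theorem inter_nonempty_of_leviFlat (hm : 3 ≤ m) (hM : IsProjectiveClosedSet M)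
    (hLM : IsSmoothLeviFlatHypersurface M) (hN : IsProjectiveClosedSet N)
    (hLN : IsSmoothLeviFlatHypersurface N) : (M ∩ N).Nonempty := by
  by_contra hdis
  have hNM : ∀ x ∈ N, x ∉ M := fun x hx hx' => hdis ⟨x, hx', hx⟩
  have hpos : ∀ x ∈ N, 0 < dM M x := fun x hx => dM_pos hM (hN.2.1 x hx) (hNM x hx)
  obtain ⟨x0, hx0⟩ := hN.1
  obtain ⟨c0, -, hc1, hc2⟩ := IsProjectiveClosedSet.exists_norm_one hN hx0
  obtain ⟨q, ⟨hq, -⟩, hqmin⟩ := (IsProjectiveClosedSet.isCompact_sphere hN).exists_isMinOn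
    ⟨_, hc2, hc1⟩ (f := fun x => dM M x / eu x) (continuous_dM.continuousOn.div
      continuous_eu.continuousOn fun x hx => (eu_pos (hN.2.1 x hx.1)).ne')
  have hq0 := hN.2.1 q hq
  have hqp := eu_pos hq0
  set μ := dM M q / eu q with hμ
  have hμ0 : 0 < μ := div_pos (hpos q hq) hqp
  have hmin : ∀ x ∈ N, μ * eu x ≤ dM M x := fun x hx => by
    obtain ⟨c, hc, h1, h2⟩ := IsProjectiveClosedSet.exists_norm_one hN hx
    have h3 : μ ≤ dM M (c • x) / eu (c • x) := hqmin ⟨h2, h1⟩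
    rwa [dM_smul hM hc, eu_smul, mul_div_mul_left _ _ (norm_ne_zero_iff.2 hc),
      le_div_iff₀ (eu_pos (hN.2.1 x hx))] at h3
  have hmin' : ∀ y, μ * eu y ≤ dM M y + (1 + μ) * dM N y := fun y => by
    refine le_of_forall_pos_le_add fun ε hε => ?_
    obtain ⟨x, hx, hxy⟩ := exists_near hN.1 (show dM N y < dM N y + ε / (1 + μ) by
      linarith [div_pos hε (show 0 < 1 + μ by linarith)])
    have h1 := hmin x hx
    have h2 := dM_le_add (M := M) x y
    have h3 := eu_add_le x (y - x)
    rw [add_sub_cancel] at h3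
    rw [eu_sub_comm] at h2
    have h4 : (1 + μ) * eu (y - x) ≤ (1 + μ) * (dM N y + ε / (1 + μ)) := by gcongr
    have h5 : (1 + μ) * (dM N y + ε / (1 + μ)) = (1 + μ) * dM N y + ε := by field_simp
    nlinarith
  obtain ⟨ρ, hc⟩ := exists_chart hLN hq
  obtain ⟨w, hw0, hw, hwq⟩ := exists_tangent_orthogonal hm (clin ρ q) q
  obtain ⟨B, hB⟩ := hc.osculate hq hw
  obtain ⟨w2, hw2⟩ : ∃ w2, clin ρ q w2 = -B := by
    obtain ⟨e, he⟩ : ∃ e, clin ρ q e ≠ 0 := by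
      by_contra! h
      refine hc.grad ?_
      ext v
      rw [← re_clin, h v]; rfl
    exact ⟨(-B / clin ρ q e) • e, by rw [map_smul, smul_eq_mul, div_mul_cancel₀ _ he]⟩
  have hjet := hB (fun ζ => q + ζ • w + ζ ^ 2 • w2) w2 hw2 (by
    refine (isLittleO_zero _ _).congr_left fun ζ => ?_
    abel)
  obtain ⟨a, b, hab⟩ := log_dM_two_jet hM hLM hq0 (hNM q hq) w w2
  have hd0 := hpos q hq
  have hW := eu_pos hw0
  set η := eu w ^ 2 / eu q ^ 2 with hη
  have hη0 : 0 < η := by positivity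
  have hz : ∀ᶠ ζ : ℂ in 𝓝 0, 0 < eu (q + ζ • w + ζ ^ 2 • w2) ∧
      Real.log (eu (q + ζ • w + ζ ^ 2 • w2)) ≤ Real.log (eu q) + (a * ζ + b * ζ ^ 2).re
        + η / 8 * ‖ζ‖ ^ 2 := by
    have hcont : Tendsto (fun ζ : ℂ => eu (q + ζ • w + ζ ^ 2 • w2)) (𝓝 0) (𝓝 (eu q)) :=
      (continuous_eu.comp (by fun_prop)).tendsto' 0 _ (by simp)
    have hε : 0 < η * dM M q / 48 := by positivity
    filter_upwards [hab _ hε, hcont.eventually (lt_mem_nhds hqp),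
      hjet.def (show 0 < η * dM M q / 48 / (1 + μ) by positivity)] with ζ h1 h2 h3
    refine ⟨h2, ?_⟩
    rw [Real.norm_eq_abs, abs_of_nonneg (dM_nonneg _), Real.norm_eq_abs,
      abs_of_nonneg (by positivity)] at h3
    have h4 := h1 (μ * eu (q + ζ • w + ζ ^ 2 • w2)) (by positivity) (by
      refine (hmin' _).trans ?_
      have : (1 + μ) * dM N (q + ζ • w + ζ ^ 2 • w2) ≤
          (1 + μ) * (η * dM M q / 48 / (1 + μ) * ‖ζ‖ ^ 2) := by gcongr
      have e : (1 + μ) * (η * dM M q / 48 / (1 + μ) * ‖ζ‖ ^ 2) = η * dM M q / 48 * ‖ζ‖ ^ 2 := by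
        field_simp
      linarith)
    have e1 : dM M q = μ * eu q := by rw [hμ]; field_simp
    have e2 : 6 * (η * dM M q / 48) / dM M q = η / 8 := by field_simp; norm_num
    rw [Real.log_mul hμ0.ne' h2.ne', e2, e1, Real.log_mul hμ0.ne' hqp.ne'] at h4
    linarith
  obtain ⟨t, ht, hlow, ht0⟩ := ((eventually_four hz).and
    ((sum_log_eu_ge (w2 := w2) hq0 hwq η hη0).and eventually_mem_nhdsWithin)).exists
  have ht0 : 0 < t := ht0
  have nt : ‖(t : ℂ)‖ = t := Complex.norm_of_nonneg ht0.le
  have k1 := ht.1.2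
  have k2 := ht.2.1.2
  have k3 := ht.2.2.1.2
  have k4 := ht.2.2.2.2
  rw [norm_neg] at k3 k4
  rw [norm_mul, norm_I, one_mul] at k2 k4
  rw [nt] at k1 k2 k3 k4
  have hsum := re_four_sum a b t
  have e3 : 2 * eu w ^ 2 / eu q ^ 2 = 2 * η := by rw [hη]; ring
  rw [e3] at hlow
  nlinarith [mul_pos hη0 (pow_pos ht0 2)]

end Frankel

section Sides
variable {m : ℕ} {M : Set ℂ^m}

theorem half_neighbourhood {p e : ℂ^m} {r : ℝ} {ρ : ℂ^m → ℝ} (hr : 0 < r)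
    (hc : ContinuousOn ρ (ball p r)) (hp : ρ p = 0)
    (hz : ∀ q ∈ ball p r, q ∈ M ↔ ρ q = 0)
    (hd : ∀ x ∈ ball p r, ∀ t : ℝ, 0 < t → x + (t : ℂ) • e ∈ ball p r →
      ρ x + t ≤ ρ (x + (t : ℂ) • e)) {W : Set ℂ^m} (hW : W ∈ 𝓝 p) :
    ∃ W' ∈ 𝓝 p, ∃ P, IsPreconnected P ∧ P ⊆ W \ M ∧ ∀ y ∈ W', 0 < ρ y → y ∈ P := by
  obtain ⟨r0, hr0, hrW⟩ := Metric.mem_nhds_iff.1 hW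
  set r' := min r r0 with hr'
  have hr'0 : 0 < r' := lt_min hr hr0
  set δ := r' / (4 * (‖e‖ + 1)) with hδ
  have hδ0 : 0 < δ := by positivity
  have hδe : δ * ‖e‖ ≤ r' / 4 := by
    rw [hδ, div_mul_eq_mul_div, div_le_div_iff₀ (by positivity) (by norm_num)]
    nlinarith [norm_nonneg e]
  have hcp : ContinuousAt ρ p := hc.continuousAt (ball_mem_nhds _ hr)
  have h1 : ∀ᶠ y in 𝓝 p, -δ < ρ y :=
    hcp.eventually (lt_mem_nhds (by rw [hp]; linarith))
  obtain ⟨r2, hr2, h2⟩ := eventually_nhds_iff_ball.1 h1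
  set r1 := min r2 (r' / 4) with hr1
  have hr10 : 0 < r1 := lt_min hr2 (by positivity)
  have hball : ∀ y ∈ ball p r1, ∀ t : ℝ, 0 ≤ t → t ≤ δ →
      y + (t : ℂ) • e ∈ ball p r' := by
    intro y hy t ht0 ht
    rw [mem_ball_iff_norm] at hy ⊢
    have : ‖y + (t : ℂ) • e - p‖ ≤ ‖y - p‖ + t * ‖e‖ := by
      rw [show y + (t : ℂ) • e - p = (y - p) + (t : ℂ) • e by abel]
      refine (norm_add_le _ _).trans (le_of_eq ?_)
      rw [norm_smul, norm_real, Real.norm_of_nonneg ht0]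
    have h3 : t * ‖e‖ ≤ δ * ‖e‖ := by gcongr
    have := min_le_right r2 (r' / 4)
    linarith
  have hsub : ball p r' ⊆ ball p r := ball_subset_ball (min_le_left _ _)
  have hge : ∀ y ∈ ball p r1, ∀ t : ℝ, 0 ≤ t → t ≤ δ → ρ y + t ≤ ρ (y + (t : ℂ) • e) := by
    intro y hy t ht0 ht
    rcases ht0.eq_or_lt with rfl | h
    · simp
    · refine hd y (hsub ?_) t h (hsub (hball y hy t ht0 ht))
      simpa using hball y hy 0 le_rfl hδ0.le
  refine ⟨ball p r1, ball_mem_nhds _ hr10,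
    {z | ∃ y ∈ ball p r1, ∃ t : ℝ, 0 ≤ t ∧ t ≤ δ ∧ 0 < ρ y + t ∧ z = y + (t : ℂ) • e},
    ?_, ?_, fun y hy h => ⟨y, hy, 0, le_rfl, hδ0.le, by simpa using h, by simp⟩⟩
  · refine isPreconnected_of_forall (p + (δ : ℂ) • e) ?_
    rintro _ ⟨y, hy, t, ht0, ht, hyt, rfl⟩
    refine ⟨((fun x => x + (δ : ℂ) • e) '' ball p r1) ∪
      ((fun s : ℝ => y + (s : ℂ) • e) '' Icc t δ), ?_, Or.inl ⟨p, mem_ball_self hr10, rfl⟩,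
      Or.inr ⟨t, ⟨le_rfl, ht⟩, rfl⟩, IsPreconnected.union' ?_ ?_ ?_⟩
    · rintro _ (⟨x, hx, rfl⟩ | ⟨s, hs, rfl⟩)
      · refine ⟨x, hx, δ, hδ0.le, le_rfl, ?_, rfl⟩
        linarith [h2 x (ball_subset_ball (min_le_left _ _) hx)]
      · exact ⟨y, hy, s, ht0.trans hs.1, hs.2, by linarith [hs.1], rfl⟩
    · exact ⟨y + (δ : ℂ) • e, ⟨y, hy, rfl⟩, δ, ⟨ht, le_rfl⟩, rfl⟩
    · exact (convex_ball _ _).isPreconnected.image _ (by fun_prop)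
    · exact isPreconnected_Icc.image _ (by fun_prop)
  · rintro _ ⟨y, hy, t, ht0, ht, hyt, rfl⟩
    have hb := hball y hy t ht0 ht
    refine ⟨hrW (ball_subset_ball (min_le_right _ _) hb), fun h => ?_⟩
    have := (hz _ (hsub hb)).1 h
    linarith [hge y hy t ht0 ht]

/-- `S` is, near `x`, one of the two sides of `M`. -/
def Good (M S : Set ℂ^m) (x : ℂ^m) : Prop :=
  ∀ᶠ y in 𝓝 x, (y ∉ M → ∀ᶠ z in 𝓝 y, (z ∈ S ↔ y ∈ S)) ∧
    (y ∈ M → (∃ᶠ z in 𝓝 y, z ∉ M ∧ z ∈ S) ∧ (∃ᶠ z in 𝓝 y, z ∉ M ∧ z ∉ S))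

/-- `S` and `S'` coincide near `x` off `M`. -/
def Ag (M S S' : Set ℂ^m) (x : ℂ^m) : Prop :=
  ∀ᶠ y in 𝓝 x, y ∉ M → (y ∈ S ↔ y ∈ S')

variable {S S' S'' : Set ℂ^m} {x : ℂ^m}

theorem Good.compl (h : Good M S x) : Good M Sᶜ x := by
  filter_upwards [h] with y hy
  refine ⟨fun h' => ?_, fun h' => ?_⟩
  · filter_upwards [hy.1 h'] with z hz using not_congr hz
  · obtain ⟨h1, h2⟩ := hy.2 h'
    exact ⟨h2, h1.mono fun z hz => ⟨hz.1, not_not.2 hz.2⟩⟩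

theorem Ag.symm (h : Ag M S S' x) : Ag M S' S x := h.mono fun _ hy h' => (hy h').symm

theorem Ag.trans (h : Ag M S S' x) (h' : Ag M S' S'' x) : Ag M S S'' x := by
  filter_upwards [h, h'] with y h1 h2 hy using (h1 hy).trans (h2 hy)

theorem Good.frequently (h : Good M S x) : ∃ᶠ z in 𝓝 x, z ∉ M := by
  by_cases hx : x ∈ M
  · exact (h.self_of_nhds.2 hx).1.mono fun z hz => hz.1
  · exact fun h' => h'.self_of_nhds hx

theorem Good.not_both (h : Good M S x) (h1 : Ag M S S' x) (h2 : Ag M S S'ᶜ x) : False := by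
  obtain ⟨z, hz, hz1, hz2⟩ := (h.frequently.and_eventually (h1.and h2)).exists
  have a := hz1 hz
  have b := hz2 hz
  rw [mem_compl_iff] at b
  tauto

theorem eventually_notMem_nhds (hM : IsProjectiveClosedSet M) (hx : x ≠ 0) (hxM : x ∉ M) :
    ∀ᶠ y in 𝓝 x, y ∉ M := by
  have : x ∉ closure M := fun h => hxM (hM.2.2.2 x h hx)
  filter_upwards [isClosed_closure.isOpen_compl.mem_nhds this] with y hy hyM
    using hy (subset_closure hyM)

theorem Good.congr (h : Good M S x) (h' : Ag M S S' x) (hM : IsProjectiveClosedSet M)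
    (hx : x ≠ 0) : Good M S' x := by
  filter_upwards [h, h'.eventually_nhds, isOpen_ne.mem_nhds hx] with y hy hy' hy0
  refine ⟨fun hyM => ?_, fun hyM => ⟨((hy.2 hyM).1.and_eventually hy').mono ?_,
    ((hy.2 hyM).2.and_eventually hy').mono ?_⟩⟩
  · filter_upwards [hy.1 hyM, hy', eventually_notMem_nhds hM hy0 hyM] with z h1 h2 h3
    rw [← h2 h3, ← hy'.self_of_nhds hyM, h1]
  · exact fun z hz => ⟨hz.1.1, (hz.2 hz.1.1).1 hz.1.2⟩
  · exact fun z hz => ⟨hz.1.1, fun h => hz.1.2 ((hz.2 hz.1.1).2 h)⟩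

theorem subset_or_disjoint_of_locally_const {P : Set ℂ^m} (hP : IsPreconnected P)
    (h : ∀ y ∈ P, ∀ᶠ z in 𝓝 y, (z ∈ S ↔ y ∈ S)) : P ⊆ S ∨ P ⊆ Sᶜ := by
  have := hP.subset_or_subset (u := interior S) (v := interior Sᶜ) isOpen_interior isOpen_interior
    (disjoint_compl_right.mono interior_subset interior_subset) fun y hy => by
      by_cases hyS : y ∈ S
      · exact Or.inl (mem_interior_iff_mem_nhds.2 ((h y hy).mono fun z hz => hz.2 hyS))
      · exact Or.inr (mem_interior_iff_mem_nhds.2 ((h y hy).mono fun z hz h => hyS (hz.1 h)))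
  exact this.imp (·.trans interior_subset) (·.trans interior_subset)

theorem exists_halves (hM : IsProjectiveClosedSet M) (hL : IsSmoothLeviFlatHypersurface M)
    (hx : x ≠ 0) {W : Set ℂ^m} (hW : W ∈ 𝓝 x) :
    ∃ W' ∈ 𝓝 x, ∃ P Q, IsPreconnected P ∧ IsPreconnected Q ∧ P ⊆ W \ M ∧ Q ⊆ W \ M ∧
      W' \ M ⊆ P ∪ Q := by
  by_cases hxM : x ∈ M
  · obtain ⟨ρ, hρ⟩ := exists_chart hL hxM
    obtain ⟨e, r, hr, hc, hz, hd⟩ := hρ.exists_dir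
    have hp : ρ x = 0 := (hz x (mem_ball_self hr)).1 hxM
    obtain ⟨W1, hW1, P, hP1, hP2, hP3⟩ := half_neighbourhood hr hc hp hz hd hW
    obtain ⟨W2, hW2, Q, hQ1, hQ2, hQ3⟩ := half_neighbourhood (ρ := fun y => -ρ y) (e := -e) hr
      hc.neg (by simpa using hp) (by simpa using hz) (fun y hy t ht hyt => by
        have := hd _ hyt t ht (by simpa using hy)
        simp only [smul_neg, neg_add_cancel_right] at this ⊢
        linarith) hW
    refine ⟨W1 ∩ W2 ∩ ball x r,
      inter_mem (inter_mem hW1 hW2) (ball_mem_nhds _ hr), P, Q, hP1, hQ1, hP2, hQ2, ?_⟩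
    rintro y ⟨⟨⟨h1, h2⟩, h3⟩, hyM⟩
    rcases lt_trichotomy (ρ y) 0 with h | h | h
    · exact Or.inr (hQ3 y h2 (by simpa using h))
    · exact absurd ((hz y h3).2 h) hyM
    · exact Or.inl (hP3 y h1 h)
  · obtain ⟨r, hr, h⟩ := Metric.mem_nhds_iff.1
      (inter_mem hW (eventually_notMem_nhds hM hx hxM))
    exact ⟨_, ball_mem_nhds x hr, _, _, (convex_ball x r).isPreconnected,
      (convex_ball x r).isPreconnected, h, h, fun y hy => Or.inl hy.1⟩

theorem exists_good (hM : IsProjectiveClosedSet M) (hL : IsSmoothLeviFlatHypersurface M)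
    (hx : x ≠ 0) : ∃ S, Good M S x := by
  by_cases hxM : x ∈ M
  · obtain ⟨ρ, hρ⟩ := exists_chart hL hxM
    obtain ⟨e, r, hr, hc, hz, hd⟩ := hρ.exists_dir
    refine ⟨{y | 0 < ρ y}, ?_⟩
    filter_upwards [ball_mem_nhds x hr] with y hy
    have hcy : ContinuousAt ρ y := hc.continuousAt (isOpen_ball.mem_nhds hy)
    refine ⟨fun h => ?_, fun h => ?_⟩
    · rcases lt_or_gt_of_ne (mt (hz y hy).2 h) with h' | h'
      · filter_upwards [hcy.eventually (gt_mem_nhds h')] with z hz'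
        exact iff_of_false hz'.not_gt h'.not_gt
      · filter_upwards [hcy.eventually (lt_mem_nhds h')] with z hz'
        exact iff_of_true hz' h'
    · have hy0 := (hz y hy).1 h
      have key : ∀ f : ℂ^m, Tendsto (fun t : ℝ => y + (t : ℂ) • f) (𝓝[>] 0) (𝓝 y) :=
        fun f => (Continuous.tendsto' (by fun_prop) 0 y (by simp)).mono_left nhdsWithin_le_nhds
      constructor
      · refine (key e).frequently (Eventually.frequently ?_)
        filter_upwards [(key e).eventually (isOpen_ball.mem_nhds hy),
          eventually_mem_nhdsWithin] with t ht ht0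
        have h1 : 0 < ρ (y + (t : ℂ) • e) := by
          have := hd y hy t ht0 ht
          have : (0 : ℝ) < t := ht0
          linarith
        exact ⟨fun h' => h1.ne' ((hz _ ht).1 h'), h1⟩
      · refine (key (-e)).frequently (Eventually.frequently ?_)
        filter_upwards [(key (-e)).eventually (isOpen_ball.mem_nhds hy),
          eventually_mem_nhdsWithin] with t ht ht0
        have h1 : ρ (y + (t : ℂ) • -e) < 0 := by
          have := hd _ ht t ht0 (by simpa using hy)
          simp only [smul_neg, neg_add_cancel_right] at this ⊢
          have : (0 : ℝ) < t := ht0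
          linarith
        exact ⟨fun h' => h1.ne ((hz _ ht).1 h'), not_lt.2 h1.le⟩
  · refine ⟨univ, ?_⟩
    filter_upwards [eventually_notMem_nhds hM hx hxM] with y hy
    exact ⟨fun _ => by simp, fun h => absurd h hy⟩

/-- A good set contains exactly one of the two local sides. -/
theorem Good.separates {P Q W : Set ℂ^m} (hx : x ∈ M) (hW : W ∈ 𝓝 x)
    (hPQ : W \ M ⊆ P ∪ Q) (hP : P ⊆ S ∨ P ⊆ Sᶜ) (hQ : Q ⊆ S ∨ Q ⊆ Sᶜ) (h : Good M S x) :
    (P ⊆ S ∧ Q ⊆ Sᶜ) ∨ (P ⊆ Sᶜ ∧ Q ⊆ S) := by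
  obtain ⟨h1, h2⟩ := h.self_of_nhds.2 hx
  obtain ⟨y, ⟨hyM, hyS⟩, hyW⟩ := (h1.and_eventually hW).exists
  obtain ⟨z, ⟨hzM, hzS⟩, hzW⟩ := (h2.and_eventually hW).exists
  have hy := hPQ ⟨hyW, hyM⟩
  have hz := hPQ ⟨hzW, hzM⟩
  rcases hP with hP | hP <;> rcases hQ with hQ | hQ
  · exact absurd (hz.elim (fun h => hP h) fun h => hQ h) hzS
  · exact Or.inl ⟨hP, hQ⟩
  · exact Or.inr ⟨hP, hQ⟩
  · exact absurd hyS (hy.elim (fun h => hP h) fun h => hQ h)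

theorem Good.ag_or (hM : IsProjectiveClosedSet M) (hL : IsSmoothLeviFlatHypersurface M)
    (hx : x ≠ 0) (h : Good M S x) (h' : Good M S' x) : Ag M S S' x ∨ Ag M S S'ᶜ x := by
  by_cases hxM : x ∈ M
  · obtain ⟨W, hW, P, Q, hP, hQ, hPW, hQW, hPQ⟩ := exists_halves hM hL hx (h.and h')
    have a := h.separates hxM hW hPQ
      (subset_or_disjoint_of_locally_const hP fun y hy => (hPW hy).1.1.1 (hPW hy).2)
      (subset_or_disjoint_of_locally_const hQ fun y hy => (hQW hy).1.1.1 (hQW hy).2)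
    have b := h'.separates hxM hW hPQ
      (subset_or_disjoint_of_locally_const hP fun y hy => (hPW hy).1.2.1 (hPW hy).2)
      (subset_or_disjoint_of_locally_const hQ fun y hy => (hQW hy).1.2.1 (hQW hy).2)
    have c : (∀ y ∈ P ∪ Q, y ∈ S ↔ y ∈ S') ∨ (∀ y ∈ P ∪ Q, y ∈ S ↔ y ∈ S'ᶜ) := by
      rcases a with ⟨a1, a2⟩ | ⟨a1, a2⟩ <;> rcases b with ⟨b1, b2⟩ | ⟨b1, b2⟩
      · exact Or.inl fun y hy => hy.elim (fun h => iff_of_true (a1 h) (b1 h))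
          fun h => iff_of_false (a2 h) (b2 h)
      · exact Or.inr fun y hy => hy.elim (fun h => iff_of_true (a1 h) (b1 h))
          fun h => iff_of_false (a2 h) (not_not.2 (b2 h))
      · exact Or.inr fun y hy => hy.elim (fun h => iff_of_false (a1 h) (not_not.2 (b1 h)))
          fun h => iff_of_true (a2 h) (b2 h)
      · exact Or.inl fun y hy => hy.elim (fun h => iff_of_false (a1 h) (b1 h))
          fun h => iff_of_true (a2 h) (b2 h)
    refine c.imp (fun c => ?_) fun c => ?_ <;>
    filter_upwards [hW] with y hy hyM using c y (hPQ ⟨hy, hyM⟩)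
  · have h1 := h.self_of_nhds.1 hxM
    have h2 := h'.self_of_nhds.1 hxM
    by_cases c : x ∈ S ↔ x ∈ S'
    · refine Or.inl ?_
      filter_upwards [h1, h2] with y h1 h2 _ using by rw [h1, h2, c]
    · refine Or.inr ?_
      filter_upwards [h1, h2] with y h1 h2 _
      rw [mem_compl_iff, h1, h2]
      tauto

theorem ag_propagate (hM : IsProjectiveClosedSet M) (hL : IsSmoothLeviFlatHypersurface M)
    {T : Set ℂ^m} (hT : IsPreconnected T) (hT0 : ∀ x ∈ T, x ≠ 0)
    (h : ∀ x ∈ T, Good M S x) (h' : ∀ x ∈ T, Good M S' x) :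
    (∀ x ∈ T, Ag M S S' x) ∨ (∀ x ∈ T, Ag M S S'ᶜ x) := by
  have ho : ∀ S', IsOpen {x | Ag M S S' x} := fun S' => isOpen_iff_eventually.2 fun x hx =>
    hx.eventually_nhds
  refine isPreconnected_iff_subset_of_disjoint.1 hT _ _ (ho S') (ho S'ᶜ)
    (fun x hx => (h x hx).ag_or hM hL (hT0 x hx) (h' x hx)) ?_
  ext x
  simp only [mem_inter_iff, mem_empty_iff_false, iff_false]
  rintro ⟨hx, h1, h2⟩
  exact (h x hx).not_both h1 h2

end Sides

section Topology
variable {m : ℕ} {M S S' A : Set ℂ^m} {x a : ℂ^m}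

theorem exists_good_segment (hM : IsProjectiveClosedSet M) (hL : IsSmoothLeviFlatHypersurface M)
    (h0 : ∀ y ∈ segment ℝ a x, y ≠ 0) : ∃ S, ∀ y ∈ segment ℝ a x, Good M S y := by
  rcases eq_or_ne a x with rfl | hax
  · rw [segment_same] at *
    obtain ⟨S, hS⟩ := exists_good hM hL (h0 a rfl)
    exact ⟨S, by rintro _ rfl; exact hS⟩
  have hl : 0 < ‖x - a‖ := norm_pos_iff.2 (sub_ne_zero.2 hax.symm)
  rw [segment_eq_image'] at *
  set γ : ℝ → Fin m → ℂ := fun u => a + u • (x - a)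
  have hγ : Continuous γ := by fun_prop
  have h0 : ∀ u ∈ Icc (0 : ℝ) 1, γ u ≠ 0 := fun u hu => h0 _ ⟨u, hu, rfl⟩
  have hf : ∀ u, 0 ≤ u → ‖γ u - a‖ = u * ‖x - a‖ := fun u hu => by
    simp [γ, norm_smul, abs_of_nonneg hu]
  have key := isPreconnected_Icc.induction₂' (s := Icc (0 : ℝ) 1)
    (fun s t => (∃ S, ∀ v ∈ Icc 0 s, Good M S (γ v)) → ∃ S, ∀ v ∈ Icc 0 t, Good M S (γ v))
    (fun u hu => by
      obtain ⟨S', hS'⟩ := exists_good hM hL (h0 u hu)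
      obtain ⟨ε, hε, hb⟩ := eventually_nhds_iff_ball.1
        (hγ.continuousAt.eventually hS'.eventually_nhds)
      have main : ∀ s ∈ ball u ε, ∀ t ∈ ball u ε, s ∈ Icc (0 : ℝ) 1 →
          t ∈ Icc (0 : ℝ) 1 →
          (∃ S, ∀ v ∈ Icc 0 s, Good M S (γ v)) → ∃ S, ∀ v ∈ Icc 0 t, Good M S (γ v) := by
        rintro s hs t ht hs1 ht1 ⟨S, hS⟩
        rcases le_total t s with hts | hst
        · exact ⟨S, fun v hv => hS v ⟨hv.1, hv.2.trans hts⟩⟩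
        have hgs := hS s ⟨hs1.1, le_rfl⟩
        obtain ⟨S1, hS1, hag⟩ : ∃ S1, (∀ v ∈ ball u ε, Good M S1 (γ v)) ∧
            Ag M S S1 (γ s) := by
          rcases hgs.ag_or hM hL (h0 s hs1) (hb s hs) with h | h
          · exact ⟨_, hb, h⟩
          · exact ⟨_, fun v hv => Good.compl (hb v hv), h⟩
        have hd : Continuous fun y : ℂ^m => ‖y - a‖ := by fun_prop
        refine ⟨{y | (‖y - a‖ < s * ‖x - a‖ ∧ y ∈ S) ∨ (¬ ‖y - a‖ < s * ‖x - a‖ ∧ y ∈ S1)},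
          fun v hv => ?_⟩
        have hv0 := h0 v ⟨hv.1, hv.2.trans ht1.2⟩
        rcases lt_trichotomy v s with hvs | rfl | hvs
        · refine (hS v ⟨hv.1, hvs.le⟩).congr ?_ hM hv0
          filter_upwards [hd.continuousAt.eventually (gt_mem_nhds
            (show ‖γ v - a‖ < s * ‖x - a‖ by rw [hf v hv.1]; gcongr))] with y hy _
          simp [hy]
        · refine (hS v ⟨hv.1, le_rfl⟩).congr ?_ hM hv0
          filter_upwards [hag] with y hy hyM
          have := hy hyM
          by_cases c : ‖y - a‖ < v * ‖x - a‖ <;> simp [c, this]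
        · have hvb : v ∈ ball u ε := by
            rw [Real.ball_eq_Ioo] at *
            exact ⟨hs.1.trans hvs, hv.2.trans_lt ht.2⟩
          refine (hS1 v hvb).congr ?_ hM hv0
          filter_upwards [hd.continuousAt.eventually (lt_mem_nhds
            (show s * ‖x - a‖ < ‖γ v - a‖ by rw [hf v hv.1]; gcongr))] with y hy _
          simp [hy.not_gt]
      filter_upwards [mem_nhdsWithin_of_mem_nhds (ball_mem_nhds u hε),
        self_mem_nhdsWithin] with v hv hv1
      exact ⟨main u (mem_ball_self hε) v hv hu hv1,
        main v hv u (mem_ball_self hε) hv1 hu⟩)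
    (fun _ _ _ _ _ _ h1 h2 h => h2 (h1 h)) (x := 0) (y := 1) (by simp) (by simp) (by
      obtain ⟨S, hS⟩ := exists_good hM hL (h0 0 (by simp))
      refine ⟨S, fun v hv => ?_⟩
      rw [Icc_self, mem_singleton_iff] at hv
      rwa [hv])
  obtain ⟨S, hS⟩ := key
  exact ⟨S, by rintro _ ⟨u, hu, rfl⟩; exact hS u hu⟩

theorem isOpen_star (a : ℂ^m) : IsOpen {x | ∀ y ∈ segment ℝ a x, y ≠ 0} := by
  refine isOpen_iff_eventually.2 fun x hx => ?_
  simp only [Set.mem_ofPred_eq, segment_eq_image', forall_mem_image] at hx ⊢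
  refine isCompact_Icc.eventually_forall_of_forall_eventually
    (P := fun x θ => a + θ • (x - a) ≠ 0) fun θ hθ => ?_
  have : Continuous fun z : ℂ^m × ℝ => a + z.2 • (z.1 - a) := by fun_prop
  exact (this.continuousAt (x := (x, θ))).eventually_ne (hx hθ)

theorem exists_good_star (hM : IsProjectiveClosedSet M) (hL : IsSmoothLeviFlatHypersurface M)
    (ha : a ≠ 0) : ∃ S, ∀ x, (∀ y ∈ segment ℝ a x, y ≠ 0) → Good M S x := by
  obtain ⟨Sa, hSa⟩ := exists_good hM hL ha
  have hch : ∀ x, ∃ S, (∀ y ∈ segment ℝ a x, y ≠ 0) →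
      (∀ y ∈ segment ℝ a x, Good M S y) ∧ Ag M S Sa a := by
    intro x
    by_cases h : ∀ y ∈ segment ℝ a x, y ≠ 0
    · obtain ⟨S, hS⟩ := exists_good_segment hM hL h
      rcases hSa.ag_or hM hL ha (hS a (left_mem_segment ℝ a x)) with h' | h'
      · exact ⟨S, fun _ => ⟨hS, h'.symm⟩⟩
      · exact ⟨Sᶜ, fun _ => ⟨fun y hy => (hS y hy).compl, h'.symm⟩⟩
    · exact ⟨∅, fun h' => absurd h' h⟩
  choose f hf using hch
  refine ⟨{x | x ∈ f x}, fun x hx => ?_⟩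
  obtain ⟨h1, h2⟩ := hf x hx
  refine (h1 x (right_mem_segment ℝ a x)).congr ?_ hM (hx x (right_mem_segment ℝ a x))
  have hs : ∀ᶠ x' in 𝓝 x, ∀ y ∈ segment ℝ a x', Good M (f x) y := by
    simp only [segment_eq_image', forall_mem_image] at h1 ⊢
    refine isCompact_Icc.eventually_forall_of_forall_eventually
      (P := fun x' θ => Good M (f x) (a + θ • (x' - a))) fun θ hθ => ?_
    have : Continuous fun z : ℂ^m × ℝ => a + z.2 • (z.1 - a) := by fun_prop
    exact this.continuousAt.eventually (h1 hθ).eventually_nhds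
  filter_upwards [hs, (isOpen_star a).mem_nhds hx] with x' h3 h4 hx'M
  obtain ⟨h5, h6⟩ := hf x' h4
  have hl := left_mem_segment ℝ a x'
  rcases ag_propagate hM hL (convex_segment a x').isPreconnected h4 h3 h5 with h | h
  · exact (h x' (right_mem_segment ℝ a x')).self_of_nhds hx'M
  · exact ((h3 a hl).not_both (h2.trans h6.symm) (h a hl)).elim

theorem exists_global_good (hm : 2 ≤ m) (hM : IsProjectiveClosedSet M)
    (hL : IsSmoothLeviFlatHypersurface M) : ∃ S, ∀ x, x ≠ 0 → Good M S x := by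
  obtain ⟨a, haM⟩ := hM.1
  have ha := hM.2.1 a haM
  obtain ⟨S1, h1⟩ := exists_good_star hM hL ha
  obtain ⟨S2, h2⟩ := exists_good_star hM hL (neg_ne_zero.2 ha)
  set L := Submodule.span ℝ {a}
  have hT : IsPreconnected (L : Set ℂ^m)ᶜ := by
    refine (isConnected_compl_of_one_lt_codim ?_).isPreconnected
    have e := Submodule.finrank_quotient_add_finrank L
    have e1 : Module.finrank ℝ ℂ^m = 2 * m := by
      rw [← Module.finrank_mul_finrank ℝ ℂ]; simp
    rw [finrank_span_singleton ha, e1] at e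
    rw [← Module.finrank_eq_rank]
    exact_mod_cast (by omega : 1 < Module.finrank ℝ (ℂ^m ⧸ L))
  have hseg : ∀ (b : ℂ^m), b ∈ L → b ≠ 0 → ∀ x ∉ L, ∀ y ∈ segment ℝ b x, y ≠ 0 := by
    rintro b hb hb0 x hx _ hy rfl
    rw [segment_eq_image] at hy
    obtain ⟨θ, -, h⟩ := hy
    replace h : (1 - θ) • b + θ • x = 0 := h
    rcases eq_or_ne θ 0 with rfl | hθ
    · simp [hb0] at h
    · refine hx ?_
      have : x = (-(θ⁻¹ * (1 - θ))) • b := by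
        have : θ • x = -((1 - θ) • b) := by rw [eq_neg_iff_add_eq_zero, add_comm, h]
        rw [← inv_smul_smul₀ hθ x, this, smul_neg, smul_smul, neg_smul]
      rw [this]
      exact L.smul_mem _ hb
  have haL : a ∈ L := Submodule.mem_span_singleton_self a
  have hs1 := hseg a haL ha
  have hs2 := hseg (-a) (L.neg_mem haL) (neg_ne_zero.2 ha)
  obtain ⟨S3, h3, hag⟩ : ∃ S3, (∀ x, (∀ y ∈ segment ℝ (-a) x, y ≠ 0) → Good M S3 x) ∧
      ∀ x ∉ L, Ag M S1 S3 x := by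
    rcases ag_propagate hM hL hT (fun x hx h => hx (h ▸ L.zero_mem)) (fun x hx => h1 x (hs1 x hx))
      (fun x hx => h2 x (hs2 x hx)) with h | h
    · exact ⟨S2, h2, h⟩
    · exact ⟨S2ᶜ, fun x hx => (h2 x hx).compl, h⟩
  refine ⟨{x | ((∀ y ∈ segment ℝ a x, y ≠ 0) ∧ x ∈ S1) ∨
    (¬ (∀ y ∈ segment ℝ a x, y ≠ 0) ∧ x ∈ S3)}, fun x hx => ?_⟩
  by_cases c : ∀ y ∈ segment ℝ a x, y ≠ 0
  · refine (h1 x c).congr ?_ hM hx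
    filter_upwards [(isOpen_star a).mem_nhds c] with y hy _
    exact ⟨fun h => Or.inl ⟨hy, h⟩, fun h => h.elim (·.2) fun h => absurd hy h.1⟩
  · have hnot : ∀ y, (∀ z ∈ segment ℝ a y, z ≠ 0) → (∀ z ∈ segment ℝ (-a) y, z ≠ 0) → y ∉ L := by
      intro y hy hy' hyL
      obtain ⟨t, rfl⟩ := Submodule.mem_span_singleton.1 hyL
      rcases le_total 0 t with ht | ht
      · refine hy' 0 ?_ rfl
        refine ⟨t / (1 + t), 1 / (1 + t), by positivity, by positivity, by field_simp; ring, ?_⟩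
        rw [smul_smul, smul_neg, ← neg_smul, ← add_smul]
        convert zero_smul ℝ a using 2
        ring
      · refine hy 0 ?_ rfl
        have : 0 < 1 - t := by linarith
        refine ⟨-t / (1 - t), 1 / (1 - t), div_nonneg (by linarith) this.le, by positivity,
          by field_simp; ring, ?_⟩
        rw [smul_smul, ← add_smul]
        convert zero_smul ℝ a using 2
        ring
    have hx2 : ∀ y ∈ segment ℝ (-a) x, y ≠ 0 := by
      by_cases hxL : x ∈ L
      · obtain ⟨t, rfl⟩ := Submodule.mem_span_singleton.1 hxL
        have ht0 : t ≠ 0 := fun h => hx (by rw [h, zero_smul])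
        rw [segment_eq_image] at c ⊢
        rcases lt_or_gt_of_ne ht0 with ht | ht
        · rintro _ ⟨θ, hθ, rfl⟩ h
          simp only [smul_smul, smul_neg, ← neg_smul, ← add_smul] at h
          have := (smul_eq_zero.1 h).resolve_right ha
          have h5 : θ * t ≤ 0 := mul_nonpos_of_nonneg_of_nonpos hθ.1 ht.le
          have h6 : θ = 1 := by linarith [hθ.2]
          rw [h6] at this
          linarith
        · refine absurd ?_ c
          rintro _ ⟨θ, hθ, rfl⟩ h
          simp only [smul_smul, ← add_smul] at h
          have := (smul_eq_zero.1 h).resolve_right ha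
          have h5 : 0 ≤ θ * t := mul_nonneg hθ.1 ht.le
          have h6 : θ = 1 := by linarith [hθ.2]
          rw [h6] at this
          linarith
      · exact hs2 x hxL
    refine (h3 x hx2).congr ?_ hM hx
    filter_upwards [(isOpen_star (-a)).mem_nhds hx2] with y hy hyM
    by_cases cy : ∀ z ∈ segment ℝ a y, z ≠ 0
    · have := (hag y (hnot y cy hy)).self_of_nhds hyM
      refine this.symm.trans ?_
      exact ⟨fun h => Or.inl ⟨cy, h⟩, fun h => h.elim (·.2) fun h => absurd cy h.1⟩
    · exact ⟨fun h => Or.inr ⟨cy, h⟩, fun h => h.elim (fun h => absurd h.1 cy) (·.2)⟩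

end Topology

section Components
variable {m : ℕ} {M S A : Set ℂ^m} {x a : ℂ^m}

/-- `A` is a union of components of the complement of `M`. -/
def Piece (M A : Set ℂ^m) : Prop :=
  (∀ y ∈ A, y ≠ 0 ∧ y ∉ M) ∧ ∀ y, y ≠ 0 → y ∉ M → ∀ᶠ z in 𝓝 y, (z ∈ A ↔ y ∈ A)

theorem Piece.isOpen (hA : Piece M A) : IsOpen A := isOpen_iff_eventually.2 fun y hy =>
  (hA.2 y (hA.1 y hy).1 (hA.1 y hy).2).mono fun _ h => h.2 hy

theorem IsCone.smul_mem_iff (hM : IsCone M) {c : ℂ} (hc : c ≠ 0) : c • x ∈ M ↔ x ∈ M :=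
  ⟨fun h => by simpa [smul_smul, hc] using hM c⁻¹ (inv_ne_zero hc) _ h, hM c hc x⟩

theorem Piece.isCone (hM : IsProjectiveClosedSet M) (hA : Piece M A) : IsCone A := by
  intro c hc z hz
  have hT : IsPreconnected ((fun c : ℂ => c • z) '' {0}ᶜ) :=
    (isConnected_compl_singleton_of_one_lt_rank (by simp) (0 : ℂ)).isPreconnected.image _
      (by fun_prop)
  rcases subset_or_disjoint_of_locally_const (S := A) hT (by
    rintro _ ⟨b, hb, rfl⟩
    exact hA.2 _ (smul_ne_zero hb (hA.1 z hz).1)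
      fun h => (hA.1 z hz).2 ((IsCone.smul_mem_iff hM.2.2.1 hb).1 h)) with h | h
  · exact h ⟨c, hc, rfl⟩
  · exact absurd hz (h ⟨1, one_ne_zero, one_smul _ _⟩)

theorem eventually_mem_closure_iff (hM : IsProjectiveClosedSet M)
    (hL : IsSmoothLeviFlatHypersurface M) (hG : ∀ x, x ≠ 0 → Good M S x) (hA : Piece M A)
    (hx : x ≠ 0) : ∀ᶠ q in 𝓝 x, q ∈ M → (q ∈ closure A ↔ x ∈ closure A) := by
  by_cases hxM : x ∈ M
  swap
  · filter_upwards [eventually_notMem_nhds hM hx hxM] with y hy h using absurd h hy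
  obtain ⟨W, hW, P, Q, hP, hQ, hPW, hQW, hPQ⟩ := exists_halves hM hL hx (isOpen_ne.mem_nhds hx)
  have hPA := subset_or_disjoint_of_locally_const (S := A) hP fun y hy =>
    hA.2 y (hPW hy).1 (hPW hy).2
  have hQA := subset_or_disjoint_of_locally_const (S := A) hQ fun y hy =>
    hA.2 y (hQW hy).1 (hQW hy).2
  have hPS := subset_or_disjoint_of_locally_const (S := S) hP fun y hy =>
    (hG y (hPW hy).1).self_of_nhds.1 (hPW hy).2
  have hQS := subset_or_disjoint_of_locally_const (S := S) hQ fun y hy =>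
    (hG y (hQW hy).1).self_of_nhds.1 (hQW hy).2
  have key : ∀ q, W ∈ 𝓝 q → q ∈ M → (q ∈ closure A ↔ P ⊆ A ∧ P.Nonempty ∨ Q ⊆ A ∧ Q.Nonempty) := by
    intro q hq hqM
    have hGq := hG q (hM.2.1 q hqM)
    constructor
    · intro h
      obtain ⟨b, hb, hbA⟩ := mem_closure_iff_nhds.1 h W hq
      rcases hPQ ⟨hb, (hA.1 b hbA).2⟩ with h' | h'
      · exact Or.inl ⟨hPA.resolve_right fun h => h h' hbA, b, h'⟩
      · exact Or.inr ⟨hQA.resolve_right fun h => h h' hbA, b, h'⟩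
    · intro h
      rw [mem_closure_iff_frequently]
      obtain ⟨h1, h2⟩ := hGq.self_of_nhds.2 hqM
      have h1 := h1.and_eventually hq
      have h2 := h2.and_eventually hq
      rcases hGq.separates hqM hq hPQ hPS hQS with ⟨s1, s2⟩ | ⟨s1, s2⟩ <;>
      rcases h with ⟨h, -⟩ | ⟨h, -⟩
      · exact h1.mono fun z hz => h ((hPQ ⟨hz.2, hz.1.1⟩).resolve_right fun h => s2 h hz.1.2)
      · exact h2.mono fun z hz => h ((hPQ ⟨hz.2, hz.1.1⟩).resolve_left fun h => hz.1.2 (s1 h))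
      · exact h2.mono fun z hz => h ((hPQ ⟨hz.2, hz.1.1⟩).resolve_right fun h => hz.1.2 (s2 h))
      · exact h1.mono fun z hz => h ((hPQ ⟨hz.2, hz.1.1⟩).resolve_left fun h => s1 h hz.1.2)
  filter_upwards [eventually_mem_nhds_iff.2 hW] with q hq hqM
  rw [key q hq hqM, key x hW hxM]

theorem leviFlat_mono {T : Set ℂ^m} (hL : IsSmoothLeviFlatHypersurface M) (hT : T ⊆ M)
    (h : ∀ p ∈ T, ∀ᶠ q in 𝓝 p, q ∈ M → q ∈ T) : IsSmoothLeviFlatHypersurface T := by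
  intro p hp
  obtain ⟨V, hV, hpV, ρ, h1, h2, h3, h4⟩ := hL p (hT hp)
  obtain ⟨W, hW, hWo, hpW⟩ := _root_.eventually_nhds_iff.1 (h p hp)
  exact ⟨V ∩ W, hV.inter hWo, ⟨hpV, hpW⟩, ρ, fun k => (h1 k).mono inter_subset_left,
    fun q hq => h2 q hq.1, fun q hq => ⟨fun h => (h3 q hq.1).1 (hT h),
      fun h => hW q hq.2 ((h3 q hq.1).2 h)⟩, fun q hq => h4 q hq.1⟩

theorem Piece.subset_closure (hm : 3 ≤ m) (hM : IsProjectiveClosedSet M)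
    (hL : IsSmoothLeviFlatHypersurface M) (hG : ∀ x, x ≠ 0 → Good M S x) (hA : Piece M A)
    (hne : A.Nonempty) : M ⊆ closure A := by
  have hcl := fun x (hx : x ≠ 0) => eventually_mem_closure_iff hM hL hG hA hx
  have hcone : IsCone (closure A) := fun c hc z hz =>
    map_mem_closure (by fun_prop : Continuous fun z : ℂ^m => c • z) hz
      fun y hy => hA.isCone hM c hc y hy
  by_contra hcon
  obtain ⟨p, hpM, hpA⟩ := not_subset.1 hcon
  have h1 : (M ∩ closure A).Nonempty := by
    by_contra hemp
    have hE : IsPreconnected ({0}ᶜ : Set ℂ^m) := by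
      have : Nonempty (Fin m) := ⟨⟨0, by omega⟩⟩
      refine (isConnected_compl_singleton_of_one_lt_rank ?_ 0).isPreconnected
      rw [← Module.finrank_eq_rank, ← Module.finrank_mul_finrank ℝ ℂ]
      simp only [finrank_real_complex, Module.finrank_fintype_fun_eq_card, Fintype.card_fin]
      exact_mod_cast (by omega : 1 < 2 * m)
    obtain ⟨b, hb⟩ := hne
    rcases subset_or_disjoint_of_locally_const (S := A) hE (fun y hy => by
      by_cases hyM : y ∈ M
      · have hyc : y ∉ closure A := fun h => hemp ⟨y, hyM, h⟩
        filter_upwards [isClosed_closure.isOpen_compl.mem_nhds hyc] with z hz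
        exact iff_of_false (fun h => hz (_root_.subset_closure h))
          fun h => hyc (_root_.subset_closure h)
      · exact hA.2 y hy hyM) with h | h
    · exact (hA.1 p (h (hM.2.1 p hpM))).2 hpM
    · exact h (hA.1 b hb).1 hb
  obtain ⟨z, ⟨hz1, hz2⟩, hz3, hz4⟩ := inter_nonempty_of_leviFlat (M := M ∩ closure A)
    (N := M \ closure A) hm
    ⟨h1, fun z hz => hM.2.1 z hz.1, fun c hc z hz => ⟨hM.2.2.1 c hc z hz.1, hcone c hc z hz.2⟩,
      fun z hz h0 => ⟨hM.2.2.2 z (closure_mono inter_subset_left hz) h0,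
        closure_minimal inter_subset_right isClosed_closure hz⟩⟩
    (leviFlat_mono hL inter_subset_left fun p hp => by
      filter_upwards [hcl p (hM.2.1 p hp.1)] with q hq hqM using ⟨hqM, (hq hqM).2 hp.2⟩)
    ⟨⟨p, hpM, hpA⟩, fun z hz => hM.2.1 z hz.1, fun c hc z hz => ⟨hM.2.2.1 c hc z hz.1,
      fun h => hz.2 ((IsCone.smul_mem_iff hcone hc).1 h)⟩,
      fun z hz h0 => by
        have hzM := hM.2.2.2 z (closure_mono sdiff_subset hz) h0
        refine ⟨hzM, fun h => ?_⟩
        obtain ⟨q, hq, hq2⟩ := mem_closure_iff_nhds.1 hz _ (hcl z h0)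
        exact hq2.2 ((hq hq2.1).2 h)⟩
    (leviFlat_mono hL sdiff_subset fun p hp => by
      filter_upwards [hcl p (hM.2.1 p hp.1)] with q hq hqM
        using ⟨hqM, fun h => hp.2 ((hq hqM).1 h)⟩)
  exact hz4 hz2

theorem piece_of_good (hM : IsProjectiveClosedSet M) (hG : ∀ x, x ≠ 0 → Good M S x) :
    Piece M {z | z ≠ 0 ∧ z ∉ M ∧ z ∈ S} := by
  refine ⟨fun y hy => ⟨hy.1, hy.2.1⟩, fun y h0 hy => ?_⟩
  filter_upwards [(hG y h0).self_of_nhds.1 hy, isOpen_ne.mem_nhds h0,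
    eventually_notMem_nhds hM h0 hy] with z h1 h2 h3
  exact ⟨fun h => ⟨h0, hy, h1.1 h.2.2⟩, fun h => ⟨h2, h3, h1.2 h.2.2⟩⟩

theorem isConnected_of_good (hm : 3 ≤ m) (hM : IsProjectiveClosedSet M)
    (hL : IsSmoothLeviFlatHypersurface M) (hG : ∀ x, x ≠ 0 → Good M S x) :
    IsConnected {z | z ≠ 0 ∧ z ∉ M ∧ z ∈ S} := by
  obtain ⟨p, hp⟩ := hM.1
  have hp0 := hM.2.1 p hp
  have hpiece := piece_of_good hM hG
  constructor
  · obtain ⟨z, hz, h0⟩ := (((hG p hp0).self_of_nhds.2 hp).1.and_eventually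
      (isOpen_ne.mem_nhds hp0)).exists
    exact ⟨z, h0, hz.1, hz.2⟩
  refine isPreconnected_iff_subset_of_disjoint.2 fun u v hu hv huv hd => ?_
  by_contra! hcon
  obtain ⟨⟨a, ha, hau⟩, b, hb, hbv⟩ := And.imp not_subset.1 not_subset.1 hcon
  set C := {z | z ≠ 0 ∧ z ∉ M ∧ z ∈ S}
  have hdis : ∀ z ∈ C, z ∈ u → z ∉ v := fun z h1 h2 h3 => by
    have : z ∈ C ∩ (u ∩ v) := ⟨h1, h2, h3⟩
    rw [hd] at this
    exact this
  have hsub : ∀ u v : Set ℂ^m, IsOpen u → IsOpen v → C ⊆ u ∪ v →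
      (∀ z ∈ C, z ∈ u → z ∉ v) → Piece M (C ∩ u) := by
    intro u v hu hv huv hdis
    refine ⟨fun y hy => hpiece.1 y hy.1, fun y h0 hy => ?_⟩
    filter_upwards [hpiece.2 y h0 hy, show ∀ᶠ z in 𝓝 y, y ∈ u → z ∈ u from
      eventually_imp_distrib_left.2 fun h => hu.mem_nhds h, show ∀ᶠ z in 𝓝 y, y ∈ v → z ∈ v from
      eventually_imp_distrib_left.2 fun h => hv.mem_nhds h] with z h1 h2 h3
    refine ⟨fun h => ⟨h1.1 h.1, ?_⟩, fun h => ⟨h1.2 h.1, h2 h.2⟩⟩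
    by_contra hyu
    exact hdis z h.1 h.2 (h3 ((huv (h1.1 h.1)).resolve_left hyu))
  have hA := hsub v u hv hu (by rwa [union_comm]) fun z h1 h2 h3 => hdis z h1 h3 h2
  have hB := hsub u v hu hv huv hdis
  have hpA := hA.subset_closure hm hM hL hG ⟨a, ha, (huv ha).resolve_left hau⟩ hp
  have hpB := hB.subset_closure hm hM hL hG ⟨b, hb, (huv hb).resolve_right hbv⟩ hp
  obtain ⟨W, hW, P, Q, hP, hQ, hPW, hQW, hPQ⟩ :=
    exists_halves hM hL hp0 (isOpen_ne.mem_nhds hp0)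
  have hloc : ∀ A, Piece M A → ∀ P, IsPreconnected P → P ⊆ {y | y ≠ 0} \ M → P ⊆ A ∨ P ⊆ Aᶜ :=
    fun A hA P hP hPW => subset_or_disjoint_of_locally_const hP fun y hy =>
      hA.2 y (hPW hy).1 (hPW hy).2
  have hS : ∀ P, IsPreconnected P → P ⊆ {y | y ≠ 0} \ M → P ⊆ S ∨ P ⊆ Sᶜ :=
    fun P hP hPW => subset_or_disjoint_of_locally_const hP fun y hy =>
      (hG y (hPW hy).1).self_of_nhds.1 (hPW hy).2
  obtain ⟨z, hzW, hz⟩ := mem_closure_iff_nhds.1 hpA W hW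
  obtain ⟨y, hyW, hy⟩ := mem_closure_iff_nhds.1 hpB W hW
  have hz' := hPQ ⟨hzW, hz.1.2.1⟩
  have hy' := hPQ ⟨hyW, hy.1.2.1⟩
  have fin : ∀ P, IsPreconnected P → P ⊆ {y | y ≠ 0} \ M → z ∈ P → y ∈ P → False :=
    fun P hP hPW hz1 hy1 => by
      have := (hloc _ hA P hP hPW).resolve_right fun h => h hz1 hz
      exact hdis y hy.1 hy.2 (this hy1).2
  rcases (hG p hp0).separates hp hW hPQ (hS P hP hPW) (hS Q hQ hQW) with ⟨s1, s2⟩ | ⟨s1, s2⟩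
  · exact fin P hP hPW (hz'.resolve_right fun h => s2 h hz.1.2.2)
      (hy'.resolve_right fun h => s2 h hy.1.2.2)
  · exact fin Q hQ hQW (hz'.resolve_left fun h => s1 h hz.1.2.2)
      (hy'.resolve_left fun h => s1 h hy.1.2.2)

/-- The complement of a closed Levi-flat hypersurface has exactly two components. -/
theorem exists_two_components (hm : 3 ≤ m) (hM : IsProjectiveClosedSet M)
    (hL : IsSmoothLeviFlatHypersurface M) : ∃ C₁ C₂, Piece M C₁ ∧ Piece M C₂ ∧
      IsConnected C₁ ∧ IsConnected C₂ ∧ Disjoint C₁ C₂ ∧ C₁ ∪ C₂ = {z | z ≠ 0 ∧ z ∉ M} := by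
  obtain ⟨S, hS⟩ := exists_global_good (by omega) hM hL
  have hS' : ∀ x, x ≠ 0 → Good M Sᶜ x := fun x hx => (hS x hx).compl
  refine ⟨_, _, piece_of_good hM hS, piece_of_good hM hS', isConnected_of_good hm hM hL hS,
    isConnected_of_good hm hM hL hS', ?_, ?_⟩
  · exact disjoint_left.2 fun z h1 h2 => h2.2.2 h1.2.2
  · ext z
    simp only [mem_union, Set.mem_ofPred_eq, mem_compl_iff]
    tauto

end Components

section Average
variable {m : ℕ} {F : ℂ^m → ℂ} {Y : Set ℂ^m} {x : ℂ^m}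

theorem contDiffAt_of_holomorphic (hY : IsOpen Y) (hF : DifferentiableOn ℂ F Y) (hx : x ∈ Y) :
    ContDiffAt ℝ ∞ F x := by
  obtain ⟨R, hR, hRY⟩ := nhds_basis_closedBall.mem_iff.1 (hY.mem_nhds hx)
  set ε := R / 2 with hε
  have hε0 : 0 < ε := by positivity
  have hd : ∀ y ∈ closedBall x R, DifferentiableAt ℂ F y := fun y hy =>
    hF.differentiableAt (hY.mem_nhds (hRY hy))
  set f := (closedBall x R).indicator F
  have hf : Integrable f := by
    refine (integrable_indicator_iff measurableSet_closedBall).2 ?_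
    exact (hF.continuousOn.mono hRY).integrableOn_compact (isCompact_closedBall x R)
  refine (contDiff_sm hε0 hf.locallyIntegrable).contDiffAt.congr_of_eventuallyEq ?_
  filter_upwards [ball_mem_nhds x hε0] with y hy
  have hsub : closedBall y ε ⊆ closedBall x R := by
    refine closedBall_subset_closedBall' ?_
    have := mem_ball.1 hy
    linarith
  rw [sm_congr (g := F) hε0, sm_eq_self hε0 fun z hz => hd z (hsub hz)]
  intro z hz
  exact indicator_of_mem (hsub (mem_closedBall_iff_norm.2 hz.le)) F

theorem continuousOn_fderiv (hY : IsOpen Y) (hF : DifferentiableOn ℂ F Y) :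
    ContinuousOn (fderiv ℂ F) Y := by
  have h1 : ContinuousOn (fderiv ℝ F) Y := fun y hy =>
    ((contDiffAt_of_holomorphic hY hF hy).fderiv_right (m := ∞) (by simp)).continuousAt
      |>.continuousWithinAt
  have h2 : EqOn (fderiv ℝ F) (fun y => (fderiv ℂ F y).restrictScalars ℝ) Y := fun y hy =>
    ((hF.differentiableAt (hY.mem_nhds hy)).hasFDerivAt.restrictScalars ℝ).fderiv
  have h3 := h1.congr h2.symm
  exact (ContinuousLinearMap.isEmbedding_restrictScalars (𝕜 := ℂ) (E := Fin m → ℂ) (F := ℂ)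
    ℝ).continuousOn_iff.2 h3

/-- The part of degree `-1` of a holomorphic function on a cone. -/
theorem exists_homogeneous (hY : IsOpen Y) (hYc : IsCone Y) (hF : DifferentiableOn ℂ F Y) :
    ∃ u : ℂ^m → ℂ, DifferentiableOn ℂ u Y ∧
      (∀ c : ℂ, c ≠ 0 → ∀ z ∈ Y, u (c • z) = c⁻¹ * u z) ∧
      ∀ z ∈ Y, ∀ w : ℂ, ∀ B : ℝ, (∀ c : ℂ, ‖c‖ = 1 → ‖c * F (c • z) - w‖ ≤ B) → ‖u z - w‖ ≤ B := by
  set e : ℝ → ℂ := fun θ => Complex.exp (θ * I) with he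
  have hec : Continuous e := by fun_prop
  have he0 : ∀ θ, e θ ≠ 0 := fun θ => Complex.exp_ne_zero _
  have he1 : ∀ θ, ‖e θ‖ = 1 := fun θ => Complex.norm_exp_ofReal_mul_I θ
  have hmem : ∀ z ∈ Y, ∀ θ, e θ • z ∈ Y := fun z hz θ => hYc _ (he0 θ) z hz
  have hcont : ∀ z ∈ Y, Continuous fun θ => e θ * F (e θ • z) := fun z hz => by
    refine hec.mul (continuous_iff_continuousAt.2 fun θ => ?_)
    exact ContinuousAt.comp (f := fun θ => e θ • z)
      (hF.differentiableAt (hY.mem_nhds (hmem z hz θ))).continuousAt (by fun_prop)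
  set u : ℂ^m → ℂ := fun z =>
    (2 * Real.pi : ℂ)⁻¹ * ∫ θ in (0 : ℝ)..(2 * Real.pi), e θ * F (e θ • z) with hu
  have hpi : (2 * Real.pi : ℂ) ≠ 0 := by
    have := Real.pi_ne_zero
    simp
  have hud : DifferentiableOn ℂ u Y := by
    intro x hx
    refine DifferentiableAt.differentiableWithinAt ?_
    obtain ⟨R, hR, hRY⟩ := nhds_basis_closedBall.mem_iff.1 (hY.mem_nhds hx)
    have hDc : ContinuousOn (fun p : ℂ^m × ℝ => (e p.2) ^ 2 • fderiv ℂ F (e p.2 • p.1))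
        (closedBall x R ×ˢ Icc 0 (2 * Real.pi)) := by
      refine ContinuousOn.smul ((hec.comp continuous_snd).pow 2).continuousOn ?_
      refine (continuousOn_fderiv hY hF).comp (by fun_prop) fun p hp => ?_
      exact hmem _ (hRY hp.1) _
    obtain ⟨C, hC⟩ := ((isCompact_closedBall x R).prod isCompact_Icc).exists_bound_of_continuousOn
      hDc
    have hder : ∀ y ∈ Y, ∀ θ, HasFDerivAt (fun y => e θ * F (e θ • y))
        ((e θ) ^ 2 • fderiv ℂ F (e θ • y)) y := by
      intro y hy θ
      have h1 : HasFDerivAt (fun y : ℂ^m => e θ • y)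
          (e θ • ContinuousLinearMap.id ℂ ℂ^m) y := (hasFDerivAt_id y).const_smul (e θ)
      have h2 := ((hF.differentiableAt (hY.mem_nhds (hmem y hy θ))).hasFDerivAt.comp y
        h1).const_mul (e θ)
      refine h2.congr_fderiv (ContinuousLinearMap.ext fun v => ?_)
      simp [pow_two, mul_assoc]
    have := intervalIntegral.hasFDerivAt_integral_of_dominated_of_fderiv_le (μ := volume)
      (a := 0) (b := 2 * Real.pi) (𝕜 := ℂ) (F := fun y θ => e θ * F (e θ • y)) (x₀ := x)
      (F' := fun y θ => (e θ) ^ 2 • fderiv ℂ F (e θ • y)) (bound := fun _ => C)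
      (closedBall_mem_nhds x hR)
      (by
        filter_upwards [closedBall_mem_nhds x hR] with y hy
        exact (hcont y (hRY hy)).aestronglyMeasurable)
      ((hcont x hx).intervalIntegrable _ _)
      (by
        refine Continuous.aestronglyMeasurable ?_
        refine (hec.pow 2).smul (continuous_iff_continuousAt.2 fun θ => ?_)
        exact ContinuousAt.comp (f := fun θ => e θ • x)
          ((continuousOn_fderiv hY hF).continuousAt (hY.mem_nhds (hmem x hx θ))) (by fun_prop))
      (.of_forall fun θ hθ y hy => by
        rw [uIoc_of_le (by positivity)] at hθ
        exact hC (y, θ) ⟨hy, hθ.1.le, hθ.2⟩)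
      intervalIntegrable_const
      (.of_forall fun θ _ y hy => hder y (hRY hy) θ)
    exact (this.const_mul _).differentiableAt
  have hrot : ∀ z ∈ Y, ∀ t : ℝ, e t * u (e t • z) = u z := by
    intro z hz t
    have hper : Function.Periodic (fun θ => e θ * F (e θ • z)) (2 * Real.pi) := by
      intro θ
      have : e (θ + 2 * Real.pi) = e θ := by
        simp only [he]
        push_cast
        rw [add_mul, Complex.exp_add, Complex.exp_two_pi_mul_I, mul_one]
      simp only [this]
    have h1 : ∀ θ, e t * (e θ * F (e θ • e t • z)) = e (θ + t) * F (e (θ + t) • z) := by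
      intro θ
      have : e (θ + t) = e θ * e t := by
        simp only [he]
        push_cast
        rw [add_mul, Complex.exp_add]
      rw [this, smul_smul]
      ring
    simp only [hu]
    rw [mul_left_comm, ← intervalIntegral.integral_const_mul]
    congr 1
    rw [intervalIntegral.integral_congr fun θ _ => h1 θ,
      intervalIntegral.integral_comp_add_right fun θ => e θ * F (e θ • z)]
    have := hper.intervalIntegral_add_eq (0 + t) 0
    rw [zero_add] at this ⊢
    rw [add_comm (2 * Real.pi) t, this, zero_add]
  refine ⟨u, hud, ?_, ?_⟩
  · intro c hc z hz
    set h : ℂ → ℂ := fun w => Complex.exp w * u (Complex.exp w • z) with hh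
    have hhd : Differentiable ℂ h := by
      intro w
      refine DifferentiableAt.mul (by fun_prop) ?_
      exact DifferentiableAt.comp w (f := fun w => Complex.exp w • z)
        (hud.differentiableAt (hY.mem_nhds (hYc _ (Complex.exp_ne_zero w) z hz))) (by fun_prop)
    have hd0 : ∀ w, deriv h w = 0 := by
      intro w
      have h1 : ∀ t : ℝ, h (w + t * I) = h w := by
        intro t
        have := hrot _ (hYc _ (Complex.exp_ne_zero w) z hz) t
        simp only [hh, Complex.exp_add]
        rw [mul_assoc, mul_comm (Complex.exp w) (Complex.exp (t * I)), mul_smul]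
        rw [← mul_assoc, mul_comm (Complex.exp w), mul_assoc, ← this]
        ring
      have h2 : HasDerivAt (fun t : ℝ => w + t * I) I 0 := by
        simpa using (ofRealCLM.hasDerivAt.mul_const I).const_add w (x := (0 : ℝ))
      have h3 := HasDerivAt.scomp (𝕜 := ℝ) (𝕜' := ℂ) (0 : ℝ) (g₁ := h) (h := fun t : ℝ => w + t * I)
        (g₁' := deriv h w) (by simpa using (hhd w).hasDerivAt) h2
      have h4 : (h ∘ fun t : ℝ => w + t * I) = fun _ => h w := funext h1
      rw [h4] at h3
      have := h3.unique (hasDerivAt_const (0 : ℝ) (h w))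
      simpa using this
    have := is_const_of_deriv_eq_zero hhd hd0 (Complex.log c) 0
    simp only [hh, Complex.exp_log hc, Complex.exp_zero, one_smul, one_mul] at this
    rw [← this, inv_mul_cancel_left₀ hc]
  · intro z hz w B hB
    have h1 : u z - w = (2 * Real.pi : ℂ)⁻¹ *
        ∫ θ in (0 : ℝ)..(2 * Real.pi), (e θ * F (e θ • z) - w) := by
      rw [intervalIntegral.integral_sub ((hcont z hz).intervalIntegrable _ _)
        intervalIntegrable_const, intervalIntegral.integral_const, mul_sub, hu]
      congr 1
      rw [sub_zero, real_smul]
      push_cast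
      rw [inv_mul_cancel_left₀ hpi]
    have h2 := intervalIntegral.norm_integral_le_of_norm_le_const (a := 0) (b := 2 * Real.pi)
      (f := fun θ => e θ * F (e θ • z) - w) (C := B) fun θ _ => hB _ (he1 θ)
    have hpp := Real.pi_pos
    rw [h1, norm_mul, norm_inv]
    have h3 : ‖(2 * Real.pi : ℂ)‖ = 2 * Real.pi := by
      rw [norm_mul, norm_real, Real.norm_of_nonneg hpp.le]; simp
    rw [h3, inv_mul_le_iff₀ (by positivity)]
    rw [sub_zero, abs_of_pos (by positivity)] at h2
    linarith

end Average

section Weights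
variable {m k : ℕ} {M : Set ℂ^m}

theorem fourPt_log_eu {a : Fin k → ℂ} (ha : a ≠ 0) (v : Fin k → ℂ) :
    FourPt fun ζ => Real.log (eu (a + ζ • v)) := by
  intro ε hε
  set b : ℂ := inner ℂ (WithLp.toLp 2 a : EuclideanSpace ℂ (Fin k)) (WithLp.toLp 2 v) / eu a ^ 2
    with hb
  have hpos := eu_pos ha
  have hbe : (eu a ^ 2 : ℂ) ≠ 0 := by exact_mod_cast (pow_pos hpos 2).ne'
  have hcs : ∀ ζ : ℂ, eu a * ‖1 + ζ * b‖ ≤ eu (a + ζ • v) := by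
    intro ζ
    have h1 := norm_inner_le_norm (𝕜 := ℂ) (WithLp.toLp 2 a : EuclideanSpace ℂ (Fin k))
      (WithLp.toLp 2 (a + ζ • v))
    rw [WithLp.toLp_add, WithLp.toLp_smul, inner_add_right, inner_smul_right,
      inner_self_eq_norm_sq_to_K] at h1
    have h2 : ((‖(WithLp.toLp 2 a : EuclideanSpace ℂ (Fin k))‖ : ℂ) ^ 2 + ζ *
        inner ℂ (WithLp.toLp 2 a : EuclideanSpace ℂ (Fin k)) (WithLp.toLp 2 v)) =
        eu a ^ 2 * (1 + ζ * b) := by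
      change (eu a : ℂ) ^ 2 + ζ * inner ℂ _ _ = _
      rw [hb, mul_add, mul_one, mul_left_comm, mul_div_cancel₀ _ hbe]
    have h3 : eu a ^ 2 * ‖1 + ζ * b‖ ≤ eu a * eu (a + ζ • v) := by
      have h4 : ‖(eu a ^ 2 * (1 + ζ * b) : ℂ)‖ = eu a ^ 2 * ‖1 + ζ * b‖ := by
        rw [norm_mul, norm_pow, norm_real, Real.norm_of_nonneg hpos.le]
      rw [← h4, ← h2]
      exact h1
    rw [pow_two, mul_assoc] at h3
    exact le_of_mul_le_mul_left h3 hpos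
  have hs : ∀ᶠ t : ℝ in 𝓝[>] 0, ‖(t : ℂ) * b‖ < 1 / 2 ∧ 2 * t ^ 2 * ‖b‖ ^ 4 < ε := by
    have c1 : Tendsto (fun t : ℝ => ‖(t : ℂ) * b‖) (𝓝 0) (𝓝 0) :=
      Continuous.tendsto' (by fun_prop) _ _ (by simp)
    have c2 : Tendsto (fun t : ℝ => 2 * t ^ 2 * ‖b‖ ^ 4) (𝓝 0) (𝓝 0) :=
      Continuous.tendsto' (by fun_prop) _ _ (by simp)
    exact ((c1.eventually_lt_const (by norm_num)).and
      (c2.eventually_lt_const hε)).filter_mono nhdsWithin_le_nhds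
  filter_upwards [hs, self_mem_nhdsWithin] with t ht ht0
  have key : ∀ ζ : ℂ, ‖ζ * b‖ < 1 / 2 →
      Real.log (eu a) + Real.log ‖1 + ζ * b‖ ≤ Real.log (eu (a + ζ • v)) ∧ ‖1 + ζ * b‖ ≠ 0 := by
    intro ζ hζ
    have h1 : 0 < ‖1 + ζ * b‖ := by
      have := norm_sub_norm_le (1 : ℂ) (-(ζ * b))
      rw [sub_neg_eq_add, norm_neg, norm_one] at this
      linarith
    rw [← Real.log_mul hpos.ne' h1.ne']
    exact ⟨Real.log_le_log (mul_pos hpos h1) (hcs ζ), h1.ne'⟩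
  have hn : ‖-(t : ℂ) * b‖ = ‖(t : ℂ) * b‖ := by rw [neg_mul, norm_neg]
  have hn2 : ‖I * (t : ℂ) * b‖ = ‖(t : ℂ) * b‖ := by rw [mul_assoc, norm_mul, norm_I, one_mul]
  have hn3 : ‖-(I * (t : ℂ)) * b‖ = ‖(t : ℂ) * b‖ := by rw [neg_mul, norm_neg, hn2]
  obtain ⟨k1, n1⟩ := key t ht.1
  obtain ⟨k2, n2⟩ := key (I * t) (hn2.trans_lt ht.1)
  obtain ⟨k3, n3⟩ := key (-t) (hn.trans_lt ht.1)
  obtain ⟨k4, n4⟩ := key (-(I * t)) (hn3.trans_lt ht.1)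
  have hprod : Real.log ‖1 + t * b‖ + Real.log ‖1 + I * t * b‖ + Real.log ‖1 + -t * b‖ +
      Real.log ‖1 + -(I * t) * b‖ = Real.log ‖1 - (t * b) ^ 4‖ := by
    rw [← Real.log_mul n1 n2, ← Real.log_mul (mul_ne_zero n1 n2) n3,
      ← Real.log_mul (mul_ne_zero (mul_ne_zero n1 n2) n3) n4, ← norm_mul, ← norm_mul, ← norm_mul]
    congr 2
    linear_combination (t ^ 2 * b ^ 2 * (t ^ 2 * b ^ 2 - 1)) * I_sq
  have hx : ‖((t : ℂ) * b) ^ 4‖ ≤ 1 / 2 := by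
    rw [norm_pow]
    calc ‖(t : ℂ) * b‖ ^ 4 ≤ (1 / 2) ^ 4 := pow_le_pow_left₀ (norm_nonneg _) ht.1.le 4
      _ ≤ 1 / 2 := by norm_num
  set x := ‖((t : ℂ) * b) ^ 4‖ with hxd
  have h1x : 1 - x ≤ ‖1 - ((t : ℂ) * b) ^ 4‖ := by
    have := norm_sub_norm_le (1 : ℂ) (((t : ℂ) * b) ^ 4)
    rwa [norm_one] at this
  have hlog : -(2 * x) ≤ Real.log ‖1 - ((t : ℂ) * b) ^ 4‖ := by
    refine le_trans ?_ (Real.log_le_log (by linarith) h1x)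
    have h0 : 0 ≤ x := norm_nonneg _
    have := Real.one_sub_inv_le_log_of_pos (show 0 < 1 - x by linarith)
    refine le_trans ?_ this
    have : (1 - x)⁻¹ ≤ 1 + 2 * x := by
      rw [inv_le_iff_one_le_mul₀ (by linarith)]
      nlinarith
    linarith
  have hxe : 2 * x ≤ ε * t ^ 2 := by
    have : x = t ^ 4 * ‖b‖ ^ 4 := by
      rw [hxd, norm_pow, norm_mul, norm_real, mul_pow, Real.norm_of_nonneg (le_of_lt ht0)]
    rw [this]
    nlinarith [ht.2, sq_nonneg t]
  simp only [zero_smul, add_zero]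
  linarith

theorem psh_log_eu {O : Set ℂ^m} (B : ℂ^m →L[ℂ] (Fin k → ℂ)) (b : Fin k → ℂ)
    (h : ∀ z ∈ O, B z + b ≠ 0) : Psh (fun z => Real.log (eu (B z + b))) O := by
  refine ⟨ContinuousOn.log ?_ fun z hz => (eu_pos (h z hz)).ne', fun z hz w => ?_⟩
  · exact (continuous_eu.comp (B.continuous.add continuous_const)).continuousOn
  · convert fourPt_log_eu (h z hz) (B w) using 4 with ζ
    rw [map_add, map_smul]
    abel

theorem integrable_gaussian :
    Integrable fun z : ℂ^m => Real.exp (-∑ j, ‖z j‖ ^ 2) := by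
  have h1 : Integrable fun z : ℂ => Real.exp (-‖z‖ ^ 2) := by
    have := (GaussianFourier.integrable_cexp_neg_mul_sq_norm_add (V := ℂ) (b := 1) (by simp) 0
      0).norm
    refine this.congr (.of_forall fun z => ?_)
    simp only [Complex.norm_exp]
    congr 1
    norm_cast
    simp
  have h2 := Integrable.fintype_prod (f := fun (_ : Fin m) (z : ℂ) => Real.exp (-‖z‖ ^ 2))
    fun _ => h1
  refine h2.congr (.of_forall fun z => ?_)
  simp only [← Real.exp_sum, Finset.sum_neg_distrib]

/-- Weighted sub-mean value estimate for holomorphic functions. -/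
theorem normSq_le_of_weight {Y : Set ℂ^m} {f G : ℂ^m → ℂ} {W : ℂ^m → ℝ}
    {x : ℂ^m} {r κ A : ℝ} (hr : 0 < r) (hκ : 0 < κ) (hY : closedBall x r ⊆ Y)
    (hf : ∀ y ∈ closedBall x r, DifferentiableAt ℂ f y)
    (hfG : ∀ y ∈ closedBall x r, ‖f y‖ = ‖G y‖) (hW : ∀ y ∈ closedBall x r, κ ≤ W y)
    (hW0 : ∀ y, 0 ≤ W y) (hi : IntegrableOn (fun y => ‖G y‖ ^ 2 * W y) Y)
    (hA : ∫ y in Y, ‖G y‖ ^ 2 * W y ≤ A) :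
    ‖f x‖ ^ 2 ≤ (∫ y, bump m r y)⁻¹ * (κ⁻¹ * A) := by
  refine (normSq_le_integral hr hf).trans ?_
  refine mul_le_mul_of_nonneg_left ?_ (inv_nonneg.2 (integral_bump_pos hr).le)
  rw [← div_eq_inv_mul, le_div_iff₀ hκ, ← integral_mul_const]
  have hc : ContinuousOn (fun y => ‖f y‖ ^ 2 * κ) (closedBall x r) :=
    ((continuousOn_of_forall_continuousAt fun y hy => (hf y hy).continuousAt).norm.pow 2).mul
      continuousOn_const
  refine (setIntegral_mono_on (hc.integrableOn_compact (isCompact_closedBall x r))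
    (IntegrableOn.mono_set hi hY) measurableSet_closedBall fun y hy => ?_).trans
    ((setIntegral_mono_set hi (.of_forall fun y => by have := hW0 y; positivity)
      (.of_forall hY)).trans hA)
  rw [hfG y hy]
  exact mul_le_mul_of_nonneg_left (hW y hy) (by positivity)

end Weights

section Cutoff
variable {m : ℕ} {p : ℂ^m} {i : Fin m}

/-- The projection to the coordinate hyperplane along `p`. -/
def along (p : ℂ^m) (i : Fin m) : ℂ^m →L[ℂ] ℂ^m :=
  ContinuousLinearMap.id ℂ _ -
    ((p i)⁻¹ • ContinuousLinearMap.proj (R := ℂ) (φ := fun _ : Fin m => ℂ) i).smulRight p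

theorem along_apply (z : ℂ^m) : along p i z = z - (z i / p i) • p := by
  simp [along, div_eq_inv_mul]

theorem along_apply_same (hp : p i ≠ 0) (z : ℂ^m) : along p i z i = 0 := by
  rw [along_apply, Pi.sub_apply, Pi.smul_apply, smul_eq_mul, div_mul_cancel₀ _ hp, sub_self]

/-- A conic cutoff of `p i / z i`, supported near the line through `p`. -/
def coneCutoff (p : ℂ^m) (i : Fin m) (δ : ℝ) (z : ℂ^m) : ℂ :=
  (Real.smoothTransition (2 - eu (along p i z) ^ 2 / (δ ^ 2 * ‖z i / p i‖ ^ 2)) : ℂ) * (z i / p i)⁻¹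

variable {δ : ℝ} {z : ℂ^m}

theorem coneCutoff_eq_inv (h : eu (along p i z) < δ * ‖z i / p i‖) :
    coneCutoff p i δ z = (z i / p i)⁻¹ := by
  have h0 : 0 < δ * ‖z i / p i‖ := (eu_nonneg _).trans_lt h
  rw [coneCutoff, Real.smoothTransition.one_of_one_le, ofReal_one, one_mul]
  have : eu (along p i z) ^ 2 / (δ ^ 2 * ‖z i / p i‖ ^ 2) ≤ 1 := by
    rw [← mul_pow, div_le_one (pow_pos h0 2)]
    exact pow_le_pow_left₀ (eu_nonneg _) h.le 2
  linarith

theorem coneCutoff_eq_zero (hδ : 0 < δ) (h : 2 * δ * ‖z i / p i‖ < eu (along p i z)) :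
    coneCutoff p i δ z = 0 := by
  by_cases h0 : z i / p i = 0
  · rw [coneCutoff, h0, inv_zero, mul_zero]
  have h1 : 0 < δ * ‖z i / p i‖ := mul_pos hδ (norm_pos_iff.2 h0)
  rw [coneCutoff, Real.smoothTransition.zero_of_nonpos, ofReal_zero, zero_mul]
  have : 2 ≤ eu (along p i z) ^ 2 / (δ ^ 2 * ‖z i / p i‖ ^ 2) := by
    rw [← mul_pow, le_div_iff₀ (pow_pos h1 2)]
    nlinarith
  linarith

theorem continuous_ratio : Continuous fun z : ℂ^m => z i / p i :=
  (continuous_apply i).div_const _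

theorem isOpen_inner : IsOpen {z | eu (along p i z) < δ * ‖z i / p i‖} :=
  isOpen_lt (continuous_eu.comp (along p i).continuous) (continuous_ratio.norm.const_mul δ)

theorem isOpen_outer : IsOpen {z | 2 * δ * ‖z i / p i‖ < eu (along p i z)} :=
  isOpen_lt (continuous_ratio.norm.const_mul _) (continuous_eu.comp (along p i).continuous)

theorem outer_of_zero (hz : z ≠ 0) (h : z i / p i = 0) :
    2 * δ * ‖z i / p i‖ < eu (along p i z) := by
  rw [along_apply, h, norm_zero, mul_zero, zero_smul, sub_zero]
  exact eu_pos hz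

theorem contDiffAt_coneCutoff (hδ : 0 < δ) (hz : z ≠ 0) : ContDiffAt ℝ ∞ (coneCutoff p i δ) z := by
  by_cases h0 : z i / p i = 0
  · refine (contDiffAt_const (c := (0 : ℂ))).congr_of_eventuallyEq ?_
    filter_upwards [isOpen_outer.mem_nhds (outer_of_zero (δ := δ) hz h0)] with y hy
    exact coneCutoff_eq_zero hδ hy
  · have hr : ContDiff ℝ ∞ fun z : ℂ^m => z i / p i := by fun_prop
    have h1 : ContDiff ℝ ∞ fun z => eu (along p i z) ^ 2 := by
      simp only [eu_sq]
      exact contDiff_normSq.comp ((along p i).restrictScalars ℝ).contDiff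
    have h2 : ContDiff ℝ ∞ fun z : ℂ^m => δ ^ 2 * ‖z i / p i‖ ^ 2 :=
      contDiff_const.mul (hr.norm_sq ℝ)
    have h3 : ContDiffAt ℝ ∞ (fun z : ℂ^m => 2 - eu (along p i z) ^ 2 /
        (δ ^ 2 * ‖z i / p i‖ ^ 2)) z := by
      refine contDiffAt_const.sub (h1.contDiffAt.div h2.contDiffAt ?_)
      have := norm_pos_iff.2 h0
      positivity
    exact (ofRealCLM.contDiff.contDiffAt.comp z
      (Real.smoothTransition.contDiff.contDiffAt.comp z h3)).mul (hr.contDiffAt.inv h0)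

theorem dzb_coneCutoff_eq_zero (hδ : 0 < δ) (j : Fin m)
    (h : eu (along p i z) < δ * ‖z i / p i‖ ∨ 2 * δ * ‖z i / p i‖ < eu (along p i z)) :
    dzb j (coneCutoff p i δ) z = 0 := by
  rcases h with h | h
  · have h0 : z i / p i ≠ 0 := fun h0 => by
      rw [h0, norm_zero, mul_zero] at h
      exact (eu_nonneg _).not_gt h
    have : coneCutoff p i δ =ᶠ[𝓝 z] fun z => (z i / p i)⁻¹ := by
      filter_upwards [isOpen_inner.mem_nhds h] with y hy using coneCutoff_eq_inv hy
    refine (wirt_congr this).trans (dzb_eq_zero ?_)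
    exact DifferentiableAt.inv (by fun_prop) h0
  · have : coneCutoff p i δ =ᶠ[𝓝 z] fun _ => 0 := by
      filter_upwards [isOpen_outer.mem_nhds h] with y hy using coneCutoff_eq_zero hδ hy
    exact (wirt_congr this).trans (wirt_const 0)

theorem exists_dzb_coneCutoff_le (p : ℂ^m) (i : Fin m) (hδ : 0 < δ) :
    ∃ C : ℝ, 0 ≤ C ∧ ∀ z : ℂ^m, z ≠ 0 →
      ∑ j, ‖dzb j (coneCutoff p i δ) z‖ ^ 2 ≤ C * (‖z‖ ^ 4)⁻¹ := by
  set g := coneCutoff p i δ with hg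
  have hc : ContinuousOn (fun z => ∑ j, ‖dzb j g z‖ ^ 2) (sphere (0 : ℂ^m) 1) := by
    refine continuousOn_of_forall_continuousAt fun z hz => ?_
    have hz0 : z ≠ 0 := ne_zero_of_mem_unit_sphere ⟨z, hz⟩
    exact tendsto_finsetSum _ fun j _ =>
      ((contDiffAt_wirt (contDiffAt_coneCutoff hδ hz0)).continuousAt.norm.pow 2)
  obtain ⟨C, hC⟩ := (isCompact_sphere (0 : ℂ^m) 1).exists_bound_of_continuousOn hc
  have hhom : ∀ t : ℝ, 0 < t → ∀ z, g (t • z) = (t⁻¹ : ℝ) * g z := by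
    intro t ht z
    have h1 : along p i (t • z) = (t : ℂ) • along p i z := by
      rw [← map_smul]; rfl
    have h2 : (t • z) i / p i = t * (z i / p i) := by
      rw [Pi.smul_apply, real_smul, mul_div_assoc]
    rw [hg, coneCutoff, h1, h2, eu_smul, norm_mul, norm_real, Real.norm_of_nonneg ht.le, mul_pow,
      mul_pow, mul_left_comm, mul_div_mul_left _ _ (pow_pos ht 2).ne', coneCutoff, mul_inv]
    push_cast
    ring
  have hder : ∀ t : ℝ, 0 < t → ∀ z, z ≠ 0 → ∀ j, dzb j g (t • z) = (t⁻¹ ^ 2 : ℝ) * dzb j g z := by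
    intro t ht z hz j
    have hd := ((contDiffAt_coneCutoff (p := p) (i := i) hδ (smul_ne_zero ht.ne' hz)).differentiableAt
      (by simp)).hasFDerivAt
    have h1 : HasFDerivAt (fun z : ℂ^m => t • z)
        (t • ContinuousLinearMap.id ℝ ℂ^m) z := (hasFDerivAt_id z).const_smul t
    have h2 := hd.comp z h1
    have h3 : (g ∘ fun z => t • z) = fun z => t⁻¹ • g z := funext fun z => by
      rw [Function.comp_apply, hhom t ht, real_smul]
    rw [h3] at h2
    have h4 := h2.unique (((contDiffAt_coneCutoff (p := p) (i := i) hδ hz).differentiableAt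
      (by simp)).hasFDerivAt.const_smul t⁻¹)
    have h5 : ∀ v, fderiv ℝ g (t • z) v = (t⁻¹ ^ 2 : ℝ) * fderiv ℝ g z v := by
      intro v
      have := congrArg (fun L : ℂ^m →L[ℝ] ℂ => t⁻¹ • L v) h4
      simp only [ContinuousLinearMap.comp_apply, smul_apply, ContinuousLinearMap.id_apply,
        map_smul, inv_smul_smul₀ ht.ne'] at this
      rw [this, smul_smul, real_smul, pow_two]
    simp only [wirt, h5]
    ring
  refine ⟨max C 0, le_max_right _ _, fun z hz => ?_⟩
  have hn := norm_pos_iff.2 hz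
  have h1 : ‖z‖ • (‖z‖⁻¹ • z) = z := smul_inv_smul₀ hn.ne' z
  have hs : ‖‖z‖⁻¹ • z‖ = 1 := by rw [norm_smul, norm_inv, norm_norm, inv_mul_cancel₀ hn.ne']
  have h0 : ‖z‖⁻¹ • z ≠ 0 := fun h => by simp [h] at hs
  have h2 : ∑ j, ‖dzb j g z‖ ^ 2 = (‖z‖ ^ 4)⁻¹ * ∑ j, ‖dzb j g (‖z‖⁻¹ • z)‖ ^ 2 := by
    rw [Finset.mul_sum]
    refine Finset.sum_congr rfl fun j _ => ?_
    conv_lhs => rw [← h1, hder _ hn _ h0]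
    rw [norm_mul, norm_real, Real.norm_of_nonneg (by positivity)]
    ring
  rw [h2, mul_comm]
  refine mul_le_mul_of_nonneg_right ?_ (by positivity)
  exact (le_abs_self _).trans ((hC _ (mem_sphere_zero_iff_norm.2 hs)).trans (le_max_left _ _))

end Cutoff

section Exhaustion
variable {m : ℕ} {M : Set ℂ^m}

/-- The cone over the complement of the hypersurface. -/
def off (M : Set ℂ^m) : Set ℂ^m := {z | z ≠ 0 ∧ z ∉ M}

/-- The exhaustion function of the complement of the hypersurface. -/
def exh (M : Set ℂ^m) (z : ℂ^m) : ℝ := Real.log (eu z) - Real.log (dM M z)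

theorem dM_of_mem {z : ℂ^m} (hz : z ∈ M) : dM M z = 0 :=
  ((dM_le hz z).trans_eq (by rw [sub_self, eu_eq_zero])).antisymm (dM_nonneg z)

theorem dM_zero (hM : IsProjectiveClosedSet M) : dM M 0 = 0 := by
  have h := dM_smul hM (two_ne_zero) 0
  rw [smul_zero, norm_ofNat] at h
  linarith

theorem dM_pos_iff (hM : IsProjectiveClosedSet M) {z : ℂ^m} : 0 < dM M z ↔ z ∈ off M :=
  ⟨fun h => ⟨fun h0 => by simp [h0, dM_zero hM] at h, fun h0 => by simp [dM_of_mem h0] at h⟩,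
    fun h => dM_pos hM h.1 h.2⟩

theorem isOpen_off (hM : IsProjectiveClosedSet M) : IsOpen (off M) := by
  have : off M = {z | 0 < dM M z} := Set.ext fun z => (dM_pos_iff hM).symm
  rw [this]
  exact isOpen_lt continuous_const continuous_dM

theorem smul_mem_off (hM : IsProjectiveClosedSet M) : IsCone (off M) := fun c hc z hz => by
  have := (dM_pos_iff hM).2 hz
  refine (dM_pos_iff hM).1 ?_
  rw [dM_smul hM hc]
  have := norm_pos_iff.2 hc
  positivity

theorem exh_smul (hM : IsProjectiveClosedSet M) {c : ℂ} (hc : c ≠ 0) {z : ℂ^m}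
    (hz : z ∈ off M) : exh M (c • z) = exh M z := by
  have h1 := (eu_pos hz.1).ne'
  have h2 := ((dM_pos_iff hM).2 hz).ne'
  have h3 := norm_ne_zero_iff.2 hc
  rw [exh, dM_smul hM hc, eu_smul, Real.log_mul h3 h1, Real.log_mul h3 h2, exh]
  ring

theorem continuousOn_exh (hM : IsProjectiveClosedSet M) : ContinuousOn (exh M) (off M) :=
  (continuous_eu.continuousOn.log fun _ hz => (eu_pos hz.1).ne').sub
    (continuous_dM.continuousOn.log fun _ hz => ((dM_pos_iff hM).2 hz).ne')

theorem exh_pos (hM : IsProjectiveClosedSet M) (hL : IsSmoothLeviFlatHypersurface M)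
    {z : ℂ^m} (hz : z ∈ off M) : 0 < exh M z :=
  sub_pos.2 (Real.log_lt_log ((dM_pos_iff hM).2 hz) (dM_lt_eu hM hL hz.1))

theorem isCompact_exh_le (hM : IsProjectiveClosedSet M) (c : ℝ) :
    IsCompact {z | z ∈ off M ∧ ‖z‖ = 1 ∧ exh M z ≤ c} := by
  have h : {z | z ∈ off M ∧ ‖z‖ = 1 ∧ exh M z ≤ c} =
      sphere 0 1 ∩ {z | eu z * Real.exp (-c) ≤ dM M z} := by
    ext z
    constructor
    · rintro ⟨hz, h1, h2⟩
      refine ⟨mem_sphere_zero_iff_norm.2 h1, ?_⟩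
      have hd := (dM_pos_iff hM).2 hz
      refine (Real.log_le_log_iff (by have := eu_pos hz.1; positivity) hd).1 ?_
      rw [Real.log_mul (eu_pos hz.1).ne' (Real.exp_pos _).ne', Real.log_exp]
      rw [exh] at h2
      linarith
    · rintro ⟨h1, h2⟩
      have hz0 : z ≠ 0 := ne_zero_of_mem_unit_sphere ⟨z, h1⟩
      have he := eu_pos hz0
      have hd : 0 < dM M z := lt_of_lt_of_le (by positivity) h2
      refine ⟨(dM_pos_iff hM).1 hd, mem_sphere_zero_iff_norm.1 h1, ?_⟩
      have := Real.log_le_log (by positivity) h2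
      rw [Real.log_mul he.ne' (Real.exp_pos _).ne', Real.log_exp] at this
      rw [exh]
      linarith
  rw [h]
  exact (isCompact_sphere _ _).inter_right
    (isClosed_le (continuous_eu.mul continuous_const) continuous_dM)

theorem isCompact_weight_le (hM : IsProjectiveClosedSet M) (hL : IsSmoothLeviFlatHypersurface M)
    (c : ℝ) : IsCompact {z | z ∈ off M ∧ -Real.log (dM M z) + ∑ j, ‖z j‖ ^ 2 ≤ c} := by
  have h : {z | z ∈ off M ∧ -Real.log (dM M z) + ∑ j, ‖z j‖ ^ 2 ≤ c} =
      {z | Real.exp (eu z ^ 2 - c) ≤ dM M z} := by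
    ext z
    constructor
    · rintro ⟨hz, h⟩
      refine (Real.le_log_iff_exp_le ((dM_pos_iff hM).2 hz)).1 ?_
      rw [eu_sq]
      linarith
    · intro h
      have hd : 0 < dM M z := (Real.exp_pos _).trans_le h
      refine ⟨(dM_pos_iff hM).1 hd, ?_⟩
      have := (Real.le_log_iff_exp_le hd).2 h
      rw [eu_sq] at this
      linarith
  rw [h]
  refine (isCompact_closedBall (0 : ℂ^m) (1 + |c|)).of_isClosed_subset
    (isClosed_le (Real.continuous_exp.comp ((continuous_eu.pow 2).sub continuous_const))
      continuous_dM) fun z hz => ?_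
  rw [mem_closedBall_zero_iff]
  refine (norm_le_eu z).trans ?_
  have h1 : Real.exp (eu z ^ 2 - c) ≤ dM M z := hz
  have hzo := (dM_pos_iff hM).1 ((Real.exp_pos _).trans_le h1)
  have h2 := Real.add_one_le_exp (eu z ^ 2 - c)
  have h3 := (dM_lt_eu hM hL hzo.1).le
  have h4 := le_abs_self c
  have h5 := abs_nonneg c
  by_contra! h
  nlinarith

variable {p : ℂ^m} {i : Fin m}

/-- The plurisubharmonic weight for the peak functions. -/
def peakWeight (M : Set ℂ^m) (p : ℂ^m) (i : Fin m) (k : ℕ) (ε : ℝ)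
    (z : ℂ^m) : ℝ :=
  k * exh M z + (2 * (m + 1) + 4) * -Real.log (dM M z) +
    2 * (m + 1) * Real.log (eu (along p i z + Pi.single i (ε : ℂ)))

theorem shift_ne_zero (hp : p i ≠ 0) {ε : ℝ} (hε : 0 < ε) (z : ℂ^m) :
    along p i z + Pi.single i (ε : ℂ) ≠ 0 := fun h => by
  have := congrFun h i
  rw [Pi.add_apply, along_apply_same hp, Pi.single_eq_same, zero_add, Pi.zero_apply] at this
  exact hε.ne' (ofReal_eq_zero.1 this)

theorem eu_along_le (hp : p i ≠ 0) (ε : ℝ) (z : ℂ^m) :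
    eu (along p i z) ≤ eu (along p i z + Pi.single i (ε : ℂ)) := by
  refine le_of_sq_le_sq ?_ (eu_nonneg _)
  rw [eu_sq, eu_sq]
  refine Finset.sum_le_sum fun j _ => pow_le_pow_left₀ (norm_nonneg _) ?_ 2
  by_cases h : j = i
  · rw [h, along_apply_same hp, norm_zero]
    exact norm_nonneg _
  · rw [Pi.add_apply, Pi.single_eq_of_ne h, add_zero]

theorem psh_peakWeight (hM : IsProjectiveClosedSet M) (hL : IsSmoothLeviFlatHypersurface M)
    (hp : p i ≠ 0) (k : ℕ) {ε : ℝ} (hε : 0 < ε) : Psh (peakWeight M p i k ε) (off M) := by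
  have h1 := psh_neg_log_dM hM hL
  have h2 : Psh (fun z => Real.log (eu z)) (off M) := by
    have := psh_log_eu (O := off M) (ContinuousLinearMap.id ℂ ℂ^m) 0 fun z hz => by
      simpa using hz.1
    simpa using this
  have h3 := psh_log_eu (O := off M) (along p i) (Pi.single i (ε : ℂ)) fun z _ =>
    shift_ne_zero hp hε z
  exact (((h2.add h1).const_mul (Nat.cast_nonneg k)).add (h1.const_mul (by positivity))).add
    (h3.const_mul (by positivity))

/-- The regularised cutoff is almost holomorphic in the weighted `L²` sense. -/
theorem exists_peak_correction (hM : IsProjectiveClosedSet M)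
    (hL : IsSmoothLeviFlatHypersurface M) (hp : p i ≠ 0) {δ c : ℝ} (hδ : 0 < δ)
    (hc : ∀ z ∈ off M, δ * ‖z i / p i‖ ≤ eu (along p i z) →
      eu (along p i z) ≤ 2 * δ * ‖z i / p i‖ → c ≤ exh M z) :
    ∃ A, 0 ≤ A ∧ ∀ k : ℕ, ∀ ε : ℝ, 0 < ε → ∃ F, DifferentiableOn ℂ F (off M) ∧
      IntegrableOn (fun z => ‖coneCutoff p i δ z - F z‖ ^ 2 *
        Real.exp (-(peakWeight M p i k ε z + ∑ j, ‖z j‖ ^ 2))) (off M) ∧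
      ∫ z in off M, ‖coneCutoff p i δ z - F z‖ ^ 2 *
        Real.exp (-(peakWeight M p i k ε z + ∑ j, ‖z j‖ ^ 2)) ≤ A * Real.exp (-(k * c)) := by
  obtain ⟨C, hC0, hC⟩ := exists_dzb_coneCutoff_le p i hδ
  set c0 : ℝ := (1 + eu p / δ)⁻¹ with hc0
  have hc0p : 0 < c0 := by have := eu_nonneg p; positivity
  set B : ℝ := C * (Real.exp (-(2 * (m + 1) * Real.log c0)) * m ^ 2) with hB
  have hB0 : 0 ≤ B := by positivity
  have hYm := (isOpen_off hM).measurableSet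
  refine ⟨4 * (B * ∫ z : ℂ^m, Real.exp (-∑ j, ‖z j‖ ^ 2)), by positivity, fun k ε hε => ?_⟩
  have hψ := psh_peakWeight hM hL hp k hε
  have hg : ContDiffOn ℝ ∞ (coneCutoff p i δ) (off M) := fun z hz =>
    (contDiffAt_coneCutoff hδ hz.1).contDiffWithinAt
  have hbound : ∀ z ∈ off M, (∑ j, ‖dzb j (coneCutoff p i δ) z‖ ^ 2) *
      Real.exp (-(peakWeight M p i k ε z + ∑ j, ‖z j‖ ^ 2)) ≤
      B * Real.exp (-(k * c)) * Real.exp (-∑ j, ‖z j‖ ^ 2) := by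
    intro z hz
    by_cases h : eu (along p i z) < δ * ‖z i / p i‖ ∨ 2 * δ * ‖z i / p i‖ < eu (along p i z)
    · have : ∑ j, ‖dzb j (coneCutoff p i δ) z‖ ^ 2 = 0 :=
        Finset.sum_eq_zero fun j _ => by rw [dzb_coneCutoff_eq_zero hδ j h]; simp
      rw [this, zero_mul]
      positivity
    · push Not at h
      have hz0 := norm_pos_iff.2 hz.1
      have hex := hc z hz h.1 h.2
      have hE := eu_pos hz.1
      have hV : c0 * eu z ≤ eu (along p i z + Pi.single i (ε : ℂ)) := by
        refine le_trans ?_ (eu_along_le hp ε z)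
        have h1 : eu z ≤ eu (along p i z) + ‖z i / p i‖ * eu p := by
          rw [← eu_smul]
          refine le_trans (le_of_eq ?_) (eu_add_le _ _)
          rw [along_apply, sub_add_cancel]
        have h2 : ‖z i / p i‖ ≤ eu (along p i z) / δ := by
          rw [le_div_iff₀ hδ]; linarith [h.1]
        rw [hc0, inv_mul_le_iff₀ (by have := eu_nonneg p; positivity)]
        calc eu z ≤ eu (along p i z) + eu (along p i z) / δ * eu p := by
              have := mul_le_mul_of_nonneg_right h2 (eu_nonneg p)
              linarith
          _ = _ := by ring
      have h1 := Real.log_le_log (by positivity) hV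
      rw [Real.log_mul hc0p.ne' hE.ne'] at h1
      have h2 := Real.log_le_log ((dM_pos_iff hM).2 hz) (dM_lt_eu hM hL hz.1).le
      have h3 : -(peakWeight M p i k ε z + ∑ j, ‖z j‖ ^ 2) ≤
          -(k * c) + -∑ j, ‖z j‖ ^ 2 + (-(2 * (m + 1) * Real.log c0) + 4 * Real.log (eu z)) := by
        have h4 : (k : ℝ) * c ≤ k * exh M z := mul_le_mul_of_nonneg_left hex (Nat.cast_nonneg k)
        have h5 := mul_le_mul_of_nonneg_left h1 (show (0 : ℝ) ≤ 2 * (m + 1) by positivity)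
        have h6 := mul_le_mul_of_nonneg_left h2 (show (0 : ℝ) ≤ 2 * (m + 1) + 4 by positivity)
        rw [peakWeight]
        linarith
      have h4 : Real.exp (4 * Real.log (eu z)) ≤ m ^ 2 * ‖z‖ ^ 4 := by
        have : (4 : ℝ) * Real.log (eu z) = Real.log (eu z ^ 4) := by rw [Real.log_pow]; norm_num
        rw [this, Real.exp_log (by positivity)]
        calc eu z ^ 4 ≤ (Real.sqrt m * ‖z‖) ^ 4 := pow_le_pow_left₀ hE.le (eu_le_norm z) 4
          _ = (Real.sqrt m ^ 2) ^ 2 * ‖z‖ ^ 4 := by ring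
          _ = _ := by rw [Real.sq_sqrt (Nat.cast_nonneg m)]
      calc _ ≤ C * (‖z‖ ^ 4)⁻¹ * (Real.exp (-(k * c)) * Real.exp (-∑ j, ‖z j‖ ^ 2) *
            (Real.exp (-(2 * (m + 1) * Real.log c0)) * (m ^ 2 * ‖z‖ ^ 4))) := by
            refine mul_le_mul (hC z hz.1) ?_ (Real.exp_pos _).le (by positivity)
            refine (Real.exp_le_exp.2 h3).trans ?_
            rw [Real.exp_add, Real.exp_add, Real.exp_add]
            gcongr
        _ = _ := by rw [hB]; field_simp
  have hdom : Integrable fun z : ℂ^m =>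
      B * Real.exp (-(k * c)) * Real.exp (-∑ j, ‖z j‖ ^ 2) := integrable_gaussian.const_mul _
  have hgi : IntegrableOn (fun z => (∑ j, ‖dzb j (coneCutoff p i δ) z‖ ^ 2) *
      Real.exp (-(peakWeight M p i k ε z + ∑ j, ‖z j‖ ^ 2))) (off M) := by
    refine Integrable.mono' hdom.integrableOn ?_ ?_
    · refine ContinuousOn.aestronglyMeasurable ?_ hYm
      refine ContinuousOn.mul (continuousOn_of_forall_continuousAt fun z hz =>
        tendsto_finsetSum _ fun j _ =>
          (contDiffAt_wirt (contDiffAt_coneCutoff hδ hz.1)).continuousAt.norm.pow 2) ?_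
      exact Real.continuous_exp.comp_continuousOn
        (hψ.cont.add contDiff_normSq.continuous.continuousOn).neg
    · filter_upwards [ae_restrict_mem hYm] with z hz
      rw [Real.norm_of_nonneg (by positivity)]
      exact hbound z hz
  simp only [Finset.sum_mul] at hgi hbound
  obtain ⟨F, hF, hFi, hFb⟩ := exists_holomorphic_near (isOpen_off hM) (psh_neg_log_dM hM hL)
    (isCompact_weight_le hM hL) hψ hg hgi
  refine ⟨F, hF, hFi, hFb.trans ?_⟩
  have h1 := setIntegral_mono_on hgi hdom.integrableOn hYm hbound
  have h2 : ∫ z in off M, B * Real.exp (-(k * c)) * Real.exp (-∑ j, ‖z j‖ ^ 2) ≤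
      B * Real.exp (-(k * c)) * ∫ z : ℂ^m, Real.exp (-∑ j, ‖z j‖ ^ 2) := by
    rw [← integral_const_mul]
    exact setIntegral_le_integral hdom (.of_forall fun z => by positivity)
  calc _ ≤ 4 * (B * Real.exp (-(k * c)) * ∫ z : ℂ^m, Real.exp (-∑ j, ‖z j‖ ^ 2)) :=
        mul_le_mul_of_nonneg_left (h1.trans h2) (by norm_num)
    _ = _ := by ring

end Exhaustion

section Peak
variable {m : ℕ} {M : Set ℂ^m} {p : ℂ^m} {i : Fin m}

theorem exh_of_cone (hM : IsProjectiveClosedSet M) (hp : p ∈ off M) {c : ℝ} (hc : c < exh M p) :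
    ∃ δ > 0, ∀ z ∈ off M, eu (along p i z) ≤ 2 * δ * ‖z i / p i‖ → c < exh M z := by
  obtain ⟨r, hr, hball⟩ := eventually_nhds_iff_ball.1
    (((continuousOn_exh hM).continuousAt ((isOpen_off hM).mem_nhds hp)).eventually_const_lt hc)
  refine ⟨r / 4, by positivity, fun z hz h => ?_⟩
  by_cases h0 : z i / p i = 0
  · exact absurd (outer_of_zero (δ := r / 4) hz.1 h0) (not_lt.2 h)
  have h1 := norm_pos_iff.2 h0
  rw [← exh_smul hM (inv_ne_zero h0) hz]
  refine hball _ (mem_ball_iff_norm.2 ?_)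
  have h2 : (z i / p i)⁻¹ • z - p = (z i / p i)⁻¹ • along p i z := by
    rw [along_apply, smul_sub, inv_smul_smul₀ h0]
  rw [h2]
  refine (norm_le_eu _).trans_lt ?_
  rw [eu_smul, norm_inv, inv_mul_lt_iff₀ h1]
  nlinarith

theorem exp_neg_peakWeight (k : ℕ) (ε : ℝ) (z : ℂ^m) :
    Real.exp (-(peakWeight M p i k ε z + ∑ j, ‖z j‖ ^ 2)) = Real.exp (-(k * exh M z)) *
      Real.exp ((2 * (m + 1) + 4) * Real.log (dM M z) - ∑ j, ‖z j‖ ^ 2) *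
      Real.exp (-(2 * (m + 1) * Real.log (eu (along p i z + Pi.single i (ε : ℂ))))) := by
  rw [← Real.exp_add, ← Real.exp_add, peakWeight]
  ring_nf

theorem eu_shift_le {ε : ℝ} (hε : 0 ≤ ε) (z : ℂ^m) :
    eu (along p i z + Pi.single i (ε : ℂ)) ≤ eu (along p i z) + ε := by
  refine (eu_add_le _ _).trans (add_le_add_right (le_of_sq_le_sq (le_of_eq ?_) hε) _)
  rw [eu_sq, Finset.sum_eq_single i (fun j _ h => by rw [Pi.single_eq_of_ne h]; simp) (by simp)]
  rw [Pi.single_eq_same, norm_real, Real.norm_of_nonneg hε]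

theorem continuousOn_dWeight (hM : IsProjectiveClosedSet M) (a : ℝ) :
    ContinuousOn (fun z => Real.exp (a * Real.log (dM M z) - ∑ j, ‖z j‖ ^ 2)) (off M) :=
  Real.continuous_exp.comp_continuousOn ((continuousOn_const.mul
    (continuous_dM.continuousOn.log fun _ hz => ((dM_pos_iff hM).2 hz).ne')).sub
      contDiff_normSq.continuous.continuousOn)

set_option maxHeartbeats 1000000 in
/-- Holomorphic sections of degree `-1` peaking at a given point. -/
theorem exists_peak (hM : IsProjectiveClosedSet M) (hL : IsSmoothLeviFlatHypersurface M)
    (hp : p ∈ off M) {c η : ℝ} (hc : c < exh M p) (hη : 0 < η) :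
    ∃ u : ℂ^m → ℂ, DifferentiableOn ℂ u (off M) ∧
      (∀ c : ℂ, c ≠ 0 → ∀ z ∈ off M, u (c • z) = c⁻¹ * u z) ∧ 1 ≤ ‖u p‖ ∧
      ∀ z ∈ off M, ‖z‖ = 1 → exh M z ≤ c → ‖u z‖ ≤ η := by
  obtain ⟨i, hi⟩ := Function.ne_iff.1 hp.1
  obtain ⟨c₁, hc₁, hc₁p⟩ := exists_between hc
  obtain ⟨c', hc', hc'₁⟩ := exists_between hc₁
  have hY := isOpen_off hM
  obtain ⟨δ, hδ, hcone⟩ := exh_of_cone (i := i) hM hp hc₁p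
  obtain ⟨A, hA, hF⟩ := exists_peak_correction hM hL hi hδ (c := c₁)
    fun z hz _ h => (hcone z hz h).le
  have hcV : Continuous fun z => eu (along p i z) := continuous_eu.comp (along p i).continuous
  -- the region where the section has to be small
  have hK := isCompact_exh_le hM c
  obtain ⟨r₁, hr₁, hK₁⟩ := hK.exists_cthickening_subset_open
    ((continuousOn_exh hM).isOpen_inter_preimage hY isOpen_Iio)
    (fun z hz => ⟨hz.1, hz.2.2.trans_lt hc'⟩ :
      {z | z ∈ off M ∧ ‖z‖ = 1 ∧ exh M z ≤ c} ⊆ off M ∩ exh M ⁻¹' Iio c')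
  obtain ⟨κ₁, hκ₁, hκ₁b⟩ := (hK.cthickening (r := r₁)).exists_forall_le'
    (f := fun z => Real.exp ((2 * (m + 1) + 4) * Real.log (dM M z) - ∑ j, ‖z j‖ ^ 2) *
      Real.exp (-(2 * (m + 1) * Real.log (eu (along p i z) + 1)))) (a := 0)
    (((continuousOn_dWeight hM _).mono fun z hz => (hK₁ hz).1).mul
      (Real.continuous_exp.comp_continuousOn (continuousOn_const.mul
        ((hcV.add continuous_const).continuousOn.log fun z _ =>
          (add_pos_of_nonneg_of_pos (eu_nonneg _) one_pos).ne')).neg))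
    fun z _ => by positivity
  set S₁ := (∫ y, bump m r₁ y)⁻¹ * (κ₁⁻¹ * A) with hS₁
  obtain ⟨k, hk⟩ : ∃ k : ℕ, S₁ * Real.exp (-(k * (c₁ - c'))) ≤ (η / 2) ^ 2 := by
    have h1 : Tendsto (fun k : ℕ => S₁ * Real.exp (-(k * (c₁ - c')))) atTop (𝓝 (S₁ * 0)) :=
      (Real.tendsto_exp_neg_atTop_nhds_zero.comp
        (tendsto_natCast_atTop_atTop.atTop_mul_const (sub_pos.2 hc'₁))).const_mul S₁
    rw [mul_zero] at h1
    exact (h1.eventually_le_const (by positivity)).exists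
  -- the region near the peak
  have hKp : IsCompact ((fun l : ℂ => l • p) '' sphere 0 1) :=
    (isCompact_sphere 0 1).image (by fun_prop)
  have hratio : ∀ l : ℂ, (l • p) i / p i = l := fun l => by
    rw [Pi.smul_apply, smul_eq_mul, mul_div_cancel_right₀ _ hi]
  have halong : ∀ l : ℂ, along p i (l • p) = 0 := fun l => by
    rw [along_apply, hratio, sub_self]
  obtain ⟨r₂, hr₂, hK₂⟩ := hKp.exists_cthickening_subset_open
    (hY.inter (isOpen_inner (p := p) (i := i) (δ := δ))) (by
      rintro _ ⟨l, hl, rfl⟩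
      have hl1 : ‖l‖ = 1 := mem_sphere_zero_iff_norm.1 hl
      refine ⟨smul_mem_off hM l (norm_ne_zero_iff.1 (by rw [hl1]; exact one_ne_zero)) p hp, ?_⟩
      change eu (along p i (l • p)) < δ * ‖(l • p) i / p i‖
      rwa [halong, hratio, hl1, eu_eq_zero.2 rfl, mul_one])
  obtain ⟨κ₂, hκ₂, hκ₂b⟩ := (hKp.cthickening (r := r₂)).exists_forall_le'
    (f := fun z => Real.exp (-(k * exh M z)) *
      Real.exp ((2 * (m + 1) + 4) * Real.log (dM M z) - ∑ j, ‖z j‖ ^ 2)) (a := 0)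
    ((Real.continuous_exp.comp_continuousOn (continuousOn_const.mul ((continuousOn_exh hM).mono
      fun z hz => (hK₂ hz).1)).neg).mul ((continuousOn_dWeight hM _).mono fun z hz => (hK₂ hz).1))
    fun z _ => by positivity
  set D : ℝ := Real.sqrt m * ‖along p i‖ + 1 with hD
  have hD0 : 0 < D := by positivity
  set S₂ := (∫ y, bump m 1 y)⁻¹ * (κ₂⁻¹ * D ^ (2 * (m + 1)) * (A * Real.exp (-(k * c₁)))) with hS₂
  obtain ⟨ε, hε, hε₁, hεr, hεS⟩ : ∃ ε > 0, ε ≤ 1 ∧ ε ≤ r₂ ∧ S₂ * ε ^ 2 ≤ (1 / 2) ^ 2 := by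
    have h1 : Tendsto (fun ε : ℝ => S₂ * ε ^ 2) (𝓝[>] 0) (𝓝 0) :=
      (Continuous.tendsto' (by fun_prop) 0 0 (by simp)).mono_left nhdsWithin_le_nhds
    obtain ⟨ε, h⟩ := ((h1.eventually_le_const (show (0 : ℝ) < (1 / 2) ^ 2 by positivity)).and
      (Ioc_mem_nhdsGT (lt_min one_pos hr₂))).exists
    exact ⟨ε, h.2.1, h.2.2.trans (min_le_left _ _), h.2.2.trans (min_le_right _ _), h.1⟩
  obtain ⟨F, hFd, hFi, hFA⟩ := hF k ε hε
  obtain ⟨u, hu, huh, hub⟩ := exists_homogeneous hY (smul_mem_off hM) hFd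
  have hsmall : ∀ x ∈ off M, ‖x‖ = 1 → exh M x ≤ c → ‖F x‖ ≤ η / 2 := by
    intro x hx hx1 hxc
    have hball : closedBall x r₁ ⊆ cthickening r₁
        {z | z ∈ off M ∧ ‖z‖ = 1 ∧ exh M z ≤ c} :=
      closedBall_subset_cthickening (E := {z | z ∈ off M ∧ ‖z‖ = 1 ∧ exh M z ≤ c})
        ⟨hx, hx1, hxc⟩ r₁
    refine le_of_sq_le_sq (le_trans ?_ hk) (by positivity)
    refine (normSq_le_of_weight (f := F) (κ := Real.exp (-(k * c')) * κ₁) hr₁ (by positivity)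
      (fun y hy => (hK₁ (hball hy)).1)
      (fun y hy => hFd.differentiableAt (hY.mem_nhds (hK₁ (hball hy)).1)) ?_ ?_
      (fun y => (Real.exp_pos _).le) hFi hFA).trans_eq ?_
    · intro y hy
      have h1 := hK₁ (hball hy)
      have h2 : exh M y < c' := h1.2
      rw [coneCutoff_eq_zero hδ, zero_sub, norm_neg]
      by_contra! h
      exact (hcone y h1.1 h).not_gt (h2.trans hc'₁)
    · intro y hy
      have h1 := hK₁ (hball hy)
      have h2 : exh M y ≤ c' := le_of_lt h1.2
      rw [exp_neg_peakWeight, mul_assoc]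
      refine mul_le_mul (Real.exp_le_exp.2 (neg_le_neg (mul_le_mul_of_nonneg_left h2
        (Nat.cast_nonneg k)))) ((hκ₁b y (hball hy)).trans ?_) hκ₁.le (Real.exp_pos _).le
      refine mul_le_mul_of_nonneg_left (Real.exp_le_exp.2 (neg_le_neg
        (mul_le_mul_of_nonneg_left (Real.log_le_log (eu_pos (shift_ne_zero hi hε y))
          ((eu_shift_le hε.le y).trans (by linarith))) (by positivity)))) (Real.exp_pos _).le
    · have : Real.exp (-(k * (c₁ - c'))) = (Real.exp (-(k * c')))⁻¹ * Real.exp (-(k * c₁)) := by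
        rw [← Real.exp_neg, ← Real.exp_add]
        ring_nf
      rw [hS₁, this, mul_inv]
      ring
  have hpeak : ∀ l : ℂ, ‖l‖ = 1 → ‖l * F (l • p) - 1‖ ≤ 1 / 2 := by
    intro l hl
    have hl0 : l ≠ 0 := norm_ne_zero_iff.1 (by rw [hl]; exact one_ne_zero)
    have hball : closedBall (l • p) ε ⊆ cthickening r₂
        ((fun l : ℂ => l • p) '' sphere 0 1) :=
      (closedBall_subset_closedBall hεr).trans (closedBall_subset_cthickening
        (E := (fun l : ℂ => l • p) '' sphere 0 1)
        ⟨l, mem_sphere_zero_iff_norm.2 hl, rfl⟩ r₂)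
    have heq : ‖l * F (l • p) - 1‖ = ‖((l • p) i / p i)⁻¹ - F (l • p)‖ := by
      have h1 : l * F (l • p) - 1 = -(l * (l⁻¹ - F (l • p))) := by
        rw [mul_sub, mul_inv_cancel₀ hl0]
        ring
      rw [hratio, h1, norm_neg, norm_mul, hl, one_mul]
    rw [heq]
    refine le_of_sq_le_sq (le_trans ?_ hεS) (by positivity)
    refine (normSq_le_of_weight (f := fun z => (z i / p i)⁻¹ - F z)
      (κ := κ₂ * ((D * ε) ^ (2 * (m + 1)))⁻¹) hε (by positivity)
      (fun y hy => (hK₂ (hball hy)).1) ?_ ?_ ?_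
      (fun y => (Real.exp_pos _).le) hFi hFA).trans_eq ?_
    · intro y hy
      have h1 := hK₂ (hball hy)
      have h2 : eu (along p i y) < δ * ‖y i / p i‖ := h1.2
      have h0 : y i / p i ≠ 0 := fun h0 => by
        rw [h0, norm_zero, mul_zero] at h2
        exact (eu_nonneg _).not_gt h2
      have h3 : DifferentiableAt ℂ (fun z : ℂ^m => (z i / p i)⁻¹) y :=
        DifferentiableAt.inv (by fun_prop) h0
      exact h3.sub (hFd.differentiableAt (hY.mem_nhds h1.1))
    · intro y hy
      rw [coneCutoff_eq_inv (hK₂ (hball hy)).2]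
    · intro y hy
      rw [exp_neg_peakWeight]
      refine mul_le_mul (hκ₂b y (hball hy)) ?_ (by positivity) (by positivity)
      have h1 : eu (along p i y + Pi.single i (ε : ℂ)) ≤ D * ε := by
        refine (eu_shift_le hε.le y).trans ?_
        have h2 : along p i y = along p i (y - l • p) := by rw [map_sub, halong, sub_zero]
        have h3 : ‖along p i (y - l • p)‖ ≤ ‖along p i‖ * ε :=
          ((along p i).le_opNorm _).trans (mul_le_mul_of_nonneg_left
            (mem_closedBall_iff_norm.1 hy) (norm_nonneg _))
        rw [h2]
        have h4 := (eu_le_norm (along p i (y - l • p))).trans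
          (mul_le_mul_of_nonneg_left h3 (Real.sqrt_nonneg m))
        rw [hD]
        linarith
      have h2 := Real.log_le_log (eu_pos (shift_ne_zero hi hε y)) h1
      rw [← Real.exp_log (show 0 < ((D * ε) ^ (2 * (m + 1)))⁻¹ by positivity), Real.log_inv,
        Real.log_pow]
      push_cast
      exact Real.exp_le_exp.2 (neg_le_neg (mul_le_mul_of_nonneg_left h2 (by positivity)))
    · rw [integral_bump hε, hS₂]
      field_simp
      rw [mul_pow]
      ring
  refine ⟨fun z => 2 * u z, hu.const_mul 2, fun l hl z hz => ?_, ?_, fun z hz hz1 hzc => ?_⟩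
  · change 2 * u (l • z) = l⁻¹ * (2 * u z)
    rw [huh l hl z hz]
    ring
  · have h1 := hub p hp 1 (1 / 2) hpeak
    have h2 := norm_sub_norm_le (1 : ℂ) (u p)
    rw [norm_sub_rev, norm_one] at h2
    change 1 ≤ ‖2 * u p‖
    rw [norm_mul, norm_ofNat]
    linarith
  · have h1 := hub z hz 0 (η / 2) fun l hl => by
      have hl0 : l ≠ 0 := norm_ne_zero_iff.1 (by rw [hl]; exact one_ne_zero)
      rw [sub_zero, norm_mul, hl, one_mul]
      refine hsmall _ (smul_mem_off hM l hl0 z hz) (by rw [norm_smul, hl, hz1, one_mul]) ?_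
      rwa [exh_smul hM hl0 hz]
    rw [sub_zero] at h1
    change ‖2 * u z‖ ≤ η
    rw [norm_mul, norm_ofNat]
    linarith

end Peak

section Random
variable {ι : Type*} [Fintype ι]

theorem volume_slab_le {R : ℝ} (hR : 1 ≤ R) (H : ι → ℂ) (b : ℂ) {i₀ : ι} (h : H i₀ ≠ 0) :
    volume {l : ι → ℂ | (∀ i, ‖l i‖ ≤ 1) ∧ ‖∑ i, l i * H i + b‖ ≤ R} ≤
      ENNReal.ofReal ((‖H i₀‖ ^ 2)⁻¹) * volume (closedBall (0 : ℂ) R) ^ Fintype.card ι := by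
  classical
  set Φ : (ι → ℂ) →ₗ[ℝ] (ι → ℂ) :=
    (Matrix.toLin' ((1 : Matrix ι ι ℂ).updateRow i₀ H)).restrictScalars ℝ with hΦ
  have hdet : LinearMap.det Φ = ‖H i₀‖ ^ 2 := by
    rw [hΦ, LinearMap.det_restrictScalars, LinearMap.det_toLin', Algebra.norm_complex_apply,
      ← Matrix.det_transpose, ← Matrix.updateCol_transpose, Matrix.transpose_one,
      ← Matrix.cramer_apply, Matrix.cramer_one, normSq_eq_norm_sq]
    rfl
  have hsub : {l : ι → ℂ | (∀ i, ‖l i‖ ≤ 1) ∧ ‖∑ i, l i * H i + b‖ ≤ R} ⊆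
      Φ ⁻¹' Set.pi univ fun i => closedBall (if i = i₀ then -b else 0) R := by
    rintro l ⟨h1, h2⟩ i _
    have : Φ l i = (1 : Matrix ι ι ℂ).updateRow i₀ H i ⬝ᵥ l := rfl
    rw [mem_closedBall_iff_norm, this]
    split_ifs with hi
    · rw [hi, Matrix.updateRow_self, sub_neg_eq_add]
      refine (le_of_eq ?_).trans h2
      simp only [dotProduct, mul_comm]
    · have h3 : (1 : Matrix ι ι ℂ) i ⬝ᵥ l = l i := congrFun (Matrix.one_mulVec l) i
      rw [Matrix.updateRow_ne hi, h3, sub_zero]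
      exact (h1 i).trans hR
  refine (measure_mono hsub).trans ?_
  rw [Measure.addHaar_preimage_linearMap _ (by rw [hdet]; positivity), hdet,
    abs_of_pos (by positivity), volume_pi_pi]
  refine mul_le_mul_right (le_of_eq ?_) _
  simp only [Measure.addHaar_closedBall_center]
  rw [Finset.prod_const, Finset.card_univ]

variable {m : ℕ} {g h : ι → ℂ^m → ℂ} {b : Fin (4 * m) → ℂ^m → ℂ}

/-- The coefficients in the unit polydisc for which a combination of the functions `h * g ^ k`,
perturbed by `b`, fails to be large somewhere on `V`. -/
def badCoeff (g h : ι → ℂ^m → ℂ) (b : Fin (4 * m) → ℂ^m → ℂ) (R : ℝ) (k : ℕ)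
    (V : Set ℂ^m) : Set (Fin (4 * m) → ι → ℂ) :=
  {L | (∀ n i, ‖L n i‖ ≤ 1) ∧ ∃ z ∈ V, ∀ n, ‖∑ i, L n i * (h i z * g i z ^ k) + b n z‖ ≤ R}

theorem badCoeff_mono (R : ℝ) (k : ℕ) {V W : Set ℂ^m} (hVW : V ⊆ W) :
    badCoeff g h b R k V ⊆ badCoeff g h b R k W :=
  fun _ hL => ⟨hL.1, hL.2.imp fun _ hz => ⟨hVW hz.1, hz.2⟩⟩

theorem badCoeff_union (R : ℝ) (k : ℕ) (V W : Set ℂ^m) :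
    badCoeff g h b R k (V ∪ W) ⊆ badCoeff g h b R k V ∪ badCoeff g h b R k W := by
  rintro L ⟨h1, z, hz | hz, h2⟩
  exacts [.inl ⟨h1, z, hz, h2⟩, .inr ⟨h1, z, hz, h2⟩]

theorem norm_mul_pow_sub_le {x y u v : ℂ} {s Q δ : ℝ} (hs : 1 ≤ s) (hQ : 1 ≤ Q) (hu : ‖u‖ ≤ s)
    (hv : ‖v‖ ≤ s) (hy : ‖y‖ ≤ Q) (hxy : ‖x - y‖ ≤ Q * δ) (huv : ‖u - v‖ ≤ Q * δ)
    (hδ : 0 ≤ δ) (k : ℕ) : ‖x * u ^ k - y * v ^ k‖ ≤ Q ^ 2 * (k + 1) * s ^ k * δ := by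
  induction k with
  | zero =>
    simp only [pow_zero, mul_one, Nat.cast_zero, zero_add]
    exact hxy.trans (mul_le_mul_of_nonneg_right (by nlinarith) hδ)
  | succ k ih =>
    have h1 : x * u ^ (k + 1) - y * v ^ (k + 1) =
        (x * u ^ k - y * v ^ k) * u + y * v ^ k * (u - v) := by ring
    have h2 : ‖y * v ^ k‖ ≤ Q * s ^ k := by
      rw [norm_mul, norm_pow]
      gcongr
    have h3 : ‖y * v ^ k * (u - v)‖ ≤ Q * s ^ k * (Q * δ) := by
      rw [norm_mul]
      gcongr
    have h4 : ‖(x * u ^ k - y * v ^ k) * u‖ ≤ Q ^ 2 * (k + 1) * s ^ k * δ * s := by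
      rw [norm_mul]
      gcongr
    rw [h1]
    refine (norm_add_le _ _).trans ((add_le_add h4 h3).trans ?_)
    have h5 : 0 ≤ Q ^ 2 * s ^ k * δ := by positivity
    rw [pow_succ s k]
    push_cast
    nlinarith [mul_nonneg h5 (sub_nonneg.2 hs)]

/-- The cell of the grid of mesh `1 / n` containing a point. -/
def cell (n : ℕ) (z : ℂ^m) : Fin m → ℤ × ℤ := fun i => (⌊(z i).re * n⌋, ⌊(z i).im * n⌋)

/-- The cells meeting the unit polydisc. -/
def cells (m n : ℕ) : Finset (Fin m → ℤ × ℤ) :=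
  Fintype.piFinset fun _ => Finset.Icc (-n : ℤ) n ×ˢ Finset.Icc (-n : ℤ) n

theorem floor_mem_Icc {x : ℝ} (hx : |x| ≤ 1) (n : ℕ) : ⌊x * n⌋ ∈ Finset.Icc (-n : ℤ) n := by
  obtain ⟨h1, h2⟩ := abs_le.1 hx
  have hn : (0 : ℝ) ≤ n := n.cast_nonneg
  rw [Finset.mem_Icc, Int.le_floor]
  refine ⟨by push_cast; nlinarith, ?_⟩
  have h3 : (⌊x * n⌋ : ℝ) ≤ n := (Int.floor_le _).trans (by nlinarith)
  exact_mod_cast h3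

theorem cell_mem_cells {z : ℂ^m} (hz : ‖z‖ ≤ 1) (n : ℕ) : cell n z ∈ cells m n :=
  Fintype.mem_piFinset.2 fun i => Finset.mem_product.2
    ⟨floor_mem_Icc ((abs_re_le_norm _).trans ((norm_le_pi_norm z i).trans hz)) n,
      floor_mem_Icc ((abs_im_le_norm _).trans ((norm_le_pi_norm z i).trans hz)) n⟩

theorem card_cells_le {n : ℕ} (hn : 1 ≤ n) : ((cells m n).card : ℝ) ≤ (9 * (n : ℝ) ^ 2) ^ m := by
  rw [cells, Fintype.card_piFinset_const, Finset.card_product, Int.card_Icc]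
  have h1 : ((n : ℤ) + 1 - -n).toNat = 2 * n + 1 := by omega
  rw [h1]
  push_cast
  have : (1 : ℝ) ≤ n := by exact_mod_cast hn
  exact pow_le_pow_left₀ (by positivity) (by nlinarith) m

theorem norm_sub_le_of_cell_eq {n : ℕ} (hn : 1 ≤ n) {z w : ℂ^m} (h : cell n z = cell n w) :
    ‖z - w‖ ≤ 2 / n := by
  have hn' : (0 : ℝ) < n := by exact_mod_cast hn
  have key : ∀ x y : ℝ, ⌊x * n⌋ = ⌊y * n⌋ → |x - y| ≤ 1 / n := fun x y hxy => by
    rw [le_div_iff₀ hn', ← Nat.abs_cast n, ← abs_mul, sub_mul]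
    exact (Int.abs_sub_lt_one_of_floor_eq_floor hxy).le
  refine (pi_norm_le_iff_of_nonneg (by positivity)).2 fun i => ?_
  have hi := congrFun h i
  refine (norm_le_abs_re_add_abs_im _).trans ?_
  have h1 := key _ _ (congrArg Prod.fst hi)
  have h2 := key _ _ (congrArg Prod.snd hi)
  rw [Pi.sub_apply, sub_re, sub_im]
  have h3 : (2 : ℝ) / n = 1 / n + 1 / n := by ring
  rw [h3]
  exact add_le_add h1 h2

/-- On a small piece, where one of the functions dominates, almost all coefficients are good. -/
theorem tendsto_volume_badCoeff (hm : 0 < m) {V : Set ℂ^m} (hV : ∀ z ∈ V, ‖z‖ ≤ 1)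
    {s r Q R : ℝ} (hs : 1 ≤ s) (hr : 0 < r) (hsr : s < r ^ 4) (hQ : 1 ≤ Q) (hR : 0 ≤ R)
    (hg : ∀ z ∈ V, ∀ i, ‖g i z‖ ≤ s) (hh : ∀ z ∈ V, ∀ i, ‖h i z‖ ≤ Q)
    (hgl : ∀ z ∈ V, ∀ w ∈ V, ∀ i, ‖g i z - g i w‖ ≤ Q * ‖z - w‖)
    (hhl : ∀ z ∈ V, ∀ w ∈ V, ∀ i, ‖h i z - h i w‖ ≤ Q * ‖z - w‖)
    (hbl : ∀ z ∈ V, ∀ w ∈ V, ∀ i, ‖b i z - b i w‖ ≤ Q * ‖z - w‖) {i₀ : ι}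
    (hi₀ : ∀ z ∈ V, r ≤ ‖g i₀ z‖ ∧ 1 ≤ ‖h i₀ z‖) :
    Tendsto (fun k => volume (badCoeff g h b R k V)) atTop (𝓝 0) := by
  set A : ℝ := (volume (closedBall (0 : ℂ) (R + 1)) ^ Fintype.card ι).toReal with hA
  set D : ℝ := (Fintype.card ι + 1) * Q ^ 2 with hD
  have hD1 : 1 ≤ D := by
    have : (0 : ℝ) ≤ Fintype.card ι := Nat.cast_nonneg _
    nlinarith
  have hA0 : 0 ≤ A := ENNReal.toReal_nonneg
  have hAtop : volume (closedBall (0 : ℂ) (R + 1)) ^ Fintype.card ι = ENNReal.ofReal A :=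
    (ENNReal.ofReal_toReal (ENNReal.pow_ne_top measure_closedBall_lt_top.ne)).symm
  -- a bound for each cell
  have hpt : ∀ k : ℕ, ∀ z ∈ V, volume {L : Fin (4 * m) → ι → ℂ | (∀ n i, ‖L n i‖ ≤ 1) ∧
      ∀ n, ‖∑ i, L n i * (h i z * g i z ^ k) + b n z‖ ≤ R + 1} ≤
        ENNReal.ofReal (((r ^ k) ^ 2)⁻¹ * A) ^ (4 * m) := by
    intro k z hz
    have h0 : r ^ k ≤ ‖h i₀ z * g i₀ z ^ k‖ := by
      rw [norm_mul, norm_pow, ← one_mul (r ^ k)]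
      exact mul_le_mul (hi₀ z hz).2 (pow_le_pow_left₀ hr.le (hi₀ z hz).1 k) (by positivity)
        (norm_nonneg _)
    have h1 : {L : Fin (4 * m) → ι → ℂ | (∀ n i, ‖L n i‖ ≤ 1) ∧
        ∀ n, ‖∑ i, L n i * (h i z * g i z ^ k) + b n z‖ ≤ R + 1} =
        Set.pi univ fun n => {l : ι → ℂ | (∀ i, ‖l i‖ ≤ 1) ∧
          ‖∑ i, l i * (h i z * g i z ^ k) + b n z‖ ≤ R + 1} :=
      Set.ext fun L => ⟨fun hL n _ => ⟨hL.1 n, hL.2 n⟩,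
        fun hL => ⟨fun n => (hL n trivial).1, fun n => (hL n trivial).2⟩⟩
    rw [h1, volume_pi_pi]
    refine (Finset.prod_le_pow_card _ _ _ fun n _ => ?_).trans_eq (by
      rw [Finset.card_univ, Fintype.card_fin])
    refine (volume_slab_le (by linarith) _ (b n z) (i₀ := i₀)
      (norm_pos_iff.1 ((pow_pos hr k).trans_le h0))).trans ?_
    rw [hAtop, ← ENNReal.ofReal_mul (by positivity)]
    have := pow_pos hr k
    exact ENNReal.ofReal_le_ofReal (by gcongr)
  have hbound : ∀ k : ℕ, volume (badCoeff g h b R k V) ≤ ENNReal.ofReal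
      ((81 * D ^ 2 * A ^ 4 * (((k + 1) * (s / r ^ 4) ^ k) ^ 2)) ^ m) := by
    intro k
    set n := ⌈2 * (D * (k + 1) * s ^ k)⌉₊ with hn
    have hX : 1 ≤ D * (k + 1) * s ^ k := by
      have : (0 : ℝ) ≤ k := Nat.cast_nonneg _
      exact one_le_mul_of_one_le_of_one_le (by nlinarith) (one_le_pow₀ hs)
    have hn1 : 2 * (D * (k + 1) * s ^ k) ≤ n := Nat.le_ceil _
    have hn2 : (n : ℝ) ≤ 3 * (D * (k + 1) * s ^ k) :=
      (Nat.ceil_lt_add_one (by linarith)).le.trans (by linarith)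
    have hn0 : 1 ≤ n := by
      have : (1 : ℝ) ≤ n := by linarith
      exact_mod_cast this
    have hsub : badCoeff g h b R k V ⊆ ⋃ c ∈ cells m n, badCoeff g h b R k (V ∩ {z | cell n z = c}) :=
      fun L ⟨h1, z, hz, h2⟩ => mem_biUnion (cell_mem_cells (hV z hz) n) ⟨h1, z, ⟨hz, rfl⟩, h2⟩
    refine (measure_mono hsub).trans ((measure_biUnion_finset_le _ _).trans
      ((Finset.sum_le_card_nsmul _ _ (ENNReal.ofReal (((r ^ k) ^ 2)⁻¹ * A) ^ (4 * m))
        fun c _ => ?_).trans ?_))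
    · rcases (V ∩ {z | cell n z = c}).eq_empty_or_nonempty with he | ⟨w, hw, hwc⟩
      · have : badCoeff g h b R k (V ∩ {z | cell n z = c}) = ∅ := by
          rw [he]
          exact eq_empty_of_forall_notMem fun L hL => hL.2.elim fun z hz => hz.1
        rw [this, measure_empty]
        exact zero_le
      refine (measure_mono ?_).trans (hpt k w hw)
      rintro L ⟨h1, z, ⟨hz, hzc⟩, h2⟩
      refine ⟨h1, fun j => ?_⟩
      have hzw := norm_sub_le_of_cell_eq hn0 (hwc.trans hzc.symm)
      have e : ∑ i, L j i * (h i w * g i w ^ k) + b j w =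
          (∑ i, L j i * (h i z * g i z ^ k) + b j z) +
          (∑ i, L j i * (h i w * g i w ^ k - h i z * g i z ^ k) + (b j w - b j z)) := by
        simp only [mul_sub, Finset.sum_sub_distrib]
        ring
      rw [e]
      refine (norm_add_le _ _).trans (add_le_add (h2 j) ((norm_add_le _ _).trans ?_))
      have h3 : ‖∑ i, L j i * (h i w * g i w ^ k - h i z * g i z ^ k)‖ ≤
          Fintype.card ι * (Q ^ 2 * (k + 1) * s ^ k * ‖w - z‖) := by
        rw [← nsmul_eq_mul, ← Finset.card_univ, ← Finset.sum_const]
        refine norm_sum_le_of_le _ fun i _ => ?_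
        rw [norm_mul, ← one_mul (Q ^ 2 * _ * _ * _)]
        exact mul_le_mul (h1 j i) (norm_mul_pow_sub_le hs hQ (hg w hw i) (hg z hz i) (hh z hz i)
          (hhl w hw z hz i) (hgl w hw z hz i) (norm_nonneg _) k) (norm_nonneg _) zero_le_one
      have h4 : Q * ‖w - z‖ ≤ Q ^ 2 * (k + 1) * s ^ k * ‖w - z‖ := by
        refine mul_le_mul_of_nonneg_right ?_ (norm_nonneg _)
        have h5 : Q ≤ Q ^ 2 := by nlinarith
        have h6 : (1 : ℝ) ≤ (k + 1) * s ^ k :=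
          one_le_mul_of_one_le_of_one_le (by linarith [(Nat.cast_nonneg k : (0 : ℝ) ≤ k)])
            (one_le_pow₀ hs)
        nlinarith
      refine (add_le_add h3 ((hbl w hw z hz j).trans h4)).trans ?_
      calc _ = D * (k + 1) * s ^ k * ‖w - z‖ := by rw [hD]; ring
        _ ≤ D * (k + 1) * s ^ k * (2 / n) := by gcongr
        _ ≤ 1 := by
          rw [mul_div_assoc', div_le_one (by linarith)]
          linarith
    · rw [nsmul_eq_mul, ← ENNReal.ofReal_natCast, ← ENNReal.ofReal_pow (by positivity),
        ← ENNReal.ofReal_mul (Nat.cast_nonneg _)]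
      refine ENNReal.ofReal_le_ofReal ?_
      calc _ ≤ (9 * (3 * (D * (k + 1) * s ^ k)) ^ 2) ^ m * (((r ^ k) ^ 2)⁻¹ * A) ^ (4 * m) := by
            refine mul_le_mul_of_nonneg_right ((card_cells_le hn0).trans ?_) (by positivity)
            gcongr
        _ = _ := by
          rw [pow_mul, ← mul_pow, div_pow, ← pow_mul r 4, mul_comm 4 k, pow_mul r k]
          congr 1
          have hx := (pow_pos hr k).ne'
          generalize r ^ k = x at hx ⊢
          generalize s ^ k = y
          field_simp
          ring
  have hlim : Tendsto (fun k : ℕ => (81 * D ^ 2 * A ^ 4 * (((k + 1) * (s / r ^ 4) ^ k) ^ 2)) ^ m)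
      atTop (𝓝 0) := by
    have hx0 : 0 ≤ s / r ^ 4 := by positivity
    have hx1 : s / r ^ 4 < 1 := (div_lt_one (by positivity)).2 hsr
    have h1 : Tendsto (fun k : ℕ => ((k : ℝ) + 1) * (s / r ^ 4) ^ k) atTop (𝓝 (0 + 0)) := by
      simp only [add_mul, one_mul]
      exact (tendsto_self_mul_const_pow_of_lt_one hx0 hx1).add
        (tendsto_pow_atTop_nhds_zero_of_lt_one hx0 hx1)
    have h2 := (((h1.pow 2).const_mul (81 * D ^ 2 * A ^ 4)).pow m)
    rwa [add_zero, zero_pow two_ne_zero, mul_zero, zero_pow hm.ne'] at h2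
  have h3 := ENNReal.tendsto_ofReal hlim
  rw [ENNReal.ofReal_zero] at h3
  exact tendsto_of_tendsto_of_tendsto_of_le_of_le tendsto_const_nhds h3 (fun _ => zero_le) hbound

end Random

section Random
variable {ι : Type*} [Fintype ι] {m : ℕ} {g h : ι → ℂ^m → ℂ}
  {b : Fin (4 * m) → ℂ^m → ℂ}

/-- Generic combinations of `h * g ^ k` make the perturbed functions `b` large on a compact set. -/
theorem eventually_exists_coeff (hm : 0 < m) {Y K : Set ℂ^m} (hY : IsOpen Y)
    (hK : IsCompact K) (hKY : K ⊆ Y) (hK1 : ∀ z ∈ K, ‖z‖ ≤ 1)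
    (hg : ∀ i, DifferentiableOn ℂ (g i) Y) (hh : ∀ i, DifferentiableOn ℂ (h i) Y)
    (hb : ∀ n, DifferentiableOn ℂ (b n) Y) (hgh : ∀ z ∈ K, ∀ i, ‖g i z‖ ≤ ‖h i z‖)
    (hbig : ∀ z ∈ K, ∃ i, 2 ≤ ‖g i z‖) {R : ℝ} (hR : 0 ≤ R) :
    ∀ᶠ k in atTop, ∃ L : Fin (4 * m) → ι → ℂ, (∀ n i, ‖L n i‖ ≤ 1) ∧
      ∀ z ∈ K, ∃ n, R ≤ ‖∑ i, L n i * (h i z * g i z ^ k) + b n z‖ := by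
  have key : Tendsto (fun k => volume (badCoeff g h b R k K)) atTop (𝓝 0) := by
    refine hK.induction_on (p := fun V => Tendsto (fun k => volume (badCoeff g h b R k V))
      atTop (𝓝 0)) ?_ (fun V W hVW hW => ?_) (fun V W hV hW => ?_) fun p hp => ?_
    · have : ∀ k, badCoeff g h b R k ∅ = ∅ := fun k =>
        eq_empty_of_forall_notMem fun L hL => hL.2.elim fun z hz => hz.1
      simp only [this, measure_empty]
      exact tendsto_const_nhds
    · exact tendsto_of_tendsto_of_tendsto_of_le_of_le tendsto_const_nhds hW (fun _ => zero_le)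
        fun k => measure_mono (badCoeff_mono R k hVW)
    · have h1 := hV.add hW
      rw [add_zero] at h1
      exact tendsto_of_tendsto_of_tendsto_of_le_of_le tendsto_const_nhds h1 (fun _ => zero_le)
        fun k => (measure_mono (badCoeff_union R k V W)).trans (measure_union_le _ _)
    obtain ⟨j, hj⟩ := hbig p hp
    have : Nonempty ι := ⟨j⟩
    obtain ⟨i₀, hi₀⟩ := Finite.exists_max fun i => ‖g i p‖
    have hw : 2 ≤ ‖g i₀ p‖ := hj.trans (hi₀ j)
    set w := ‖g i₀ p‖ with hw_def
    set G : ℂ^m → (ι ⊕ ι ⊕ Fin (4 * m)) → ℂ := fun z =>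
      Sum.elim (fun i => g i z) (Sum.elim (fun i => h i z) fun n => b n z) with hG
    have hGc : ContDiffAt ℝ 1 G p := by
      refine contDiffAt_pi.2 ?_
      rintro (i | i | i)
      exacts [(contDiffAt_of_holomorphic hY (hg i) (hKY hp)).of_le (by simp),
        (contDiffAt_of_holomorphic hY (hh i) (hKY hp)).of_le (by simp),
        (contDiffAt_of_holomorphic hY (hb i) (hKY hp)).of_le (by simp)]
    obtain ⟨C, t, ht, hC⟩ := hGc.exists_lipschitzOnWith
    have hGn : ∀ᶠ z in 𝓝 p, ‖G z‖ < ‖G p‖ + 1 :=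
      hGc.continuousAt.norm.eventually_lt_const (lt_add_one _)
    have hgc : ∀ i, ContinuousAt (fun z => ‖g i z‖) p := fun i =>
      ((hg i).continuousOn.continuousAt (hY.mem_nhds (hKY hp))).norm
    have hgs : ∀ᶠ z in 𝓝 p, ∀ i, ‖g i z‖ < 2 * w := eventually_all.2 fun i =>
      (hgc i).eventually_lt_const ((hi₀ i).trans_lt (by linarith))
    have hgr : ∀ᶠ z in 𝓝 p, 3 / 4 * w < ‖g i₀ z‖ :=
      (hgc i₀).eventually_const_lt (show 3 / 4 * w < ‖g i₀ p‖ by linarith)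
    refine ⟨K ∩ {z | z ∈ t ∧ ‖G z‖ < ‖G p‖ + 1 ∧ (∀ i, ‖g i z‖ < 2 * w) ∧ 3 / 4 * w < ‖g i₀ z‖},
      inter_mem self_mem_nhdsWithin (mem_nhdsWithin_of_mem_nhds
        (Filter.Eventually.and ht (hGn.and (hgs.and hgr)))), ?_⟩
    have hlip : ∀ z ∈ t, ∀ z' ∈ t, ∀ i, ‖G z i - G z' i‖ ≤ (‖G p‖ + 1 + C) * ‖z - z'‖ :=
      fun z hz z' hz' i => (norm_le_pi_norm (G z - G z') i).trans ((hC.norm_sub_le hz hz').trans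
        (mul_le_mul_of_nonneg_right (by linarith [norm_nonneg (G p)]) (norm_nonneg _)))
    have hC0 : (0 : ℝ) ≤ C := C.coe_nonneg
    have hw4 : 2 * w < (3 / 4 * w) ^ 4 := by
      have h1 : 8 ≤ w ^ 3 := by nlinarith [sq_nonneg (w - 2)]
      nlinarith
    refine tendsto_volume_badCoeff hm (fun z hz => hK1 z hz.1) (s := 2 * w) (r := 3 / 4 * w)
      (Q := ‖G p‖ + 1 + C) (by linarith) (by linarith) hw4 (by linarith [norm_nonneg (G p)]) hR
      (fun z hz i => (hz.2.2.2.1 i).le) (fun z hz i => ?_)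
      (fun z hz z' hz' i => hlip z hz.2.1 z' hz'.2.1 (.inl i))
      (fun z hz z' hz' i => hlip z hz.2.1 z' hz'.2.1 (.inr (.inl i)))
      (fun z hz z' hz' i => hlip z hz.2.1 z' hz'.2.1 (.inr (.inr i))) (i₀ := i₀)
      fun z hz => ⟨hz.2.2.2.2.le, ?_⟩
    · exact (norm_le_pi_norm (G z) (.inr (.inl i))).trans (by linarith [hz.2.2.1])
    · exact le_trans (by linarith [hz.2.2.2.2]) (hgh z hz.1 i₀)
  have hpos : 0 < volume (closedBall (0 : Fin (4 * m) → ι → ℂ) 1) :=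
    measure_closedBall_pos _ _ one_pos
  filter_upwards [key.eventually_lt_const hpos] with k hk
  obtain ⟨L, hL, hLb⟩ := not_subset.1 fun hsub => (measure_mono hsub).not_gt hk
  have hL1 : ∀ n i, ‖L n i‖ ≤ 1 := fun n i =>
    (norm_le_pi_norm (L n) i).trans ((norm_le_pi_norm L n).trans (mem_closedBall_zero_iff.1 hL))
  refine ⟨L, hL1, fun z hz => ?_⟩
  by_contra! hn
  exact hLb ⟨hL1, z, hz, fun n => (hn n).le⟩

variable {M : Set ℂ^m}

/-- Holomorphic sections of degree `-1`. -/
def IsSection (M : Set ℂ^m) (u : ℂ^m → ℂ) : Prop :=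
  DifferentiableOn ℂ u (off M) ∧ ∀ c : ℂ, c ≠ 0 → ∀ z ∈ off M, u (c • z) = c⁻¹ * u z

theorem exists_coord (hm : 0 < m) {z : ℂ^m} (hz : ‖z‖ = 1) : ∃ a, ‖z a‖ = 1 := by
  have : Nonempty (Fin m) := ⟨⟨0, hm⟩⟩
  obtain ⟨a, ha⟩ := Finite.exists_max fun i => ‖z i‖
  exact ⟨a, le_antisymm (hz ▸ norm_le_pi_norm z a)
    (hz ▸ (pi_norm_le_iff_of_nonneg (norm_nonneg _)).2 ha)⟩

/-- Sections can be made large on a shell without changing them much inside. -/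
theorem exists_section_step (hM : IsProjectiveClosedSet M) (hL : IsSmoothLeviFlatHypersurface M)
    (hm : 0 < m) {c c' c'' ε R : ℝ} (hc : c < c') (hε : 0 < ε) (hR : 0 ≤ R)
    (hb : ∀ n, IsSection M (b n)) :
    ∃ f : Fin (4 * m) → ℂ^m → ℂ, (∀ n, IsSection M (f n)) ∧
      (∀ n, ∀ z ∈ off M, ‖z‖ = 1 → exh M z ≤ c → ‖f n z - b n z‖ ≤ ε) ∧
      ∀ z ∈ off M, ‖z‖ = 1 → c' ≤ exh M z → exh M z ≤ c'' → ∃ n, R ≤ ‖f n z‖ := by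
  have hY := isOpen_off hM
  set K := {z | z ∈ off M ∧ ‖z‖ = 1 ∧ exh M z ≤ c''} ∩ {z | z ∈ off M ∧ c' ≤ exh M z} with hKdef
  have hK : IsCompact K := by
    have h1 : K = {z | z ∈ off M ∧ ‖z‖ = 1 ∧ exh M z ≤ c''} \ (off M ∩ exh M ⁻¹' Iio c') := by
      ext z
      exact ⟨fun hz => ⟨hz.1, fun h => (not_lt.2 hz.2.2) h.2⟩,
        fun hz => ⟨hz.1, hz.1.1, not_lt.1 fun h => hz.2 ⟨hz.1.1, h⟩⟩⟩
    rw [h1]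
    exact IsCompact.diff (isCompact_exh_le hM c'') ((continuousOn_exh hM).isOpen_inter_preimage hY isOpen_Iio)
  have hpk : ∀ p ∈ K, ∃ u, IsSection M u ∧ 3 ≤ ‖u p‖ ∧
      ∀ z ∈ off M, ‖z‖ = 1 → exh M z ≤ c → ‖u z‖ ≤ 1 / 2 := by
    intro p hp
    obtain ⟨u, h1, h2, h3, h4⟩ := exists_peak hM hL hp.1.1 (hc.trans_le hp.2.2)
      (show (0 : ℝ) < 1 / 6 by norm_num)
    refine ⟨fun z => 3 * u z, ⟨h1.const_mul 3, fun l hl z hz => ?_⟩, ?_, fun z hz hz1 hzc => ?_⟩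
    · change 3 * u (l • z) = l⁻¹ * (3 * u z)
      rw [h2 l hl z hz]
      ring
    · change 3 ≤ ‖3 * u p‖
      rw [norm_mul, norm_ofNat]
      linarith
    · change ‖3 * u z‖ ≤ 1 / 2
      rw [norm_mul, norm_ofNat]
      linarith [h4 z hz hz1 hzc]
  choose! u hu hup hus using hpk
  obtain ⟨t, htK, ht⟩ := hK.elim_nhds_subcover (fun p => {z | ∃ a, 2 < ‖z a * u p z‖})
    fun p hp => by
      obtain ⟨a, ha⟩ := exists_coord hm hp.1.2.1
      have h1 : ContinuousAt (fun z => ‖z a * u p z‖) p :=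
        ((continuous_apply a).continuousAt.mul
          ((hu p hp).1.continuousOn.continuousAt (hY.mem_nhds hp.1.1))).norm
      filter_upwards [h1.eventually_const_lt (u := 2)
        (show 2 < ‖p a * u p p‖ by
          rw [norm_mul, ha, one_mul]
          linarith [hup p hp])] with z hz
      exact ⟨a, hz⟩
  have hug : ∀ i : Fin m × t, DifferentiableOn ℂ (fun z => z i.1 * u i.2 z) (off M) := fun i =>
    DifferentiableOn.mul (by fun_prop) (hu _ (htK _ i.2.2)).1
  obtain ⟨k, ⟨L, hL1, hLR⟩, hk⟩ := ((eventually_exists_coeff (ι := Fin m × t) hm hY hK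
    (fun z hz => hz.1.1) (fun z hz => hz.1.2.1.le) (g := fun i z => z i.1 * u i.2 z)
    (h := fun i z => u i.2 z) hug (fun i => (hu _ (htK _ i.2.2)).1) (fun n => (hb n).1)
    (fun z hz i => by
      rw [norm_mul]
      exact mul_le_of_le_one_left (norm_nonneg _) (hz.1.2.1 ▸ norm_le_pi_norm z i.1))
    (fun z hz => by
      obtain ⟨p, hp, a, ha⟩ := mem_iUnion₂.1 (ht hz)
      exact ⟨(a, ⟨p, hp⟩), ha.le⟩) hR).and (((tendsto_pow_atTop_nhds_zero_of_lt_one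
        (show (0 : ℝ) ≤ 1 / 2 by norm_num) (by norm_num)).const_mul
          (Fintype.card (Fin m × t) : ℝ)).eventually_lt_const (by rwa [mul_zero]))).exists
  refine ⟨fun n z => ∑ i : Fin m × t, L n i * (u i.2 z * (z i.1 * u i.2 z) ^ k) + b n z,
    fun n => ⟨?_, fun l hl z hz => ?_⟩, fun n z hz hz1 hzc => ?_,
    fun z hz hz1 h1 h2 => hLR z ⟨⟨hz, hz1, h2⟩, hz, h1⟩⟩
  · exact (DifferentiableOn.fun_sum fun i _ =>
      (((hu _ (htK _ i.2.2)).1.mul ((hug i).pow k)).const_mul _)).add (hb n).1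
  · beta_reduce
    rw [mul_add, Finset.mul_sum, (hb n).2 l hl z hz]
    congr 1
    refine Finset.sum_congr rfl fun i _ => ?_
    rw [(hu _ (htK _ i.2.2)).2 l hl z hz, Pi.smul_apply, smul_eq_mul]
    have : l * z i.1 * (l⁻¹ * u i.2 z) = z i.1 * u i.2 z := by field_simp
    rw [this]
    ring
  · rw [add_sub_cancel_right]
    refine le_trans (norm_sum_le_of_le _ (n := fun _ => (1 / 2 : ℝ) ^ k) fun i _ => ?_) ?_
    · have h1 := hus _ (htK _ i.2.2) z hz hz1 hzc
      have h2 : ‖z i.1 * u i.2 z‖ ≤ 1 / 2 := by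
        rw [norm_mul]
        exact (mul_le_of_le_one_left (norm_nonneg _) (hz1 ▸ norm_le_pi_norm z i.1)).trans h1
      rw [norm_mul, norm_mul, norm_pow]
      have h3 := hL1 n i
      calc ‖L n i‖ * (‖u i.2 z‖ * ‖z i.1 * u i.2 z‖ ^ k) ≤ 1 * (1 * (1 / 2) ^ k) := by
            gcongr
            linarith
        _ = (1 / 2) ^ k := by ring
    · rw [Finset.sum_const, Finset.card_univ, nsmul_eq_mul]
      exact hk.le

end Random

section Limit
variable {m : ℕ} {M : Set ℂ^m}

theorem differentiableAt_tsum_of_norm_le {E : Type*} [NormedAddCommGroup E] [NormedSpace ℂ E]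
    {d : ℕ → E → ℂ} {p : E} {r C : ℝ} {i₀ : ℕ} (hr : 0 < r)
    (hd : ∀ l, DifferentiableOn ℂ (d l) (ball p (r + r)))
    (hb : ∀ l, i₀ ≤ l → ∀ z ∈ ball p (r + r), ‖d l z‖ ≤ C * (1 / 2) ^ l) :
    DifferentiableAt ℂ (fun z => ∑' l, d l z) p := by
  have hsub : ∀ x ∈ ball p r, ball x r ⊆ ball p (r + r) := fun x hx =>
    ball_subset_ball' (by linarith [mem_ball.1 hx])
  have hmem : ∀ x ∈ ball p r, x ∈ ball p (r + r) := fun x hx =>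
    hsub x hx (mem_ball_self hr)
  have hsum : ∀ a : ℝ, Summable fun l => a * (1 / 2 : ℝ) ^ (l + i₀) := fun a =>
    ((summable_nat_add_iff i₀).2 summable_geometric_two).mul_left a
  have hds : ∀ x ∈ ball p r, Summable fun l => d (l + i₀) x := fun x hx =>
    .of_norm_bounded (hsum C) fun l => hb _ (Nat.le_add_left _ _) x (hmem x hx)
  have hdiff : ∀ l, ∀ x ∈ ball p r, DifferentiableAt ℂ (d l) x := fun l x hx =>
    (hd l).differentiableAt (isOpen_ball.mem_nhds (hmem x hx))
  have htail : DifferentiableAt ℂ (fun z => ∑' l, d (l + i₀) z) p := by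
    refine (hasFDerivAt_tsum_of_isPreconnected (hsum (2 * C / r)) isOpen_ball
      (convex_ball p r).isPreconnected (fun l x hx => (hdiff (l + i₀) x hx).hasFDerivAt)
      (fun l x hx => ?_) (mem_ball_self hr) (hds p (mem_ball_self hr))
      (mem_ball_self hr)).differentiableAt
    have hle := Nat.le_add_left i₀ l
    refine (norm_fderiv_le_div_of_mapsTo_ball (R₂ := 2 * (C * (1 / 2) ^ (l + i₀)))
      ((hd _).mono (hsub x hx)) (fun y hy => mem_closedBall_iff_norm.2 ?_) hr).trans_eq (by ring)
    exact (norm_sub_le _ _).trans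
      (by linarith [hb _ hle y (hsub x hx hy), hb _ hle x (hmem x hx)])
  have hhead : DifferentiableAt ℂ (fun z => ∑ l ∈ Finset.range i₀, d l z) p :=
    .fun_sum fun l _ => hdiff l p (mem_ball_self hr)
  refine (hhead.add htail).congr_of_eventuallyEq ?_
  filter_upwards [ball_mem_nhds p hr] with x hx
  exact (((summable_nat_add_iff i₀).1 (hds x hx)).sum_add_tsum_nat_add i₀).symm

theorem IsSection.sub {f g : ℂ^m → ℂ} (hf : IsSection M f) (hg : IsSection M g) :
    IsSection M (fun z => f z - g z) :=
  ⟨hf.1.sub hg.1, fun c hc z hz => by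
    beta_reduce
    rw [hf.2 c hc z hz, hg.2 c hc z hz, mul_sub]⟩

theorem normalize_mem (hM : IsProjectiveClosedSet M) {z : ℂ^m} (hz : z ∈ off M) :
    (‖z‖ : ℂ)⁻¹ • z ∈ off M ∧ ‖(‖z‖ : ℂ)⁻¹ • z‖ = 1 ∧
      exh M ((‖z‖ : ℂ)⁻¹ • z) = exh M z ∧
      ∀ u, IsSection M u → ‖u ((‖z‖ : ℂ)⁻¹ • z)‖ = ‖z‖ * ‖u z‖ := by
  have h0 : ‖z‖ ≠ 0 := norm_ne_zero_iff.2 hz.1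
  have h1 : (‖z‖ : ℂ)⁻¹ ≠ 0 := inv_ne_zero (ofReal_ne_zero.2 h0)
  refine ⟨smul_mem_off hM _ h1 z hz, ?_, exh_smul hM h1 hz, fun u hu => ?_⟩
  · rw [norm_smul, norm_inv, norm_real, norm_norm, inv_mul_cancel₀ h0]
  · rw [hu.2 _ h1 z hz, inv_inv, norm_mul, norm_real, norm_norm]

/-- Sections which are jointly large on every second shell. -/
theorem exists_sections (hM : IsProjectiveClosedSet M) (hL : IsSmoothLeviFlatHypersurface M)
    (hm : 0 < m) (s : ℝ) : ∃ u : Fin (4 * m) → ℂ^m → ℂ, (∀ n, IsSection M (u n)) ∧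
      ∀ i : ℕ, ∀ z ∈ off M, ‖z‖ = 1 → 2 * i + s ≤ exh M z → exh M z ≤ 2 * i + s + 1 →
        ∃ n, (i : ℝ) + 1 ≤ ‖u n z‖ := by
  have hstep : ∀ (i : ℕ) (b : {b : Fin (4 * m) → ℂ^m → ℂ // ∀ n, IsSection M (b n)}),
      ∃ f : {b : Fin (4 * m) → ℂ^m → ℂ // ∀ n, IsSection M (b n)},
        (∀ n, ∀ z ∈ off M, ‖z‖ = 1 → exh M z ≤ 2 * i + s - 1 / 2 →
          ‖f.1 n z - b.1 n z‖ ≤ (1 / 2) ^ i) ∧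
        ∀ z ∈ off M, ‖z‖ = 1 → 2 * i + s ≤ exh M z → exh M z ≤ 2 * i + s + 1 →
          ∃ n, (i : ℝ) + 2 ≤ ‖f.1 n z‖ := fun i b => by
    obtain ⟨f, h1, h2, h3⟩ := exists_section_step hM hL hm (c := 2 * i + s - 1 / 2)
      (c' := 2 * i + s) (c'' := 2 * i + s + 1) (ε := (1 / 2) ^ i) (R := i + 2) (by linarith)
      (by positivity) (by positivity) b.2
    exact ⟨⟨f, h1⟩, h2, h3⟩
  choose step hs1 hs2 using hstep
  set f : ℕ → {b : Fin (4 * m) → ℂ^m → ℂ // ∀ n, IsSection M (b n)} := fun i =>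
    Nat.rec ⟨fun _ _ => 0, fun _ => ⟨differentiableOn_const 0, fun _ _ _ _ => (mul_zero _).symm⟩⟩
      step i with hf
  set d : ℕ → Fin (4 * m) → ℂ^m → ℂ := fun l n z => (f (l + 1)).1 n z - (f l).1 n z with hd
  have hdS : ∀ l n, IsSection M (d l n) := fun l n => ((f (l + 1)).2 n).sub ((f l).2 n)
  have hd1 : ∀ (l : ℕ) n, ∀ z ∈ off M, exh M z ≤ 2 * l + s - 1 / 2 →
      ‖z‖ * ‖d l n z‖ ≤ (1 / 2) ^ l := fun l n z hz h => by
    obtain ⟨h1, h2, h3, h4⟩ := normalize_mem hM hz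
    rw [← h4 _ (hdS l n)]
    exact hs1 l (f l) n _ h1 h2 (h3.trans_le h)
  refine ⟨fun n z => ∑' l, d l n z, fun n => ⟨fun p hp => ?_, fun c hc z hz => ?_⟩,
    fun i z hz hz1 h1 h2 => ?_⟩
  · obtain ⟨i₀, hi₀⟩ := exists_nat_gt (exh M p - s + 1 / 2)
    have hp0 := norm_pos_iff.2 hp.1
    have hex : ∀ᶠ z in 𝓝 p, exh M z < i₀ + s - 1 / 2 :=
      ((continuousOn_exh hM).continuousAt ((isOpen_off hM).mem_nhds hp)).eventually_lt_const
        (by linarith)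
    have hnear : ∀ᶠ z in 𝓝 p, z ∈ off M ∧ ‖p‖ / 2 < ‖z‖ ∧ exh M z < i₀ + s - 1 / 2 :=
      Filter.Eventually.and ((isOpen_off hM).mem_nhds hp)
        ((continuous_norm.continuousAt.eventually_const_lt (half_lt_self hp0)).and hex)
    obtain ⟨r, hr, hball⟩ := eventually_nhds_iff_ball.1 hnear
    refine (differentiableAt_tsum_of_norm_le (r := r / 2) (C := 2 / ‖p‖) (i₀ := i₀)
      (half_pos hr) (fun l => (hdS l n).1.mono fun z hz => (hball z ?_).1)
      fun l hl z hz => ?_).differentiableWithinAt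
    · rwa [add_halves] at hz
    · rw [add_halves] at hz
      obtain ⟨h1, h2, h3⟩ := hball z hz
      have hl' : (i₀ : ℝ) ≤ l := by exact_mod_cast hl
      have h4 := hd1 l n z h1 (by linarith [(Nat.cast_nonneg l : (0 : ℝ) ≤ l)])
      rw [div_mul_eq_mul_div, le_div_iff₀ hp0]
      nlinarith [mul_nonneg (sub_nonneg.2 h2.le) (norm_nonneg (d l n z))]
  · beta_reduce
    rw [← tsum_mul_left]
    exact tsum_congr fun l => (hdS l n).2 c hc z hz
  · obtain ⟨n, hn⟩ := hs2 i (f i) z hz hz1 h1 h2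
    refine ⟨n, ?_⟩
    have hb : ∀ l, ‖d (l + (i + 1)) n z‖ ≤ 1 / 2 / 2 ^ l := fun l => by
      have h3 := hd1 (l + (i + 1)) n z hz (by
        push_cast
        linarith [(Nat.cast_nonneg l : (0 : ℝ) ≤ l)])
      rw [hz1, one_mul] at h3
      refine h3.trans ?_
      rw [div_div, ← pow_succ', ← one_div_pow]
      exact pow_le_pow_of_le_one (by norm_num) (by norm_num) (by omega)
    have hsum : Summable fun l => d l n z :=
      (summable_nat_add_iff (i + 1)).1 (.of_norm_bounded (hasSum_geometric_two' 1).summable hb)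
    have h4 : ∑ l ∈ Finset.range (i + 1), d l n z = (f (i + 1)).1 n z := by
      rw [Finset.sum_range_sub (fun l => (f l).1 n z)]
      exact sub_zero _
    have h5 := tsum_of_norm_bounded (hasSum_geometric_two' 1) hb
    beta_reduce
    rw [← hsum.sum_add_tsum_nat_add (i + 1), h4]
    have h6 := norm_sub_le_norm_add ((f (i + 1)).1 n z) (∑' l, d (l + (i + 1)) n z)
    have h7 : (i : ℝ) + 2 ≤ ‖(f (i + 1)).1 n z‖ := hn
    linarith

/-- Sections whose joint size grows like the exhaustion function. -/
theorem exists_proper_sections (hM : IsProjectiveClosedSet M)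
    (hL : IsSmoothLeviFlatHypersurface M) (hm : 0 < m) :
    ∃ u : Bool × Fin (4 * m) → ℂ^m → ℂ, (∀ k, IsSection M (u k)) ∧
      ∀ z ∈ off M, ‖z‖ = 1 → ∃ k, exh M z / 2 ≤ ‖u k z‖ := by
  choose u hu hug using fun s : Bool => exists_sections hM hL hm (if s then 1 else 0)
  refine ⟨fun k => u k.1 k.2, fun k => hu _ _, fun z hz hz1 => ?_⟩
  have h0 := exh_pos hM hL hz
  have h1 := Nat.floor_le h0.le
  have h2 := Nat.lt_floor_add_one (exh M z)
  obtain ⟨i, hi⟩ := Nat.even_or_odd' ⌊exh M z⌋₊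
  rcases hi with hi | hi <;> rw [hi] at h1 h2 <;> push_cast at h1 h2
  · obtain ⟨n, hn⟩ := hug false i z hz hz1 (by simpa using h1) (by simpa using h2.le)
    exact ⟨(false, n), by linarith⟩
  · obtain ⟨n, hn⟩ := hug true i z hz hz1 (by simpa using h1) (by simpa using h2.le)
    exact ⟨(true, n), by linarith⟩

end Limit

section Stein
variable {m : ℕ} {M : Set ℂ^m}

theorem Piece.isSteinConeDomain {C C' : Set ℂ^m} (hm : 0 < m)
    (hM : IsProjectiveClosedSet M) (hL : IsSmoothLeviFlatHypersurface M) (hC : Piece M C)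
    (hC' : Piece M C') (hd : Disjoint C C') (hun : C ∪ C' = {z | z ≠ 0 ∧ z ∉ M}) :
    IsSteinConeDomain C := by
  obtain ⟨u, hu, hug⟩ := exists_proper_sections hM hL hm
  have hY := isOpen_off hM
  have hCoff : C ⊆ off M := hC.1
  have hne : ∀ z ∈ off M, ∃ k, u k z ≠ 0 := fun z hz => by
    obtain ⟨h1, h2, h3, h4⟩ := normalize_mem hM hz
    obtain ⟨k, hk⟩ := hug _ h1 h2
    rw [h3, h4 _ (hu k)] at hk
    refine ⟨k, fun h0 => ?_⟩
    rw [h0, norm_zero, mul_zero] at hk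
    linarith [exh_pos hM hL hz]
  set e := Fintype.equivFin (Fin m × Bool × Fin (4 * m)) with he
  set F : ℂ^m → Fin (Fintype.card (Fin m × Bool × Fin (4 * m))) → ℂ :=
    fun z j => z (e.symm j).1 * u (e.symm j).2 z with hF
  have hFapp : ∀ z i k, F z (e (i, k)) = z i * u k z := fun z i k => by
    rw [hF]
    beta_reduce
    rw [Equiv.symm_apply_apply]
  have hFd : DifferentiableOn ℂ F (off M) := differentiableOn_pi.2 fun j =>
    DifferentiableOn.mul (by fun_prop) (hu _).1
  have hFinv : ∀ c : ℂ, c ≠ 0 → ∀ z ∈ off M, F (c • z) = F z := fun c hc z hz => funext fun j => by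
    rw [hF]
    beta_reduce
    rw [(hu _).2 c hc z hz, Pi.smul_apply, smul_eq_mul]
    field_simp
  refine ⟨_, F, hFd.mono hCoff, fun c hc z hz => hFinv c hc z (hCoff hz), fun z hz w hw h => ?_,
    fun K hK => ?_, fun z hz v => ⟨fun h => ?_, ?_⟩⟩
  · obtain ⟨k, hk⟩ := hne z (hCoff hz)
    have hi : ∀ i, z i * u k z = w i * u k w := fun i => by rw [← hFapp, ← hFapp, h]
    have hkw : u k w ≠ 0 := fun h0 => (hCoff hz).1 (funext fun i => by
      have := hi i
      rw [h0, mul_zero] at this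
      exact (mul_eq_zero.1 this).resolve_right hk)
    refine ⟨u k z / u k w, div_ne_zero hk hkw, funext fun i => ?_⟩
    rw [Pi.smul_apply, smul_eq_mul, div_mul_eq_mul_div, eq_div_iff hkw, ← hi, mul_comm]
  · obtain ⟨B, hB⟩ := hK.isBounded.exists_norm_le
    have h1 : {z | z ∈ C ∧ ‖z‖ = 1 ∧ F z ∈ K} =
        {z | z ∈ off M ∧ ‖z‖ = 1 ∧ exh M z ≤ 2 * B} \ (C' ∪ off M ∩ F ⁻¹' Kᶜ) := by
      ext z
      constructor
      · rintro ⟨hz, hz1, hzK⟩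
        refine ⟨⟨hCoff hz, hz1, ?_⟩, ?_⟩
        · obtain ⟨k, hk⟩ := hug z (hCoff hz) hz1
          obtain ⟨a, ha⟩ := exists_coord hm hz1
          have h2 := (norm_le_pi_norm (F z) (e (a, k))).trans (hB _ hzK)
          rw [hFapp, norm_mul, ha, one_mul] at h2
          linarith
        · rintro (h | h)
          exacts [disjoint_left.1 hd hz h, h.2 hzK]
      · rintro ⟨⟨hz, hz1, -⟩, hn⟩
        have h2 : z ∈ C ∪ C' := hun ▸ hz
        exact ⟨h2.resolve_right fun h => hn (.inl h), hz1,
          not_not.1 fun h => hn (.inr ⟨hz, h⟩)⟩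
    rw [h1]
    exact (isCompact_exh_le hM _).diff (hC'.isOpen.union
      (hFd.continuousOn.isOpen_inter_preimage hY hK.isClosed.isOpen_compl))
  · obtain ⟨k, hk⟩ := hne z (hCoff hz)
    have hFz := (hFd.differentiableAt (hY.mem_nhds (hCoff hz))).hasFDerivAt
    have huz := ((hu k).1.differentiableAt (hY.mem_nhds (hCoff hz))).hasFDerivAt
    refine ⟨-(fderiv ℂ (u k) z v / u k z), funext fun i => ?_⟩
    have h1 := hasFDerivAt_pi'.1 hFz (e (i, k))
    have h2 : HasFDerivAt (fun y => F y (e (i, k)))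
        (z i • fderiv ℂ (u k) z + u k z • ContinuousLinearMap.proj (R := ℂ) i) z := by
      simp only [hFapp]
      exact (ContinuousLinearMap.proj (R := ℂ) (φ := fun _ : Fin m => ℂ) i).hasFDerivAt.mul huz
    have h3 : fderiv ℂ F z v (e (i, k)) = z i * fderiv ℂ (u k) z v + u k z * v i :=
      congrArg (fun T : ℂ^m →L[ℂ] ℂ => T v) (h1.unique h2)
    rw [h, Pi.zero_apply] at h3
    rw [Pi.smul_apply, smul_eq_mul]
    field_simp
    linear_combination -h3
  · rintro ⟨c, rfl⟩
    have hFz := (hFd.differentiableAt (hY.mem_nhds (hCoff hz))).hasFDerivAt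
    have h1 : HasDerivAt (fun t : ℂ => z + t • c • z) (c • z) 0 := by
      simpa using ((hasDerivAt_id (0 : ℂ)).smul_const (c • z)).const_add z
    have h2 : HasDerivAt (fun t : ℂ => F (z + t • c • z)) (fderiv ℂ F z (c • z)) 0 := by
      refine HasFDerivAt.comp_hasDerivAt (l := F) (l' := fderiv ℂ F z) (0 : ℂ) ?_ h1
      rwa [zero_smul, add_zero]
    have h3 : ∀ᶠ t : ℂ in 𝓝 0, 1 + t * c ≠ 0 :=
      ContinuousAt.eventually_ne (by fun_prop) (by simp)
    have h4 : (fun t : ℂ => F (z + t • c • z)) =ᶠ[𝓝 0] fun _ => F z := by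
      filter_upwards [h3] with t ht
      rw [← hFinv _ ht z (hCoff hz), add_smul, one_smul, mul_smul]
    exact h2.unique ((hasDerivAt_const (0 : ℂ) (F z)).congr_of_eventuallyEq h4)

end Stein

end LeviFlat

/-- A closed smooth Levi-flat hypersurface in `ℂℙⁿ`, `n ≥ 2`, divides `ℂℙⁿ` into two
connected components, each of which is a Stein manifold. -/
theorem leviFlat_divides_CPn_into_two_Stein_pieces (n : ℕ) (hn : 2 ≤ n)
    (M : Set (Fin (n + 1) → ℂ)) (hM : IsProjectiveClosedSet M)
    (hLF : IsSmoothLeviFlatHypersurface M) :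
    ∃ C₁ C₂ : Set (Fin (n + 1) → ℂ),
      IsOpen C₁ ∧ IsOpen C₂ ∧ IsConnected C₁ ∧ IsConnected C₂ ∧ Disjoint C₁ C₂ ∧
      C₁ ∪ C₂ = {z | z ≠ 0 ∧ z ∉ M} ∧
      IsSteinConeDomain C₁ ∧ IsSteinConeDomain C₂ := by
  obtain ⟨C₁, C₂, h₁, h₂, hc₁, hc₂, hd, hun⟩ :=
    LeviFlat.exists_two_components (by omega) hM hLF
  exact ⟨C₁, C₂, h₁.isOpen, h₂.isOpen, hc₁, hc₂, hd, hun,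
    h₁.isSteinConeDomain n.succ_pos hM hLF h₂ hd hun,
    h₂.isSteinConeDomain n.succ_pos hM hLF h₁ hd.symm (by rw [union_comm, hun])⟩
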